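/- Let d ≥ 1, p ∈ (1,2], let L = (1/2)∑_{i,j} a_{ij}(x) ∂²/∂x_i∂x_j + ∑_i b_i(x) ∂/∂x_i with a_{ij}, b_i locally Hölder continuous, a symmetric and strictly elliptic, and let α, β : ℝ^d → ℝ be locally Hölder continuous with 0 < α, sup_{x∈ℝ^d} α(x) < ∞, β bounded from above, and inf_{x∈ℝ^d} β(x) > −∞. Suppose there exists a bounded, nonnegative, not identically zero function v : ℝ^d × [0,∞) → ℝ, continuous on ℝ^d × [0,∞), twice continuously differentiable in x and once in t on ℝ^d × (0,∞), satisfying ∂v/∂t = Lv on ℝ^d × (0,∞) and v(·,0) = 0. Then there exists a nonnegative, not identically zero function u : ℝ^d × [0,∞) → ℝ, continuous on ℝ^d × [0,∞), C² in x and C¹ in t on ℝ^d × (0,∞), satisfying ∂u/∂t = Lu + β(x)u − α(x)u^p on ℝ^d × (0,∞) and u(·,0) = 0. -/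

import Mathlib

open Set

/-- The `i`-th partial derivative of a function on `ℝ^d`. -/
noncomputable def pd {d : ℕ} (i : Fin d) (f : EuclideanSpace ℝ (Fin d) → ℝ)
    (x : EuclideanSpace ℝ (Fin d)) : ℝ :=
  fderiv ℝ f x (EuclideanSpace.single i 1)

/-- `f` is locally Hölder continuous. -/
def LocHolder {d : ℕ} (f : EuclideanSpace ℝ (Fin d) → ℝ) : Prop :=
  ∀ K : Set (EuclideanSpace ℝ (Fin d)), IsCompact K →
    ∃ κ C : ℝ, 0 < κ ∧ κ ≤ 1 ∧ 0 ≤ C ∧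
      ∀ x ∈ K, ∀ y ∈ K, |f x - f y| ≤ C * ‖x - y‖ ^ κ

set_option linter.unusedSectionVars false

namespace ParabolicExplosion

open Filter Topology MeasureTheory

section Taylor

variable {E : Type*} [NormedAddCommGroup E] [NormedSpace ℝ E]

/-- Bounded bilinear forms on `E`, with the operator norm. -/
def Bil (E : Type*) [NormedAddCommGroup E] [NormedSpace ℝ E] := E →L[ℝ] E →L[ℝ] ℝ

noncomputable instance : NormedAddCommGroup (Bil E) :=
  inferInstanceAs (NormedAddCommGroup (E →L[ℝ] E →L[ℝ] ℝ))

noncomputable instance : NormedSpace ℝ (Bil E) :=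
  inferInstanceAs (NormedSpace ℝ (E →L[ℝ] E →L[ℝ] ℝ))

instance : CompleteSpace (Bil E) :=
  inferInstanceAs (CompleteSpace (E →L[ℝ] E →L[ℝ] ℝ))

instance [FiniteDimensional ℝ E] : FiniteDimensional ℝ (Bil E) :=
  inferInstanceAs (FiniteDimensional ℝ (E →L[ℝ] E →L[ℝ] ℝ))

namespace Bil

/-- The partial application of a bilinear form. -/
noncomputable def left (B : Bil E) (v : E) : E →L[ℝ] ℝ := (show E →L[ℝ] E →L[ℝ] ℝ from B) v

@[simp] theorem left_add (B : Bil E) (v w : E) : B.left (v + w) = B.left v + B.left w :=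
  map_add (show E →L[ℝ] E →L[ℝ] ℝ from B) v w

@[simp] theorem left_sub (B : Bil E) (v w : E) : B.left (v - w) = B.left v - B.left w :=
  map_sub (show E →L[ℝ] E →L[ℝ] ℝ from B) v w

@[simp] theorem left_neg (B : Bil E) (v : E) : B.left (-v) = -B.left v :=
  map_neg (show E →L[ℝ] E →L[ℝ] ℝ from B) v

@[simp] theorem left_smul (B : Bil E) (c : ℝ) (v : E) : B.left (c • v) = c • B.left v :=
  map_smul (show E →L[ℝ] E →L[ℝ] ℝ from B) c v

@[simp] theorem left_zero (B : Bil E) : B.left 0 = 0 :=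
  map_zero (show E →L[ℝ] E →L[ℝ] ℝ from B)

@[simp] theorem add_left (B C : Bil E) (v : E) : (B + C).left v = B.left v + C.left v := rfl

@[simp] theorem sub_left (B C : Bil E) (v : E) : (B - C).left v = B.left v - C.left v := rfl

@[simp] theorem neg_left (B : Bil E) (v : E) : (-B).left v = -B.left v := rfl

@[simp] theorem smul_left (c : ℝ) (B : Bil E) (v : E) : (c • B).left v = c • B.left v := rfl

@[simp] theorem zero_left (v : E) : (0 : Bil E).left v = 0 := rfl

theorem norm_left_le (B : Bil E) (v : E) : ‖B.left v‖ ≤ ‖B‖ * ‖v‖ :=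
  ContinuousLinearMap.le_opNorm (show E →L[ℝ] E →L[ℝ] ℝ from B) v

theorem abs_apply_le (B : Bil E) (v w : E) : |B.left v w| ≤ ‖B‖ * ‖v‖ * ‖w‖ :=
  ((B.left v).le_opNorm w).trans (mul_le_mul_of_nonneg_right (B.norm_left_le v) (norm_nonneg _))

theorem norm_le_of_unit {B : Bil E} {c : ℝ} (hc : 0 ≤ c)
    (h : ∀ v w : E, ‖v‖ = 1 → ‖w‖ = 1 → |B.left v w| ≤ c) : ‖B‖ ≤ c :=
  ContinuousLinearMap.opNorm_le_of_unit_norm (f := (show E →L[ℝ] E →L[ℝ] ℝ from B)) hc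
    fun v hv => ContinuousLinearMap.opNorm_le_of_unit_norm hc fun w hw => h v w hv hw

end Bil

/-- The second Fréchet derivative as a bilinear form. -/
noncomputable def D2 (φ : E → ℝ) (x : E) : Bil E := fderiv ℝ (fderiv ℝ φ) x

theorem D2_left_apply (φ : E → ℝ) (x v w : E) :
    (D2 φ x).left v w = fderiv ℝ (fderiv ℝ φ) x v w := rfl

theorem hasFDerivAt_of_C2 {φ : E → ℝ} (hφ : ContDiff ℝ 2 φ) (x : E) :
    HasFDerivAt φ (fderiv ℝ φ x) x :=
  (hφ.differentiable (by norm_num) x).hasFDerivAt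

theorem hasFDerivAt_fderiv_of_C2 {φ : E → ℝ} (hφ : ContDiff ℝ 2 φ) (x : E) :
    HasFDerivAt (fderiv ℝ φ) (fderiv ℝ (fderiv ℝ φ) x) x := by
  have h : ContDiff ℝ 1 (fderiv ℝ φ) := hφ.fderiv_right (by norm_num)
  exact (h.differentiable (by norm_num) x).hasFDerivAt

theorem continuous_D2 {φ : E → ℝ} (hφ : ContDiff ℝ 2 φ) : Continuous (D2 φ) := by
  have h : ContDiff ℝ 1 (fderiv ℝ φ) := hφ.fderiv_right (by norm_num)
  exact h.continuous_fderiv (by norm_num)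

theorem continuous_fderiv_of_C2 {φ : E → ℝ} (hφ : ContDiff ℝ 2 φ) : Continuous (fderiv ℝ φ) :=
  hφ.continuous_fderiv (by norm_num)

theorem D2_symm {φ : E → ℝ} (hφ : ContDiff ℝ 2 φ) (x v w : E) :
    (D2 φ x).left v w = (D2 φ x).left w v := by
  have h : IsSymmSndFDerivAt ℝ φ x := hφ.contDiffAt.isSymmSndFDerivAt (by simp)
  exact h v w

theorem norm_fderiv_sub_taylor_le {φ : E → ℝ} (hφ : ContDiff ℝ 2 φ) {x : E} {h κ : ℝ}
    (hκ : ∀ y ∈ Metric.closedBall x h, ‖D2 φ y - D2 φ x‖ ≤ κ) {y : E}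
    (hy : y ∈ Metric.closedBall x h) :
    ‖fderiv ℝ φ y - fderiv ℝ φ x - (D2 φ x).left (y - x)‖ ≤ κ * ‖y - x‖ := by
  have h0 : 0 ≤ h := by
    have := dist_nonneg.trans (Metric.mem_closedBall.1 hy); exact this
  exact (convex_closedBall x h).norm_image_sub_le_of_norm_hasFDerivWithin_le'
    (fun z _ => (hasFDerivAt_fderiv_of_C2 hφ z).hasFDerivWithinAt) hκ
    (Metric.mem_closedBall_self h0) hy

theorem abs_taylor_two_le {φ : E → ℝ} (hφ : ContDiff ℝ 2 φ) {x : E} {h κ : ℝ} (hκ0 : 0 ≤ κ)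
    (hκ : ∀ y ∈ Metric.closedBall x h, ‖D2 φ y - D2 φ x‖ ≤ κ) {v : E} (hv : ‖v‖ ≤ h) :
    |φ (x + v) - φ x - fderiv ℝ φ x v - (1 / 2) * (D2 φ x).left v v| ≤ κ * ‖v‖ ^ 2 := by
  have h0 : 0 ≤ ‖v‖ := norm_nonneg _
  set ψ : E → ℝ := fun y =>
    φ y - fderiv ℝ φ x (y - x) - (1 / 2) * (D2 φ x).left (y - x) (y - x) with hψ
  have hd : ∀ y, HasFDerivAt ψ (fderiv ℝ φ y - fderiv ℝ φ x - (D2 φ x).left (y - x)) y := by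
    intro y
    have h1 : HasFDerivAt (fun y : E => y - x) (ContinuousLinearMap.id ℝ E) y :=
      (hasFDerivAt_id y).sub_const x
    have h2 := (fderiv ℝ φ x).hasFDerivAt.comp y h1
    have h3 := ((fderiv ℝ (fderiv ℝ φ) x).hasFDerivAt.comp y h1).clm_apply h1
    have h4 := ((hasFDerivAt_of_C2 hφ y).sub h2).sub (h3.const_mul (1 / 2))
    refine h4.congr_fderiv ?_
    ext w
    have e : fderiv ℝ (fderiv ℝ φ) x w (y - x) = fderiv ℝ (fderiv ℝ φ) x (y - x) w :=
      D2_symm hφ x w (y - x)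
    change _ = fderiv ℝ φ y w - fderiv ℝ φ x w - fderiv ℝ (fderiv ℝ φ) x (y - x) w
    simp only [map_sub, sub_apply] at e
    simp
    linarith
  have key := (convex_closedBall x ‖v‖).norm_image_sub_le_of_norm_hasFDerivWithin_le
    (f := ψ) (C := κ * ‖v‖) (fun z _ => (hd z).hasFDerivWithinAt) (x := x) (y := x + v)
    (fun z hz => ?_) (Metric.mem_closedBall_self h0) (by simp)
  · simp only [hψ, add_sub_cancel_left, sub_self, map_zero, Real.norm_eq_abs] at key
    have e : φ (x + v) - fderiv ℝ φ x v - 1 / 2 * (D2 φ x).left v v - (φ x - 0 - 1 / 2 * 0)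
      = φ (x + v) - φ x - fderiv ℝ φ x v - (1 / 2) * (D2 φ x).left v v := by ring
    have key2 := e ▸ key
    linarith [key2, show κ * ‖v‖ * ‖v‖ = κ * ‖v‖ ^ 2 by ring]
  · have hz1 : ‖z - x‖ ≤ ‖v‖ := by simpa [dist_eq_norm] using hz
    have hz' : z ∈ Metric.closedBall x h := by
      rw [Metric.mem_closedBall, dist_eq_norm]; exact hz1.trans hv
    exact (norm_fderiv_sub_taylor_le hφ hκ hz').trans (mul_le_mul_of_nonneg_left hz1 hκ0)

theorem opNorm_bilin_le_of_quadratic {B : Bil E} (hs : ∀ v w, B.left v w = B.left w v) {c : ℝ}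
    (hc : 0 ≤ c) (h : ∀ v, |B.left v v| ≤ c * ‖v‖ ^ 2) : ‖B‖ ≤ 2 * c := by
  have key : ∀ v w : E, ‖v‖ ≤ 1 → ‖w‖ ≤ 1 → |B.left v w| ≤ 2 * c := by
    intro v w hv hw
    have e : B.left v w = (1 / 4) * (B.left (v + w) (v + w) - B.left (v - w) (v - w)) := by
      simp [hs w v]; ring
    have h1 := h (v + w)
    have h2 := h (v - w)
    have n1 : ‖v + w‖ ^ 2 ≤ 4 := by
      have := norm_add_le v w
      nlinarith [norm_nonneg (v + w)]
    have n2 : ‖v - w‖ ^ 2 ≤ 4 := by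
      have := norm_sub_le v w
      nlinarith [norm_nonneg (v - w)]
    have h1' : |B.left (v + w) (v + w)| ≤ c * 4 := h1.trans (mul_le_mul_of_nonneg_left n1 hc)
    have h2' : |B.left (v - w) (v - w)| ≤ c * 4 := h2.trans (mul_le_mul_of_nonneg_left n2 hc)
    rw [e, abs_le]
    rw [abs_le] at h1' h2'
    constructor <;> linarith [h1'.1, h1'.2, h2'.1, h2'.2]
  exact Bil.norm_le_of_unit (by positivity) fun v w hv hw => key v w hv.le hw.le

/-- Interpolation: the second derivative is controlled by the function and the oscillation of the
second derivative. -/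
theorem norm_D2_le_of_osc {φ : E → ℝ} (hφ : ContDiff ℝ 2 φ) {x : E} {h κ M : ℝ} (hh : 0 < h)
    (hM : ∀ y ∈ Metric.closedBall x h, |φ y| ≤ M)
    (hκ : ∀ y ∈ Metric.closedBall x h, ‖D2 φ y - D2 φ x‖ ≤ κ) :
    ‖D2 φ x‖ ≤ 8 * M / h ^ 2 + 4 * κ := by
  have hx : x ∈ Metric.closedBall x h := Metric.mem_closedBall_self hh.le
  have hκ0 : 0 ≤ κ := by simpa using hκ x hx
  have hM0 : 0 ≤ M := (abs_nonneg _).trans (hM x hx)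
  have hq : ∀ v, |(D2 φ x).left v v| ≤ (4 * M / h ^ 2 + 2 * κ) * ‖v‖ ^ 2 := by
    intro v
    rcases eq_or_ne v 0 with rfl | hv
    · simp
    have hvn : 0 < ‖v‖ := norm_pos_iff.2 hv
    set w : E := (h / ‖v‖) • v with hw
    have hwn : ‖w‖ = h := by
      rw [hw, norm_smul, Real.norm_eq_abs, abs_of_pos (by positivity)]; field_simp
    have t1 := abs_taylor_two_le hφ hκ0 hκ (v := w) hwn.le
    have t2 := abs_taylor_two_le hφ hκ0 hκ (v := -w) (by rw [norm_neg]; exact hwn.le)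
    have m1 := hM (x + w) (by simp [hwn])
    have m2 := hM (x + -w) (by simp [hwn])
    have m3 := hM x hx
    simp only [map_neg, neg_neg, norm_neg, Bil.left_neg, neg_apply, hwn] at t1 t2
    rw [abs_le] at t1 t2 m1 m2 m3
    have hB : |(D2 φ x).left w w| ≤ 4 * M + 2 * κ * h ^ 2 := by
      rw [abs_le]
      constructor <;> linarith [t1.1, t1.2, t2.1, t2.2, m1.1, m1.2, m2.1, m2.2, m3.1, m3.2]
    have e : (D2 φ x).left v v = (‖v‖ / h) ^ 2 * (D2 φ x).left w w := by
      simp only [hw, map_smul, Bil.left_smul, smul_apply, smul_eq_mul]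
      field_simp
    rw [e, abs_mul, abs_of_nonneg (by positivity : 0 ≤ (‖v‖ / h) ^ 2)]
    calc (‖v‖ / h) ^ 2 * |(D2 φ x).left w w| ≤ (‖v‖ / h) ^ 2 * (4 * M + 2 * κ * h ^ 2) := by gcongr
      _ = _ := by field_simp
  calc ‖D2 φ x‖ ≤ 2 * (4 * M / h ^ 2 + 2 * κ) :=
        opNorm_bilin_le_of_quadratic (D2_symm hφ x) (by positivity) hq
    _ = _ := by ring

theorem norm_fderiv_le_of_osc {φ : E → ℝ} (hφ : ContDiff ℝ 2 φ) {x : E} {h κ M : ℝ} (hh : 0 < h)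
    (hM : ∀ y ∈ Metric.closedBall x h, |φ y| ≤ M)
    (hκ : ∀ y ∈ Metric.closedBall x h, ‖D2 φ y - D2 φ x‖ ≤ κ) :
    ‖fderiv ℝ φ x‖ ≤ M / h + κ * h := by
  have hx : x ∈ Metric.closedBall x h := Metric.mem_closedBall_self hh.le
  have hκ0 : 0 ≤ κ := by simpa using hκ x hx
  have hM0 : 0 ≤ M := (abs_nonneg _).trans (hM x hx)
  refine ContinuousLinearMap.opNorm_le_of_unit_norm (by positivity) fun v hv => ?_
  have hwn : ‖h • v‖ = h := by
    rw [norm_smul, Real.norm_eq_abs, abs_of_pos hh, hv, mul_one]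
  have t1 := abs_taylor_two_le hφ hκ0 hκ (v := h • v) hwn.le
  have t2 := abs_taylor_two_le hφ hκ0 hκ (v := -(h • v)) (by rw [norm_neg]; exact hwn.le)
  have m1 := hM (x + h • v) (by simp [hwn])
  have m2 := hM (x + -(h • v)) (by simp [hwn])
  simp only [map_neg, neg_neg, norm_neg, Bil.left_neg, neg_apply, hwn] at t1 t2
  rw [abs_le] at t1 t2 m1 m2
  have e : fderiv ℝ φ x (h • v) = h * fderiv ℝ φ x v := by simp
  rw [e] at t1 t2
  have hB : |h * fderiv ℝ φ x v| ≤ M + κ * h ^ 2 := by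
    rw [abs_le]; constructor <;> linarith [t1.1, t1.2, t2.1, t2.2, m1.1, m1.2, m2.1, m2.2]
  rw [abs_mul, abs_of_pos hh] at hB
  rw [Real.norm_eq_abs]
  have : |fderiv ℝ φ x v| ≤ (M + κ * h ^ 2) / h := by rw [le_div_iff₀ hh]; linarith
  calc _ ≤ _ := this
    _ = _ := by field_simp

end Taylor

section Limits

theorem hasFDerivWithinAt_of_tendsto {ι E G : Type*} [NormedAddCommGroup E] [NormedSpace ℝ E]
    [NormedAddCommGroup G] [NormedSpace ℝ G] {l : Filter ι} [l.NeBot] {s : Set E}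
    (hs : Convex ℝ s) {x₀ : E} (hx₀ : x₀ ∈ s) {ψ : ι → E → G} {ψ' : ι → E → E →L[ℝ] G}
    {φ : E → G} {φ' : E →L[ℝ] G}
    (hd : ∀ᶠ n in l, ∀ x ∈ s, HasFDerivWithinAt (ψ n) (ψ' n x) s x)
    (hlim : ∀ x ∈ s, Tendsto (fun n => ψ n x) l (𝓝 (φ x)))
    (hlim' : Tendsto (fun n => ψ' n x₀) l (𝓝 φ'))
    (hequi : ∀ ε > 0, ∃ δ > 0, ∀ᶠ n in l, ∀ x ∈ s, dist x x₀ < δ → ‖ψ' n x - ψ' n x₀‖ ≤ ε) :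
    HasFDerivWithinAt φ φ' s x₀ := by
  rw [hasFDerivWithinAt_iff_isLittleO, Asymptotics.isLittleO_iff]
  intro ε hε
  obtain ⟨δ, hδ, hn⟩ := hequi ε hε
  have hball : Metric.ball x₀ δ ∈ 𝓝[s] x₀ := mem_nhdsWithin_of_mem_nhds (Metric.ball_mem_nhds _ hδ)
  filter_upwards [hball, self_mem_nhdsWithin] with x hx hxs
  have h1 : ∀ᶠ n in l, ‖ψ n x - ψ n x₀ - ψ' n x₀ (x - x₀)‖ ≤ ε * ‖x - x₀‖ := by
    filter_upwards [hd, hn] with n hdn hn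
    refine (hs.inter (convex_ball x₀ δ)).norm_image_sub_le_of_norm_hasFDerivWithin_le'
      (f' := ψ' n) (fun z hz => (hdn z hz.1).mono inter_subset_left) (fun z hz => ?_)
      ⟨hx₀, Metric.mem_ball_self hδ⟩ ⟨hxs, hx⟩
    exact hn z hz.1 hz.2
  have h2 : Tendsto (fun n => ‖ψ n x - ψ n x₀ - ψ' n x₀ (x - x₀)‖) l
      (𝓝 ‖φ x - φ x₀ - φ' (x - x₀)‖) := by
    have h3 : Tendsto (fun n => ψ' n x₀ (x - x₀)) l (𝓝 (φ' (x - x₀))) :=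
      ((ContinuousLinearMap.apply ℝ G (x - x₀)).continuous.tendsto φ').comp hlim'
    exact (((hlim x hxs).sub (hlim x₀ hx₀)).sub h3).norm
  exact le_of_tendsto h2 h1

theorem hasDerivWithinAt_of_tendsto {ι : Type*} {l : Filter ι} [l.NeBot] {s : Set ℝ}
    (hs : Convex ℝ s) {t₀ : ℝ} (ht₀ : t₀ ∈ s) {ψ : ι → ℝ → ℝ} {ψ' : ι → ℝ → ℝ}
    {φ : ℝ → ℝ} {φ' : ℝ}
    (hd : ∀ᶠ n in l, ∀ t ∈ s, HasDerivWithinAt (ψ n) (ψ' n t) s t)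
    (hlim : ∀ t ∈ s, Tendsto (fun n => ψ n t) l (𝓝 (φ t)))
    (hlim' : Tendsto (fun n => ψ' n t₀) l (𝓝 φ'))
    (hequi : ∀ ε > 0, ∃ δ > 0, ∀ᶠ n in l, ∀ t ∈ s, dist t t₀ < δ → |ψ' n t - ψ' n t₀| ≤ ε) :
    HasDerivWithinAt φ φ' s t₀ := by
  let T : ℝ →L[ℝ] (ℝ →L[ℝ] ℝ) := ContinuousLinearMap.smulRightL ℝ ℝ ℝ (1 : ℝ →L[ℝ] ℝ)
  refine (hasFDerivWithinAt_of_tendsto hs ht₀ (ψ := ψ) (ψ' := fun n t => T (ψ' n t))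
    (φ' := T φ') ?_ hlim ((T.continuous.tendsto _).comp hlim') ?_).hasDerivWithinAt.congr_deriv ?_
  · filter_upwards [hd] with n hn t ht
    refine (hn t ht).hasFDerivWithinAt.congr_fderiv ?_
    ext; simp [T]
  · intro ε hε
    obtain ⟨δ, hδ, h⟩ := hequi ε hε
    refine ⟨δ, hδ, ?_⟩
    filter_upwards [h] with n hn t ht htd
    refine ContinuousLinearMap.opNorm_le_bound _ hε.le fun x => ?_
    have e : (T (ψ' n t) - T (ψ' n t₀)) x = x * (ψ' n t - ψ' n t₀) := by
      simp [T, mul_sub]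
    rw [e, norm_mul, mul_comm]
    exact mul_le_mul_of_nonneg_right (hn t ht htd) (norm_nonneg _)
  · simp [T]

theorem exists_tendsto_of_bounded {ι G : Type*} [NormedAddCommGroup G] [ProperSpace G]
    (l : Ultrafilter ι) {f : ι → G} {C : ℝ} (h : ∀ᶠ n in (l : Filter ι), ‖f n‖ ≤ C) :
    ∃ g, Tendsto f l (𝓝 g) := by
  obtain ⟨g, -, hg⟩ := (isCompact_closedBall (0 : G) C).ultrafilter_le_nhds (l.map f) (by
    rw [le_principal_iff]
    change ∀ᶠ n in (l : Filter ι), f n ∈ Metric.closedBall (0 : G) C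
    exact h.mono fun n hn => by simpa using hn)
  exact ⟨g, hg⟩

variable {E : Type*} [NormedAddCommGroup E] [NormedSpace ℝ E]

theorem contDiff_two_of_hasFDerivAt {φ : E → ℝ} {P : E → E →L[ℝ] ℝ} {B : E → Bil E}
    (h1 : ∀ x, HasFDerivAt φ (P x) x)
    (h2 : ∀ x, HasFDerivAt P (show E →L[ℝ] E →L[ℝ] ℝ from B x) x) (hB : Continuous B) :
    ContDiff ℝ 2 φ ∧ fderiv ℝ φ = P ∧ D2 φ = B := by
  have e1 : fderiv ℝ φ = P := funext fun x => (h1 x).fderiv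
  have e2 : D2 φ = B := by
    funext x
    unfold D2
    rw [e1]
    exact (h2 x).fderiv
  refine ⟨?_, e1, e2⟩
  have hP : ContDiff ℝ 1 P := by
    refine contDiff_one_iff_fderiv.2 ⟨fun x => (h2 x).differentiableAt, ?_⟩
    have : fderiv ℝ P = B := funext fun x => (h2 x).fderiv
    rw [this]
    exact hB
  have : ContDiff ℝ (1 + 1) φ := by
    rw [contDiff_succ_iff_fderiv]
    exact ⟨fun x => (h1 x).differentiableAt, by simp, e1 ▸ hP⟩
  simpa [one_add_one_eq_two] using this

theorem contDiff_two_of_tendsto {ι : Type*} {l : Filter ι} [l.NeBot] {u : ι → E → ℝ}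
    (hu : ∀ᶠ n in l, ContDiff ℝ 2 (u n)) {φ : E → ℝ} {P : E → E →L[ℝ] ℝ} {B : E → Bil E}
    (h0 : ∀ x, Tendsto (fun n => u n x) l (𝓝 (φ x)))
    (h1 : ∀ x, Tendsto (fun n => fderiv ℝ (u n) x) l (𝓝 (P x)))
    (h2 : ∀ x, Tendsto (fun n => D2 (u n) x) l (𝓝 (B x)))
    (hequi : ∀ x₀, ∀ ε > 0, ∃ δ > 0, ∀ᶠ n in l, ∀ x, dist x x₀ < δ →
      ‖D2 (u n) x - D2 (u n) x₀‖ ≤ ε) :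
    ContDiff ℝ 2 φ ∧ fderiv ℝ φ = P ∧ D2 φ = B := by
  have hequi1 : ∀ x₀, ∀ ε > 0, ∃ δ > 0, ∀ᶠ n in l, ∀ x, dist x x₀ < δ →
      ‖fderiv ℝ (u n) x - fderiv ℝ (u n) x₀‖ ≤ ε := by
    intro x₀ ε hε
    obtain ⟨δ, hδ, h⟩ := hequi x₀ 1 one_pos
    have hb : ∀ᶠ n in l, ‖D2 (u n) x₀‖ < ‖B x₀‖ + 1 :=
      (h2 x₀).norm.eventually (gt_mem_nhds (by linarith))
    have hc : 0 < ‖B x₀‖ + 2 := by positivity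
    refine ⟨min δ (ε / (‖B x₀‖ + 2)), lt_min hδ (div_pos hε hc), ?_⟩
    filter_upwards [hu, h, hb] with n hun hn hbn x hx
    have hx1 : x ∈ Metric.ball x₀ δ := hx.trans_le (min_le_left _ _)
    have key := (convex_ball x₀ δ).norm_image_sub_le_of_norm_hasFDerivWithin_le
      (f := fderiv ℝ (u n)) (C := ‖B x₀‖ + 2)
      (fun z _ => (hasFDerivAt_fderiv_of_C2 hun z).hasFDerivWithinAt)
      (fun z hz => ?_) (Metric.mem_ball_self hδ) hx1
    · refine key.trans ?_
      have := (hx.trans_le (min_le_right _ _)).le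
      rw [dist_eq_norm, le_div_iff₀ hc] at this
      linarith
    · have e : D2 (u n) z = (D2 (u n) z - D2 (u n) x₀) + D2 (u n) x₀ := by abel
      calc ‖fderiv ℝ (fderiv ℝ (u n)) z‖ = ‖(D2 (u n) z - D2 (u n) x₀) + D2 (u n) x₀‖ := by
            rw [← e]; rfl
        _ ≤ ‖D2 (u n) z - D2 (u n) x₀‖ + ‖D2 (u n) x₀‖ := norm_add_le _ _
        _ ≤ 1 + (‖B x₀‖ + 1) := add_le_add (hn z hz) hbn.le
        _ = _ := by ring
  have hB : Continuous B := by
    rw [continuous_iff_continuousAt]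
    intro x₀
    rw [Metric.continuousAt_iff]
    intro ε hε
    obtain ⟨δ, hδ, h⟩ := hequi x₀ (ε / 2) (by positivity)
    refine ⟨δ, hδ, fun {x} hx => ?_⟩
    have : ‖B x - B x₀‖ ≤ ε / 2 :=
      le_of_tendsto ((h2 x).sub (h2 x₀)).norm (h.mono fun n hn => hn x hx)
    rw [dist_eq_norm]
    linarith
  refine contDiff_two_of_hasFDerivAt (fun x₀ => ?_) (fun x₀ => ?_) hB
  · rw [← hasFDerivWithinAt_univ]
    refine hasFDerivWithinAt_of_tendsto convex_univ (mem_univ _) (ψ := u)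
      (ψ' := fun n => fderiv ℝ (u n)) ?_ (fun x _ => h0 x) (h1 x₀) ?_
    · filter_upwards [hu] with n hn x _
      exact (hasFDerivAt_of_C2 hn x).hasFDerivWithinAt
    · intro ε hε
      obtain ⟨δ, hδ, h⟩ := hequi1 x₀ ε hε
      exact ⟨δ, hδ, h.mono fun n hn x _ => hn x⟩
  · rw [← hasFDerivWithinAt_univ]
    refine hasFDerivWithinAt_of_tendsto convex_univ (mem_univ _) (ψ := fun n => fderiv ℝ (u n))
      (ψ' := fun n => fderiv ℝ (fderiv ℝ (u n))) ?_ (fun x _ => h1 x) (h2 x₀) ?_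
    · filter_upwards [hu] with n hn x _
      exact (hasFDerivAt_fderiv_of_C2 hn x).hasFDerivWithinAt
    · intro ε hε
      obtain ⟨δ, hδ, h⟩ := hequi x₀ ε hε
      exact ⟨δ, hδ, h.mono fun n hn x _ => hn x⟩

end Limits

section Solutions

variable {E : Type*} [NormedAddCommGroup E] [NormedSpace ℝ E]

theorem fderiv_sub_of_C2 {φ ψ : E → ℝ} (hφ : ContDiff ℝ 2 φ) (hψ : ContDiff ℝ 2 ψ) :
    fderiv ℝ (fun x => φ x - ψ x) = fun x => fderiv ℝ φ x - fderiv ℝ ψ x :=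
  funext fun x => ((hasFDerivAt_of_C2 hφ x).sub (hasFDerivAt_of_C2 hψ x)).fderiv

theorem D2_sub {φ ψ : E → ℝ} (hφ : ContDiff ℝ 2 φ) (hψ : ContDiff ℝ 2 ψ) (x : E) :
    D2 (fun x => φ x - ψ x) x = D2 φ x - D2 ψ x := by
  unfold D2
  rw [fderiv_sub_of_C2 hφ hψ]
  exact ((hasFDerivAt_fderiv_of_C2 hφ x).sub (hasFDerivAt_fderiv_of_C2 hψ x)).fderiv

theorem fderiv_add_of_C2 {φ ψ : E → ℝ} (hφ : ContDiff ℝ 2 φ) (hψ : ContDiff ℝ 2 ψ) :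
    fderiv ℝ (fun x => φ x + ψ x) = fun x => fderiv ℝ φ x + fderiv ℝ ψ x :=
  funext fun x => ((hasFDerivAt_of_C2 hφ x).add (hasFDerivAt_of_C2 hψ x)).fderiv

theorem D2_add {φ ψ : E → ℝ} (hφ : ContDiff ℝ 2 φ) (hψ : ContDiff ℝ 2 ψ) (x : E) :
    D2 (fun x => φ x + ψ x) x = D2 φ x + D2 ψ x := by
  unfold D2
  rw [fderiv_add_of_C2 hφ hψ]
  exact ((hasFDerivAt_fderiv_of_C2 hφ x).add (hasFDerivAt_fderiv_of_C2 hψ x)).fderiv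

theorem fderiv_const_mul_of_C2 {φ : E → ℝ} (hφ : ContDiff ℝ 2 φ) (c : ℝ) :
    fderiv ℝ (fun x => c * φ x) = fun x => c • fderiv ℝ φ x :=
  funext fun x => ((hasFDerivAt_of_C2 hφ x).const_mul c).fderiv

theorem D2_const_mul {φ : E → ℝ} (hφ : ContDiff ℝ 2 φ) (c : ℝ) (x : E) :
    D2 (fun x => c * φ x) x = c • D2 φ x := by
  unfold D2
  rw [fderiv_const_mul_of_C2 hφ c]
  exact ((hasFDerivAt_fderiv_of_C2 hφ x).const_smul c).fderiv

/-- The second order operator with leading part `A` and drift `b`. -/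
noncomputable def Lop (A : E → Bil E →L[ℝ] ℝ) (b : E → E) (φ : E → ℝ) (x : E) : ℝ :=
  A x (D2 φ x) + fderiv ℝ φ x (b x)

theorem Lop_sub {A : E → Bil E →L[ℝ] ℝ} {b : E → E} {φ ψ : E → ℝ} (hφ : ContDiff ℝ 2 φ)
    (hψ : ContDiff ℝ 2 ψ) (x : E) :
    Lop A b (fun x => φ x - ψ x) x = Lop A b φ x - Lop A b ψ x := by
  simp only [Lop, D2_sub hφ hψ, fderiv_sub_of_C2 hφ hψ, map_sub, sub_apply]
  ring

theorem Lop_add {A : E → Bil E →L[ℝ] ℝ} {b : E → E} {φ ψ : E → ℝ} (hφ : ContDiff ℝ 2 φ)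
    (hψ : ContDiff ℝ 2 ψ) (x : E) :
    Lop A b (fun x => φ x + ψ x) x = Lop A b φ x + Lop A b ψ x := by
  simp only [Lop, D2_add hφ hψ, fderiv_add_of_C2 hφ hψ, map_add, add_apply]
  ring

theorem Lop_const_mul {A : E → Bil E →L[ℝ] ℝ} {b : E → E} {φ : E → ℝ} (hφ : ContDiff ℝ 2 φ)
    (c : ℝ) (x : E) : Lop A b (fun x => c * φ x) x = c * Lop A b φ x := by
  simp only [Lop, D2_const_mul hφ, fderiv_const_mul_of_C2 hφ, map_smul, smul_apply, smul_eq_mul]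
  ring

/-- `u` is a classical solution on `[0, T]` of `u_t = L u + f` with zero initial data. -/
structure IsSol (A : E → Bil E →L[ℝ] ℝ) (b : E → E) (T : ℝ) (f u : ℝ → E → ℝ) : Prop where
  init : ∀ x, u 0 x = 0
  smooth : ∀ t ∈ Icc 0 T, ContDiff ℝ 2 (u t)
  eqn : ∀ t ∈ Icc 0 T, ∀ x,
    HasDerivWithinAt (fun s => u s x) (Lop A b (u t) x + f t x) (Icc 0 T) t

/-- A function together with its first two derivatives is bounded by `K` on `S`, and the second
derivative is Hölder continuous on `S`. -/
structure C2BoundOn (α K : ℝ) (S : Set E) (φ : E → ℝ) : Prop where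
  abs_le : ∀ x ∈ S, |φ x| ≤ K
  fderiv_le : ∀ x ∈ S, ‖fderiv ℝ φ x‖ ≤ K
  D2_le : ∀ x ∈ S, ‖D2 φ x‖ ≤ K
  holder : ∀ x ∈ S, ∀ y ∈ S, ‖D2 φ x - D2 φ y‖ ≤ K * ‖x - y‖ ^ α

theorem C2BoundOn.mono {α K K' : ℝ} {S S' : Set E} {φ : E → ℝ} (h : C2BoundOn α K S φ)
    (hS : S' ⊆ S) (hK : K ≤ K') : C2BoundOn α K' S' φ where
  abs_le x hx := (h.abs_le x (hS hx)).trans hK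
  fderiv_le x hx := (h.fderiv_le x (hS hx)).trans hK
  D2_le x hx := (h.D2_le x (hS hx)).trans hK
  holder x hx y hy := (h.holder x (hS hx) y (hS hy)).trans
    (mul_le_mul_of_nonneg_right hK (by positivity))

theorem exists_small_rpow {α : ℝ} (hα : 0 < α) (K : ℝ) {r ε : ℝ} (hr : 0 < r) (hε : 0 < ε) :
    ∃ h, 0 < h ∧ h ≤ r ∧ h ≤ 1 ∧ K * h ^ α ≤ ε := by
  have hc : Tendsto (fun h : ℝ => K * h ^ α) (𝓝[>] 0) (𝓝 (K * 0 ^ α)) :=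
    ((Real.continuousAt_rpow_const 0 α (Or.inr hα.le)).const_mul K).mono_left nhdsWithin_le_nhds
  rw [Real.zero_rpow hα.ne', mul_zero] at hc
  have h1 := hc.eventually (ge_mem_nhds hε)
  have h2 : ∀ᶠ h : ℝ in 𝓝[>] 0, h ∈ Ioc 0 (min r 1) := Ioc_mem_nhdsGT (lt_min hr one_pos)
  obtain ⟨h, hh, hh2⟩ := (h1.and h2).exists
  exact ⟨h, hh2.1, hh2.2.trans (min_le_left _ _), hh2.2.trans (min_le_right _ _), hh⟩

/-- Smallness of a difference in the sup norm forces smallness of the difference of the first two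
derivatives, quantitatively for functions with Hölder continuous second derivative. -/
theorem exists_delta_interp {α : ℝ} (hα : 0 < α) {K r ε : ℝ} (hK : 0 ≤ K) (hr : 0 < r)
    (hε : 0 < ε) :
    ∃ δ > 0, ∀ (φ ψ : E → ℝ) (x : E), ContDiff ℝ 2 φ → ContDiff ℝ 2 ψ →
      C2BoundOn α K (Metric.closedBall x r) φ → C2BoundOn α K (Metric.closedBall x r) ψ →
      (∀ y ∈ Metric.closedBall x r, |φ y - ψ y| ≤ δ) →
      ‖fderiv ℝ φ x - fderiv ℝ ψ x‖ ≤ ε ∧ ‖D2 φ x - D2 ψ x‖ ≤ ε := by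
  obtain ⟨h, h0, hhr, hh1, hhε⟩ := exists_small_rpow hα (8 * K) hr (half_pos hε)
  refine ⟨ε * h ^ 2 / 16, by positivity, fun φ ψ x hφ hψ bφ bψ hd => ?_⟩
  have hsub : Metric.closedBall x h ⊆ Metric.closedBall x r :=
    Metric.closedBall_subset_closedBall hhr
  have hx : x ∈ Metric.closedBall x r := Metric.mem_closedBall_self hr.le
  have hsm : ContDiff ℝ 2 (fun y => φ y - ψ y) := hφ.sub hψ
  have hosc : ∀ y ∈ Metric.closedBall x h,
      ‖D2 (fun y => φ y - ψ y) y - D2 (fun y => φ y - ψ y) x‖ ≤ 2 * K * h ^ α := by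
    intro y hy
    have hn : ‖y - x‖ ≤ h := by simpa [dist_eq_norm] using hy
    have hp : ‖y - x‖ ^ α ≤ h ^ α := Real.rpow_le_rpow (norm_nonneg _) hn hα.le
    rw [D2_sub hφ hψ, D2_sub hφ hψ]
    have e : D2 φ y - D2 ψ y - (D2 φ x - D2 ψ x) = (D2 φ y - D2 φ x) - (D2 ψ y - D2 ψ x) := by abel
    rw [e]
    calc _ ≤ ‖D2 φ y - D2 φ x‖ + ‖D2 ψ y - D2 ψ x‖ := norm_sub_le _ _
      _ ≤ K * ‖y - x‖ ^ α + K * ‖y - x‖ ^ α :=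
          add_le_add (bφ.holder y (hsub hy) x hx) (bψ.holder y (hsub hy) x hx)
      _ ≤ K * h ^ α + K * h ^ α := by gcongr
      _ = _ := by ring
  have h1 := norm_fderiv_le_of_osc hsm h0 (fun y hy => hd y (hsub hy)) hosc
  have h2 := norm_D2_le_of_osc hsm h0 (fun y hy => hd y (hsub hy)) hosc
  rw [fderiv_sub_of_C2 hφ hψ] at h1
  rw [D2_sub hφ hψ] at h2
  have e1 : ε * h ^ 2 / 16 / h = ε / 16 * h := by field_simp
  have e2 : 8 * (ε * h ^ 2 / 16) / h ^ 2 = ε / 2 := by field_simp; norm_num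
  have hKh : 0 ≤ K * h ^ α := by positivity
  constructor
  · rw [e1] at h1
    refine h1.trans ?_
    nlinarith
  · rw [e2] at h2
    refine h2.trans ?_
    nlinarith

theorem abs_Lop_le {A : E → Bil E →L[ℝ] ℝ} {b : E → E} {φ : E → ℝ} {x : E} {K K' : ℝ}
    (hK' : 0 ≤ K') (hA : ‖A x‖ ≤ K') (hb : ‖b x‖ ≤ K') (h1 : ‖fderiv ℝ φ x‖ ≤ K)
    (h2 : ‖D2 φ x‖ ≤ K) : |Lop A b φ x| ≤ 2 * K' * K := by
  have i1 : |A x (D2 φ x)| ≤ K' * K :=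
    ((A x).le_opNorm _).trans (mul_le_mul hA h2 (norm_nonneg _) hK')
  have i2 : |fderiv ℝ φ x (b x)| ≤ K * K' :=
    ((fderiv ℝ φ x).le_opNorm _).trans
      (mul_le_mul h1 hb (norm_nonneg _) ((norm_nonneg _).trans h1))
  calc _ ≤ |A x (D2 φ x)| + |fderiv ℝ φ x (b x)| := abs_add_le _ _
    _ ≤ _ := by linarith

theorem abs_Lop_sub_le {A : E → Bil E →L[ℝ] ℝ} {b : E → E} {φ ψ : E → ℝ} {x : E} {ε K' : ℝ}
    (hK' : 0 ≤ K') (hA : ‖A x‖ ≤ K') (hb : ‖b x‖ ≤ K') (h1 : ‖fderiv ℝ φ x - fderiv ℝ ψ x‖ ≤ ε)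
    (h2 : ‖D2 φ x - D2 ψ x‖ ≤ ε) : |Lop A b φ x - Lop A b ψ x| ≤ 2 * K' * ε := by
  have i1 : |A x (D2 φ x - D2 ψ x)| ≤ K' * ε :=
    ((A x).le_opNorm _).trans (mul_le_mul hA h2 (norm_nonneg _) hK')
  have i2 : |(fderiv ℝ φ x - fderiv ℝ ψ x) (b x)| ≤ ε * K' :=
    ((fderiv ℝ φ x - fderiv ℝ ψ x).le_opNorm _).trans
      (mul_le_mul h1 hb (norm_nonneg _) ((norm_nonneg _).trans h1))
  have e : Lop A b φ x - Lop A b ψ x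
      = A x (D2 φ x - D2 ψ x) + (fderiv ℝ φ x - fderiv ℝ ψ x) (b x) := by
    simp only [Lop, map_sub, sub_apply]; ring
  rw [e]
  calc _ ≤ |A x (D2 φ x - D2 ψ x)| + |(fderiv ℝ φ x - fderiv ℝ ψ x) (b x)| := abs_add_le _ _
    _ ≤ _ := by linarith

/-- Lipschitz continuity in time. -/
theorem IsSol.abs_sub_le {A : E → Bil E →L[ℝ] ℝ} {b : E → E} {T : ℝ} {f u : ℝ → E → ℝ}
    (h : IsSol A b T f u) {x : E} {C : ℝ}
    (hC : ∀ t ∈ Icc 0 T, |Lop A b (u t) x + f t x| ≤ C) {s t : ℝ} (hs : s ∈ Icc 0 T)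
    (ht : t ∈ Icc 0 T) : |u t x - u s x| ≤ C * |t - s| :=
  (convex_Icc 0 T).norm_image_sub_le_of_norm_hasDerivWithin_le
    (fun t ht => h.eqn t ht x) hC hs ht

theorem IsSol.limit_of_local {ι : Type*} {l : Ultrafilter ι} [FiniteDimensional ℝ E] {T : ℝ}
    (hT : 0 ≤ T)
    {A' : ι → E → Bil E →L[ℝ] ℝ} {b' : ι → E → E} {f' u' : ι → ℝ → E → ℝ}
    {A : E → Bil E →L[ℝ] ℝ} {b : E → E} {f u : ℝ → E → ℝ}
    (hsol : ∀ᶠ n in (l : Filter ι), IsSol (A' n) (b' n) T (f' n) (u' n))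
    (hA : ∀ x, Tendsto (fun n => A' n x) l (𝓝 (A x)))
    (hb : ∀ x, Tendsto (fun n => b' n x) l (𝓝 (b x)))
    (hf : ∀ t ∈ Icc 0 T, ∀ x, Tendsto (fun n => f' n t x) l (𝓝 (f t x)))
    (hu : ∀ t ∈ Icc 0 T, ∀ x, Tendsto (fun n => u' n t x) l (𝓝 (u t x)))
    (hloc : ∀ x₀, ∃ α > 0, ∃ r > 0, ∃ K, 0 ≤ K ∧ ∀ᶠ n in (l : Filter ι),
      (∀ t ∈ Icc 0 T, C2BoundOn α K (Metric.closedBall x₀ r) (u' n t)) ∧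
      ∀ x ∈ Metric.closedBall x₀ r, ‖A' n x‖ ≤ K ∧ ‖b' n x‖ ≤ K ∧ ∀ t ∈ Icc 0 T, |f' n t x| ≤ K)
    (hfe : ∀ x, ∀ t ∈ Icc 0 T, ∀ ε > 0, ∃ δ > 0, ∀ᶠ n in (l : Filter ι), ∀ s ∈ Icc 0 T,
      |s - t| < δ → |f' n s x - f' n t x| ≤ ε) :
    IsSol A b T f u ∧ ∀ t ∈ Icc 0 T, ∀ x,
      Tendsto (fun n => fderiv ℝ (u' n t) x) l (𝓝 (fderiv ℝ (u t) x)) ∧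
      Tendsto (fun n => D2 (u' n t) x) l (𝓝 (D2 (u t) x)) := by
  have : ProperSpace (E →L[ℝ] ℝ) := FiniteDimensional.proper_real _
  have : ProperSpace (Bil E) := FiniteDimensional.proper_real _
  have hspace : ∀ t ∈ Icc 0 T, ContDiff ℝ 2 (u t) ∧ ∀ x,
      Tendsto (fun n => fderiv ℝ (u' n t) x) l (𝓝 (fderiv ℝ (u t) x)) ∧
      Tendsto (fun n => D2 (u' n t) x) l (𝓝 (D2 (u t) x)) := by
    intro t ht
    have e1 : ∀ x, ∃ g, Tendsto (fun n => fderiv ℝ (u' n t) x) l (𝓝 g) := by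
      intro x
      obtain ⟨α, -, r, hr, K, -, hK⟩ := hloc x
      exact exists_tendsto_of_bounded l (C := K)
        (hK.mono fun n hn => (hn.1 t ht).fderiv_le x (Metric.mem_closedBall_self hr.le))
    have e2 : ∀ x, ∃ g, Tendsto (fun n => D2 (u' n t) x) l (𝓝 g) := by
      intro x
      obtain ⟨α, -, r, hr, K, -, hK⟩ := hloc x
      exact exists_tendsto_of_bounded l (C := K)
        (hK.mono fun n hn => (hn.1 t ht).D2_le x (Metric.mem_closedBall_self hr.le))
    choose P hP using e1
    choose B hB using e2
    obtain ⟨c1, c2, c3⟩ := contDiff_two_of_tendsto (hsol.mono fun n hn => hn.smooth t ht)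
      (hu t ht) hP hB (by
        intro x₀ ε hε
        obtain ⟨α, hα, r, hr, K, hK0, hK⟩ := hloc x₀
        obtain ⟨h, h0, hhr, -, hhε⟩ := exists_small_rpow hα K hr hε
        refine ⟨h, h0, hK.mono fun n hn x hx => ?_⟩
        have hx' : x ∈ Metric.closedBall x₀ r := (hx.le.trans hhr)
        refine ((hn.1 t ht).holder x hx' x₀ (Metric.mem_closedBall_self hr.le)).trans
          (le_trans ?_ hhε)
        rw [← dist_eq_norm]
        gcongr)
    refine ⟨c1, fun x => ⟨?_, ?_⟩⟩
    · rw [c2]; exact hP x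
    · rw [c3]; exact hB x
  refine ⟨⟨fun x => ?_, fun t ht => (hspace t ht).1, fun t ht x => ?_⟩,
    fun t ht => (hspace t ht).2⟩
  · have h0 : (0 : ℝ) ∈ Icc 0 T := ⟨le_rfl, hT⟩
    refine tendsto_nhds_unique_of_eventuallyEq (hu 0 h0 x) tendsto_const_nhds ?_
    exact hsol.mono fun n hn => hn.init x
  · obtain ⟨α, hα, r, hr, K, hK0, hK⟩ := hloc x
    refine hasDerivWithinAt_of_tendsto (convex_Icc 0 T) ht (l := l)
      (ψ := fun n s => u' n s x)
      (ψ' := fun n s => Lop (A' n) (b' n) (u' n s) x + f' n s x)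
      (hsol.mono fun n hn s hs => hn.eqn s hs x) (fun s hs => hu s hs x) ?_ ?_
    · refine Tendsto.add ?_ (hf t ht x)
      obtain ⟨-, hh⟩ := hspace t ht
      refine Tendsto.add ?_ ?_
      · exact ((isBoundedBilinearMap_apply (𝕜 := ℝ) (E := Bil E) (F := ℝ)).continuous.tendsto
          (A x, D2 (u t) x)).comp ((hA x).prodMk_nhds (hh x).2)
      · exact ((isBoundedBilinearMap_apply (𝕜 := ℝ) (E := E) (F := ℝ)).continuous.tendsto
          (fderiv ℝ (u t) x, b x)).comp ((hh x).1.prodMk_nhds (hb x))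
    · intro ε hε
      have hK1 : 0 < 4 * (K + 1) := by positivity
      obtain ⟨δ, hδ, hδ'⟩ := exists_delta_interp (E := E) hα hK0 hr (div_pos hε hK1)
      obtain ⟨δ₂, hδ₂, hf2⟩ := hfe x t ht (ε / 2) (half_pos hε)
      set C := 2 * K * K + K + 1 with hC
      have hC0 : 0 < C := by positivity
      refine ⟨min δ₂ (δ / C), lt_min hδ₂ (div_pos hδ hC0), ?_⟩
      filter_upwards [hsol, hK, hf2] with n hn hKn hfn s hs hst
      have hst1 : |s - t| < δ₂ := hst.trans_le (min_le_left _ _)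
      have hst2 : |s - t| ≤ δ / C := (hst.trans_le (min_le_right _ _)).le
      have hx : x ∈ Metric.closedBall x r := Metric.mem_closedBall_self hr.le
      obtain ⟨i1, i2⟩ := hδ' (u' n s) (u' n t) x (hn.smooth s hs) (hn.smooth t ht) (hKn.1 s hs)
        (hKn.1 t ht) (fun y hy => by
          have hb := hn.abs_sub_le (x := y) (C := C) (fun τ hτ => by
            have := abs_Lop_le hK0 (hKn.2 y hy).1 (hKn.2 y hy).2.1 ((hKn.1 τ hτ).fderiv_le y hy)
              ((hKn.1 τ hτ).D2_le y hy)
            have h3 := (hKn.2 y hy).2.2 τ hτ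
            exact (abs_add_le _ _).trans (by linarith)) ht hs
          refine hb.trans ?_
          rw [le_div_iff₀ hC0] at hst2
          linarith)
      have i3 := abs_Lop_sub_le hK0 (hKn.2 x hx).1 (hKn.2 x hx).2.1 i1 i2
      have i4 := hfn s hs hst1
      have i5 : 2 * K * (ε / (4 * (K + 1))) ≤ ε / 2 := by
        rw [← mul_div_assoc, div_le_iff₀ hK1]
        nlinarith
      calc _ = |(Lop (A' n) (b' n) (u' n s) x - Lop (A' n) (b' n) (u' n t) x)
            + (f' n s x - f' n t x)| := by congr 1; ring
        _ ≤ _ := abs_add_le _ _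
        _ ≤ ε := by linarith

theorem IsSol.limit {ι : Type*} {l : Ultrafilter ι} [FiniteDimensional ℝ E] {α T : ℝ}
    (hα : 0 < α) (hT : 0 ≤ T)
    {A' : ι → E → Bil E →L[ℝ] ℝ} {b' : ι → E → E} {f' u' : ι → ℝ → E → ℝ}
    {A : E → Bil E →L[ℝ] ℝ} {b : E → E} {f u : ℝ → E → ℝ}
    (hsol : ∀ᶠ n in (l : Filter ι), IsSol (A' n) (b' n) T (f' n) (u' n))
    (hA : ∀ x, Tendsto (fun n => A' n x) l (𝓝 (A x)))
    (hb : ∀ x, Tendsto (fun n => b' n x) l (𝓝 (b x)))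
    (hf : ∀ t ∈ Icc 0 T, ∀ x, Tendsto (fun n => f' n t x) l (𝓝 (f t x)))
    (hu : ∀ t ∈ Icc 0 T, ∀ x, Tendsto (fun n => u' n t x) l (𝓝 (u t x)))
    (hloc : ∀ x₀, ∃ r > 0, ∃ K, 0 ≤ K ∧ ∀ᶠ n in (l : Filter ι),
      (∀ t ∈ Icc 0 T, C2BoundOn α K (Metric.closedBall x₀ r) (u' n t)) ∧
      ∀ x ∈ Metric.closedBall x₀ r, ‖A' n x‖ ≤ K ∧ ‖b' n x‖ ≤ K ∧ ∀ t ∈ Icc 0 T, |f' n t x| ≤ K)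
    (hfe : ∀ x, ∀ t ∈ Icc 0 T, ∀ ε > 0, ∃ δ > 0, ∀ᶠ n in (l : Filter ι), ∀ s ∈ Icc 0 T,
      |s - t| < δ → |f' n s x - f' n t x| ≤ ε) :
    IsSol A b T f u ∧ ∀ t ∈ Icc 0 T, ∀ x,
      Tendsto (fun n => fderiv ℝ (u' n t) x) l (𝓝 (fderiv ℝ (u t) x)) ∧
      Tendsto (fun n => D2 (u' n t) x) l (𝓝 (D2 (u t) x)) :=
  IsSol.limit_of_local hT hsol hA hb hf hu (fun x₀ => ⟨α, hα, hloc x₀⟩) hfe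

end Solutions

section MaxPrinciple

variable {E : Type*} [NormedAddCommGroup E] [NormedSpace ℝ E]

/-- A linear functional on bilinear forms is elliptic (possibly degenerate) if it is nonpositive on
negative semidefinite forms. -/
def IsDegElliptic (A₀ : Bil E →L[ℝ] ℝ) : Prop :=
  ∀ B : Bil E, (∀ v w, B.left v w = B.left w v) → (∀ v, B.left v v ≤ 0) → A₀ B ≤ 0

theorem D2_nonpos_of_isLocalMax {φ : E → ℝ} (hφ : ContDiff ℝ 2 φ) {x : E} (h : IsLocalMax φ x)
    (v : E) : (D2 φ x).left v v ≤ 0 := by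
  by_contra! hc
  have hv : v ≠ 0 := by rintro rfl; simp at hc
  have hvn : 0 < ‖v‖ := norm_pos_iff.2 hv
  set c := (D2 φ x).left v v with hcdef
  have hκ : 0 < c / (4 * ‖v‖ ^ 2) := by positivity
  have h1 : ∀ᶠ y in 𝓝 x, ‖D2 φ y - D2 φ x‖ < c / (4 * ‖v‖ ^ 2) := by
    have := Metric.tendsto_nhds.1 ((continuous_D2 hφ).tendsto x) _ hκ
    simpa only [dist_eq_norm] using this
  obtain ⟨h, h0, hh⟩ := Metric.nhds_basis_closedBall.eventually_iff.1 (h1.and h)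
  have t1 := abs_taylor_two_le hφ hκ.le (h := h) (x := x) (fun y hy => (hh hy).1.le)
    (v := (h / ‖v‖) • v) (by
      rw [norm_smul, Real.norm_eq_abs, abs_of_pos (by positivity)]; field_simp; exact le_rfl)
  have t2 := (hh (x := x + (h / ‖v‖) • v) (by
    rw [Metric.mem_closedBall, dist_eq_norm, add_sub_cancel_left, norm_smul, Real.norm_eq_abs,
      abs_of_pos (by positivity)]; field_simp; exact le_rfl)).2
  have e0 : fderiv ℝ φ x = 0 := IsLocalMax.fderiv_eq_zero ‹_›
  rw [e0] at t1
  simp only [Bil.left_smul, map_smul, smul_apply, smul_eq_mul, zero_apply,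
    ← hcdef, norm_smul, Real.norm_eq_abs, abs_of_pos (div_pos h0 hvn)] at t1
  have e2 : c / (4 * ‖v‖ ^ 2) * (h / ‖v‖ * ‖v‖) ^ 2 = (1 / 4) * (h / ‖v‖ * (h / ‖v‖ * c)) := by
    field_simp
  rw [e2] at t1
  have hp : 0 < h / ‖v‖ * (h / ‖v‖ * c) := by positivity
  have := (abs_le.1 t1).1
  linarith

theorem Lop_nonpos_of_isLocalMax {A : E → Bil E →L[ℝ] ℝ} {b : E → E} {φ : E → ℝ}
    (hφ : ContDiff ℝ 2 φ) {x : E} (h : IsLocalMax φ x) (hA : IsDegElliptic (A x)) :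
    Lop A b φ x ≤ 0 := by
  have := hA _ (D2_symm hφ x) (D2_nonpos_of_isLocalMax hφ h)
  simpa [Lop, h.fderiv_eq_zero] using this

theorem deriv_nonneg_of_left_max {g : ℝ → ℝ} {g' t T : ℝ} (ht : 0 < t) (htT : t ≤ T)
    (hg : HasDerivWithinAt g g' (Icc 0 T) t) (hmax : ∀ s ∈ Icc 0 T, g s ≤ g t) : 0 ≤ g' := by
  have h1 : HasDerivWithinAt g g' (Ico 0 t) t :=
    hg.mono fun s hs => ⟨hs.1, hs.2.le.trans htT⟩
  rw [hasDerivWithinAt_iff_tendsto_slope' (by simp), nhdsWithin_Ico_eq_nhdsLT ht] at h1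
  refine ge_of_tendsto h1 ?_
  filter_upwards [Ioo_mem_nhdsLT ht] with s hs
  rw [slope_def_field]
  have := hmax s ⟨hs.1.le, hs.2.le.trans htT⟩
  rw [← neg_div_neg_eq]
  exact div_nonneg (by linarith) (by linarith [hs.2])

theorem max_principle_compact {A : E → Bil E →L[ℝ] ℝ} {b : E → E} (hA : ∀ x, IsDegElliptic (A x))
    {K : Set E} (hK : IsCompact K) {T : ℝ} {z : ℝ → E → ℝ}
    (hz : ContinuousOn (fun q : ℝ × E => z q.1 q.2) (Icc 0 T ×ˢ K))
    (h : ∀ t ∈ Icc 0 T, ∀ x ∈ K, 0 < z t x → 0 < t ∧ x ∈ interior K ∧ ContDiff ℝ 2 (z t) ∧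
      ∃ zt, HasDerivWithinAt (fun s => z s x) zt (Icc 0 T) t ∧ zt < Lop A b (z t) x) :
    ∀ t ∈ Icc 0 T, ∀ x ∈ K, z t x ≤ 0 := by
  intro t₀ ht₀ x₀ hx₀
  by_contra! hpos
  obtain ⟨⟨t, x⟩, ⟨ht, hx⟩, hmax⟩ := (isCompact_Icc.prod hK).exists_isMaxOn
    ⟨(t₀, x₀), ht₀, hx₀⟩ hz
  have hmax' : ∀ s ∈ Icc 0 T, ∀ y ∈ K, z s y ≤ z t x := fun s hs y hy =>
    hmax (show (s, y) ∈ Icc 0 T ×ˢ K from ⟨hs, hy⟩)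
  obtain ⟨h0, hi, hc, zt, hd, hlt⟩ := h t ht x hx (hpos.trans_le (hmax' _ ht₀ _ hx₀))
  have h1 : IsLocalMax (z t) x := by
    filter_upwards [mem_interior_iff_mem_nhds.1 hi] with y hy using hmax' t ht y hy
  have h2 := Lop_nonpos_of_isLocalMax (b := b) hc h1 (hA x)
  have h3 := deriv_nonneg_of_left_max h0 ht.2 hd (fun s hs => hmax' s hs x hx)
  linarith

end MaxPrinciple

section WholeSpace

variable {E : Type*} [NormedAddCommGroup E] [InnerProductSpace ℝ E]

theorem contDiff_one_add_norm_sq : ContDiff ℝ 2 (fun x : E => 1 + ‖x‖ ^ 2) :=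
  contDiff_const.add (contDiff_norm_sq ℝ)

theorem fderiv_one_add_norm_sq :
    fderiv ℝ (fun x : E => 1 + ‖x‖ ^ 2) = fun x => (2 : ℝ) • innerSL ℝ x := by
  funext x
  exact (((hasStrictFDerivAt_norm_sq x).hasFDerivAt).const_add 1).fderiv.trans (by norm_cast)

theorem norm_fderiv_one_add_norm_sq_le (x : E) :
    ‖fderiv ℝ (fun x : E => 1 + ‖x‖ ^ 2) x‖ ≤ 2 * ‖x‖ := by
  rw [fderiv_one_add_norm_sq, norm_smul, innerSL_apply_norm]
  simp

theorem norm_D2_one_add_norm_sq_le (x : E) : ‖D2 (fun x : E => 1 + ‖x‖ ^ 2) x‖ ≤ 2 := by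
  have h : HasFDerivAt (fun x : E => (2 : ℝ) • innerSL ℝ x)
      ((2 : ℝ) • (isBoundedBilinearMap_inner (𝕜 := ℝ) (E := E)).toContinuousLinearMap) x := by
    have := ((isBoundedBilinearMap_inner (𝕜 := ℝ) (E := E)).toContinuousLinearMap).hasFDerivAt
      (x := x)
    exact this.const_smul (2 : ℝ)
  refine Bil.norm_le_of_unit (by norm_num) fun v w hv hw => ?_
  have e : (D2 (fun x : E => 1 + ‖x‖ ^ 2) x).left v w = 2 * inner ℝ v w := by
    rw [D2_left_apply, fderiv_one_add_norm_sq, h.fderiv]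
    rfl
  rw [e, abs_mul]
  have := abs_real_inner_le_norm v w
  rw [hv, hw] at this
  norm_num
  linarith

/-- The weak maximum principle on the whole space for bounded coefficients. -/
theorem max_principle_whole [FiniteDimensional ℝ E] {A : E → Bil E →L[ℝ] ℝ} {b : E → E}
    (hA : ∀ x, IsDegElliptic (A x)) {Λ : ℝ} (hAb : ∀ x, ‖A x‖ ≤ Λ) (hbb : ∀ x, ‖b x‖ ≤ Λ)
    {T M : ℝ} {z : ℝ → E → ℝ}
    (hz : ContinuousOn (fun q : ℝ × E => z q.1 q.2) (Icc 0 T ×ˢ univ))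
    (hM : ∀ t ∈ Icc 0 T, ∀ x, z t x ≤ M) (h0 : ∀ x, z 0 x ≤ 0)
    (hsm : ∀ t ∈ Icc 0 T, ContDiff ℝ 2 (z t))
    (h : ∀ t ∈ Icc 0 T, ∀ x, 0 < z t x →
      ∃ zt, HasDerivWithinAt (fun s => z s x) zt (Icc 0 T) t ∧ zt ≤ Lop A b (z t) x) :
    ∀ t ∈ Icc 0 T, ∀ x, z t x ≤ 0 := by
  have hΛ : 0 ≤ Λ := (norm_nonneg _).trans (hbb 0)
  intro t ht x
  have key : ∀ ε > 0, z t x ≤ ε * (Real.exp ((5 * Λ + 1) * t) * (1 + ‖x‖ ^ 2)) := by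
    intro ε hε
    set κ := 5 * Λ + 1 with hκ
    obtain ⟨R, hR0, hxR, hRM⟩ : ∃ R, 0 ≤ R ∧ ‖x‖ ≤ R ∧ M ≤ ε * (1 + R ^ 2) := by
      refine ⟨max ‖x‖ (|M| / ε + 1), (norm_nonneg x).trans (le_max_left _ _), le_max_left _ _, ?_⟩
      have h1 : |M| / ε + 1 ≤ max ‖x‖ (|M| / ε + 1) := le_max_right _ _
      set R := max ‖x‖ (|M| / ε + 1)
      have h2 : 0 ≤ |M| / ε := by positivity
      have h3 : |M| / ε ≤ 1 + R ^ 2 := by nlinarith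
      rw [div_le_iff₀ hε] at h3
      linarith [le_abs_self M]
    have hc := max_principle_compact (b := b) hA (isCompact_closedBall (0 : E) R) (T := T)
      (z := fun t x => z t x - ε * (Real.exp (κ * t) * (1 + ‖x‖ ^ 2))) ?_ ?_ t ht x
        (by simpa using hxR)
    · linarith
    · refine ContinuousOn.sub (hz.mono (prod_mono_right (subset_univ _))) ?_
      exact Continuous.continuousOn (by fun_prop)
    · intro s hs y hy hpos
      have hy' : ‖y‖ ≤ R := by simpa using hy
      have hpe : 0 < Real.exp (κ * s) := Real.exp_pos _
      have hzpos : 0 < z s y := by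
        have : 0 < ε * (Real.exp (κ * s) * (1 + ‖y‖ ^ 2)) := by positivity
        linarith
      have hs0 : 0 < s := by
        rcases hs.1.eq_or_lt with h | h
        · rw [← h] at hzpos; linarith [h0 y]
        · exact h
      have hqs : ContDiff ℝ 2 (fun x : E => 1 + ‖x‖ ^ 2) := contDiff_one_add_norm_sq
      have hq2 : ContDiff ℝ 2 (fun x : E => Real.exp (κ * s) * (1 + ‖x‖ ^ 2)) :=
        contDiff_const.mul hqs
      have hq3 : ContDiff ℝ 2 (fun x : E => ε * (Real.exp (κ * s) * (1 + ‖x‖ ^ 2))) :=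
        contDiff_const.mul hq2
      refine ⟨hs0, ?_, (hsm s hs).sub hq3, ?_⟩
      · have : ‖y‖ < R := by
          refine lt_of_le_of_ne hy' fun e => ?_
          have h1 := hM s hs y
          have h2 : 1 ≤ Real.exp (κ * s) := Real.one_le_exp (by positivity)
          have h3 : 0 ≤ (Real.exp (κ * s) - 1) * (1 + ‖y‖ ^ 2) :=
            mul_nonneg (by linarith) (by positivity)
          have h4 : ε * (1 + R ^ 2) ≤ ε * (Real.exp (κ * s) * (1 + ‖y‖ ^ 2)) := by
            refine mul_le_mul_of_nonneg_left ?_ hε.le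
            rw [← e]; linarith
          linarith
        refine Metric.ball_subset_interior_closedBall ?_
        simpa using this
      · obtain ⟨zt, hzt, hle⟩ := h s hs y hzpos
        have hexp : HasDerivAt (fun s => ε * (Real.exp (κ * s) * (1 + ‖y‖ ^ 2)))
            (ε * (Real.exp (κ * s) * κ * (1 + ‖y‖ ^ 2))) s := by
          have h1 : HasDerivAt (fun s : ℝ => κ * s) κ s := by
            simpa using (hasDerivAt_id s).const_mul κ
          exact (h1.exp.mul_const _).const_mul ε
        refine ⟨_, hzt.sub hexp.hasDerivWithinAt, ?_⟩
        rw [Lop_sub (hsm s hs) hq3, Lop_const_mul hq2, Lop_const_mul hqs]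
        have hL : Lop A b (fun x : E => 1 + ‖x‖ ^ 2) y < κ * (1 + ‖y‖ ^ 2) := by
          have i1 : A y (D2 (fun x : E => 1 + ‖x‖ ^ 2) y) ≤ Λ * 2 :=
            (le_abs_self _).trans (((A y).le_opNorm _).trans
              (mul_le_mul (hAb y) (norm_D2_one_add_norm_sq_le y) (norm_nonneg _) hΛ))
          have i2 : fderiv ℝ (fun x : E => 1 + ‖x‖ ^ 2) y (b y) ≤ 2 * ‖y‖ * Λ :=
            (le_abs_self _).trans (((fderiv ℝ _ y).le_opNorm _).trans
              (mul_le_mul (norm_fderiv_one_add_norm_sq_le y) (hbb y) (norm_nonneg _)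
                (by positivity)))
          have i3 : 2 * ‖y‖ ≤ 1 + ‖y‖ ^ 2 := by nlinarith [sq_nonneg (‖y‖ - 1)]
          have i4 : 2 * ‖y‖ * Λ ≤ (1 + ‖y‖ ^ 2) * Λ := mul_le_mul_of_nonneg_right i3 hΛ
          have i5 : 0 ≤ Λ * ‖y‖ ^ 2 := by positivity
          have i6 : 0 ≤ ‖y‖ ^ 2 := by positivity
          unfold Lop
          rw [hκ]
          nlinarith
        have hp : 0 < ε * Real.exp (κ * s) := by positivity
        have := mul_lt_mul_of_pos_left hL hp
        nlinarith
  by_contra! hpos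
  set q := Real.exp ((5 * Λ + 1) * t) * (1 + ‖x‖ ^ 2)
  have hq : 0 < q := by positivity
  have := key (z t x / (2 * q)) (by positivity)
  have e : z t x / (2 * q) * q = z t x / 2 := by field_simp
  rw [e] at this
  linarith

theorem continuousOn_of_lipschitz_time {E : Type*} [PseudoMetricSpace E] {T : ℝ} {u : ℝ → E → ℝ}
    (hc : ∀ t ∈ Icc 0 T, Continuous (u t))
    (hl : ∀ x₀, ∃ r > 0, ∃ C, ∀ x ∈ Metric.ball x₀ r, ∀ s ∈ Icc 0 T, ∀ t ∈ Icc 0 T,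
      |u t x - u s x| ≤ C * |t - s|) :
    ContinuousOn (fun q : ℝ × E => u q.1 q.2) (Icc 0 T ×ˢ univ) := by
  rintro ⟨t₀, x₀⟩ ⟨ht₀, -⟩
  obtain ⟨r, hr, C, hC⟩ := hl x₀
  have h2 : Tendsto (fun q : ℝ × E => u t₀ q.2) (𝓝[Icc 0 T ×ˢ univ] (t₀, x₀)) (𝓝 (u t₀ x₀)) :=
    (((hc t₀ ht₀).comp continuous_snd).tendsto (t₀, x₀)).mono_left nhdsWithin_le_nhds
  have h1 : Tendsto (fun q : ℝ × E => u q.1 q.2 - u t₀ q.2) (𝓝[Icc 0 T ×ˢ univ] (t₀, x₀))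
      (𝓝 0) := by
    have h3 : Tendsto (fun q : ℝ × E => C * |q.1 - t₀|) (𝓝[Icc 0 T ×ˢ univ] (t₀, x₀)) (𝓝 0) := by
      have hcont : Continuous (fun q : ℝ × E => C * |q.1 - t₀|) := by fun_prop
      have := (hcont.tendsto (t₀, x₀)).mono_left
        (nhdsWithin_le_nhds (s := Icc (0 : ℝ) T ×ˢ (univ : Set E)))
      simpa using this
    refine squeeze_zero_norm' ?_ h3
    have hb : ∀ᶠ q : ℝ × E in 𝓝[Icc 0 T ×ˢ univ] (t₀, x₀), q.2 ∈ Metric.ball x₀ r :=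
      (continuous_snd.tendsto (t₀, x₀)).mono_left nhdsWithin_le_nhds
        (Metric.ball_mem_nhds _ hr)
    filter_upwards [hb, self_mem_nhdsWithin] with q hq hqs
    exact hC q.2 hq t₀ ht₀ q.1 hqs.1
  have := h1.add h2
  simpa [ContinuousWithinAt] using this

/-- A solution with bounded coefficients, bounded derivatives and bounded forcing is bounded by the
primitive of the bound on the forcing. -/
theorem IsSol.abs_le [FiniteDimensional ℝ E] {A : E → Bil E →L[ℝ] ℝ} {b : E → E}
    (hA : ∀ x, IsDegElliptic (A x)) {Λ : ℝ} (hAb : ∀ x, ‖A x‖ ≤ Λ) (hbb : ∀ x, ‖b x‖ ≤ Λ)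
    {T K : ℝ} {f u : ℝ → E → ℝ} (hu : IsSol A b T f u)
    (hK0 : ∀ t ∈ Icc 0 T, ∀ x, |u t x| ≤ K) (hK1 : ∀ t ∈ Icc 0 T, ∀ x, ‖fderiv ℝ (u t) x‖ ≤ K)
    (hK2 : ∀ t ∈ Icc 0 T, ∀ x, ‖D2 (u t) x‖ ≤ K)
    {g g' : ℝ → ℝ} (hg : ∀ t, HasDerivAt g (g' t) t) (hg0 : g 0 = 0)
    (hf : ∀ t ∈ Icc 0 T, ∀ x, |f t x| ≤ g' t) (hfb : ∃ F, ∀ t ∈ Icc 0 T, ∀ x, |f t x| ≤ F) :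
    ∀ t ∈ Icc 0 T, ∀ x, |u t x| ≤ g t := by
  have hΛ : 0 ≤ Λ := (norm_nonneg _).trans (hbb 0)
  obtain ⟨F, hF⟩ := hfb
  have hgc : Continuous g := continuous_iff_continuousAt.2 fun t => (hg t).continuousAt
  have hcont : ContinuousOn (fun q : ℝ × E => u q.1 q.2) (Icc 0 T ×ˢ univ) := by
    refine continuousOn_of_lipschitz_time (fun t ht => (hu.smooth t ht).continuous) fun x₀ =>
      ⟨1, one_pos, 2 * Λ * K + F, fun x _ s hs t ht => hu.abs_sub_le (fun τ hτ => ?_) hs ht⟩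
    exact (abs_add_le _ _).trans (add_le_add
      (abs_Lop_le hΛ (hAb x) (hbb x) (hK1 τ hτ x) (hK2 τ hτ x)) (hF τ hτ x))
  obtain ⟨G, hG⟩ : ∃ G, ∀ t ∈ Icc 0 T, |g t| ≤ G := by
    obtain ⟨G, hG⟩ := isCompact_Icc.exists_bound_of_continuousOn (hgc.continuousOn (s := Icc 0 T))
    exact ⟨G, hG⟩
  have key : ∀ σ : ℝ, |σ| = 1 → ∀ t ∈ Icc 0 T, ∀ x, σ * u t x - g t ≤ 0 := by
    intro σ hσ
    have hc0 : ∀ t, ContDiff ℝ 2 (fun _ : E => g t) := fun t => contDiff_const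
    have hsu : ∀ t ∈ Icc 0 T, ContDiff ℝ 2 (fun x => σ * u t x) := fun t ht =>
      contDiff_const.mul (hu.smooth t ht)
    refine max_principle_whole (b := b) (M := K + G) hA hAb hbb ?_ ?_ ?_ ?_ ?_
    · exact (continuousOn_const.mul hcont).sub (hgc.comp continuous_fst).continuousOn
    · intro t ht x
      have h1 : σ * u t x ≤ K := by
        refine (le_abs_self _).trans ?_
        rw [abs_mul, hσ, one_mul]
        exact hK0 t ht x
      linarith [neg_le_of_abs_le (hG t ht)]
    · intro x
      rw [hu.init, hg0]; simp
    · exact fun t ht => (hsu t ht).sub (hc0 t)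
    · intro t ht x _
      refine ⟨_, ((hu.eqn t ht x).const_mul σ).sub (hg t).hasDerivWithinAt, ?_⟩
      rw [Lop_sub (hsu t ht) (hc0 t), Lop_const_mul (hu.smooth t ht)]
      have e : Lop A b (fun _ : E => g t) x = 0 := by
        have e1 : fderiv ℝ (fun _ : E => g t) = fun _ => 0 := by
          funext y; exact fderiv_const_apply _
        have e2 : D2 (fun _ : E => g t) x = 0 := by
          unfold D2; rw [e1]; exact fderiv_const_apply _
        unfold Lop
        rw [e2, e1]; simp
      have h1 : σ * f t x ≤ g' t := by
        refine (le_abs_self _).trans ?_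
        rw [abs_mul, hσ, one_mul]
        exact hf t ht x
      rw [e]
      linarith
  intro t ht x
  rw [_root_.abs_le]
  constructor
  · linarith [key (-1) (by simp) t ht x]
  · linarith [key 1 (by simp) t ht x]

end WholeSpace

section Gauss

variable {E : Type*} [NormedAddCommGroup E] [InnerProductSpace ℝ E] [FiniteDimensional ℝ E]
  [MeasurableSpace E] [BorelSpace E]

/-- Continuous functions of at most polynomial growth. -/
def PolyGrowth {E G : Type*} [NormedAddCommGroup E] [NormedAddCommGroup G] (g : E → G) : Prop :=
  Continuous g ∧ ∃ (C : ℝ) (N : ℕ), 0 ≤ C ∧ ∀ z, ‖g z‖ ≤ C * (1 + ‖z‖) ^ N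

theorem PolyGrowth.of_bounded {E G : Type*} [NormedAddCommGroup E] [NormedAddCommGroup G]
    {g : E → G} (hg : Continuous g) {C : ℝ} (hC : ∀ z, ‖g z‖ ≤ C) : PolyGrowth g :=
  ⟨hg, C, 0, (norm_nonneg _).trans (hC 0), by simpa using hC⟩

theorem PolyGrowth.mul {E : Type*} [NormedAddCommGroup E] {g h : E → ℝ} (hg : PolyGrowth g)
    (hh : PolyGrowth h) : PolyGrowth (fun z => g z * h z) := by
  obtain ⟨c1, C1, N1, p1, h1⟩ := hg
  obtain ⟨c2, C2, N2, p2, h2⟩ := hh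
  refine ⟨c1.mul c2, C1 * C2, N1 + N2, by positivity, fun z => ?_⟩
  rw [norm_mul]
  calc _ ≤ (C1 * (1 + ‖z‖) ^ N1) * (C2 * (1 + ‖z‖) ^ N2) :=
        mul_le_mul (h1 z) (h2 z) (norm_nonneg _) (by positivity)
    _ = _ := by ring

theorem PolyGrowth.sub {E : Type*} [NormedAddCommGroup E] {g h : E → ℝ} (hg : PolyGrowth g)
    (hh : PolyGrowth h) : PolyGrowth (fun z => g z - h z) := by
  obtain ⟨c1, C1, N1, p1, h1⟩ := hg
  obtain ⟨c2, C2, N2, p2, h2⟩ := hh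
  refine ⟨c1.sub c2, C1 + C2, N1 + N2, by positivity, fun z => ?_⟩
  have hz : 1 ≤ 1 + ‖z‖ := by linarith [norm_nonneg z]
  have i1 : (1 + ‖z‖) ^ N1 ≤ (1 + ‖z‖) ^ (N1 + N2) := pow_le_pow_right₀ hz (by omega)
  have i2 : (1 + ‖z‖) ^ N2 ≤ (1 + ‖z‖) ^ (N1 + N2) := pow_le_pow_right₀ hz (by omega)
  calc _ ≤ ‖g z‖ + ‖h z‖ := norm_sub_le _ _
    _ ≤ C1 * (1 + ‖z‖) ^ N1 + C2 * (1 + ‖z‖) ^ N2 := add_le_add (h1 z) (h2 z)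
    _ ≤ C1 * (1 + ‖z‖) ^ (N1 + N2) + C2 * (1 + ‖z‖) ^ (N1 + N2) := by gcongr
    _ = _ := by ring

theorem PolyGrowth.inner {E : Type*} [NormedAddCommGroup E] [InnerProductSpace ℝ E] (k : E) :
    PolyGrowth (fun z : E => inner ℝ k z) := by
  refine ⟨by fun_prop, ‖k‖, 1, norm_nonneg _, fun z => ?_⟩
  refine (norm_inner_le_norm k z).trans ?_
  gcongr
  simp

theorem PolyGrowth.const {E : Type*} [NormedAddCommGroup E] (c : ℝ) :
    PolyGrowth (fun _ : E => c) :=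
  PolyGrowth.of_bounded continuous_const (C := |c|) fun _ => le_rfl

theorem PolyGrowth.comp_affine {E G : Type*} [NormedAddCommGroup E] [NormedSpace ℝ E]
    [NormedAddCommGroup G] {g : E → G} (hg : PolyGrowth g) (x : E) (S : E →L[ℝ] E) :
    PolyGrowth (fun z => g (x + S z)) := by
  obtain ⟨c1, C1, N1, p1, h1⟩ := hg
  refine ⟨by fun_prop, C1 * (1 + ‖x‖ + ‖S‖) ^ N1, N1, by positivity, fun z => ?_⟩
  refine (h1 _).trans ?_
  rw [mul_assoc, ← mul_pow]
  gcongr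
  have := norm_add_le x (S z)
  have := S.le_opNorm z
  nlinarith [norm_nonneg x, norm_nonneg z, mul_nonneg (norm_nonneg x) (norm_nonneg z),
    norm_nonneg S]

theorem PolyGrowth.norm_one_add_pow {E : Type*} [NormedAddCommGroup E] (N : ℕ) :
    PolyGrowth (fun z : E => (1 + ‖z‖) ^ N) :=
  ⟨by fun_prop, 1, N, zero_le_one, fun z => by
    rw [Real.norm_of_nonneg (by positivity), one_mul]⟩

theorem integrable_exp_neg_norm_sq {c : ℝ} (hc : 0 < c) :
    Integrable (fun z : E => Real.exp (-c * ‖z‖ ^ 2)) := by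
  have h := GaussianFourier.integrable_cexp_neg_mul_sq_norm_add (V := E) (b := (c : ℂ))
    (by simpa using hc) 0 0
  refine h.norm.congr (Eventually.of_forall fun z => ?_)
  change ‖Complex.exp _‖ = Real.exp _
  rw [Complex.norm_exp]
  congr 1
  simp [← Complex.ofReal_pow]

/-- The unnormalized Gaussian density. -/
noncomputable def gaussWeight (z : E) : ℝ := Real.exp (-(1 / 2) * ‖z‖ ^ 2)

theorem one_add_pow_mul_exp_le (N : ℕ) {r : ℝ} (hr : 0 ≤ r) :
    (1 + r) ^ N * Real.exp (-(1 / 2) * r ^ 2)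
      ≤ (N.factorial * Real.exp 2) * Real.exp (-(1 / 4) * r ^ 2) := by
  have h1 := Real.pow_div_factorial_le_exp (1 + r) (by positivity) N
  rw [div_le_iff₀ (by positivity)] at h1
  calc _ ≤ (Real.exp (1 + r) * N.factorial) * Real.exp (-(1 / 2) * r ^ 2) := by gcongr
    _ = N.factorial * Real.exp (1 + r + -(1 / 2) * r ^ 2) := by rw [Real.exp_add (1 + r)]; ring
    _ ≤ N.factorial * Real.exp (2 + -(1 / 4) * r ^ 2) := by
        exact mul_le_mul_of_nonneg_left
          (Real.exp_le_exp.2 (by nlinarith [sq_nonneg (r - 2)])) (by positivity)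
    _ = _ := by rw [Real.exp_add]; ring

theorem PolyGrowth.integrable_mul_gaussWeight {g : E → ℝ} (hg : PolyGrowth g) :
    Integrable (fun z => gaussWeight z * g z) := by
  obtain ⟨c, C, N, hC, h⟩ := hg
  refine ((integrable_exp_neg_norm_sq (E := E) (c := 1 / 4) (by norm_num)).const_mul
    (C * (N.factorial * Real.exp 2))).mono' ?_ (Eventually.of_forall fun z => ?_)
  · refine Continuous.aestronglyMeasurable ?_
    unfold gaussWeight
    fun_prop
  · have h0 : 0 < gaussWeight z := Real.exp_pos _
    rw [norm_mul, Real.norm_of_nonneg h0.le]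
    calc _ ≤ gaussWeight z * (C * (1 + ‖z‖) ^ N) := by gcongr; exact h z
      _ = C * ((1 + ‖z‖) ^ N * Real.exp (-(1 / 2) * ‖z‖ ^ 2)) := by unfold gaussWeight; ring
      _ ≤ C * ((N.factorial * Real.exp 2) * Real.exp (-(1 / 4) * ‖z‖ ^ 2)) := by
          gcongr C * ?_
          exact one_add_pow_mul_exp_le N (norm_nonneg z)
      _ = _ := by ring

variable (E) in
/-- The total mass of the unnormalized Gaussian density. -/
noncomputable def gaussMass : ℝ := ∫ z : E, gaussWeight z

theorem gaussMass_pos : 0 < gaussMass E := by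
  have hi : Integrable (fun z : E => gaussWeight z) := integrable_exp_neg_norm_sq (by norm_num)
  refine (integral_pos_iff_support_of_nonneg (fun z => (Real.exp_pos _).le) hi).2 ?_
  have : Function.support (fun z : E => gaussWeight z) = univ := by
    ext z; simp [gaussWeight]
  change 0 < volume (Function.support fun z : E => gaussWeight z)
  rw [this]
  exact isOpen_univ.measure_pos _ univ_nonempty

variable (E) in
/-- The standard Gaussian probability measure, as a density. -/
noncomputable def gauss : Measure E :=
  volume.withDensity fun z => ENNReal.ofReal (gaussWeight z / gaussMass E)

theorem integral_gauss {G : Type*} [NormedAddCommGroup G] [NormedSpace ℝ G] (g : E → G) :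
    ∫ z, g z ∂gauss E = ∫ z, (gaussWeight z / gaussMass E) • g z := by
  have hm : Measurable fun z : E => ENNReal.ofReal (gaussWeight z / gaussMass E) := by
    unfold gaussWeight; fun_prop
  unfold gauss
  rw [integral_withDensity_eq_integral_toReal_smul hm (by simp)]
  refine integral_congr_ae (Eventually.of_forall fun z => ?_)
  have : 0 ≤ gaussWeight z / gaussMass E := div_nonneg (Real.exp_pos _).le gaussMass_pos.le
  simp [ENNReal.toReal_ofReal this]

theorem PolyGrowth.integrable_gauss {g : E → ℝ} (hg : PolyGrowth g) : Integrable g (gauss E) := by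
  have hm : Measurable fun z : E => ENNReal.ofReal (gaussWeight z / gaussMass E) := by
    unfold gaussWeight; fun_prop
  unfold gauss
  rw [integrable_withDensity_iff_integrable_smul' hm (by simp)]
  refine (hg.integrable_mul_gaussWeight.div_const (gaussMass E)).congr
    (Eventually.of_forall fun z => ?_)
  have : 0 ≤ gaussWeight z / gaussMass E := div_nonneg (Real.exp_pos _).le gaussMass_pos.le
  simp [ENNReal.toReal_ofReal this]
  ring

instance : IsProbabilityMeasure (gauss E) := by
  have hm : Measurable fun z : E => ENNReal.ofReal (gaussWeight z / gaussMass E) := by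
    unfold gaussWeight; fun_prop
  have hi : Integrable (fun z : E => gaussWeight z / gaussMass E) :=
    (integrable_exp_neg_norm_sq (E := E) (by norm_num : (0 : ℝ) < 1 / 2)).div_const _
  refine ⟨?_⟩
  unfold gauss
  rw [withDensity_apply _ MeasurableSet.univ, Measure.restrict_univ,
    ← ofReal_integral_eq_lintegral_ofReal hi
      (Eventually.of_forall fun z => div_nonneg (Real.exp_pos _).le gaussMass_pos.le),
    integral_div]
  change ENNReal.ofReal (gaussMass E / gaussMass E) = 1
  rw [div_self gaussMass_pos.ne', ENNReal.ofReal_one]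

theorem hasFDerivAt_gaussWeight (z : E) :
    HasFDerivAt (gaussWeight (E := E)) (-(gaussWeight z) • innerSL ℝ z) z := by
  have h := ((hasStrictFDerivAt_norm_sq z).hasFDerivAt.const_mul (-(1 / 2) : ℝ)).exp
  refine h.congr_fderiv ?_
  ext w
  simp [gaussWeight]

/-- Gaussian integration by parts. -/
theorem integral_fderiv_gauss {g : E → ℝ} (hg : ContDiff ℝ 1 g) (h0 : PolyGrowth g) (k : E)
    (h1 : PolyGrowth (fun z => fderiv ℝ g z k)) :
    ∫ z, fderiv ℝ g z k ∂gauss E = ∫ z, inner ℝ k z * g z ∂gauss E := by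
  have hd : Differentiable ℝ g := hg.differentiable (by norm_num)
  have e1 : ∀ z : E, fderiv ℝ (gaussWeight (E := E)) z k = -(gaussWeight z * inner ℝ k z) := by
    intro z
    rw [(hasFDerivAt_gaussWeight z).fderiv]
    simp [real_inner_comm]
  have key := integral_mul_fderiv_eq_neg_fderiv_mul_of_integrable (μ := (volume : Measure E))
    (f := gaussWeight (E := E)) (g := g) (v := k) ?_ h1.integrable_mul_gaussWeight
    h0.integrable_mul_gaussWeight (fun z _ => (hasFDerivAt_gaussWeight z).differentiableAt)
    (fun z _ => hd z)
  · rw [integral_gauss, integral_gauss]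
    simp only [smul_eq_mul, div_mul_eq_mul_div, integral_div]
    rw [key, ← integral_neg]
    congr 2
    funext z
    rw [e1]; ring
  · simp only [e1]
    refine ((PolyGrowth.inner k).mul h0).integrable_mul_gaussWeight.neg.congr
      (Eventually.of_forall fun z => ?_)
    simp; ring

end Gauss

section Heat

variable {E : Type*} [NormedAddCommGroup E] [InnerProductSpace ℝ E] [FiniteDimensional ℝ E]
  [MeasurableSpace E] [BorelSpace E]
  {G : Type*} [NormedAddCommGroup G] [NormedSpace ℝ G]

/-- The heat semigroup associated with `σ σᵀ / 2`, evaluated at time `s`. -/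
noncomputable def heatQ (σ : E →L[ℝ] E) (s : ℝ) (g : E → G) (x : E) : G :=
  ∫ z, g (x + Real.sqrt s • σ z) ∂gauss E

theorem norm_heatQ_le (σ : E →L[ℝ] E) (s : ℝ) {g : E → G} {K : ℝ} (hK : ∀ x, ‖g x‖ ≤ K) (x : E) :
    ‖heatQ σ s g x‖ ≤ K := by
  have := norm_integral_le_of_norm_le_const (μ := gauss E)
    (f := fun z => g (x + Real.sqrt s • σ z)) (C := K) (Eventually.of_forall fun z => hK _)
  simpa [heatQ] using this

theorem integrable_gauss_of_bounded {g : E → G} (hg : Continuous g) {K : ℝ} (hK : ∀ x, ‖g x‖ ≤ K) :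
    Integrable g (gauss E) :=
  Integrable.mono' (integrable_const K) hg.aestronglyMeasurable (Eventually.of_forall hK)

theorem continuous_heatQ {P : Type*} [TopologicalSpace P] [FirstCountableTopology P]
    (σ : E →L[ℝ] E) {F : P → E → G} {K : ℝ}
    (hF : Continuous fun q : P × E => F q.1 q.2) (hK : ∀ p x, ‖F p x‖ ≤ K) :
    Continuous fun q : P × ℝ × E => heatQ σ q.2.1 (F q.1) q.2.2 := by
  unfold heatQ
  refine continuous_of_dominated (bound := fun _ => K) (fun q => ?_) (fun q => ?_)
    (integrable_const K) (Eventually.of_forall fun z => ?_)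
  · refine Continuous.aestronglyMeasurable ?_
    exact hF.comp (f := fun z : E => (q.1, q.2.2 + Real.sqrt q.2.1 • σ z)) (by fun_prop)
  · exact Eventually.of_forall fun z => hK _ _
  · exact hF.comp (f := fun q : P × ℝ × E => (q.1, q.2.2 + Real.sqrt q.2.1 • σ z)) (by fun_prop)

theorem hasFDerivAt_weighted {w : E → ℝ} (hw : Integrable w (gauss E)) (hwc : Continuous w)
    (S : E →L[ℝ] E) {g : E → G} {g' : E → E →L[ℝ] G} {K : ℝ} (hd : ∀ x, HasFDerivAt g (g' x) x)
    (hg' : Continuous g') (h0 : ∀ x, ‖g x‖ ≤ K) (h1 : ∀ x, ‖g' x‖ ≤ K) (x : E) :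
    HasFDerivAt (fun x => ∫ z, w z • g (x + S z) ∂gauss E)
      (∫ z, w z • g' (x + S z) ∂gauss E) x := by
  have hgc : Continuous g := continuous_iff_continuousAt.2 fun x => (hd x).continuousAt
  refine hasFDerivAt_integral_of_dominated_of_fderiv_le (s := univ)
    (F' := fun x z => w z • g' (x + S z)) (bound := fun z => ‖w z‖ * K) univ_mem
    (Eventually.of_forall fun y => ?_) ?_ ?_
    (Eventually.of_forall fun z y _ => ?_) (hw.norm.mul_const K)
    (Eventually.of_forall fun z y _ => ?_)
  · exact Continuous.aestronglyMeasurable (by fun_prop)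
  · refine (hw.norm.mul_const K).mono' (Continuous.aestronglyMeasurable (by fun_prop))
      (Eventually.of_forall fun z => ?_)
    rw [norm_smul]
    exact mul_le_mul_of_nonneg_left (h0 _) (norm_nonneg _)
  · exact Continuous.aestronglyMeasurable (by fun_prop)
  · rw [norm_smul]
    exact mul_le_mul_of_nonneg_left (h1 _) (norm_nonneg _)
  · have h := (hd (y + S z)).comp y ((hasFDerivAt_id y).add_const (S z))
    rw [ContinuousLinearMap.comp_id] at h
    exact h.const_smul (w z)

theorem hasFDerivAt_heatQ (σ : E →L[ℝ] E) (s : ℝ) {g : E → G} {g' : E → E →L[ℝ] G} {K : ℝ}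
    (hd : ∀ x, HasFDerivAt g (g' x) x) (hg' : Continuous g') (h0 : ∀ x, ‖g x‖ ≤ K)
    (h1 : ∀ x, ‖g' x‖ ≤ K) (x : E) :
    HasFDerivAt (heatQ σ s g) (heatQ σ s g' x) x := by
  have := hasFDerivAt_weighted (w := fun _ : E => (1 : ℝ)) (integrable_const _) continuous_const
    (Real.sqrt s • σ) hd hg' h0 h1 x
  simp only [one_smul] at this
  exact this

/-- A source term which is smooth in space, jointly continuous with its derivatives. -/
structure SmoothSource (K : ℝ) (f : ℝ → E → ℝ) : Prop where
  smooth : ∀ t, ContDiff ℝ 2 (f t)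
  cont0 : Continuous fun q : ℝ × E => f q.1 q.2
  cont1 : Continuous fun q : ℝ × E => fderiv ℝ (f q.1) q.2
  cont2 : Continuous fun q : ℝ × E => D2 (f q.1) q.2
  le0 : ∀ t x, ‖f t x‖ ≤ K
  le1 : ∀ t x, ‖fderiv ℝ (f t) x‖ ≤ K
  le2 : ∀ t x, ‖D2 (f t) x‖ ≤ K

/-- The Duhamel integral. -/
noncomputable def heatU (σ : E →L[ℝ] E) (F : ℝ → E → G) (t : ℝ) (x : E) : G :=
  ∫ s in (0 : ℝ)..t, heatQ σ s (F (t - s)) x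

theorem continuous_heatQ_shift (σ : E →L[ℝ] E) {F : ℝ → E → G} {K : ℝ}
    (hF : Continuous fun q : ℝ × E => F q.1 q.2) (hK : ∀ p x, ‖F p x‖ ≤ K) :
    Continuous fun q : (ℝ × E) × ℝ => heatQ σ q.2 (F (q.1.1 - q.2)) q.1.2 :=
  (continuous_heatQ σ hF hK).comp
    (f := fun q : (ℝ × E) × ℝ => (q.1.1 - q.2, q.2, q.1.2)) (by fun_prop)

theorem continuous_heatU (σ : E →L[ℝ] E) {F : ℝ → E → G} {K : ℝ}
    (hF : Continuous fun q : ℝ × E => F q.1 q.2) (hK : ∀ p x, ‖F p x‖ ≤ K) :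
    Continuous fun q : ℝ × E => heatU σ F q.1 q.2 :=
  intervalIntegral.continuous_parametric_intervalIntegral_of_continuous
    (f := fun (q : ℝ × E) s => heatQ σ s (F (q.1 - s)) q.2)
    (continuous_heatQ_shift σ hF hK) continuous_fst

theorem norm_heatU_le (σ : E →L[ℝ] E) {F : ℝ → E → G} {K : ℝ} (hK : ∀ p x, ‖F p x‖ ≤ K) {t : ℝ}
    (ht : 0 ≤ t) (x : E) : ‖heatU σ F t x‖ ≤ K * t := by
  have := intervalIntegral.norm_integral_le_of_norm_le_const (a := 0) (b := t) (C := K)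
    (f := fun s => heatQ σ s (F (t - s)) x) fun s _ => norm_heatQ_le σ s (hK _) x
  simpa [heatU, abs_of_nonneg ht] using this

theorem hasFDerivAt_heatU (σ : E →L[ℝ] E) {F : ℝ → E → G} {F' : ℝ → E → E →L[ℝ] G} {K : ℝ}
    (hd : ∀ t x, HasFDerivAt (F t) (F' t x) x)
    (hF : Continuous fun q : ℝ × E => F q.1 q.2) (hF' : Continuous fun q : ℝ × E => F' q.1 q.2)
    (h0 : ∀ t x, ‖F t x‖ ≤ K) (h1 : ∀ t x, ‖F' t x‖ ≤ K) (t : ℝ) (x : E) :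
    HasFDerivAt (heatU σ F t) (heatU σ F' t x) x := by
  have hc : ∀ y, Continuous fun s => heatQ σ s (F (t - s)) y := fun y =>
    (continuous_heatQ_shift σ hF h0).comp (f := fun s => ((t, y), s)) (by fun_prop)
  have hc' : ∀ y, Continuous fun s => heatQ σ s (F' (t - s)) y := fun y =>
    (continuous_heatQ_shift σ hF' h1).comp (f := fun s => ((t, y), s)) (by fun_prop)
  have hF't : ∀ t, Continuous (F' t) := fun t =>
    hF'.comp (f := fun x => (t, x)) (by fun_prop)
  exact intervalIntegral.hasFDerivAt_integral_of_dominated_of_fderiv_le (s := univ) (𝕜 := ℝ)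
    (F' := fun x s => heatQ σ s (F' (t - s)) x) (bound := fun _ => K) univ_mem
    (Eventually.of_forall fun y => (hc y).aestronglyMeasurable) ((hc x).intervalIntegrable _ _)
    (hc' x).aestronglyMeasurable
    (Eventually.of_forall fun s _ y _ => norm_heatQ_le σ s (h1 _) y)
    (intervalIntegrable_const)
    (Eventually.of_forall fun s _ y _ => hasFDerivAt_heatQ σ s (hd _) (hF't _) (h0 _) (h1 _) y)

theorem SmoothSource.heatU_smooth {K : ℝ} {f : ℝ → E → ℝ} (hf : SmoothSource K f) (σ : E →L[ℝ] E)
    (t : ℝ) :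
    ContDiff ℝ 2 (heatU σ f t) ∧ fderiv ℝ (heatU σ f t) = heatU σ (fun t => fderiv ℝ (f t)) t ∧
      D2 (heatU σ f t) = heatU σ (fun t => D2 (f t)) t := by
  refine contDiff_two_of_hasFDerivAt (fun x => ?_) (fun x => ?_) ?_
  · exact hasFDerivAt_heatU σ (fun t x => hasFDerivAt_of_C2 (hf.smooth t) x) hf.cont0 hf.cont1
      hf.le0 hf.le1 t x
  · exact hasFDerivAt_heatU σ (fun t x => hasFDerivAt_fderiv_of_C2 (hf.smooth t) x)
      hf.cont1 hf.cont2
      hf.le1 hf.le2 t x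
  · exact (continuous_heatU σ hf.cont2 hf.le2).comp (f := fun x => (t, x)) (by fun_prop)

/-- Evaluation of a bilinear form. -/
noncomputable def Bil.evalCLM (v w : E) : Bil E →L[ℝ] ℝ :=
  (ContinuousLinearMap.apply ℝ ℝ w).comp
    (show Bil E →L[ℝ] (E →L[ℝ] ℝ) from ContinuousLinearMap.apply ℝ (E →L[ℝ] ℝ) v)

@[simp] theorem Bil.evalCLM_apply (v w : E) (B : Bil E) : Bil.evalCLM v w B = B.left v w := rfl

theorem heatQ_clm {H : Type*} [NormedAddCommGroup H] [NormedSpace ℝ H] [CompleteSpace H]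
    [CompleteSpace G] (L : G →L[ℝ] H) (σ : E →L[ℝ] E) (s : ℝ) {g : E → G}
    (hg : Continuous g) {K : ℝ} (hK : ∀ x, ‖g x‖ ≤ K) (x : E) :
    L (heatQ σ s g x) = heatQ σ s (fun y => L (g y)) x :=
  (L.integral_comp_comm (integrable_gauss_of_bounded (by fun_prop) fun z => hK _)).symm

theorem heatU_clm {H : Type*} [NormedAddCommGroup H] [NormedSpace ℝ H] [CompleteSpace H]
    [CompleteSpace G] (L : G →L[ℝ] H) (σ : E →L[ℝ] E) {F : ℝ → E → G}
    (hF : Continuous fun q : ℝ × E => F q.1 q.2) {K : ℝ} (hK : ∀ t x, ‖F t x‖ ≤ K) (t : ℝ) (x : E) :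
    L (heatU σ F t x) = heatU σ (fun t y => L (F t y)) t x := by
  have hc : Continuous fun s => heatQ σ s (F (t - s)) x :=
    (continuous_heatQ_shift σ hF hK).comp (f := fun s => ((t, x), s)) (by fun_prop)
  unfold heatU
  rw [← L.intervalIntegral_comp_comm (hc.intervalIntegrable _ _)]
  refine intervalIntegral.integral_congr fun s _ => ?_
  exact heatQ_clm L σ s (hF.comp (f := fun x => (t - s, x)) (by fun_prop)) (hK _) x

end Heat

section Kernel

variable {E : Type*} [NormedAddCommGroup E] [InnerProductSpace ℝ E] [FiniteDimensional ℝ E]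
  [MeasurableSpace E] [BorelSpace E]

theorem gauss_ibp {P g : E → ℝ} {k : E} (hP : ContDiff ℝ 1 P) (hg : ContDiff ℝ 1 g)
    (P0 : PolyGrowth P) (P1 : PolyGrowth fun z => fderiv ℝ P z k) (g0 : PolyGrowth g)
    (g1 : PolyGrowth fun z => fderiv ℝ g z k) :
    ∫ z, P z * fderiv ℝ g z k ∂gauss E
      = ∫ z, (inner ℝ k z * P z - fderiv ℝ P z k) * g z ∂gauss E := by
  have e : ∀ z, fderiv ℝ (fun z => P z * g z) z k
      = P z * fderiv ℝ g z k + fderiv ℝ P z k * g z := by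
    intro z
    have h := ((hP.differentiable (by norm_num) z).hasFDerivAt.mul
      (hg.differentiable (by norm_num) z).hasFDerivAt).fderiv
    change fderiv ℝ (fun z => P z * g z) z = _ at h
    rw [h]
    simp; ring
  have a1 : PolyGrowth fun z => P z * fderiv ℝ g z k := P0.mul g1
  have a2 : PolyGrowth fun z => fderiv ℝ P z k * g z := P1.mul g0
  have a12 : PolyGrowth fun z => P z * fderiv ℝ g z k + fderiv ℝ P z k * g z := by
    have := a1.sub ((PolyGrowth.const (-1)).mul a2)
    simpa using this
  have key := integral_fderiv_gauss (hP.mul hg) (P0.mul g0) k (by simpa only [e] using a12)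
  simp only [e] at key
  rw [integral_add a1.integrable_gauss a2.integrable_gauss] at key
  have a3 : PolyGrowth fun z => inner ℝ k z * (P z * g z) := (PolyGrowth.inner k).mul (P0.mul g0)
  have : ∫ z, P z * fderiv ℝ g z k ∂gauss E
      = ∫ z, inner ℝ k z * (P z * g z) ∂gauss E - ∫ z, fderiv ℝ P z k * g z ∂gauss E := by linarith
  rw [this, ← integral_sub a3.integrable_gauss a2.integrable_gauss]
  congr 1; funext z; ring

theorem fderiv_inner_left (k z v : E) : fderiv ℝ (fun z : E => inner ℝ k z) z v = inner ℝ k v := by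
  change fderiv ℝ (innerSL ℝ k) z v = _
  rw [ContinuousLinearMap.fderiv]; rfl

/-- The second Hermite polynomial. -/
noncomputable def herm2 (k₁ k₂ z : E) : ℝ := inner ℝ k₁ z * inner ℝ k₂ z - inner ℝ k₁ k₂

/-- The third Hermite polynomial. -/
noncomputable def herm3 (k₁ k₂ k₃ z : E) : ℝ :=
  inner ℝ k₃ z * herm2 k₁ k₂ z - (inner ℝ k₁ k₃ * inner ℝ k₂ z + inner ℝ k₁ z * inner ℝ k₂ k₃)

theorem contDiff_herm2 (k₁ k₂ : E) : ContDiff ℝ 1 (herm2 k₁ k₂) := by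
  have h1 : ContDiff ℝ 1 (fun z : E => inner ℝ k₁ z) := (innerSL ℝ k₁).contDiff
  have h2 : ContDiff ℝ 1 (fun z : E => inner ℝ k₂ z) := (innerSL ℝ k₂).contDiff
  exact (h1.mul h2).sub contDiff_const

theorem fderiv_herm2 (k₁ k₂ z v : E) :
    fderiv ℝ (herm2 k₁ k₂) z v = inner ℝ k₁ v * inner ℝ k₂ z + inner ℝ k₁ z * inner ℝ k₂ v := by
  have h1 : HasFDerivAt (fun z : E => inner ℝ k₁ z) (innerSL ℝ k₁) z := (innerSL ℝ k₁).hasFDerivAt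
  have h2 : HasFDerivAt (fun z : E => inner ℝ k₂ z) (innerSL ℝ k₂) z := (innerSL ℝ k₂).hasFDerivAt
  have h := ((h1.mul h2).sub_const (inner ℝ k₁ k₂)).fderiv
  change fderiv ℝ (herm2 k₁ k₂) z = _ at h
  rw [h]
  simp; ring

theorem polyGrowth_herm2 (k₁ k₂ : E) : PolyGrowth (herm2 k₁ k₂) :=
  ((PolyGrowth.inner k₁).mul (PolyGrowth.inner k₂)).sub (PolyGrowth.const _)

theorem polyGrowth_fderiv_herm2 (k₁ k₂ v : E) : PolyGrowth fun z => fderiv ℝ (herm2 k₁ k₂) z v := by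
  simp only [fderiv_herm2]
  have := ((PolyGrowth.const (inner ℝ k₁ v)).mul (PolyGrowth.inner k₂)).sub
    ((PolyGrowth.const (-1)).mul ((PolyGrowth.inner k₁).mul (PolyGrowth.const (inner ℝ k₂ v))))
  simpa using this

theorem abs_herm2_le (k₁ k₂ z : E) : |herm2 k₁ k₂ z| ≤ 2 * ‖k₁‖ * ‖k₂‖ * (1 + ‖z‖) ^ 3 := by
  have h1 := abs_real_inner_le_norm k₁ z
  have h2 := abs_real_inner_le_norm k₂ z
  have h3 := abs_real_inner_le_norm k₁ k₂
  have hz := norm_nonneg z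
  have hn : 0 ≤ ‖k₁‖ * ‖k₂‖ := by positivity
  have h12 : |inner ℝ k₁ z * inner ℝ k₂ z| ≤ (‖k₁‖ * ‖z‖) * (‖k₂‖ * ‖z‖) := by
    rw [abs_mul]; gcongr
  calc _ ≤ |inner ℝ k₁ z * inner ℝ k₂ z| + |inner ℝ k₁ k₂| := abs_sub _ _
    _ ≤ (‖k₁‖ * ‖k₂‖) * (‖z‖ ^ 2 + 1) := by linarith
    _ ≤ (‖k₁‖ * ‖k₂‖) * (2 * (1 + ‖z‖) ^ 3) := by
        gcongr; nlinarith [pow_nonneg hz 2, pow_nonneg hz 3]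
    _ = _ := by ring

theorem abs_herm3_le (k₁ k₂ k₃ z : E) :
    |herm3 k₁ k₂ k₃ z| ≤ 4 * ‖k₁‖ * ‖k₂‖ * ‖k₃‖ * (1 + ‖z‖) ^ 3 := by
  have h1 := abs_real_inner_le_norm k₁ z
  have h2 := abs_real_inner_le_norm k₂ z
  have h3 := abs_real_inner_le_norm k₃ z
  have h13 := abs_real_inner_le_norm k₁ k₃
  have h23 := abs_real_inner_le_norm k₂ k₃
  have h12 := abs_real_inner_le_norm k₁ k₂
  have hz := norm_nonneg z
  have hn : 0 ≤ ‖k₁‖ * ‖k₂‖ * ‖k₃‖ := by positivity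
  have e : herm3 k₁ k₂ k₃ z = inner ℝ k₃ z * inner ℝ k₁ z * inner ℝ k₂ z
      - inner ℝ k₃ z * inner ℝ k₁ k₂ - inner ℝ k₁ k₃ * inner ℝ k₂ z
        - inner ℝ k₁ z * inner ℝ k₂ k₃ := by
    unfold herm3 herm2; ring
  rw [e]
  have i1 : |inner ℝ k₃ z * inner ℝ k₁ z * inner ℝ k₂ z|
      ≤ (‖k₃‖ * ‖z‖) * (‖k₁‖ * ‖z‖) * (‖k₂‖ * ‖z‖) := by
    rw [abs_mul, abs_mul]; gcongr
  have i2 : |inner ℝ k₃ z * inner ℝ k₁ k₂| ≤ (‖k₃‖ * ‖z‖) * (‖k₁‖ * ‖k₂‖) := by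
    rw [abs_mul]; gcongr
  have i3 : |inner ℝ k₁ k₃ * inner ℝ k₂ z| ≤ (‖k₁‖ * ‖k₃‖) * (‖k₂‖ * ‖z‖) := by
    rw [abs_mul]; gcongr
  have i4 : |inner ℝ k₁ z * inner ℝ k₂ k₃| ≤ (‖k₁‖ * ‖z‖) * (‖k₂‖ * ‖k₃‖) := by
    rw [abs_mul]; gcongr
  calc _ ≤ |inner ℝ k₃ z * inner ℝ k₁ z * inner ℝ k₂ z| + |inner ℝ k₃ z * inner ℝ k₁ k₂|
        + |inner ℝ k₁ k₃ * inner ℝ k₂ z| + |inner ℝ k₁ z * inner ℝ k₂ k₃| :=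
        (abs_sub _ _).trans (add_le_add_left
          ((abs_sub _ _).trans (add_le_add_left (abs_sub _ _) _)) _)
    _ ≤ (‖k₁‖ * ‖k₂‖ * ‖k₃‖) * (‖z‖ ^ 3 + 3 * ‖z‖) := by linarith
    _ ≤ (‖k₁‖ * ‖k₂‖ * ‖k₃‖) * (4 * (1 + ‖z‖) ^ 3) := by
        gcongr; nlinarith [pow_nonneg hz 2, pow_nonneg hz 3]
    _ = _ := by ring

/-- Bounded functions with two bounded continuous derivatives. -/
structure BddC2 (K : ℝ) (g : E → ℝ) : Prop where
  smooth : ContDiff ℝ 2 g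
  le0 : ∀ x, ‖g x‖ ≤ K
  le1 : ∀ x, ‖fderiv ℝ g x‖ ≤ K
  le2 : ∀ x, ‖D2 g x‖ ≤ K

variable {K : ℝ} {g : E → ℝ}

theorem hasFDerivAt_comp_affine (hg : BddC2 K g) (S : E →L[ℝ] E) (x z : E) (c : ℝ) :
    HasFDerivAt (fun z => g (x + S z) - c) ((fderiv ℝ g (x + S z)).comp S) z :=
  ((hasFDerivAt_of_C2 hg.smooth (x + S z)).comp z (S.hasFDerivAt.const_add x)).sub_const c

theorem hasFDerivAt_fderiv_comp_affine (hg : BddC2 K g) (S : E →L[ℝ] E) (x z h : E) :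
    HasFDerivAt (fun z => fderiv ℝ g (x + S z) h)
      ((ContinuousLinearMap.apply ℝ ℝ h).comp ((fderiv ℝ (fderiv ℝ g) (x + S z)).comp S)) z :=
  (ContinuousLinearMap.apply ℝ ℝ h).hasFDerivAt.comp z
    ((hasFDerivAt_fderiv_of_C2 hg.smooth (x + S z)).comp z (S.hasFDerivAt.const_add x))

theorem fderiv_comp_affine_apply (hg : BddC2 K g) (S : E →L[ℝ] E) (x z k : E) (c : ℝ) :
    fderiv ℝ (fun z => g (x + S z) - c) z k = fderiv ℝ g (x + S z) (S k) := by
  rw [(hasFDerivAt_comp_affine hg S x z c).fderiv]; rfl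

theorem fderiv_fderiv_comp_affine_apply (hg : BddC2 K g) (S : E →L[ℝ] E) (x z h k : E) :
    fderiv ℝ (fun z => fderiv ℝ g (x + S z) h) z k = (D2 g (x + S z)).left (S k) h := by
  rw [(hasFDerivAt_fderiv_comp_affine hg S x z h).fderiv]; rfl

theorem BddC2.polyGrowth_sub (hg : BddC2 K g) (S : E →L[ℝ] E) (x : E) (c : ℝ) :
    PolyGrowth fun z => g (x + S z) - c :=
  ((PolyGrowth.of_bounded hg.smooth.continuous hg.le0).comp_affine x S).sub (PolyGrowth.const c)

theorem BddC2.polyGrowth_fderiv (hg : BddC2 K g) (S : E →L[ℝ] E) (x h : E) :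
    PolyGrowth fun z => fderiv ℝ g (x + S z) h := by
  have hc := continuous_fderiv_of_C2 hg.smooth
  refine PolyGrowth.of_bounded (by fun_prop) (C := K * ‖h‖) fun z => ?_
  exact ((fderiv ℝ g (x + S z)).le_opNorm h).trans
    (mul_le_mul_of_nonneg_right (hg.le1 _) (norm_nonneg _))

theorem BddC2.polyGrowth_D2 (hg : BddC2 K g) (S : E →L[ℝ] E) (x h k : E) :
    PolyGrowth fun z => (D2 g (x + S z)).left h k := by
  have hc := continuous_D2 hg.smooth
  have h2 : Continuous fun z => Bil.evalCLM h k (D2 g (x + S z)) := by fun_prop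
  refine PolyGrowth.of_bounded h2 (C := K * ‖h‖ * ‖k‖) fun z => ?_
  refine (Bil.abs_apply_le _ _ _).trans ?_
  gcongr
  exact hg.le2 _

theorem BddC2.contDiff_sub (hg : BddC2 K g) (S : E →L[ℝ] E) (x : E) (c : ℝ) :
    ContDiff ℝ 1 fun z => g (x + S z) - c := by
  have := hg.smooth.of_le (by norm_num : (1 : WithTop ℕ∞) ≤ 2)
  fun_prop

theorem BddC2.contDiff_fderiv (hg : BddC2 K g) (S : E →L[ℝ] E) (x h : E) :
    ContDiff ℝ 1 fun z => fderiv ℝ g (x + S z) h := by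
  have : ContDiff ℝ 1 (fderiv ℝ g) := hg.smooth.fderiv_right (by norm_num)
  fun_prop

theorem BddC2.integral_D2_eq (hg : BddC2 K g) (S : E →L[ℝ] E) (x k h : E) :
    ∫ z, (D2 g (x + S z)).left (S k) h ∂gauss E
      = ∫ z, inner ℝ k z * fderiv ℝ g (x + S z) h ∂gauss E := by
  have := integral_fderiv_gauss (hg.contDiff_fderiv S x h) (hg.polyGrowth_fderiv S x h) k
    (by simpa only [fderiv_fderiv_comp_affine_apply hg] using hg.polyGrowth_D2 S x (S k) h)
  simpa only [fderiv_fderiv_comp_affine_apply hg] using this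

theorem BddC2.integral_D2_eq_herm2 (hg : BddC2 K g) (S : E →L[ℝ] E) (x k₁ k₂ : E) (c : ℝ) :
    ∫ z, (D2 g (x + S z)).left (S k₁) (S k₂) ∂gauss E
      = ∫ z, herm2 k₁ k₂ z * (g (x + S z) - c) ∂gauss E := by
  rw [hg.integral_D2_eq]
  have := gauss_ibp (P := fun z => inner ℝ k₁ z) (k := k₂) (innerSL ℝ k₁).contDiff
    (hg.contDiff_sub S x c)
    (PolyGrowth.inner k₁) (by simpa only [fderiv_inner_left] using PolyGrowth.const _)
    (hg.polyGrowth_sub S x c)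
    (by simpa only [fderiv_comp_affine_apply hg] using hg.polyGrowth_fderiv S x (S k₂))
  simp only [fderiv_comp_affine_apply hg, fderiv_inner_left] at this
  rw [this]
  congr 1; funext z; unfold herm2; ring

theorem BddC2.integral_herm2_fderiv (hg : BddC2 K g) (S : E →L[ℝ] E) (x k₁ k₂ k₃ : E) (c : ℝ) :
    ∫ z, herm2 k₁ k₂ z * fderiv ℝ g (x + S z) (S k₃) ∂gauss E
      = ∫ z, herm3 k₁ k₂ k₃ z * (g (x + S z) - c) ∂gauss E := by
  have := gauss_ibp (P := herm2 k₁ k₂) (k := k₃) (contDiff_herm2 k₁ k₂) (hg.contDiff_sub S x c)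
    (polyGrowth_herm2 k₁ k₂) (polyGrowth_fderiv_herm2 k₁ k₂ k₃) (hg.polyGrowth_sub S x c)
    (by simpa only [fderiv_comp_affine_apply hg] using hg.polyGrowth_fderiv S x (S k₃))
  simp only [fderiv_comp_affine_apply hg, fderiv_herm2] at this
  rw [this]
  congr 1

variable (E) in
/-- A moment of the Gaussian measure. -/
noncomputable def gaussMoment : ℝ := ∫ z : E, (1 + ‖z‖) ^ 4 ∂gauss E

theorem gaussMoment_nonneg : 0 ≤ gaussMoment E := integral_nonneg fun z => by positivity

theorem abs_integral_weight_le {α H c s₀ : ℝ} (hα : 0 < α) (hα1 : α ≤ 1) (hH0 : 0 ≤ H)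
    (hH : ∀ x y, |g x - g y| ≤ H * ‖x - y‖ ^ α) (hc : 0 ≤ c) (S : E →L[ℝ] E)
    (hS : ‖S‖ ^ α ≤ s₀) {q : E → ℝ} (hq : ∀ z, |q z| ≤ c * (1 + ‖z‖) ^ 3) (x : E) :
    |∫ z, q z * (g (x + S z) - g x) ∂gauss E| ≤ c * (H * s₀) * gaussMoment E := by
  have hs₀ : 0 ≤ s₀ := le_trans (by positivity) hS
  have hb : ∀ z : E, ‖q z * (g (x + S z) - g x)‖ ≤ c * (H * s₀) * (1 + ‖z‖) ^ 4 := by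
    intro z
    have hz := norm_nonneg z
    have h1 : |g (x + S z) - g x| ≤ H * (s₀ * (1 + ‖z‖)) := by
      refine (hH _ _).trans (mul_le_mul_of_nonneg_left ?_ hH0)
      rw [add_sub_cancel_left]
      calc ‖S z‖ ^ α ≤ (‖S‖ * ‖z‖) ^ α := Real.rpow_le_rpow (norm_nonneg _) (S.le_opNorm z) hα.le
        _ = ‖S‖ ^ α * ‖z‖ ^ α := Real.mul_rpow (norm_nonneg _) hz
        _ ≤ s₀ * (1 + ‖z‖) := by
            refine mul_le_mul hS ?_ (by positivity) hs₀
            calc ‖z‖ ^ α ≤ (1 + ‖z‖) ^ α := Real.rpow_le_rpow hz (by linarith) hα.le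
              _ ≤ (1 + ‖z‖) ^ (1 : ℝ) := Real.rpow_le_rpow_of_exponent_le (by linarith) hα1
              _ = _ := Real.rpow_one _
    rw [norm_mul]
    calc _ ≤ (c * (1 + ‖z‖) ^ 3) * (H * (s₀ * (1 + ‖z‖))) :=
          mul_le_mul (hq z) h1 (abs_nonneg _) (by positivity)
      _ = _ := by ring
  have hi : Integrable (fun z : E => c * (H * s₀) * (1 + ‖z‖) ^ 4) (gauss E) :=
    (PolyGrowth.norm_one_add_pow 4).integrable_gauss.const_mul _
  have := norm_integral_le_of_norm_le hi (Eventually.of_forall hb)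
  rwa [integral_const_mul] at this

variable {σ : E ≃L[ℝ] E} {Λ α H s : ℝ}

theorem heatQ_D2_apply (hg : BddC2 K g) (σ : E →L[ℝ] E) (s : ℝ) (x h₁ h₂ : E) :
    (heatQ σ s (D2 g) x).left h₁ h₂
      = ∫ z, (D2 g (x + (Real.sqrt s • σ) z)).left h₁ h₂ ∂gauss E :=
  heatQ_clm (Bil.evalCLM h₁ h₂) σ s (continuous_D2 hg.smooth) hg.le2 x

theorem scaled_inverse (hΛ : ‖(σ.symm : E →L[ℝ] E)‖ ≤ Λ) (hs : 0 < s) (h : E) :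
    ∃ k, (Real.sqrt s • (σ : E →L[ℝ] E)) k = h ∧ ‖k‖ ≤ s ^ (-(1 / 2) : ℝ) * Λ * ‖h‖ := by
  have hs' : 0 < Real.sqrt s := Real.sqrt_pos.2 hs
  refine ⟨(Real.sqrt s)⁻¹ • σ.symm h, ?_, ?_⟩
  · simp [smul_smul, hs'.ne']
  · rw [norm_smul, Real.norm_of_nonneg (by positivity), Real.rpow_neg hs.le, ← Real.sqrt_eq_rpow,
      mul_assoc]
    gcongr
    exact ((σ.symm : E →L[ℝ] E).le_opNorm h).trans (mul_le_mul_of_nonneg_right hΛ (norm_nonneg _))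

theorem scaled_norm_rpow_le (hΛ1 : 1 ≤ Λ) (hΛ : ‖(σ : E →L[ℝ] E)‖ ≤ Λ) (hα : 0 < α) (hα1 : α ≤ 1)
    (hs : 0 < s) : ‖Real.sqrt s • (σ : E →L[ℝ] E)‖ ^ α ≤ s ^ (α / 2) * Λ := by
  rw [norm_smul, Real.norm_of_nonneg (Real.sqrt_nonneg _),
    Real.mul_rpow (Real.sqrt_nonneg _) (norm_nonneg _), Real.sqrt_eq_rpow, ← Real.rpow_mul hs.le]
  have e : (1 / 2 * α : ℝ) = α / 2 := by ring
  rw [e]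
  gcongr
  calc _ ≤ Λ ^ α := Real.rpow_le_rpow (norm_nonneg _) hΛ hα.le
    _ ≤ Λ ^ (1 : ℝ) := Real.rpow_le_rpow_of_exponent_le hΛ1 hα1
    _ = Λ := Real.rpow_one _

theorem BddC2.norm_heatQ_D2_le (hg : BddC2 K g) (hΛ1 : 1 ≤ Λ) (hσ : ‖(σ : E →L[ℝ] E)‖ ≤ Λ)
    (hσ' : ‖(σ.symm : E →L[ℝ] E)‖ ≤ Λ) (hα : 0 < α) (hα1 : α ≤ 1) (hs : 0 < s)
    (hH0 : 0 ≤ H) (hH : ∀ x y, |g x - g y| ≤ H * ‖x - y‖ ^ α) (x : E) :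
    ‖heatQ σ s (D2 g) x‖ ≤ 2 * Λ ^ 3 * gaussMoment E * H * s ^ (α / 2 - 1) := by
  have hm := gaussMoment_nonneg (E := E)
  refine Bil.norm_le_of_unit (by positivity) fun h₁ h₂ u₁ u₂ => ?_
  obtain ⟨k₁, e₁, n₁⟩ := scaled_inverse hσ' hs h₁
  obtain ⟨k₂, e₂, n₂⟩ := scaled_inverse hσ' hs h₂
  rw [heatQ_D2_apply hg]
  nth_rewrite 1 [← e₁, ← e₂]
  rw [hg.integral_D2_eq_herm2 _ x k₁ k₂ (g x)]
  rw [u₁, mul_one] at n₁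
  rw [u₂, mul_one] at n₂
  refine (abs_integral_weight_le hα hα1 hH0 hH (c := 2 * ‖k₁‖ * ‖k₂‖) (by positivity) _
    (scaled_norm_rpow_le hΛ1 hσ hα hα1 hs) (abs_herm2_le k₁ k₂) x).trans ?_
  calc _ ≤ 2 * (s ^ (-(1 / 2) : ℝ) * Λ) * (s ^ (-(1 / 2) : ℝ) * Λ) * (H * (s ^ (α / 2) * Λ))
        * gaussMoment E := by gcongr
    _ = 2 * Λ ^ 3 * gaussMoment E * H *
        (s ^ (-(1 / 2) : ℝ) * s ^ (-(1 / 2) : ℝ) * s ^ (α / 2)) := by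
        ring
    _ = _ := by
        rw [← Real.rpow_add hs, ← Real.rpow_add hs]; congr 2; ring

theorem BddC2.norm_heatQ_D2_sub_le (hg : BddC2 K g) (hΛ1 : 1 ≤ Λ) (hσ : ‖(σ : E →L[ℝ] E)‖ ≤ Λ)
    (hσ' : ‖(σ.symm : E →L[ℝ] E)‖ ≤ Λ) (hα : 0 < α) (hα1 : α ≤ 1) (hs : 0 < s)
    (hH0 : 0 ≤ H) (hH : ∀ x y, |g x - g y| ≤ H * ‖x - y‖ ^ α) (x y : E) :
    ‖heatQ σ s (D2 g) x - heatQ σ s (D2 g) y‖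
      ≤ 4 * Λ ^ 4 * gaussMoment E * H * s ^ (α / 2 - 3 / 2) * ‖x - y‖ := by
  have hm := gaussMoment_nonneg (E := E)
  refine Bil.norm_le_of_unit (by positivity) fun h₁ h₂ u₁ u₂ => ?_
  obtain ⟨k₁, e₁, n₁⟩ := scaled_inverse hσ' hs h₁
  obtain ⟨k₂, e₂, n₂⟩ := scaled_inverse hσ' hs h₂
  rw [u₁, mul_one] at n₁
  rw [u₂, mul_one] at n₂
  set S : E →L[ℝ] E := Real.sqrt s • (σ : E →L[ℝ] E) with hS
  have hval : ∀ x, (heatQ σ s (D2 g) x).left h₁ h₂ = ∫ z, herm2 k₁ k₂ z • g (x + S z) ∂gauss E := by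
    intro x
    rw [heatQ_D2_apply hg]
    nth_rewrite 1 [← e₁, ← e₂]
    rw [hg.integral_D2_eq_herm2 _ x k₁ k₂ 0]
    simp [hS]
  rw [Bil.sub_left, sub_apply, hval, hval]
  have h_int := (polyGrowth_herm2 k₁ k₂).integrable_gauss
  have hd : ∀ x, HasFDerivAt (fun x => ∫ z, herm2 k₁ k₂ z • g (x + S z) ∂gauss E)
      (∫ z, herm2 k₁ k₂ z • fderiv ℝ g (x + S z) ∂gauss E) x := fun x =>
    hasFDerivAt_weighted h_int (polyGrowth_herm2 k₁ k₂).1 S (hasFDerivAt_of_C2 hg.smooth)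
      (continuous_fderiv_of_C2 hg.smooth) hg.le0 hg.le1 x
  refine Convex.norm_image_sub_le_of_norm_hasFDerivWithin_le
    (f := fun x => ∫ z, herm2 k₁ k₂ z • g (x + S z) ∂gauss E)
    (C := 4 * Λ ^ 4 * gaussMoment E * H * s ^ (α / 2 - 3 / 2)) (s := univ)
    (fun x _ => (hd x).hasFDerivWithinAt) (fun x _ => ?_) convex_univ (mem_univ y) (mem_univ x)
  refine ContinuousLinearMap.opNorm_le_of_unit_norm (by positivity) fun h₃ u₃ => ?_
  obtain ⟨k₃, e₃, n₃⟩ := scaled_inverse hσ' hs h₃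
  rw [u₃, mul_one] at n₃
  have hc1 := continuous_fderiv_of_C2 hg.smooth
  have hc2 := (polyGrowth_herm2 k₁ k₂).1
  have hi : Integrable (fun z => herm2 k₁ k₂ z • fderiv ℝ g (x + S z)) (gauss E) := by
    refine (h_int.norm.mul_const K).mono' (Continuous.aestronglyMeasurable (by fun_prop))
      (Eventually.of_forall fun z => ?_)
    rw [norm_smul]
    exact mul_le_mul_of_nonneg_left (hg.le1 _) (norm_nonneg _)
  rw [ContinuousLinearMap.integral_apply hi]
  simp only [smul_apply, smul_eq_mul]
  rw [← e₃, hg.integral_herm2_fderiv _ x k₁ k₂ k₃ (g x)]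
  refine (abs_integral_weight_le hα hα1 hH0 hH (c := 4 * ‖k₁‖ * ‖k₂‖ * ‖k₃‖) (by positivity) _
    (scaled_norm_rpow_le hΛ1 hσ hα hα1 hs) (abs_herm3_le k₁ k₂ k₃) x).trans ?_
  calc _ ≤ 4 * (s ^ (-(1 / 2) : ℝ) * Λ) * (s ^ (-(1 / 2) : ℝ) * Λ) * (s ^ (-(1 / 2) : ℝ) * Λ)
        * (H * (s ^ (α / 2) * Λ)) * gaussMoment E := by gcongr
    _ = 4 * Λ ^ 4 * gaussMoment E * H
        * (s ^ (-(1 / 2) : ℝ) * s ^ (-(1 / 2) : ℝ) * s ^ (-(1 / 2) : ℝ) * s ^ (α / 2)) := by ring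
    _ = _ := by
        rw [← Real.rpow_add hs, ← Real.rpow_add hs, ← Real.rpow_add hs]; congr 2; ring

end Kernel

theorem norm_time_integral_le {G : Type*} [NormedAddCommGroup G] [NormedSpace ℝ G]
    {α A B r t : ℝ} (hα : 0 < α) (hα1 : α < 1) (hA : 0 ≤ A) (hB : 0 ≤ B) (hr : 0 < r) (ht : 0 ≤ t)
    {φ : ℝ → G} (hφ : Continuous φ) (h1 : ∀ s, 0 < s → ‖φ s‖ ≤ A * s ^ (α / 2 - 1))
    (h2 : ∀ s, 0 < s → ‖φ s‖ ≤ B * s ^ (α / 2 - 3 / 2) * r) :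
    ‖∫ s in (0 : ℝ)..t, φ s‖ ≤ (2 * A / α + 2 * B / (1 - α)) * r ^ α := by
  have hα1' : 0 < 1 - α := by linarith
  have near : ∀ a, 0 ≤ a → a ≤ r ^ 2 → ‖∫ s in (0 : ℝ)..a, φ s‖ ≤ 2 * A / α * r ^ α := by
    intro a ha har
    have hi : IntervalIntegrable (fun s : ℝ => A * s ^ (α / 2 - 1)) volume 0 a :=
      (intervalIntegral.intervalIntegrable_rpow' (by linarith)).const_mul A
    refine (intervalIntegral.norm_integral_le_of_norm_le ha
      (Eventually.of_forall fun s hs => h1 s hs.1) hi).trans ?_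
    rw [intervalIntegral.integral_const_mul, integral_rpow (Or.inl (by linarith)), sub_add_cancel,
      Real.zero_rpow (by positivity), sub_zero]
    have e : a ^ (α / 2) ≤ r ^ α := by
      calc a ^ (α / 2) ≤ (r ^ 2) ^ (α / 2) := Real.rpow_le_rpow ha har (by positivity)
        _ = r ^ α := by rw [← Real.rpow_natCast, ← Real.rpow_mul hr.le]; congr 1; push_cast; ring
    calc A * (a ^ (α / 2) / (α / 2)) = 2 * A / α * a ^ (α / 2) := by field_simp
      _ ≤ _ := by gcongr
  have hsecond : 0 ≤ 2 * B / (1 - α) * r ^ α := by positivity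
  rcases le_total t (r ^ 2) with h | h
  · have := near t ht h
    rw [add_mul]; linarith
  · rw [← intervalIntegral.integral_add_adjacent_intervals (hφ.intervalIntegrable 0 (r ^ 2))
      (hφ.intervalIntegrable (r ^ 2) t), add_mul]
    refine (norm_add_le _ _).trans (add_le_add (near _ (by positivity) le_rfl) ?_)
    have h0 : (0 : ℝ) ∉ uIcc (r ^ 2) t := by
      rw [uIcc_of_le h]; intro h'; have := h'.1; have := pow_pos hr 2; linarith
    have hi : IntervalIntegrable (fun s : ℝ => B * r * s ^ (α / 2 - 3 / 2)) volume (r ^ 2) t :=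
      (intervalIntegral.intervalIntegrable_rpow (Or.inr h0)).const_mul _
    refine (intervalIntegral.norm_integral_le_of_norm_le h
      (Eventually.of_forall fun s hs => (h2 s ((pow_pos hr 2).trans hs.1)).trans_eq (by ring))
      hi).trans ?_
    rw [intervalIntegral.integral_const_mul,
      integral_rpow (Or.inr ⟨by intro h'; linarith, h0⟩)]
    have e1 : α / 2 - 3 / 2 + 1 = -((1 - α) / 2) := by ring
    have e2 : (r ^ 2) ^ (-((1 - α) / 2)) * r = r ^ α := by
      nth_rewrite 2 [← Real.rpow_one r]
      rw [← Real.rpow_natCast, ← Real.rpow_mul hr.le, ← Real.rpow_add hr]; congr 1; push_cast; ring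
    have e3 : 0 ≤ t ^ (-((1 - α) / 2)) := Real.rpow_nonneg ht _
    rw [e1, div_neg, ← neg_div, neg_sub]
    calc _ ≤ B * r * ((r ^ 2) ^ (-((1 - α) / 2)) / ((1 - α) / 2)) := by gcongr; linarith
      _ = 2 * B / (1 - α) * ((r ^ 2) ^ (-((1 - α) / 2)) * r) := by field_simp
      _ = _ := by rw [e2]

theorem triangle_swap {g : ℝ → ℝ → ℝ} (hg : Continuous (Function.uncurry g)) {C : ℝ}
    (hC : ∀ s r, ‖g s r‖ ≤ C) {t : ℝ} (ht : 0 ≤ t) :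
    ∫ s in (0 : ℝ)..t, ∫ r in (0 : ℝ)..s, g s r = ∫ r in (0 : ℝ)..t, ∫ s in r..t, g s r := by
  have hm : MeasurableSet {p : ℝ × ℝ | p.2 ≤ p.1} := measurableSet_le measurable_snd measurable_fst
  have h_int : Integrable (Function.uncurry fun s r => {p : ℝ × ℝ | p.2 ≤ p.1}.indicator
      (Function.uncurry g) (s, r))
      ((volume.restrict (Ioc 0 t)).prod (volume.restrict (Ioc 0 t))) := by
    refine (integrable_const C).mono' ((hg.measurable.indicator hm).aestronglyMeasurable)
      (Eventually.of_forall fun p => ?_)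
    exact (norm_indicator_le_norm_self _ _).trans (hC _ _)
  have key := integral_integral_swap h_int
  have e1 : ∀ s ∈ Ioc 0 t, ∫ r in Ioc 0 t, {p : ℝ × ℝ | p.2 ≤ p.1}.indicator
      (Function.uncurry g) (s, r) = ∫ r in (0 : ℝ)..s, g s r := by
    intro s hs
    have : ∀ r, {p : ℝ × ℝ | p.2 ≤ p.1}.indicator (Function.uncurry g) (s, r)
        = (Iic s).indicator (g s) r := fun r => by
      simp [indicator, Function.uncurry]
    simp only [this]
    rw [setIntegral_indicator measurableSet_Iic, intervalIntegral.integral_of_le hs.1.le]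
    congr 2
    ext r; simp only [mem_inter_iff, mem_Ioc, mem_Iic]
    exact ⟨fun h => ⟨h.1.1, h.2⟩, fun h => ⟨⟨h.1, h.2.trans hs.2⟩, h.2⟩⟩
  have e2 : ∀ r ∈ Ioc 0 t, ∫ s in Ioc 0 t, {p : ℝ × ℝ | p.2 ≤ p.1}.indicator
      (Function.uncurry g) (s, r) = ∫ s in r..t, g s r := by
    intro r hr
    have : ∀ s, {p : ℝ × ℝ | p.2 ≤ p.1}.indicator (Function.uncurry g) (s, r)
        = (Ici r).indicator (fun s => g s r) s := fun s => by
      simp [indicator, Function.uncurry]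
    simp only [this]
    rw [setIntegral_indicator measurableSet_Ici, intervalIntegral.integral_of_le hr.2,
      ← integral_Icc_eq_integral_Ioc]
    congr 2
    ext s; simp only [mem_inter_iff, mem_Ioc, mem_Ici, mem_Icc]
    exact ⟨fun h => ⟨h.2, h.1.2⟩, fun h => ⟨⟨hr.1.trans_le h.1, h.2⟩, h.1⟩⟩
  rw [setIntegral_congr_fun measurableSet_Ioc e1, setIntegral_congr_fun measurableSet_Ioc e2] at key
  rw [intervalIntegral.integral_of_le ht, intervalIntegral.integral_of_le ht]
  exact key

section TimeDeriv

variable {E : Type*} [NormedAddCommGroup E] [InnerProductSpace ℝ E] [FiniteDimensional ℝ E]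
  [MeasurableSpace E] [BorelSpace E] {ι : Type*} [Fintype ι]

/-- The constant coefficient second order operator associated with `σ`. -/
noncomputable def ellOp (e : OrthonormalBasis ι ℝ E) (σ : E →L[ℝ] E) : Bil E →L[ℝ] ℝ :=
  (1 / 2 : ℝ) • ∑ k, Bil.evalCLM (σ (e k)) (σ (e k))

theorem ellOp_apply (e : OrthonormalBasis ι ℝ E) (σ : E →L[ℝ] E) (B : Bil E) :
    ellOp e σ B = 1 / 2 * ∑ k, B.left (σ (e k)) (σ (e k)) := by
  simp [ellOp]

variable {K : ℝ} {g : E → ℝ}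

theorem BddC2.hasDerivAt_dilation (hg : BddC2 K g) (e : OrthonormalBasis ι ℝ E) (σ : E →L[ℝ] E)
    (x : E) (θ : ℝ) :
    HasDerivAt (fun θ : ℝ => ∫ z, g (x + θ • σ z) ∂gauss E)
      (2 * θ * ∫ z, ellOp e σ (D2 g (x + θ • σ z)) ∂gauss E) θ := by
  have hgc := hg.smooth.continuous
  have hgc1 := continuous_fderiv_of_C2 hg.smooth
  have key := (hasDerivAt_integral_of_dominated_loc_of_deriv_le (μ := gauss E) (s := univ) (𝕜 := ℝ)
    (x₀ := θ) (F := fun θ z => g (x + θ • σ z)) (F' := fun θ z => fderiv ℝ g (x + θ • σ z) (σ z))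
    (bound := fun z => K * ‖σ z‖) univ_mem
    (Eventually.of_forall fun y => Continuous.aestronglyMeasurable (by fun_prop))
    (integrable_gauss_of_bounded (by fun_prop) fun z => hg.le0 _)
    (Continuous.aestronglyMeasurable (by fun_prop))
    (Eventually.of_forall fun z θ' _ => ((fderiv ℝ g _).le_opNorm _).trans
      (mul_le_mul_of_nonneg_right (hg.le1 _) (norm_nonneg _))) ?_
    (Eventually.of_forall fun z θ' _ => ?_)).2
  · refine key.congr_deriv ?_
    have hb : ∀ z : E, fderiv ℝ g (x + θ • σ z) (σ z)
        = ∑ k, inner ℝ (e k) z * fderiv ℝ g (x + (θ • σ) z) (σ (e k)) := by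
      intro z
      nth_rewrite 2 [← e.sum_repr' z]
      simp [map_sum]
    simp only [hb]
    rw [integral_finsetSum _ fun k _ =>
      ((PolyGrowth.inner (e k)).mul (hg.polyGrowth_fderiv (θ • σ) x (σ (e k)))).integrable_gauss]
    simp only [ellOp_apply]
    have hD : ∀ k, Integrable (fun z => (D2 g (x + θ • σ z)).left (σ (e k)) (σ (e k))) (gauss E) :=
      fun k => (hg.polyGrowth_D2 (θ • σ) x (σ (e k)) (σ (e k))).integrable_gauss
    rw [integral_const_mul, integral_finsetSum _ fun k _ => hD k, ← mul_assoc, Finset.mul_sum]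
    refine Finset.sum_congr rfl fun k _ => ?_
    rw [← hg.integral_D2_eq, ← integral_const_mul]
    congr 1; funext z
    simp only [smul_apply, Bil.left_smul, smul_eq_mul]
    ring
  · have : PolyGrowth fun z : E => K * ‖σ z‖ := by
      refine (PolyGrowth.const K).mul ⟨by fun_prop, ‖σ‖, 1, norm_nonneg _, fun z => ?_⟩
      rw [norm_norm, pow_one]
      refine (σ.le_opNorm z).trans ?_
      gcongr
      simp
    exact this.integrable_gauss
  · have h1 : HasDerivAt (fun θ : ℝ => x + θ • σ z) (σ z) θ' := by
      have := ((hasDerivAt_id θ').smul_const (σ z)).const_add x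
      simpa using this
    exact (hasFDerivAt_of_C2 hg.smooth _).comp_hasDerivAt θ' h1

theorem BddC2.heatQ_eq (hg : BddC2 K g) (e : OrthonormalBasis ι ℝ E) (σ : E →L[ℝ] E)
    (x : E) {s : ℝ} (hs : 0 ≤ s) :
    heatQ σ s g x = g x + ∫ r in (0 : ℝ)..s, heatQ σ r (fun y => ellOp e σ (D2 g y)) x := by
  have hgc := hg.smooth.continuous
  have hgc2 := continuous_D2 hg.smooth
  have c1 : Continuous fun r => heatQ σ r g x :=
    (continuous_heatQ (P := Unit) σ (F := fun _ => g) (by fun_prop) (fun _ => hg.le0)).comp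
      (f := fun r : ℝ => ((), r, x)) (by fun_prop)
  have c2 : Continuous fun r => heatQ σ r (fun y => ellOp e σ (D2 g y)) x :=
    (continuous_heatQ (P := Unit) σ (F := fun _ y => ellOp e σ (D2 g y)) (K := ‖ellOp e σ‖ * K)
      (by fun_prop) (fun _ y => ((ellOp e σ).le_opNorm _).trans
        (mul_le_mul_of_nonneg_left (hg.le2 y) (norm_nonneg _)))).comp
      (f := fun r : ℝ => ((), r, x)) (by fun_prop)
  have h := intervalIntegral.integral_eq_sub_of_hasDerivAt_of_le hs c1.continuousOn
    (f' := fun r => heatQ σ r (fun y => ellOp e σ (D2 g y)) x) (fun r hr => ?_)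
    (c2.intervalIntegrable _ _)
  · rw [h]
    simp [heatQ]
  · have hr' : 0 < Real.sqrt r := Real.sqrt_pos.2 hr.1
    have := (hg.hasDerivAt_dilation e σ x (Real.sqrt r)).comp r (Real.hasDerivAt_sqrt hr.1.ne')
    refine this.congr_deriv ?_
    unfold heatQ
    field_simp

theorem SmoothSource.bddC2 {f : ℝ → E → ℝ} (hf : SmoothSource K f) (t : ℝ) : BddC2 K (f t) :=
  ⟨hf.smooth t, hf.le0 t, hf.le1 t, hf.le2 t⟩

theorem SmoothSource.heatU_eq {f : ℝ → E → ℝ} (hf : SmoothSource K f) (e : OrthonormalBasis ι ℝ E)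
    (σ : E →L[ℝ] E) (x : E) {t : ℝ} (ht : 0 ≤ t) :
    heatU σ f t x = ∫ s in (0 : ℝ)..t, (f s x + ellOp e σ (heatU σ (fun t => D2 (f t)) s x)) := by
  have hf0 := hf.cont0
  have hf2 := hf.cont2
  have hcf : Continuous fun s => f s x := hf0.comp (f := fun s => (s, x)) (by fun_prop)
  set Φ : ℝ → ℝ → ℝ := fun r τ => heatQ σ r (fun y => ellOp e σ (D2 (f τ) y)) x with hΦ
  have hb : ∀ τ y, ‖ellOp e σ (D2 (f τ) y)‖ ≤ ‖ellOp e σ‖ * K := fun τ y =>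
    ((ellOp e σ).le_opNorm _).trans (mul_le_mul_of_nonneg_left (hf.le2 τ y) (norm_nonneg _))
  have hΦb : ∀ r τ, ‖Φ r τ‖ ≤ ‖ellOp e σ‖ * K := fun r τ => norm_heatQ_le σ r (hb τ) x
  have hΦc : Continuous (Function.uncurry Φ) :=
    (continuous_heatQ σ (F := fun τ y => ellOp e σ (D2 (f τ) y)) (by fun_prop) hb).comp
      (f := fun p : ℝ × ℝ => (p.2, p.1, x)) (by fun_prop)
  have e1 : ∀ s, ellOp e σ (heatU σ (fun t => D2 (f t)) s x) = ∫ r in (0 : ℝ)..s, Φ r (s - r) :=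
    fun s => heatU_clm (ellOp e σ) σ hf2 hf.le2 s x
  have e2 : heatU σ f t x = ∫ s in (0 : ℝ)..t, (f (t - s) x + ∫ r in (0 : ℝ)..s, Φ r (t - s)) := by
    refine intervalIntegral.integral_congr fun s hs => ?_
    rw [uIcc_of_le ht] at hs
    exact (hf.bddC2 (t - s)).heatQ_eq e σ x hs.1
  have g1 : Continuous (Function.uncurry fun s r => Φ r (t - s)) :=
    hΦc.comp (f := fun p : ℝ × ℝ => (p.2, t - p.1)) (by fun_prop)
  have g2 : Continuous (Function.uncurry fun s r => Φ r (s - r)) :=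
    hΦc.comp (f := fun p : ℝ × ℝ => (p.2, p.1 - p.2)) (by fun_prop)
  have i1 : Continuous fun s => ∫ r in (0 : ℝ)..s, Φ r (t - s) :=
    intervalIntegral.continuous_parametric_intervalIntegral_of_continuous g1 continuous_id
  have i2 : Continuous fun s => ∫ r in (0 : ℝ)..s, Φ r (s - r) :=
    intervalIntegral.continuous_parametric_intervalIntegral_of_continuous g2 continuous_id
  have hcf' : Continuous fun s => f (t - s) x := hcf.comp (f := fun s => t - s) (by fun_prop)
  simp only [e1]
  rw [e2, intervalIntegral.integral_add (hcf'.intervalIntegrable _ _) (i1.intervalIntegrable _ _),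
    intervalIntegral.integral_add (hcf.intervalIntegrable _ _) (i2.intervalIntegrable _ _),
    triangle_swap g1 (fun s r => hΦb _ _) ht, triangle_swap g2 (fun s r => hΦb _ _) ht]
  congr 1
  · rw [intervalIntegral.integral_comp_sub_left (fun s => f s x) t]; simp
  · refine intervalIntegral.integral_congr fun r _ => ?_
    rw [intervalIntegral.integral_comp_sub_left (fun s => Φ r s) t,
      intervalIntegral.integral_comp_sub_right (fun s => Φ r s) r]
    simp

theorem SmoothSource.isSol {f : ℝ → E → ℝ} (hf : SmoothSource K f) (e : OrthonormalBasis ι ℝ E)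
    (σ : E →L[ℝ] E) (T : ℝ) : IsSol (fun _ => ellOp e σ) (fun _ => 0) T f (heatU σ f) where
  init x := by simp [heatU]
  smooth t _ := (hf.heatU_smooth σ t).1
  eqn t ht x := by
    have hc : Continuous fun s => f s x + ellOp e σ (heatU σ (fun t => D2 (f t)) s x) := by
      have h1 : Continuous fun s => f s x := hf.cont0.comp (f := fun s => (s, x)) (by fun_prop)
      have h2 : Continuous fun s => heatU σ (fun t => D2 (f t)) s x :=
        (continuous_heatU σ hf.cont2 hf.le2).comp (f := fun s => (s, x)) (by fun_prop)
      fun_prop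
    have h := intervalIntegral.integral_hasDerivAt_right (hc.intervalIntegrable 0 t)
      (hc.stronglyMeasurableAtFilter _ _) hc.continuousAt
    have h' := h.hasDerivWithinAt (s := Icc 0 T)
    refine (h'.congr_of_mem (fun s hs => hf.heatU_eq e σ x hs.1) ht).congr_deriv ?_
    simp only [Lop, (hf.heatU_smooth σ t).2.2, map_zero]
    ring

/-- The constant in the Schauder estimate for constant coefficients. -/
noncomputable def schauderConst (E : Type*) [NormedAddCommGroup E] [InnerProductSpace ℝ E]
    [FiniteDimensional ℝ E] [MeasurableSpace E] [BorelSpace E] (α Λ : ℝ) : ℝ :=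
  2 * (4 * Λ ^ 3 * gaussMoment E) / α + 2 * (4 * Λ ^ 4 * gaussMoment E) / (1 - α)

theorem schauderConst_nonneg {α Λ : ℝ} (hα : 0 < α) (hα1 : α < 1) (hΛ : 1 ≤ Λ) :
    0 ≤ schauderConst E α Λ := by
  have := gaussMoment_nonneg (E := E)
  have : 0 < 1 - α := by linarith
  unfold schauderConst
  positivity

theorem SmoothSource.holder {f : ℝ → E → ℝ} (hf : SmoothSource K f) {σ : E ≃L[ℝ] E} {Λ α H : ℝ}
    (hΛ1 : 1 ≤ Λ) (hσ : ‖(σ : E →L[ℝ] E)‖ ≤ Λ) (hσ' : ‖(σ.symm : E →L[ℝ] E)‖ ≤ Λ)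
    (hα : 0 < α) (hα1 : α < 1) (hH0 : 0 ≤ H)
    (hH : ∀ t x y, |f t x - f t y| ≤ H * ‖x - y‖ ^ α) {t : ℝ} (ht : 0 ≤ t) (x y : E) :
    ‖D2 (heatU σ f t) x - D2 (heatU σ f t) y‖ ≤ schauderConst E α Λ * H * ‖x - y‖ ^ α := by
  have hm := gaussMoment_nonneg (E := E)
  rcases eq_or_ne x y with rfl | hxy
  · simp [Real.zero_rpow hα.ne']
  have hr : 0 < ‖x - y‖ := norm_pos_iff.2 (sub_ne_zero.2 hxy)
  have hc : ∀ x, Continuous fun s => heatQ σ s (D2 (f (t - s))) x := fun x =>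
    (continuous_heatQ_shift (σ : E →L[ℝ] E) hf.cont2 hf.le2).comp (f := fun s => ((t, x), s))
      (by fun_prop)
  rw [(hf.heatU_smooth σ t).2.2]
  unfold heatU
  rw [← intervalIntegral.integral_sub ((hc x).intervalIntegrable _ _)
    ((hc y).intervalIntegrable _ _)]
  refine (norm_time_integral_le (A := 4 * Λ ^ 3 * gaussMoment E * H)
    (B := 4 * Λ ^ 4 * gaussMoment E * H) hα hα1 (by positivity) (by positivity) hr ht
    ((hc x).sub (hc y)) (fun s hs => ?_) (fun s hs => ?_)).trans_eq ?_
  · have h1 := (hf.bddC2 (t - s)).norm_heatQ_D2_le hΛ1 hσ hσ' hα hα1.le hs hH0 (hH _) x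
    have h2 := (hf.bddC2 (t - s)).norm_heatQ_D2_le hΛ1 hσ hσ' hα hα1.le hs hH0 (hH _) y
    refine (norm_sub_le _ _).trans ((add_le_add h1 h2).trans_eq (by ring))
  · exact (hf.bddC2 (t - s)).norm_heatQ_D2_sub_le hΛ1 hσ hσ' hα hα1.le hs hH0 (hH _) x y
  · unfold schauderConst; ring

end TimeDeriv

section Mollify

variable {E : Type*} [NormedAddCommGroup E] [InnerProductSpace ℝ E] [FiniteDimensional ℝ E]
  [MeasurableSpace E] [BorelSpace E]

section
variable {G : Type*} [NormedAddCommGroup G] [NormedSpace ℝ G]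

/-- Convolution of the scalar function `g` with the vector valued kernel `ρ`. -/
noncomputable def mollify (ρ : E → G) (g : E → ℝ) (x : E) : G := ∫ z, g (x - z) • ρ z

theorem hasFDerivAt_mollify [CompleteSpace G] {ρ : E → G} (hρ : ContDiff ℝ 1 ρ)
    (hc : HasCompactSupport ρ)
    {g : E → ℝ} (hg : Continuous g) (x : E) :
    HasFDerivAt (mollify ρ g) (mollify (fderiv ℝ ρ) g x) x := by
  have h := HasCompactSupport.hasFDerivAt_convolution_left
    ((ContinuousLinearMap.lsmul ℝ ℝ).flip : G →L[ℝ] ℝ →L[ℝ] G) hc hρ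
    (hg.locallyIntegrable (μ := volume)) x
  refine h.congr_fderiv ?_
  rfl

theorem norm_mollify_le {ρ : E → G} (hρ : Continuous ρ) (hc : HasCompactSupport ρ) {g : E → ℝ}
    {K : ℝ} (hK : ∀ x, |g x| ≤ K) (x : E) : ‖mollify ρ g x‖ ≤ K * ∫ z, ‖ρ z‖ := by
  rw [← integral_const_mul]
  refine norm_integral_le_of_norm_le
    ((hρ.norm.integrable_of_hasCompactSupport hc.norm).const_mul K)
    (Eventually.of_forall fun z => ?_)
  rw [norm_smul]
  exact mul_le_mul_of_nonneg_right (hK _) (norm_nonneg _)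

theorem continuous_mollify {P : Type*} [TopologicalSpace P] [FirstCountableTopology P]
    {ρ : E → G} (hρ : Continuous ρ) (hc : HasCompactSupport ρ)
    {g : P → E → ℝ} (hg : Continuous fun q : P × E => g q.1 q.2) {K : ℝ} (hK : ∀ p x, |g p x| ≤ K) :
    Continuous fun q : P × E => mollify ρ (g q.1) q.2 := by
  refine continuous_of_dominated (bound := fun z => K * ‖ρ z‖) (fun q => ?_) (fun q => ?_)
    ((hρ.norm.integrable_of_hasCompactSupport hc.norm).const_mul K)
    (Eventually.of_forall fun z => ?_)
  · have : Continuous fun z => g q.1 (q.2 - z) :=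
      hg.comp (f := fun z => (q.1, q.2 - z)) (by fun_prop)
    exact (this.smul hρ).aestronglyMeasurable
  · refine Eventually.of_forall fun z => ?_
    rw [norm_smul]
    exact mul_le_mul_of_nonneg_right (hK _ _) (norm_nonneg _)
  · have : Continuous fun q : P × E => g q.1 (q.2 - z) :=
      hg.comp (f := fun q : P × E => (q.1, q.2 - z)) (by fun_prop)
    exact this.smul continuous_const
end

theorem smoothSource_mollify {ρ : E → ℝ} (hρ : ContDiff ℝ 2 ρ) (hc : HasCompactSupport ρ)
    {f : ℝ → E → ℝ} (hf : Continuous fun q : ℝ × E => f q.1 q.2) {F : ℝ} (hF : ∀ t x, |f t x| ≤ F) :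
    ∃ K, SmoothSource K (fun t => mollify ρ (f t)) := by
  have c1 : Continuous (fderiv ℝ ρ) := continuous_fderiv_of_C2 hρ
  have c2 : Continuous (D2 ρ) := continuous_D2 hρ
  have s1 : HasCompactSupport (fderiv ℝ ρ) := hc.fderiv ℝ
  have s2 : HasCompactSupport (D2 ρ) := s1.fderiv ℝ
  have hft : ∀ t, Continuous (f t) := fun t => hf.comp (f := fun x => (t, x)) (by fun_prop)
  have hd : ContDiff ℝ 1 (fderiv ℝ ρ) := hρ.fderiv_right (by norm_num)
  have key : ∀ t, ContDiff ℝ 2 (mollify ρ (f t)) ∧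
      fderiv ℝ (mollify ρ (f t)) = mollify (fderiv ℝ ρ) (f t) ∧
      D2 (mollify ρ (f t)) = mollify (D2 ρ) (f t) := fun t => by
    refine contDiff_two_of_hasFDerivAt (fun x => ?_) (fun x => ?_) ?_
    · exact hasFDerivAt_mollify (hρ.of_le (by norm_num)) hc (hft t) x
    · exact hasFDerivAt_mollify hd s1 (hft t) x
    · exact (continuous_mollify c2 s2 hf hF).comp (f := fun x => (t, x)) (by fun_prop)
  refine ⟨max (F * ∫ z, ‖ρ z‖) (max (F * ∫ z, ‖fderiv ℝ ρ z‖) (F * ∫ z, ‖D2 ρ z‖)), ?_⟩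
  refine ⟨fun t => (key t).1, continuous_mollify hρ.continuous hc hf hF, ?_, ?_, ?_, ?_, ?_⟩
  · simp only [(key _).2.1]
    exact continuous_mollify c1 s1 hf hF
  · simp only [(key _).2.2]
    exact continuous_mollify c2 s2 hf hF
  · exact fun t x => (norm_mollify_le hρ.continuous hc (hF t) x).trans (le_max_left _ _)
  · intro t x
    rw [(key _).2.1]
    exact (norm_mollify_le c1 s1 (hF t) x).trans ((le_max_left _ _).trans (le_max_right _ _))
  · intro t x
    rw [(key _).2.2]
    exact (norm_mollify_le c2 s2 (hF t) x).trans ((le_max_right _ _).trans (le_max_right _ _))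

theorem abs_mollify_sub_le {ρ : E → ℝ} (hρ : Continuous ρ) (hc : HasCompactSupport ρ)
    (h0 : ∀ z, 0 ≤ ρ z) (h1 : ∫ z, ρ z = 1) {g h : E → ℝ} (hg : Continuous g) (hh : Continuous h)
    {x y : E} {K : ℝ} (hK : ∀ z, ρ z ≠ 0 → |g (x - z) - h (y - z)| ≤ K) :
    |mollify ρ g x - mollify ρ h y| ≤ K := by
  have i1 : Integrable (fun z => g (x - z) • ρ z) volume :=
    ((hg.comp (continuous_const.sub continuous_id)).smul hρ).integrable_of_hasCompactSupport
      hc.smul_left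
  have i2 : Integrable (fun z => h (y - z) • ρ z) volume :=
    ((hh.comp (continuous_const.sub continuous_id)).smul hρ).integrable_of_hasCompactSupport
      hc.smul_left
  unfold mollify
  rw [← integral_sub i1 i2]
  have : K = ∫ z, K * ρ z := by rw [integral_const_mul, h1, mul_one]
  rw [this, ← Real.norm_eq_abs]
  refine norm_integral_le_of_norm_le ((hρ.integrable_of_hasCompactSupport hc).const_mul K)
    (Eventually.of_forall fun z => ?_)
  rw [← sub_smul, norm_smul, Real.norm_of_nonneg (h0 z)]
  by_cases hz : ρ z = 0
  · simp [hz]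
  · exact mul_le_mul_of_nonneg_right (hK z hz) (h0 z)

theorem mollify_const {ρ : E → ℝ} (h1 : ∫ z, ρ z = 1) (c : ℝ) (x : E) :
    mollify ρ (fun _ => c) x = c := by
  simp [mollify, integral_const_mul, h1]

/-- A smooth probability density supported in a small ball. -/
theorem exists_bump (E : Type*) [NormedAddCommGroup E] [InnerProductSpace ℝ E]
    [FiniteDimensional ℝ E] [MeasurableSpace E] [BorelSpace E] {ε : ℝ} (hε : 0 < ε) :
    ∃ ρ : E → ℝ, ContDiff ℝ 2 ρ ∧ HasCompactSupport ρ ∧ (∀ z, 0 ≤ ρ z) ∧ ∫ z, ρ z = 1 ∧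
      ∀ z, ρ z ≠ 0 → ‖z‖ ≤ ε := by
  let φ : ContDiffBump (0 : E) := ⟨ε / 2, ε, by positivity, by linarith⟩
  refine ⟨φ.normed volume, φ.contDiff_normed, φ.hasCompactSupport_normed, φ.nonneg_normed,
    φ.integral_normed, fun z hz => ?_⟩
  have : z ∈ Function.support (φ.normed volume) := hz
  rw [φ.support_normed_eq] at this
  have : dist z 0 < ε := this
  simpa using this.le

end Mollify

section ConstSolver

variable {E : Type*} [NormedAddCommGroup E] [InnerProductSpace ℝ E] [FiniteDimensional ℝ E]
  [MeasurableSpace E] [BorelSpace E] {ι : Type*} [Fintype ι]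

/-- Admissible right-hand sides on `[0, T]`. -/
structure HolderSource (α T F H : ℝ) (f : ℝ → E → ℝ) : Prop where
  abs_le : ∀ t ∈ Icc 0 T, ∀ x, |f t x| ≤ F
  holder : ∀ t ∈ Icc 0 T, ∀ x y, |f t x - f t y| ≤ H * ‖x - y‖ ^ α
  cont : ∀ x, ContinuousOn (fun t => f t x) (Icc 0 T)

theorem continuous_of_holder {α H : ℝ} (hα : 0 < α) {f : E → ℝ}
    (h : ∀ x y, |f x - f y| ≤ H * ‖x - y‖ ^ α) : Continuous f := by
  refine continuous_iff_continuousAt.2 fun x => ?_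
  have : Tendsto (fun y => H * ‖y - x‖ ^ α) (𝓝 x) (𝓝 0) := by
    have hc : Continuous fun y => H * ‖y - x‖ ^ α := by
      refine continuous_const.mul (Continuous.rpow_const (by fun_prop) fun _ => Or.inr hα.le)
    have := hc.tendsto x
    simpa [Real.zero_rpow hα.ne'] using this
  rw [ContinuousAt, tendsto_iff_dist_tendsto_zero]
  exact squeeze_zero (fun _ => dist_nonneg) (fun y => h y x) this

theorem continuous_joint_of_holder {P : Type*} [TopologicalSpace P] {α H : ℝ} (hα : 0 < α)
    {f : P → E → ℝ} (h : ∀ t x y, |f t x - f t y| ≤ H * ‖x - y‖ ^ α)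
    (hc : ∀ x, Continuous fun t => f t x) : Continuous fun q : P × E => f q.1 q.2 := by
  refine continuous_iff_continuousAt.2 fun ⟨t, x⟩ => ?_
  have h1 : Tendsto (fun q : P × E => H * ‖q.2 - x‖ ^ α) (𝓝 (t, x)) (𝓝 0) := by
    have hc : Continuous fun q : P × E => H * ‖q.2 - x‖ ^ α := by
      refine continuous_const.mul (Continuous.rpow_const (by fun_prop) fun _ => Or.inr hα.le)
    have := hc.tendsto (t, x)
    simpa [Real.zero_rpow hα.ne'] using this
  have h2 : Tendsto (fun q : P × E => |f q.1 x - f t x|) (𝓝 (t, x)) (𝓝 0) := by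
    have hc : Continuous fun q : P × E => |f q.1 x - f t x| :=
      (((hc x).comp continuous_fst).sub continuous_const).abs
    have := hc.tendsto (t, x)
    simpa using this
  rw [ContinuousAt, tendsto_iff_dist_tendsto_zero]
  refine squeeze_zero (fun _ => dist_nonneg) (fun q => ?_) (by simpa using h1.add h2)
  rw [Real.dist_eq]
  have := abs_sub_le (f q.1 q.2) (f q.1 x) (f t x)
  exact this.trans (add_le_add (h _ _ _) le_rfl)

/-- Solvability and Schauder estimate for constant coefficients. -/
theorem exists_isSol_const {α Λ T F H : ℝ} (hα : 0 < α) (hα1 : α < 1) (hΛ : 1 ≤ Λ) (hT : 0 ≤ T)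
    (hF0 : 0 ≤ F) (hH0 : 0 ≤ H) (e : OrthonormalBasis ι ℝ E) {σ : E ≃L[ℝ] E}
    (hσ : ‖(σ : E →L[ℝ] E)‖ ≤ Λ) (hσ' : ‖(σ.symm : E →L[ℝ] E)‖ ≤ Λ)
    {f : ℝ → E → ℝ} (hf : HolderSource α T F H f) :
    ∃ u, IsSol (fun _ => ellOp e (σ : E →L[ℝ] E)) (fun _ => 0) T f u ∧ ∀ t ∈ Icc 0 T,
      (∀ x, |u t x| ≤ F * T) ∧
      (∀ x, ‖fderiv ℝ (u t) x‖ ≤ F * T + schauderConst E α Λ * H) ∧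
      (∀ x, ‖D2 (u t) x‖ ≤ 8 * (F * T) + 4 * (schauderConst E α Λ * H)) ∧
      (∀ x y, ‖D2 (u t) x - D2 (u t) y‖ ≤ schauderConst E α Λ * H * ‖x - y‖ ^ α) := by
  set C := schauderConst E α Λ with hC
  have hC0 : 0 ≤ C := schauderConst_nonneg hα hα1 hΛ
  set f' : ℝ → E → ℝ := fun t => f (max 0 (min t T)) with hf'
  have hmem : ∀ t, max 0 (min t T) ∈ Icc 0 T := fun t =>
    ⟨le_max_left _ _, max_le hT (min_le_right _ _)⟩
  have hclamp : ∀ t ∈ Icc 0 T, f' t = f t := fun t ht => by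
    simp only [hf', min_eq_left ht.2, max_eq_right ht.1]
  have hF' : ∀ t x, |f' t x| ≤ F := fun t x => hf.abs_le _ (hmem t) x
  have hH' : ∀ t x y, |f' t x - f' t y| ≤ H * ‖x - y‖ ^ α := fun t => hf.holder _ (hmem t)
  have hcont : Continuous fun q : ℝ × E => f' q.1 q.2 :=
    continuous_joint_of_holder hα hH' fun x =>
      (hf.cont x).comp_continuous (by fun_prop) hmem
  have hct : ∀ t, Continuous (f' t) := fun t => continuous_of_holder hα (hH' t)
  have hpos : ∀ n : ℕ, (0 : ℝ) < 1 / ((n : ℝ) + 1) := fun n => Nat.one_div_pos_of_nat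
  choose ρ hρ2 hρc hρ0 hρ1 hρs using fun n => exists_bump E (hpos n)
  set g : ℕ → ℝ → E → ℝ := fun n t => mollify (ρ n) (f' t) with hg
  choose K hK using fun n => smoothSource_mollify (hρ2 n) (hρc n) hcont hF'
  have gF : ∀ n t x, |g n t x| ≤ F := fun n t x => by
    have := norm_mollify_le (hρ2 n).continuous (hρc n) (hF' t) x
    simpa [Real.norm_of_nonneg (hρ0 n _), hρ1] using this
  have gH : ∀ n t x y, |g n t x - g n t y| ≤ H * ‖x - y‖ ^ α := fun n t x y =>
    abs_mollify_sub_le (hρ2 n).continuous (hρc n) (hρ0 n) (hρ1 n) (hct t) (hct t) fun z _ => by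
      have := hH' t (x - z) (y - z)
      rwa [sub_sub_sub_cancel_right] at this
  have gA : ∀ n t x, |g n t x - f' t x| ≤ H * (1 / ((n : ℝ) + 1)) ^ α := fun n t x => by
    have := abs_mollify_sub_le (hρ2 n).continuous (hρc n) (hρ0 n) (hρ1 n) (hct t)
      (continuous_const (y := f' t x)) (x := x) (y := x) (K := H * (1 / ((n : ℝ) + 1)) ^ α)
      fun z hz => by
        have h1 := hH' t (x - z) x
        have h2 : ‖x - z - x‖ = ‖z‖ := by rw [sub_right_comm, sub_self, zero_sub, norm_neg]
        rw [h2] at h1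
        exact h1.trans (mul_le_mul_of_nonneg_left
          (Real.rpow_le_rpow (norm_nonneg _) (hρs n z hz) hα.le) hH0)
    rwa [mollify_const (hρ1 n)] at this
  have hlim0 : Tendsto (fun n : ℕ => H * (1 / ((n : ℝ) + 1)) ^ α) atTop (𝓝 0) := by
    have h1 := (tendsto_one_div_add_atTop_nhds_zero_nat (𝕜 := ℝ)).rpow_const (p := α) (Or.inr hα.le)
    have h2 := h1.const_mul H
    rwa [Real.zero_rpow hα.ne', mul_zero] at h2
  let l : Ultrafilter ℕ := Filter.hyperfilter ℕ
  have hl : (l : Filter ℕ) ≤ atTop := Nat.hyperfilter_le_atTop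
  set U : ℕ → ℝ → E → ℝ := fun n => heatU (σ : E →L[ℝ] E) (g n) with hU
  have uF : ∀ n, ∀ t ∈ Icc 0 T, ∀ x, |U n t x| ≤ F * T := fun n t ht x =>
    (norm_heatU_le (σ : E →L[ℝ] E) (F := g n) (fun p x => gF n p x) ht.1 x).trans
      (mul_le_mul_of_nonneg_left ht.2 hF0)
  have uH : ∀ n, ∀ t ∈ Icc 0 T, ∀ x y,
      ‖D2 (U n t) x - D2 (U n t) y‖ ≤ C * H * ‖x - y‖ ^ α := fun n t ht =>
    (hK n).holder hΛ hσ hσ' hα hα1 hH0 (gH n) ht.1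
  have uS : ∀ n t, ContDiff ℝ 2 (U n t) := fun n t => ((hK n).heatU_smooth _ t).1
  have osc : ∀ n, ∀ t ∈ Icc 0 T, ∀ x, ∀ y ∈ Metric.closedBall x 1,
      ‖D2 (U n t) y - D2 (U n t) x‖ ≤ C * H := fun n t ht x y hy => by
    refine (uH n t ht y x).trans (mul_le_of_le_one_right (by positivity) ?_)
    exact Real.rpow_le_one (norm_nonneg _) (by simpa [dist_eq_norm] using hy) hα.le
  have u1 : ∀ n, ∀ t ∈ Icc 0 T, ∀ x, ‖fderiv ℝ (U n t) x‖ ≤ F * T + C * H := fun n t ht x => by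
    have := norm_fderiv_le_of_osc (uS n t) one_pos (fun y _ => uF n t ht y) (osc n t ht x)
    simpa using this
  have u2 : ∀ n, ∀ t ∈ Icc 0 T, ∀ x, ‖D2 (U n t) x‖ ≤ 8 * (F * T) + 4 * (C * H) :=
    fun n t ht x => by
      have := norm_D2_le_of_osc (uS n t) one_pos (fun y _ => uF n t ht y) (osc n t ht x)
      simpa using this
  have hex : ∀ t x, ∃ c, t ∈ Icc 0 T → Tendsto (fun n => U n t x) l (𝓝 c) := fun t x => by
    by_cases ht : t ∈ Icc 0 T
    · obtain ⟨c, hc⟩ := exists_tendsto_of_bounded l (f := fun n => U n t x) (C := F * T)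
        (Eventually.of_forall fun n => uF n t ht x)
      exact ⟨c, fun _ => hc⟩
    · exact ⟨0, fun h => absurd h ht⟩
  choose u hu using hex
  have hFT : 0 ≤ F * T := mul_nonneg hF0 hT
  have hCH : 0 ≤ C * H := mul_nonneg hC0 hH0
  have hlim := IsSol.limit (l := l) (α := α) (A' := fun _ _ => ellOp e (σ : E →L[ℝ] E))
    (b' := fun _ _ => (0 : E)) (f' := g) (u' := U) (A := fun _ => ellOp e (σ : E →L[ℝ] E))
    (b := fun _ => 0) (f := f) (u := u) (T := T) hα hT
    (Eventually.of_forall fun n => (hK n).isSol e _ T) (fun _ => tendsto_const_nhds)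
    (fun _ => tendsto_const_nhds) ?_ ?_ ?_ ?_
  · refine ⟨u, hlim.1, fun t ht => ⟨fun x => ?_, fun x => ?_, fun x => ?_, fun x y => ?_⟩⟩
    · exact le_of_tendsto (hu t x ht).abs (Eventually.of_forall fun n => uF n t ht x)
    · exact le_of_tendsto (hlim.2 t ht x).1.norm (Eventually.of_forall fun n => u1 n t ht x)
    · exact le_of_tendsto (hlim.2 t ht x).2.norm (Eventually.of_forall fun n => u2 n t ht x)
    · exact le_of_tendsto ((hlim.2 t ht x).2.sub (hlim.2 t ht y).2).norm
        (Eventually.of_forall fun n => uH n t ht x y)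
  · intro t ht x
    rw [tendsto_iff_dist_tendsto_zero]
    refine squeeze_zero (fun _ => dist_nonneg) (fun n => ?_) (hlim0.mono_left hl)
    rw [← hclamp t ht]
    exact gA n t x
  · exact fun t ht x => hu t x ht
  · intro x₀
    refine ⟨1, one_pos, F + (8 * (F * T) + 4 * (C * H)) + ‖ellOp e (σ : E →L[ℝ] E)‖, by positivity,
      Eventually.of_forall fun n => ⟨fun t ht => ⟨fun x _ => ?_, fun x _ => ?_, fun x _ => ?_,
        fun x _ y _ => ?_⟩, fun x _ => ⟨?_, ?_, fun t _ => ?_⟩⟩⟩ <;>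
      have hn := norm_nonneg (ellOp e (σ : E →L[ℝ] E))
    · linarith [uF n t ht x]
    · linarith [u1 n t ht x]
    · linarith [u2 n t ht x]
    · refine (uH n t ht x y).trans (mul_le_mul_of_nonneg_right ?_ (by positivity))
      linarith
    · linarith
    · rw [norm_zero]; positivity
    · linarith [(gF n t x : |g n t x| ≤ F)]
  · intro x t ht ε hε
    obtain ⟨δ, hδ, h⟩ := Metric.continuousWithinAt_iff.1 (hf.cont x t ht) (ε / 2) (half_pos hε)
    refine ⟨δ, hδ, ?_⟩
    have hev := (hlim0.mono_left hl).eventually (ge_mem_nhds (show (0 : ℝ) < ε / 4 by positivity))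
    filter_upwards [hev] with n hn s hs hst
    have h1 := gA n s x
    have h2 := gA n t x
    rw [hclamp s hs] at h1
    rw [hclamp t ht] at h2
    have h3 : |f s x - f t x| < ε / 2 := h hs hst
    rw [abs_le] at *
    rw [abs_lt] at h3
    constructor <;> linarith

end ConstSolver

section HolderCalculus

variable {E : Type*} [NormedAddCommGroup E]
  {G G₁ G₂ G₃ : Type*} [NormedAddCommGroup G] [NormedAddCommGroup G₁] [NormedAddCommGroup G₂]
  [NormedAddCommGroup G₃]

/-- `g` is bounded by `m` on `S` and `α`-Hölder on `S` with constant `m`. -/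
structure HB (α : ℝ) (S : Set E) (m : ℝ) (g : E → G) : Prop where
  le : ∀ x ∈ S, ‖g x‖ ≤ m
  holder : ∀ x ∈ S, ∀ y ∈ S, ‖g x - g y‖ ≤ m * ‖x - y‖ ^ α

variable {α m m₁ m₂ : ℝ} {S : Set E}

theorem HB.mono {g : E → G} (h : HB α S m g) (hm : m ≤ m₁) : HB α S m₁ g where
  le x hx := (h.le x hx).trans hm
  holder x hx y hy := (h.holder x hx y hy).trans (mul_le_mul_of_nonneg_right hm (by positivity))

theorem HB.mono_set {S' : Set E} {g : E → G} (h : HB α S m g) (hS : S' ⊆ S) : HB α S' m g where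
  le x hx := h.le x (hS hx)
  holder x hx y hy := h.holder x (hS hx) y (hS hy)

theorem HB.congr {g g' : E → G} (h : HB α S m g) (hg : ∀ x ∈ S, g' x = g x) : HB α S m g' where
  le x hx := by rw [hg x hx]; exact h.le x hx
  holder x hx y hy := by rw [hg x hx, hg y hy]; exact h.holder x hx y hy

theorem HB.add {g g' : E → G} (h : HB α S m g) (h' : HB α S m₁ g') :
    HB α S (m + m₁) (fun x => g x + g' x) where
  le x hx := (norm_add_le _ _).trans (add_le_add (h.le x hx) (h'.le x hx))
  holder x hx y hy := by
    rw [add_sub_add_comm, add_mul]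
    exact (norm_add_le _ _).trans (add_le_add (h.holder x hx y hy) (h'.holder x hx y hy))

theorem HB.neg {g : E → G} (h : HB α S m g) : HB α S m (fun x => - g x) where
  le x hx := by rw [norm_neg]; exact h.le x hx
  holder x hx y hy := by rw [← neg_sub', norm_neg]; exact h.holder x hx y hy

theorem HB.sub {g g' : E → G} (h : HB α S m g) (h' : HB α S m₁ g') :
    HB α S (m + m₁) (fun x => g x - g' x) := by
  simpa only [sub_eq_add_neg] using h.add h'.neg

theorem HB.const (hm : 0 ≤ m) {c : G} (hc : ‖c‖ ≤ m) : HB α S m (fun _ => c) where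
  le x _ := hc
  holder x _ y _ := by rw [sub_self, norm_zero]; positivity

theorem rpow_ge_of_le_one {r : ℝ} (hα1 : α ≤ 1) (h0 : 0 ≤ r) (h1 : r ≤ 1) : r ≤ r ^ α := by
  rcases h0.eq_or_lt with rfl | h
  · positivity
  · simpa using Real.rpow_le_rpow_of_exponent_ge h h1 hα1

theorem HB.of_lipschitz (hα1 : α ≤ 1) (hS : ∀ x ∈ S, ∀ y ∈ S, ‖x - y‖ ≤ 1) (hm : 0 ≤ m) {g : E → G}
    (h0 : ∀ x ∈ S, ‖g x‖ ≤ m) (h1 : ∀ x ∈ S, ∀ y ∈ S, ‖g x - g y‖ ≤ m * ‖x - y‖) :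
    HB α S m g where
  le := h0
  holder x hx y hy := (h1 x hx y hy).trans (mul_le_mul_of_nonneg_left
    (rpow_ge_of_le_one hα1 (norm_nonneg _) (hS x hx y hy)) hm)

/-- A biadditive operation of norm at most one. -/
structure IsProd (op : G₁ → G₂ → G₃) : Prop where
  sub : ∀ a a' b b', op a b - op a' b' = op (a - a') b + op a' (b - b')
  norm_le : ∀ a b, ‖op a b‖ ≤ ‖a‖ * ‖b‖

/-- The Hölder estimate of a product separates the sup norms. -/
theorem IsProd.holder {op : G₁ → G₂ → G₃} (hop : IsProd op) {g : E → G₁} {g' : E → G₂} {x y : E}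
    {s s' k k' : ℝ} (h1 : ‖g y‖ ≤ s) (h2 : ‖g' x‖ ≤ s')
    (h3 : ‖g x - g y‖ ≤ k * ‖x - y‖ ^ α) (h4 : ‖g' x - g' y‖ ≤ k' * ‖x - y‖ ^ α) :
    ‖op (g x) (g' x) - op (g y) (g' y)‖ ≤ (k * s' + s * k') * ‖x - y‖ ^ α := by
  rw [hop.sub]
  calc _ ≤ ‖op (g x - g y) (g' x)‖ + ‖op (g y) (g' x - g' y)‖ := norm_add_le _ _
    _ ≤ ‖g x - g y‖ * ‖g' x‖ + ‖g y‖ * ‖g' x - g' y‖ :=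
      add_le_add (hop.norm_le _ _) (hop.norm_le _ _)
    _ ≤ k * ‖x - y‖ ^ α * s' + s * (k' * ‖x - y‖ ^ α) :=
        add_le_add (mul_le_mul h3 h2 (norm_nonneg _) ((norm_nonneg _).trans h3))
          (mul_le_mul h1 h4 (norm_nonneg _) ((norm_nonneg _).trans h1))
    _ = _ := by ring

theorem HB.prod {op : G₁ → G₂ → G₃} (hop : IsProd op) {g : E → G₁} {g' : E → G₂}
    (h : HB α S m₁ g) (h' : HB α S m₂ g') : HB α S (2 * m₁ * m₂) (fun x => op (g x) (g' x)) where
  le x hx := by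
    have h1 := h.le x hx
    have h2 := h'.le x hx
    have h3 : ‖g x‖ * ‖g' x‖ ≤ m₁ * m₂ :=
      mul_le_mul h1 h2 (norm_nonneg _) ((norm_nonneg _).trans h1)
    have h4 : 0 ≤ m₁ * m₂ := (by positivity : 0 ≤ ‖g x‖ * ‖g' x‖).trans h3
    linarith [hop.norm_le (g x) (g' x)]
  holder x hx y hy := (hop.holder (h.le y hy) (h'.le x hx) (h.holder x hx y hy)
    (h'.holder x hx y hy)).trans_eq (by ring)

theorem isProd_smul [NormedSpace ℝ G] : IsProd fun (c : ℝ) (v : G) => c • v where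
  sub a a' b b' := by rw [sub_smul, smul_sub]; abel
  norm_le a b := (norm_smul _ _).le

theorem isProd_apply [NormedSpace ℝ G] [NormedSpace ℝ G₁] :
    IsProd fun (T : G →L[ℝ] G₁) (v : G) => T v where
  sub a a' b b' := by simp
  norm_le a b := a.le_opNorm b

/-- The tensor product of two linear forms. -/
noncomputable def Bil.tensor {E : Type*} [NormedAddCommGroup E] [NormedSpace ℝ E]
    (p q : E →L[ℝ] ℝ) : Bil E :=
  show E →L[ℝ] E →L[ℝ] ℝ from p.smulRight q

@[simp] theorem Bil.tensor_left {E : Type*} [NormedAddCommGroup E] [NormedSpace ℝ E]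
    (p q : E →L[ℝ] ℝ) (v : E) : (Bil.tensor p q).left v = p v • q := rfl

theorem isProd_tensor {E : Type*} [NormedAddCommGroup E] [NormedSpace ℝ E] :
    IsProd (Bil.tensor (E := E)) where
  sub a a' b b' := by
    apply ContinuousLinearMap.ext
    intro v
    change a v • b - a' v • b' = (a - a') v • b + a' v • (b - b')
    ext w
    simp only [sub_apply, add_apply, smul_apply, smul_eq_mul]
    ring
  norm_le a b := (ContinuousLinearMap.norm_smulRight_apply a b).le

end HolderCalculus

section Products

variable {E : Type*} [NormedAddCommGroup E] [NormedSpace ℝ E]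

theorem hasFDerivAt_fderiv_mul {φ ψ : E → ℝ} (hφ : ContDiff ℝ 2 φ) (hψ : ContDiff ℝ 2 ψ) :
    ContDiff ℝ 2 (fun x => φ x * ψ x) ∧
    fderiv ℝ (fun x => φ x * ψ x) = (fun x => φ x • fderiv ℝ ψ x + ψ x • fderiv ℝ φ x) ∧
    D2 (fun x => φ x * ψ x) = (fun x => φ x • D2 ψ x + ψ x • D2 φ x +
      (Bil.tensor (fderiv ℝ φ x) (fderiv ℝ ψ x) + Bil.tensor (fderiv ℝ ψ x) (fderiv ℝ φ x))) := by
  have e1 : fderiv ℝ (fun x => φ x * ψ x) = (fun x => φ x • fderiv ℝ ψ x + ψ x • fderiv ℝ φ x) :=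
    funext fun x => ((hasFDerivAt_of_C2 hφ x).mul (hasFDerivAt_of_C2 hψ x)).fderiv
  refine ⟨hφ.mul hψ, e1, funext fun x => ?_⟩
  unfold D2
  rw [e1]
  have h := ((hasFDerivAt_of_C2 hφ x).smul (hasFDerivAt_fderiv_of_C2 hψ x)).add
    ((hasFDerivAt_of_C2 hψ x).smul (hasFDerivAt_fderiv_of_C2 hφ x))
  refine h.fderiv.trans ?_
  change (_ : E →L[ℝ] E →L[ℝ] ℝ) = _
  apply ContinuousLinearMap.ext
  intro v
  apply ContinuousLinearMap.ext
  intro w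
  change (φ x • (D2 ψ x).left v + fderiv ℝ φ x v • fderiv ℝ ψ x +
      (ψ x • (D2 φ x).left v + fderiv ℝ ψ x v • fderiv ℝ φ x)) w =
    (φ x • (D2 ψ x).left v + ψ x • (D2 φ x).left v +
      (fderiv ℝ φ x v • fderiv ℝ ψ x + fderiv ℝ ψ x v • fderiv ℝ φ x)) w
  simp only [add_apply, smul_apply, smul_eq_mul]
  ring

end Products

section Cutoff

theorem smoothTransition_bounds : ∃ C : ℝ, 1 ≤ C ∧ ∀ y : ℝ,
    |deriv Real.smoothTransition y| ≤ C ∧ |deriv (deriv Real.smoothTransition) y| ≤ C ∧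
    |deriv (deriv (deriv Real.smoothTransition)) y| ≤ C := by
  have h3 : ContDiff ℝ 3 Real.smoothTransition := Real.smoothTransition.contDiff
  have h2 : ContDiff ℝ 2 (deriv Real.smoothTransition) := by
    have : ContDiff ℝ (2 + 1) Real.smoothTransition := by simpa using (by norm_num; exact h3)
    exact (contDiff_succ_iff_deriv.1 this).2.2
  have h1 : ContDiff ℝ 1 (deriv (deriv Real.smoothTransition)) := by
    have : ContDiff ℝ (1 + 1) (deriv Real.smoothTransition) := by norm_num; exact h2
    exact (contDiff_succ_iff_deriv.1 this).2.2
  have c1 : HasCompactSupport (deriv Real.smoothTransition) := by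
    refine HasCompactSupport.intro (isCompact_Icc (a := (0 : ℝ)) (b := 1)) fun x hx => ?_
    rw [mem_Icc, not_and_or, not_le, not_le] at hx
    rcases hx with hx | hx
    · have : Real.smoothTransition =ᶠ[𝓝 x] fun _ => 0 := by
        filter_upwards [Iio_mem_nhds hx] with y hy
        exact Real.smoothTransition.zero_of_nonpos (le_of_lt hy)
      rw [this.deriv_eq, deriv_const]
    · have : Real.smoothTransition =ᶠ[𝓝 x] fun _ => 1 := by
        filter_upwards [Ioi_mem_nhds hx] with y hy
        exact Real.smoothTransition.one_of_one_le (le_of_lt hy)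
      rw [this.deriv_eq, deriv_const]
  obtain ⟨C1, hC1⟩ := h2.continuous.bounded_above_of_compact_support c1
  obtain ⟨C2, hC2⟩ := h1.continuous.bounded_above_of_compact_support c1.deriv
  obtain ⟨C3, hC3⟩ := (h1.continuous_deriv
    (by norm_num)).bounded_above_of_compact_support c1.deriv.deriv
  refine ⟨max 1 (max C1 (max C2 C3)), le_max_left _ _, fun y => ⟨?_, ?_, ?_⟩⟩
  · exact (hC1 y).trans (by simp)
  · exact (hC2 y).trans (by simp)
  · exact (hC3 y).trans (by simp)

variable {E : Type*} [NormedAddCommGroup E] [InnerProductSpace ℝ E] [FiniteDimensional ℝ E]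

/-- The inner product as a linear map into the dual. -/
noncomputable def innerCLM (E : Type*) [NormedAddCommGroup E] [InnerProductSpace ℝ E]
    [FiniteDimensional ℝ E] : Bil E :=
  show E →L[ℝ] E →L[ℝ] ℝ from LinearMap.toContinuousLinearMap
    { toFun := fun x => innerSL ℝ x
      map_add' := fun x y => map_add _ x y
      map_smul' := fun c x => by simp }

theorem innerCLM_left (x : E) : (innerCLM E).left x = innerSL ℝ x := rfl

theorem norm_innerCLM_le : ‖innerCLM E‖ ≤ 1 := by
  refine ContinuousLinearMap.opNorm_le_bound _ zero_le_one fun x => ?_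
  change ‖innerSL ℝ x‖ ≤ _
  rw [innerSL_apply_norm, one_mul]

theorem hasFDerivAt_comp_quadratic {s : ℝ → ℝ} (hs : ContDiff ℝ 2 s) (x₀ : E) (a c : ℝ) :
    let φ := fun x : E => (a - ‖x - x₀‖ ^ 2) / c
    let P := fun x : E => (-(2 / c)) • (innerCLM E).left (x - x₀)
    ContDiff ℝ 2 (fun x => s (φ x)) ∧ fderiv ℝ (fun x => s (φ x)) = (fun x => deriv s (φ x) • P x) ∧
    D2 (fun x => s (φ x)) = fun x => deriv (deriv s) (φ x) • Bil.tensor (P x) (P x) +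
      deriv s (φ x) • ((-(2 / c)) • innerCLM E) := by
  intro φ P
  have hs1 : ContDiff ℝ 1 (deriv s) := by
    have : ContDiff ℝ (1 + 1) s := by norm_num; exact hs
    exact (contDiff_succ_iff_deriv.1 this).2.2
  have hφ : ∀ x, HasFDerivAt φ (P x) x := fun x => by
    have h := (((hasStrictFDerivAt_norm_sq (x - x₀)).hasFDerivAt.comp x
      ((hasFDerivAt_id x).sub_const x₀)).const_sub a).mul_const c⁻¹
    refine (h.congr_of_eventuallyEq (Eventually.of_forall fun y => ?_)).congr_fderiv ?_
    · simp [φ, div_eq_mul_inv]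
    · ext w
      simp [P, innerCLM_left]
      ring
  have hP : ∀ x, HasFDerivAt P (show E →L[ℝ] E →L[ℝ] ℝ from (-(2 / c)) • innerCLM E) x := fun x =>
    ((show E →L[ℝ] E →L[ℝ] ℝ from (-(2 / c)) • innerCLM E).hasFDerivAt.comp x
      ((hasFDerivAt_id x).sub_const x₀)).congr_fderiv (ContinuousLinearMap.comp_id _)
  refine contDiff_two_of_hasFDerivAt (fun x => ?_) (fun x => ?_) ?_
  · exact ((hs.differentiable (by norm_num) (φ x)).hasDerivAt.comp_hasFDerivAt x (hφ x))
  · have h := ((hs1.differentiable (by norm_num) (φ x)).hasDerivAt.comp_hasFDerivAt x (hφ x)).smul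
      (hP x)
    refine h.congr_fderiv ?_
    apply ContinuousLinearMap.ext
    intro v
    apply ContinuousLinearMap.ext
    intro w
    change (deriv s (φ x) • ((-(2 / c)) • (innerCLM E).left v) +
      (deriv (deriv s) (φ x) • P x v) • P x) w =
      (deriv (deriv s) (φ x) • (P x v • P x) + deriv s (φ x) • ((-(2 / c)) • (innerCLM E).left v)) w
    simp only [add_apply, smul_apply, smul_eq_mul]
    ring
  · have cφ : Continuous φ := by simp only [φ]; fun_prop
    have cP : Continuous P := continuous_iff_continuousAt.2 fun x => (hP x).continuousAt
    have cT : Continuous fun x => Bil.tensor (P x) (P x) := by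
      change Continuous fun x => (P x).smulRight (P x)
      exact (ContinuousLinearMap.smulRightL ℝ E (E →L[ℝ] ℝ)).continuous₂.comp (cP.prodMk cP)
    exact (((hs1.continuous_deriv (by norm_num)).comp cφ).smul cT).add
      ((hs1.continuous.comp cφ).smul continuous_const)

theorem exists_cutoff (E : Type*) [NormedAddCommGroup E] [InnerProductSpace ℝ E]
    [FiniteDimensional ℝ E] :
    ∃ C : ℝ, 1 ≤ C ∧ ∀ (α : ℝ) (x₀ : E) (ρ₁ ρ₂ : ℝ), α ≤ 1 → 0 ≤ ρ₁ → ρ₁ < ρ₂ → ρ₂ ≤ 1 / 2 →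
      ∃ η : E → ℝ, ContDiff ℝ 2 η ∧ (∀ x, ‖x - x₀‖ ≤ ρ₁ → η x = 1) ∧
        (∀ x, ρ₂ ≤ ‖x - x₀‖ → η x = 0) ∧ (∀ x, 0 ≤ η x) ∧ (∀ x, η x ≤ 1) ∧
        HB α (Metric.closedBall x₀ (1 / 2)) (C / (ρ₂ ^ 2 - ρ₁ ^ 2) ^ 3) η ∧
        HB α (Metric.closedBall x₀ (1 / 2)) (C / (ρ₂ ^ 2 - ρ₁ ^ 2) ^ 3) (fderiv ℝ η) ∧
        HB α (Metric.closedBall x₀ (1 / 2)) (C / (ρ₂ ^ 2 - ρ₁ ^ 2) ^ 3) (D2 η) := by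
  obtain ⟨C, hC1, hC⟩ := smoothTransition_bounds
  refine ⟨20 * C, by linarith, fun α x₀ ρ₁ ρ₂ hα1 h1 h12 h2 => ?_⟩
  set c := ρ₂ ^ 2 - ρ₁ ^ 2 with hc
  have hc0 : 0 < c := by rw [hc]; nlinarith
  have hc1 : c ≤ 1 := by rw [hc]; nlinarith
  set S := Metric.closedBall x₀ (1 / 2 : ℝ)
  have hd : ∀ x ∈ S, ‖x - x₀‖ ≤ 1 / 2 := fun x hx => by simpa [S, dist_eq_norm] using hx
  have hS : ∀ x ∈ S, ∀ y ∈ S, ‖x - y‖ ≤ 1 := fun x hx y hy => by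
    have := norm_sub_le (x - x₀) (y - x₀)
    rw [sub_sub_sub_cancel_right] at this
    linarith [hd x hx, hd y hy]
  set φ := fun x : E => (ρ₂ ^ 2 - ‖x - x₀‖ ^ 2) / c with hφ
  set P := fun x : E => (-(2 / c)) • (innerCLM E).left (x - x₀) with hP
  obtain ⟨k0, k1, k2⟩ := hasFDerivAt_comp_quadratic (s := Real.smoothTransition)
    Real.smoothTransition.contDiff x₀ (ρ₂ ^ 2) c
  have hφl : ∀ x ∈ S, ∀ y ∈ S, |φ x - φ y| ≤ ‖x - y‖ / c := fun x hx y hy => by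
    have e : φ x - φ y = (‖y - x₀‖ - ‖x - x₀‖) * (‖y - x₀‖ + ‖x - x₀‖) / c := by
      simp only [hφ]; ring
    rw [e, abs_div, abs_of_pos hc0, abs_mul]
    gcongr
    have a1 : |‖y - x₀‖ - ‖x - x₀‖| ≤ ‖x - y‖ := by
      have := abs_norm_sub_norm_le (y - x₀) (x - x₀)
      rwa [sub_sub_sub_cancel_right, norm_sub_rev y x] at this
    have a2 : |‖y - x₀‖ + ‖x - x₀‖| ≤ 1 := by
      rw [abs_of_nonneg (by positivity)]; linarith [hd x hx, hd y hy]
    calc _ ≤ ‖x - y‖ * 1 := mul_le_mul a1 a2 (abs_nonneg _) (norm_nonneg _)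
      _ = _ := mul_one _
  have hcomp : ∀ g : ℝ → ℝ, Differentiable ℝ g → (∀ y, |g y| ≤ C) → (∀ y, |deriv g y| ≤ C) →
      HB α S (C / c) (fun x => g (φ x)) := fun g hg b0 b1 => by
    refine HB.of_lipschitz hα1 hS (by positivity) (fun x _ => (b0 _).trans ?_) fun x hx y hy => ?_
    · rw [le_div_iff₀ hc0]; nlinarith
    · have := Convex.norm_image_sub_le_of_norm_deriv_le (f := g) (C := C) (s := univ)
        (fun x _ => hg x) (fun x _ => b1 x) convex_univ (mem_univ (φ y)) (mem_univ (φ x))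
      refine this.trans ?_
      rw [div_mul_eq_mul_div, mul_div_assoc]
      exact mul_le_mul_of_nonneg_left (hφl x hx y hy) (by linarith)
  have h3 : ContDiff ℝ 3 Real.smoothTransition := Real.smoothTransition.contDiff
  have h2' : ContDiff ℝ 2 (deriv Real.smoothTransition) := by
    have : ContDiff ℝ (2 + 1) Real.smoothTransition := by norm_num; exact h3
    exact (contDiff_succ_iff_deriv.1 this).2.2
  have h1' : ContDiff ℝ 1 (deriv (deriv Real.smoothTransition)) := by
    have : ContDiff ℝ (1 + 1) (deriv Real.smoothTransition) := by norm_num; exact h2'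
    exact (contDiff_succ_iff_deriv.1 this).2.2
  have g0 := hcomp _ (h3.differentiable (by norm_num)) (fun y => by
    rw [abs_of_nonneg (Real.smoothTransition.nonneg y)]
    exact (Real.smoothTransition.le_one y).trans hC1) (fun y => (hC y).1)
  have g1 := hcomp _ (h2'.differentiable (by norm_num)) (fun y => (hC y).1) (fun y => (hC y).2.1)
  have g2 := hcomp _ (h1'.differentiable (by norm_num)) (fun y => (hC y).2.1) (fun y => (hC y).2.2)
  have hPb : HB α S (2 / c) P := by
    have hn : ∀ v : E, ‖(-(2 / c)) • (innerCLM E).left v‖ ≤ 2 / c * ‖v‖ := fun v => by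
      rw [norm_smul, norm_neg, Real.norm_of_nonneg (by positivity),
        innerCLM_left, innerSL_apply_norm]
    refine HB.of_lipschitz hα1 hS (by positivity) (fun x hx => (hn _).trans ?_) fun x hx y hy => ?_
    · exact mul_le_of_le_one_right (by positivity) ((hd x hx).trans (by norm_num))
    · have := hn (x - y)
      have e : P x - P y = (-(2 / c)) • (innerCLM E).left (x - y) := by
        simp only [hP]
        ext w
        simp only [sub_apply, smul_apply, smul_eq_mul, Bil.left_sub]
        ring
      rwa [e]
  have hJ : HB α S (2 / c) (fun _ : E => (-(2 / c)) • innerCLM E) := by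
    refine HB.const (by positivity) ?_
    rw [norm_smul, norm_neg, Real.norm_of_nonneg (by positivity)]
    exact mul_le_of_le_one_right (by positivity) norm_innerCLM_le
  have i1 : 1 ≤ 1 / c := by rw [le_div_iff₀ hc0]; linarith
  have i2 : 1 / c ≤ (1 / c) ^ 2 := by nlinarith
  have i3 : (1 / c) ^ 2 ≤ (1 / c) ^ 3 := by nlinarith [sq_nonneg (1 / c)]
  have e0 : 20 * C / c ^ 3 = 20 * C * (1 / c) ^ 3 := by field_simp
  refine ⟨fun x => Real.smoothTransition (φ x), k0, fun x hx => ?_, fun x hx => ?_,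
    fun x => Real.smoothTransition.nonneg _, fun x => Real.smoothTransition.le_one _, ?_, ?_, ?_⟩
  · refine Real.smoothTransition.one_of_one_le ?_
    simp only [hφ]
    rw [le_div_iff₀ hc0, one_mul, hc]
    have := norm_nonneg (x - x₀)
    nlinarith
  · refine Real.smoothTransition.zero_of_nonpos ?_
    simp only [hφ]
    refine div_nonpos_of_nonpos_of_nonneg ?_ hc0.le
    nlinarith
  · refine g0.mono ?_
    rw [e0]
    have : C / c = C * (1 / c) := by ring
    rw [this]; nlinarith
  · rw [k1]
    refine (g1.prod isProd_smul hPb).mono ?_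
    rw [e0]
    have : 2 * (C / c) * (2 / c) = 4 * C * (1 / c) ^ 2 := by field_simp; norm_num
    rw [this]; nlinarith
  · rw [k2]
    refine ((g2.prod isProd_smul (hPb.prod isProd_tensor hPb)).add (g1.prod isProd_smul hJ)).mono ?_
    rw [e0]
    have : 2 * (C / c) * (2 * (2 / c) * (2 / c)) + 2 * (C / c) * (2 / c) =
        16 * C * (1 / c) ^ 3 + 4 * C * (1 / c) ^ 2 := by field_simp; ring
    rw [this]; nlinarith

end Cutoff

section Localization

variable {E : Type*} [NormedAddCommGroup E] [NormedSpace ℝ E]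

/-- `u` is a classical solution of `u_t = L u + f` on `[0, T] × S` with zero initial data. -/
structure IsSolOn (S : Set E) (A : E → Bil E →L[ℝ] ℝ) (b : E → E) (T : ℝ) (f u : ℝ → E → ℝ) :
    Prop where
  init : ∀ x ∈ S, u 0 x = 0
  smooth : ∀ t ∈ Icc 0 T, ContDiff ℝ 2 (u t)
  eqn : ∀ t ∈ Icc 0 T, ∀ x ∈ S,
    HasDerivWithinAt (fun s => u s x) (Lop A b (u t) x + f t x) (Icc 0 T) t

theorem IsSol.isSolOn {A : E → Bil E →L[ℝ] ℝ} {b : E → E} {T : ℝ} {f u : ℝ → E → ℝ}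
    (h : IsSol A b T f u) (S : Set E) : IsSolOn S A b T f u :=
  ⟨fun x _ => h.init x, h.smooth, fun t ht x _ => h.eqn t ht x⟩

/-- The symmetrized tensor product of two linear forms. -/
noncomputable def symTensor (p q : E →L[ℝ] ℝ) : Bil E := Bil.tensor p q + Bil.tensor q p

/-- The lower order part of the right-hand side in the equation satisfied by `η u`. -/
noncomputable def cutLow (A' : Bil E →L[ℝ] ℝ) (b b' : E → E) (η f u : E → ℝ) (x : E) : ℝ :=
  η x • f x - A' (symTensor (fderiv ℝ η x) (fderiv ℝ u x)) - u x • A' (D2 η x)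
    + η x • (fderiv ℝ u x) (b x - b' x) - u x • fderiv ℝ η x (b' x)

/-- The right-hand side in the equation satisfied by `η u`. -/
noncomputable def cutSource (A A' : E → Bil E →L[ℝ] ℝ) (b b' : E → E) (η : E → ℝ)
    (f u : ℝ → E → ℝ) (t : ℝ) (x : E) : ℝ :=
  η x • (A x - A' x) (D2 (u t) x) + cutLow (A' x) b b' η (f t) (u t) x

theorem eq_zero_of_closed {S : Set E} (hS : IsClosed S) {η : E → ℝ} (h0 : ∀ x, x ∉ S → η x = 0)
    {x : E} (hx : x ∉ S) : fderiv ℝ η x = 0 ∧ D2 η x = 0 := by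
  have hz : ∀ y, y ∉ S → fderiv ℝ η y = 0 := fun y hy => by
    have : η =ᶠ[𝓝 y] fun _ => 0 := by
      filter_upwards [hS.isOpen_compl.mem_nhds hy] with z hz using h0 z hz
    rw [this.fderiv_eq, fderiv_fun_const]; rfl
  refine ⟨hz x hx, ?_⟩
  have : fderiv ℝ η =ᶠ[𝓝 x] fun _ => 0 := by
    filter_upwards [hS.isOpen_compl.mem_nhds hx] with z hz' using hz z hz'
  unfold D2
  rw [this.fderiv_eq, fderiv_fun_const]; rfl

theorem cutSource_eq_zero {S : Set E} (hS : IsClosed S) {η : E → ℝ} (h0 : ∀ x, x ∉ S → η x = 0)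
    (A A' : E → Bil E →L[ℝ] ℝ) (b b' : E → E) (f u : ℝ → E → ℝ) (t : ℝ) {x : E} (hx : x ∉ S) :
    cutSource A A' b b' η f u t x = 0 := by
  obtain ⟨h1, h2⟩ := eq_zero_of_closed hS h0 hx
  have h3 : symTensor 0 (fderiv ℝ (u t) x) = 0 := by
    apply ContinuousLinearMap.ext; intro v
    apply ContinuousLinearMap.ext; intro w
    change (0 : ℝ) * _ + _ * 0 = (0 : ℝ)
    ring
  simp [cutSource, cutLow, h0 x hx, h1, h2, h3]

theorem IsSolOn.mul_cutoff {S : Set E} (hS : IsClosed S) {A A' : E → Bil E →L[ℝ] ℝ} {b b' : E → E}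
    {T : ℝ} {f u : ℝ → E → ℝ} (h : IsSolOn S A b T f u) {η : E → ℝ} (hη : ContDiff ℝ 2 η)
    (h0 : ∀ x, x ∉ S → η x = 0) :
    IsSol A' b' T (cutSource A A' b b' η f u) (fun t x => η x * u t x) where
  init x := by
    by_cases hx : x ∈ S
    · rw [h.init x hx, mul_zero]
    · rw [h0 x hx, zero_mul]
  smooth t ht := hη.mul (h.smooth t ht)
  eqn t ht x := by
    obtain ⟨-, k1, k2⟩ := hasFDerivAt_fderiv_mul hη (h.smooth t ht)
    by_cases hx : x ∈ S
    · refine ((h.eqn t ht x hx).const_mul (η x)).congr_deriv ?_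
      simp only [Lop, k1, k2, cutSource, cutLow, symTensor,
        map_add, map_smul, add_apply, smul_apply,
        sub_apply, smul_eq_mul, map_sub]
      ring
    · obtain ⟨h1, h2⟩ := eq_zero_of_closed hS h0 hx
      rw [cutSource_eq_zero hS h0 A A' b b' f u t hx]
      have e1 : (fun s => η x * u s x) = fun _ => 0 := by simp [h0 x hx]
      rw [e1]
      have e2 : Lop A' b' (fun x => η x * u t x) x = 0 := by
        obtain ⟨h1', h2'⟩ := eq_zero_of_closed hS (η := fun x => η x * u t x)
          (fun y hy => by simp [h0 y hy]) hx
        simp [Lop, h1', h2']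
      rw [e2, add_zero]
      exact hasDerivWithinAt_const _ _ _

theorem holder_of_holder_closedBall {α m R ρ : ℝ} (hα : 0 < α) (hm : 0 ≤ m) {x₀ : E} (hρ : ρ < R)
    {g : E → ℝ}
    (h0 : ∀ x, x ∉ Metric.closedBall x₀ ρ → g x = 0)
    (h : ∀ x ∈ Metric.closedBall x₀ R, ∀ y ∈ Metric.closedBall x₀ R, |g x - g y| ≤ m * ‖x - y‖ ^ α)
    (x y : E) : |g x - g y| ≤ m * ‖x - y‖ ^ α := by
  have key : ∀ x ∈ Metric.closedBall x₀ R, ∀ y, y ∉ Metric.closedBall x₀ R →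
      |g x - g y| ≤ m * ‖x - y‖ ^ α := by
    intro x hx y hy
    have hc : ContinuousOn (fun s : ℝ => ‖x + s • (y - x) - x₀‖) (Icc 0 1) := by fun_prop
    have h1 : ‖x - x₀‖ ≤ R := by simpa [dist_eq_norm] using hx
    have h2 : R < ‖y - x₀‖ := by simpa [dist_eq_norm] using hy
    obtain ⟨s, hs, hsR⟩ := intermediate_value_Icc zero_le_one hc
      (show R ∈ Icc _ _ from ⟨by simpa using h1, by simpa using h2.le⟩)
    set z := x + s • (y - x)
    have hz : z ∈ Metric.closedBall x₀ R := by
      rw [Metric.mem_closedBall, dist_eq_norm]; exact hsR.le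
    have gz : g z = 0 := h0 z (by
      rw [Metric.mem_closedBall, dist_eq_norm, not_le]; exact hρ.trans_le hsR.ge)
    have gy : g y = 0 := h0 y (by
      rw [Metric.mem_closedBall, dist_eq_norm, not_le]; exact hρ.trans h2)
    have := h x hx z hz
    rw [gz] at this
    rw [gy]
    refine this.trans (mul_le_mul_of_nonneg_left (Real.rpow_le_rpow (norm_nonneg _) ?_ hα.le) hm)
    have e : x - z = -(s • (y - x)) := by simp [z]
    rw [e, norm_neg, norm_smul, Real.norm_of_nonneg hs.1, norm_sub_rev x y]
    exact mul_le_of_le_one_left (norm_nonneg _) hs.2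
  by_cases hx : x ∈ Metric.closedBall x₀ R <;> by_cases hy : y ∈ Metric.closedBall x₀ R
  · exact h x hx y hy
  · exact key x hx y hy
  · rw [abs_sub_comm, norm_sub_rev]; exact key y hy x hx
  · have hb : ∀ z, z ∉ Metric.closedBall x₀ R → g z = 0 := fun z hz =>
      h0 z fun h => hz (Metric.closedBall_subset_closedBall hρ.le h)
    rw [hb x hx, hb y hy, sub_self, abs_zero]; positivity

variable {α Λ q N Nf K : ℝ} {S : Set E}

theorem HB.symTensor {p q : E → E →L[ℝ] ℝ} {m₁ m₂ : ℝ} (hp : HB α S m₁ p) (hq : HB α S m₂ q) :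
    HB α S (4 * m₁ * m₂) (fun x => symTensor (p x) (q x)) :=
  ((hp.prod isProd_tensor hq).add (hq.prod isProd_tensor hp)).mono (le_of_eq (by ring))

theorem HB.cutLow {A' : E → Bil E →L[ℝ] ℝ} {b b' : E → E} {η f u : E → ℝ}
    (hA' : HB α S Λ A') (hb : HB α S Λ b) (hb' : HB α S Λ b') (h0 : HB α S q η)
    (h1 : HB α S q (fderiv ℝ η)) (h2 : HB α S q (D2 η)) (hf : HB α S Nf f) (hu : HB α S N u)
    (hu1 : HB α S N (fderiv ℝ u)) :
    HB α S (2 * q * Nf + 24 * Λ * q * N) (fun x => cutLow (A' x) b b' η f u x) := by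
  have t1 := h0.prod isProd_smul hf
  have t2 := hA'.prod isProd_apply (h1.symTensor hu1)
  have t3 := hu.prod isProd_smul (hA'.prod isProd_apply h2)
  have t4 := h0.prod isProd_smul (hu1.prod isProd_apply (hb.sub hb'))
  have t5 := hu.prod isProd_smul (h1.prod isProd_apply hb')
  exact ((((t1.sub t2).sub t3).add t4).sub t5).mono (le_of_eq (by ring))

theorem cutMain_le {A A' : E → Bil E →L[ℝ] ℝ} {η u : E → ℝ} {a₀ : ℝ}
    (hA : ∀ x ∈ S, ∀ y ∈ S, ‖A x - A' x - (A y - A' y)‖ ≤ Λ * ‖x - y‖ ^ α)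
    (ha : ∀ x ∈ S, ‖A x - A' x‖ ≤ a₀) (h0 : HB α S q η) (hη : ∀ x, |η x| ≤ 1)
    (h2 : ∀ x ∈ S, ‖D2 u x‖ ≤ N)
    (hK : ∀ x ∈ S, ∀ y ∈ S, ‖D2 u x - D2 u y‖ ≤ K * ‖x - y‖ ^ α) :
    (∀ x ∈ S, |η x • (A x - A' x) (D2 u x)| ≤ a₀ * N) ∧
    ∀ x ∈ S, ∀ y ∈ S, |η x • (A x - A' x) (D2 u x) - η y • (A y - A' y) (D2 u y)| ≤
      (a₀ * K + (Λ + q * a₀) * N) * ‖x - y‖ ^ α := by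
  have hle : ∀ x ∈ S, ‖(A x - A' x) (D2 u x)‖ ≤ a₀ * N := fun x hx =>
    ((A x - A' x).le_opNorm _).trans
      (mul_le_mul (ha x hx) (h2 x hx) (norm_nonneg _) ((norm_nonneg _).trans (ha x hx)))
  constructor
  · intro x hx
    rw [smul_eq_mul, abs_mul]
    exact (mul_le_of_le_one_left (abs_nonneg _) (hη x)).trans (hle x hx)
  · intro x hx y hy
    have h := isProd_apply.holder (g := fun x => A x - A' x) (g' := D2 u) (ha y hy) (h2 x hx)
      (hA x hx y hy) (hK x hx y hy)
    have h' := isProd_smul.holder (g := η) (g' := fun x => (A x - A' x) (D2 u x)) (hη y) (hle x hx)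
      (h0.holder x hx y hy) h
    exact h'.trans_eq (by ring)

end Localization

section Interior

variable {E : Type*} [NormedAddCommGroup E] [InnerProductSpace ℝ E] [FiniteDimensional ℝ E]
  [MeasurableSpace E] [BorelSpace E] {ι : Type*} [Fintype ι]

theorem isDegElliptic_ellOp (e : OrthonormalBasis ι ℝ E) (σ : E →L[ℝ] E) :
    IsDegElliptic (ellOp e σ) := by
  intro B _ hB
  rw [ellOp_apply]
  have := Finset.sum_nonpos fun k (_ : k ∈ Finset.univ) => hB (σ (e k))
  linarith

theorem IsSol.unique {A : E → Bil E →L[ℝ] ℝ} {b : E → E}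
    (hA : ∀ x, IsDegElliptic (A x)) {Λ : ℝ} (hAb : ∀ x, ‖A x‖ ≤ Λ) (hbb : ∀ x, ‖b x‖ ≤ Λ)
    {T K : ℝ} {f u v : ℝ → E → ℝ} (hu : IsSol A b T f u) (hv : IsSol A b T f v)
    (hu0 : ∀ t ∈ Icc 0 T, ∀ x, |u t x| ≤ K) (hu1 : ∀ t ∈ Icc 0 T, ∀ x, ‖fderiv ℝ (u t) x‖ ≤ K)
    (hu2 : ∀ t ∈ Icc 0 T, ∀ x, ‖D2 (u t) x‖ ≤ K)
    (hv0 : ∀ t ∈ Icc 0 T, ∀ x, |v t x| ≤ K) (hv1 : ∀ t ∈ Icc 0 T, ∀ x, ‖fderiv ℝ (v t) x‖ ≤ K)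
    (hv2 : ∀ t ∈ Icc 0 T, ∀ x, ‖D2 (v t) x‖ ≤ K) :
    ∀ t ∈ Icc 0 T, u t = v t := by
  have hd : IsSol A b T (fun _ _ => 0) (fun t x => u t x - v t x) :=
    { init := fun x => by rw [hu.init, hv.init, sub_self]
      smooth := fun t ht => (hu.smooth t ht).sub (hv.smooth t ht)
      eqn := fun t ht x => ((hu.eqn t ht x).sub (hv.eqn t ht x)).congr_deriv (by
        rw [Lop_sub (hu.smooth t ht) (hv.smooth t ht)]; ring) }
  intro t ht
  ext x
  have := hd.abs_le hA hAb hbb (K := K + K)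
    (fun t ht x => (abs_sub _ _).trans (add_le_add (hu0 t ht x) (hv0 t ht x)))
    (fun t ht x => by
      rw [fderiv_sub_of_C2 (hu.smooth t ht) (hv.smooth t ht)]
      exact (norm_sub_le _ _).trans (add_le_add (hu1 t ht x) (hv1 t ht x)))
    (fun t ht x => by
      rw [D2_sub (hu.smooth t ht) (hv.smooth t ht)]
      exact (norm_sub_le _ _).trans (add_le_add (hu2 t ht x) (hv2 t ht x)))
    (g := fun _ => 0) (g' := fun _ => 0) (fun t => hasDerivAt_const _ _) rfl (by simp)
    ⟨0, by simp⟩ t ht x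
  have h0 := abs_nonpos_iff.1 this
  linarith

theorem HB.of_C2 {α R N : ℝ} (hα1 : α ≤ 1) {x₀ : E} (hR : R ≤ 1 / 2) (hN : 0 ≤ N) {φ : E → ℝ}
    (hφ : ContDiff ℝ 2 φ) (h0 : ∀ x ∈ Metric.closedBall x₀ R, |φ x| ≤ N)
    (h1 : ∀ x ∈ Metric.closedBall x₀ R, ‖fderiv ℝ φ x‖ ≤ N)
    (h2 : ∀ x ∈ Metric.closedBall x₀ R, ‖D2 φ x‖ ≤ N) :
    HB α (Metric.closedBall x₀ R) N φ ∧ HB α (Metric.closedBall x₀ R) N (fderiv ℝ φ) := by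
  have hS : ∀ x ∈ Metric.closedBall x₀ R, ∀ y ∈ Metric.closedBall x₀ R, ‖x - y‖ ≤ 1 := by
    intro x hx y hy
    have := dist_triangle_right x y x₀
    rw [← dist_eq_norm]
    linarith [Metric.mem_closedBall.1 hx, Metric.mem_closedBall.1 hy]
  exact ⟨HB.of_lipschitz hα1 hS hN h0 fun x hx y hy =>
      (convex_closedBall x₀ R).norm_image_sub_le_of_norm_hasFDerivWithin_le
        (fun x _ => (hasFDerivAt_of_C2 hφ x).hasFDerivWithinAt) h1 hy hx,
    HB.of_lipschitz hα1 hS hN h1 fun x hx y hy =>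
      (convex_closedBall x₀ R).norm_image_sub_le_of_norm_hasFDerivWithin_le
        (fun x _ => (hasFDerivAt_fderiv_of_C2 hφ x).hasFDerivWithinAt) h2 hy hx⟩

theorem continuousOn_derivs {α K L r T : ℝ} (hα : 0 < α) (hK : 0 ≤ K) (hr : 0 < r)
    {u : ℝ → E → ℝ} {x : E}
    (hs : ∀ t ∈ Icc 0 T, ContDiff ℝ 2 (u t))
    (hb : ∀ t ∈ Icc 0 T, C2BoundOn α K (Metric.closedBall x r) (u t))
    (hl : ∀ y ∈ Metric.closedBall x r, ∀ s ∈ Icc 0 T, ∀ t ∈ Icc 0 T,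
      |u t y - u s y| ≤ L * |t - s|) :
    ContinuousOn (fun t => u t x) (Icc 0 T) ∧
    ContinuousOn (fun t => fderiv ℝ (u t) x) (Icc 0 T) ∧
    ContinuousOn (fun t => D2 (u t) x) (Icc 0 T) := by
  have key : ∀ ε > 0, ∃ δ > 0, ∀ t ∈ Icc 0 T, ∀ s ∈ Icc 0 T, |s - t| < δ →
      |u s x - u t x| ≤ ε ∧ ‖fderiv ℝ (u s) x - fderiv ℝ (u t) x‖ ≤ ε ∧
      ‖D2 (u s) x - D2 (u t) x‖ ≤ ε := by
    intro ε hε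
    obtain ⟨δ, hδ, h⟩ := exists_delta_interp (E := E) hα hK hr hε
    refine ⟨min δ ε / (|L| + 1), by positivity, fun t ht s hs' hst => ?_⟩
    have hb' : ∀ y ∈ Metric.closedBall x r, |u s y - u t y| ≤ min δ ε := fun y hy => by
      refine (hl y hy t ht s hs').trans ?_
      rw [lt_div_iff₀ (by positivity)] at hst
      nlinarith [le_abs_self L, abs_nonneg (s - t)]
    exact ⟨(hb' x (Metric.mem_closedBall_self hr.le)).trans (min_le_right _ _),
      h _ _ x (hs s hs') (hs t ht) (hb s hs') (hb t ht)
        fun y hy => (hb' y hy).trans (min_le_left _ _)⟩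
  refine ⟨fun t ht => ?_, fun t ht => ?_, fun t ht => ?_⟩ <;>
  · refine Metric.continuousWithinAt_iff.2 fun ε hε => ?_
    obtain ⟨δ, hδ, h⟩ := key (ε / 2) (half_pos hε)
    refine ⟨δ, hδ, fun s hs' hst => ?_⟩
    have := h t ht s hs' hst
    rw [dist_eq_norm]
    first
      | exact this.1.trans_lt (half_lt_self hε)
      | exact this.2.1.trans_lt (half_lt_self hε)
      | exact this.2.2.trans_lt (half_lt_self hε)

/-- Ellipticity and Hölder bounds for the coefficients on `S`. -/
structure CoefOn (e : OrthonormalBasis ι ℝ E) (α Λ : ℝ) (S : Set E) (A : E → Bil E →L[ℝ] ℝ)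
    (b : E → E) : Prop where
  ell : ∀ x ∈ S, ∃ σ : E ≃L[ℝ] E, ‖(σ : E →L[ℝ] E)‖ ≤ Λ ∧ ‖(σ.symm : E →L[ℝ] E)‖ ≤ Λ ∧
    A x = ellOp e (σ : E →L[ℝ] E)
  hA : HB α S Λ A
  hb : HB α S Λ b

/-- Bound for the Hölder seminorm of the second derivative on balls around `x₀`. -/
def HoldOn (α T : ℝ) (u : ℝ → E → ℝ) (x₀ : E) (ρ K : ℝ) : Prop :=
  ∀ t ∈ Icc 0 T, ∀ x ∈ Metric.closedBall x₀ ρ, ∀ y ∈ Metric.closedBall x₀ ρ,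
    ‖D2 (u t) x - D2 (u t) y‖ ≤ K * ‖x - y‖ ^ α

/-- The data of the interior estimate. -/
structure IntData (e : OrthonormalBasis ι ℝ E) (α Λ J T M F : ℝ) (S : Set E)
    (A : E → Bil E →L[ℝ] ℝ) (b : E → E) (f u : ℝ → E → ℝ) : Prop where
  coef : CoefOn e α Λ S A b
  sol : IsSolOn S A b T f u
  uM : ∀ t ∈ Icc 0 T, ∀ x ∈ S, |u t x| ≤ M
  fF : ∀ t ∈ Icc 0 T, ∀ x ∈ S, |f t x| ≤ F
  fH : ∀ t ∈ Icc 0 T, ∀ x ∈ S, ∀ y ∈ S,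
    |f t x - f t y| ≤ F * ‖x - y‖ ^ α + J * |u t x - u t y|
  fc : ∀ x ∈ S, ContinuousOn (fun t => f t x) (Icc 0 T)

theorem interp_ball {α K M ρ δ h : ℝ} (hα : 0 < α) (hM : 0 ≤ M) (hK : 0 ≤ K)
    (h0 : 0 < h) (hδ : h ≤ δ / 4) (h1 : h ≤ 1) {x₀ : E} {φ : E → ℝ} (hφ : ContDiff ℝ 2 φ)
    (hb : ∀ x ∈ Metric.closedBall x₀ (ρ + δ), |φ x| ≤ M)
    (hK : ∀ x ∈ Metric.closedBall x₀ (ρ + δ), ∀ y ∈ Metric.closedBall x₀ (ρ + δ),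
      ‖D2 φ x - D2 φ y‖ ≤ K * ‖x - y‖ ^ α) {x : E}
    (hx : x ∈ Metric.closedBall x₀ (ρ + 3 / 4 * δ)) :
    |φ x| ≤ 10 * M / h ^ 2 + 5 * K * h ^ α ∧ ‖fderiv ℝ φ x‖ ≤ 10 * M / h ^ 2 + 5 * K * h ^ α ∧
      ‖D2 φ x‖ ≤ 10 * M / h ^ 2 + 5 * K * h ^ α := by
  have hsub : Metric.closedBall x h ⊆ Metric.closedBall x₀ (ρ + δ) :=
    Metric.closedBall_subset_closedBall' (by linarith [Metric.mem_closedBall.1 hx])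
  have hxx := hsub (Metric.mem_closedBall_self h0.le)
  have osc : ∀ y ∈ Metric.closedBall x h, ‖D2 φ y - D2 φ x‖ ≤ K * h ^ α := fun y hy =>
    (hK y (hsub hy) x hxx).trans (mul_le_mul_of_nonneg_left
      (Real.rpow_le_rpow (norm_nonneg _) (by simpa [dist_eq_norm] using hy) hα.le) ‹0 ≤ K›)
  have k1 := norm_fderiv_le_of_osc hφ h0 (fun y hy => hb y (hsub hy)) osc
  have k2 := norm_D2_le_of_osc hφ h0 (fun y hy => hb y (hsub hy)) osc
  have hp : 0 ≤ K * h ^ α := by positivity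
  have e1 : M ≤ M / h ^ 2 := by
    rw [le_div_iff₀ (by positivity)]
    exact mul_le_of_le_one_right hM (by nlinarith)
  have e2 : M / h ≤ M / h ^ 2 := by
    gcongr
    nlinarith
  have e3 : K * h ^ α * h ≤ K * h ^ α := mul_le_of_le_one_right hp h1
  have e4 : 10 * M / h ^ 2 = 10 * (M / h ^ 2) := by ring
  have e5 : 8 * M / h ^ 2 = 8 * (M / h ^ 2) := by ring
  have e6 : 0 ≤ M / h ^ 2 := by positivity
  rw [e4]
  rw [e5] at k2
  refine ⟨(hb x hxx).trans ?_, k1.trans ?_, k2.trans ?_⟩ <;> linarith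

end Interior

section Interior

variable {E : Type*} [NormedAddCommGroup E] [InnerProductSpace ℝ E] [FiniteDimensional ℝ E]
  [MeasurableSpace E] [BorelSpace E] {ι : Type*} [Fintype ι]

theorem IsSolOn.lipschitz_time {S : Set E} {A : E → Bil E →L[ℝ] ℝ} {b : E → E} {T Λ N F : ℝ}
    {f u : ℝ → E → ℝ} (h : IsSolOn S A b T f u) {x : E} (hx : x ∈ S) (hA : ‖A x‖ ≤ Λ)
    (hb : ‖b x‖ ≤ Λ) (h1 : ∀ t ∈ Icc 0 T, ‖fderiv ℝ (u t) x‖ ≤ N)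
    (h2 : ∀ t ∈ Icc 0 T, ‖D2 (u t) x‖ ≤ N) (hf : ∀ t ∈ Icc 0 T, |f t x| ≤ F) :
    ∀ s ∈ Icc 0 T, ∀ t ∈ Icc 0 T, |u t x - u s x| ≤ (2 * Λ * N + F) * |t - s| := by
  intro s hs t ht
  refine (convex_Icc 0 T).norm_image_sub_le_of_norm_hasDerivWithin_le
    (fun r hr => h.eqn r hr x hx) (fun r hr => ?_) hs ht
  have k1 := ((A x).le_opNorm (D2 (u r) x)).trans
    (mul_le_mul hA (h2 r hr) (norm_nonneg _) ((norm_nonneg _).trans hA))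
  have k2 := ((fderiv ℝ (u r) x).le_opNorm (b x)).trans
    (mul_le_mul (h1 r hr) hb (norm_nonneg _) ((norm_nonneg _).trans (h1 r hr)))
  have k3 := hf r hr
  rw [Lop]
  refine (norm_add_le _ _).trans ?_
  refine (add_le_add ((norm_add_le _ _).trans (add_le_add k1 k2)) k3).trans_eq ?_
  ring

theorem continuousOn_cutSource {A A' : E → Bil E →L[ℝ] ℝ} {b b' : E → E} {η : E → ℝ} {T : ℝ}
    {f u : ℝ → E → ℝ} {x : E} (hf : ContinuousOn (fun t => f t x) (Icc 0 T))
    (h0 : ContinuousOn (fun t => u t x) (Icc 0 T))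
    (h1 : ContinuousOn (fun t => fderiv ℝ (u t) x) (Icc 0 T))
    (h2 : ContinuousOn (fun t => D2 (u t) x) (Icc 0 T)) :
    ContinuousOn (fun t => cutSource A A' b b' η f u t x) (Icc 0 T) := by
  have hsym : Continuous fun p : E →L[ℝ] ℝ => symTensor (fderiv ℝ η x) p := by
    have : LipschitzWith (Real.toNNReal (2 * ‖fderiv ℝ η x‖))
        fun p : E →L[ℝ] ℝ => symTensor (fderiv ℝ η x) p := by
      refine LipschitzWith.of_dist_le_mul fun p p' => ?_
      rw [dist_eq_norm, dist_eq_norm, Real.coe_toNNReal _ (by positivity)]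
      have e : symTensor (fderiv ℝ η x) p - symTensor (fderiv ℝ η x) p' =
          Bil.tensor (fderiv ℝ η x) (p - p') + Bil.tensor (p - p') (fderiv ℝ η x) := by
        apply ContinuousLinearMap.ext; intro v
        apply ContinuousLinearMap.ext; intro w
        change (fderiv ℝ η x v * p w + p v * fderiv ℝ η x w) -
          (fderiv ℝ η x v * p' w + p' v * fderiv ℝ η x w) =
          fderiv ℝ η x v * (p w - p' w) + (p v - p' v) * fderiv ℝ η x w
        ring
      rw [e]
      refine (norm_add_le _ _).trans ((add_le_add (isProd_tensor.norm_le _ _)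
        (isProd_tensor.norm_le _ _)).trans_eq ?_)
      ring
    exact this.continuous
  have hs := hsym.comp_continuousOn h1
  unfold cutSource cutLow
  have t1 := ((A x - A' x).continuous.comp_continuousOn h2).const_smul (η x)
  have t2 := (A' x).continuous.comp_continuousOn hs
  have t3 := h0.smul (continuousOn_const (c := A' x (D2 η x)))
  have t4 := (h1.clm_apply (continuousOn_const (c := b x - b' x))).const_smul (η x)
  have t5 := h0.smul (continuousOn_const (c := fderiv ℝ η x (b' x)))
  exact t1.add (((((hf.const_smul (η x)).sub t2).sub t3).add t4).sub t5)

/-- Bounds for a solution multiplied by a cutoff function. -/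
theorem mul_cutoff_bounds {q N : ℝ} {η φ : E → ℝ} (hη : ContDiff ℝ 2 η) (hφ : ContDiff ℝ 2 φ)
    {S : Set E} (hS : IsClosed S) (hz : ∀ x, x ∉ S → η x = 0)
    (hN : 0 ≤ N) (hq : 0 ≤ q) (h0 : ∀ x ∈ S, |η x| ≤ q) (h1 : ∀ x ∈ S, ‖fderiv ℝ η x‖ ≤ q)
    (h2 : ∀ x ∈ S, ‖D2 η x‖ ≤ q) (k0 : ∀ x ∈ S, |φ x| ≤ N) (k1 : ∀ x ∈ S, ‖fderiv ℝ φ x‖ ≤ N)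
    (k2 : ∀ x ∈ S, ‖D2 φ x‖ ≤ N) :
    (∀ x, |η x * φ x| ≤ 4 * (q * N)) ∧ (∀ x, ‖fderiv ℝ (fun x => η x * φ x) x‖ ≤ 4 * (q * N)) ∧
      ∀ x, ‖D2 (fun x => η x * φ x) x‖ ≤ 4 * (q * N) := by
  obtain ⟨-, d1, d2⟩ := hasFDerivAt_fderiv_mul hη hφ
  have hqN : 0 ≤ q * N := by positivity
  have hzz := fun x (hx : x ∉ S) => eq_zero_of_closed hS (η := fun x => η x * φ x)
    (fun y hy => by simp [hz y hy]) hx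
  refine ⟨fun x => ?_, fun x => ?_, fun x => ?_⟩ <;> by_cases hx : x ∈ S
  · rw [abs_mul]
    have := mul_le_mul (h0 x hx) (k0 x hx) (abs_nonneg _) hq
    linarith
  · rw [hz x hx, zero_mul, abs_zero]; positivity
  · rw [d1]
    have i1 := mul_le_mul (h0 x hx) (k1 x hx) (norm_nonneg _) hq
    have i2 := mul_le_mul (k0 x hx) (h1 x hx) (norm_nonneg _) hN
    refine (norm_add_le _ _).trans ?_
    rw [norm_smul, norm_smul, Real.norm_eq_abs, Real.norm_eq_abs]
    linarith
  · rw [(hzz x hx).1, norm_zero]; positivity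
  · rw [d2]
    have i1 := mul_le_mul (h0 x hx) (k2 x hx) (norm_nonneg _) hq
    have i2 := mul_le_mul (k0 x hx) (h2 x hx) (norm_nonneg _) hN
    have i3 := mul_le_mul (h1 x hx) (k1 x hx) (norm_nonneg _) hq
    have j1 := (isProd_tensor.norm_le (fderiv ℝ η x) (fderiv ℝ φ x))
    have j2 := (isProd_tensor.norm_le (fderiv ℝ φ x) (fderiv ℝ η x))
    have j3 := norm_smul (η x) (D2 φ x)
    have j4 := norm_smul (φ x) (D2 η x)
    rw [Real.norm_eq_abs] at j3 j4
    refine (norm_add_le _ _).trans ?_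
    have j5 := norm_add_le (η x • D2 φ x) (φ x • D2 η x)
    have j6 := norm_add_le (Bil.tensor (fderiv ℝ η x) (fderiv ℝ φ x))
      (Bil.tensor (fderiv ℝ φ x) (fderiv ℝ η x))
    linarith
  · rw [(hzz x hx).2, norm_zero]; positivity

theorem interior_core {α Λ J T M F R ρ δ a₀ K N q : ℝ} (hα : 0 < α) (hα1 : α < 1) (hΛ : 1 ≤ Λ)
    (hJ : 0 ≤ J) (hF : 0 ≤ F) (hT : 0 ≤ T) (hR : R ≤ 1 / 2) (hρ : 0 ≤ ρ)
    (hδ : 0 < δ) (hρR : ρ + δ ≤ R) (ha₀ : Λ * R ^ α ≤ a₀) (hK : 0 ≤ K) (hN : 0 ≤ N)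
    {e : OrthonormalBasis ι ℝ E} {x₀ : E} {A : E → Bil E →L[ℝ] ℝ} {b : E → E} {f u : ℝ → E → ℝ}
    (D : IntData e α Λ J T M F (Metric.closedBall x₀ R) A b f u)
    (hH : HoldOn α T u x₀ (ρ + δ) K)
    (n0 : ∀ t ∈ Icc 0 T, ∀ x ∈ Metric.closedBall x₀ (ρ + 3 / 4 * δ), |u t x| ≤ N)
    (n1 : ∀ t ∈ Icc 0 T, ∀ x ∈ Metric.closedBall x₀ (ρ + 3 / 4 * δ), ‖fderiv ℝ (u t) x‖ ≤ N)
    (n2 : ∀ t ∈ Icc 0 T, ∀ x ∈ Metric.closedBall x₀ (ρ + 3 / 4 * δ), ‖D2 (u t) x‖ ≤ N)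
    {η : E → ℝ} (hη : ContDiff ℝ 2 η) (hη1 : ∀ x, ‖x - x₀‖ ≤ ρ + δ / 4 → η x = 1)
    (hη0 : ∀ x, ρ + δ / 2 ≤ ‖x - x₀‖ → η x = 0) (hη01 : ∀ x, |η x| ≤ 1)
    (q0 : HB α (Metric.closedBall x₀ (1 / 2)) q η)
    (q1 : HB α (Metric.closedBall x₀ (1 / 2)) q (fderiv ℝ η))
    (q2 : HB α (Metric.closedBall x₀ (1 / 2)) q (D2 η)) :
    HoldOn α T u x₀ ρ (schauderConst E α Λ * (a₀ * K + (Λ + q * a₀) * N +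
      (2 * q * (F + J * N) + 24 * Λ * q * N))) := by
  set S := Metric.closedBall x₀ (ρ + 3 / 4 * δ) with hS
  have hSR : S ⊆ Metric.closedBall x₀ R := Metric.closedBall_subset_closedBall (by linarith)
  have hSh : S ⊆ Metric.closedBall x₀ (1 / 2) := Metric.closedBall_subset_closedBall (by linarith)
  have hSK : S ⊆ Metric.closedBall x₀ (ρ + δ) := Metric.closedBall_subset_closedBall (by linarith)
  have hx₀ : x₀ ∈ Metric.closedBall x₀ R := Metric.mem_closedBall_self (by linarith)
  have hx₀' : x₀ ∈ Metric.closedBall x₀ (1 / 2 : ℝ) := Metric.mem_closedBall_self (by norm_num)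
  have hq : 0 ≤ q := (norm_nonneg _).trans (q0.le x₀ hx₀')
  have hR0 : 0 < R := by linarith
  have ha0 : 0 ≤ a₀ := le_trans (by positivity) ha₀
  obtain ⟨σ, hσ, hσ', hAσ⟩ := D.coef.ell x₀ hx₀
  set A' : E → Bil E →L[ℝ] ℝ := fun _ => ellOp e (σ : E →L[ℝ] E) with hA'
  set b' : E → E := fun _ => 0 with hb'
  set Nf := F + J * N
  set H := a₀ * K + (Λ + q * a₀) * N + (2 * q * Nf + 24 * Λ * q * N) with hHd
  have hNf : 0 ≤ Nf := by positivity
  have hH0 : 0 ≤ H := by positivity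
  have hA'le : ∀ x, ‖A' x‖ ≤ Λ := fun x => by rw [hA', ← hAσ]; exact D.coef.hA.le x₀ hx₀
  set C := Metric.closedBall x₀ (ρ + δ / 2) with hC
  have hCS : C ⊆ S := Metric.closedBall_subset_closedBall (by linarith)
  have hηC : ∀ x, x ∉ C → η x = 0 := fun x hx => hη0 x (by
    rw [hC, Metric.mem_closedBall, dist_eq_norm, not_le] at hx; exact hx.le)
  have hsolS : IsSolOn C A b T f u :=
    ⟨fun x hx => D.sol.init x (hSR (hCS hx)), D.sol.smooth, fun t ht x hx =>
      D.sol.eqn t ht x (hSR (hCS hx))⟩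
  set G := cutSource A A' b b' η f u with hG
  have hw : IsSol A' b' T G (fun t x => η x * u t x) :=
    hsolS.mul_cutoff Metric.isClosed_closedBall hη hηC
  have hub : ∀ t ∈ Icc 0 T, HB α S N (u t) ∧ HB α S N (fderiv ℝ (u t)) := fun t ht =>
    HB.of_C2 hα1.le (by linarith) hN (D.sol.smooth t ht) (n0 t ht) (n1 t ht) (n2 t ht)
  have hlow : ∀ t ∈ Icc 0 T, HB α S (2 * q * Nf + 24 * Λ * q * N)
      (fun x => cutLow (A' x) b b' η (f t) (u t) x) := fun t ht => by
    refine HB.cutLow (HB.const (by linarith) (hA'le x₀)) (D.coef.hb.mono_set hSR)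
      (HB.const (by linarith) (by simp; linarith)) (q0.mono_set hSh) (q1.mono_set hSh)
      (q2.mono_set hSh) ⟨fun x hx => ?_, fun x hx y hy => ?_⟩ (hub t ht).1 (hub t ht).2
    · exact (D.fF t ht x (hSR hx)).trans (le_add_of_nonneg_right (by positivity))
    · refine (D.fH t ht x (hSR hx) y (hSR hy)).trans ?_
      have := mul_le_mul_of_nonneg_left ((hub t ht).1.holder x hx y hy) hJ
      rw [Real.norm_eq_abs] at this
      refine (add_le_add_right this _).trans_eq ?_
      simp only [Nf]; ring
  have hmain := fun t (ht : t ∈ Icc 0 T) => cutMain_le (α := α) (Λ := Λ) (q := q) (N := N) (K := K)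
    (S := S) (A := A) (A' := A') (η := η) (u := u t) (a₀ := a₀)
    (fun x hx y hy => by
      simp only [hA', sub_sub_sub_cancel_right]
      exact D.coef.hA.holder x (hSR hx) y (hSR hy))
    (fun x hx => by
      simp only [hA']
      rw [← hAσ]
      refine (D.coef.hA.holder x (hSR hx) x₀ hx₀).trans (le_trans ?_ ha₀)
      refine mul_le_mul_of_nonneg_left (Real.rpow_le_rpow (norm_nonneg _) ?_ hα.le) (by linarith)
      have := hSR hx
      rwa [Metric.mem_closedBall, dist_eq_norm] at this)
    (q0.mono_set hSh) hη01 (n2 t ht) (fun x hx y hy => hH t ht x (hSK hx) y (hSK hy))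
  have hGz : ∀ t x, x ∉ C → G t x = 0 := fun t x hx =>
    cutSource_eq_zero Metric.isClosed_closedBall hηC A A' b b' f u t hx
  set GF := a₀ * N + (2 * q * Nf + 24 * Λ * q * N) with hGF
  have hGF0 : 0 ≤ GF := by positivity
  have hsrc : HolderSource α T GF H G := by
    refine ⟨fun t ht x => ?_, fun t ht x y => ?_, fun x => ?_⟩
    · by_cases hx : x ∈ C
      · exact (abs_add_le _ _).trans (add_le_add ((hmain t ht).1 x (hCS hx))
          ((hlow t ht).le x (hCS hx)))
      · rw [hGz t x hx, abs_zero]; exact hGF0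
    · refine holder_of_holder_closedBall hα hH0 (ρ := ρ + δ / 2) (R := ρ + 3 / 4 * δ)
        (by linarith) (hGz t) (fun x hx y hy => ?_) x y
      have i1 := (hmain t ht).2 x hx y hy
      have i2 := (hlow t ht).holder x hx y hy
      have e : G t x - G t y = (η x • (A x - A' x) (D2 (u t) x) - η y • (A y - A' y) (D2 (u t) y)) +
        (cutLow (A' x) b b' η (f t) (u t) x - cutLow (A' y) b b' η (f t) (u t) y) := by
        simp only [hG, cutSource]; ring
      rw [e]
      refine (abs_add_le _ _).trans ((add_le_add i1 i2).trans_eq ?_)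
      rw [hHd]; ring
    · by_cases hx : x ∈ C
      · have hb : Metric.closedBall x (δ / 4) ⊆ S := Metric.closedBall_subset_closedBall' (by
          have := Metric.mem_closedBall.1 hx; linarith)
        obtain ⟨c0, c1, c2⟩ := continuousOn_derivs (α := α) (K := max N K) (L := 2 * Λ * N + F)
          (r := δ / 4) (T := T) (u := u) (x := x) hα (le_max_of_le_left hN) (by linarith)
          D.sol.smooth
          (fun t ht => ⟨fun y hy => (n0 t ht y (hb hy)).trans (le_max_left _ _),
            fun y hy => (n1 t ht y (hb hy)).trans (le_max_left _ _),
            fun y hy => (n2 t ht y (hb hy)).trans (le_max_left _ _),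
            fun y hy z hz => (hH t ht y (hSK (hb hy)) z (hSK (hb hz))).trans
              (mul_le_mul_of_nonneg_right (le_max_right _ _) (by positivity))⟩)
          (fun y hy => D.sol.lipschitz_time (hSR (hb hy)) (D.coef.hA.le y (hSR (hb hy)))
            (D.coef.hb.le y (hSR (hb hy))) (fun t ht => n1 t ht y (hb hy))
            (fun t ht => n2 t ht y (hb hy)) fun t ht => D.fF t ht y (hSR (hb hy)))
        exact continuousOn_cutSource (D.fc x (hSR (hCS hx))) c0 c1 c2
      · exact continuousOn_const.congr fun t _ => hGz t x hx
  obtain ⟨w, hwsol, hwb⟩ := exists_isSol_const hα hα1 hΛ hT hGF0 hH0 e hσ hσ' hsrc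
  have hsc : 0 ≤ schauderConst E α Λ := schauderConst_nonneg hα hα1 hΛ
  set Kw := 8 * (GF * T) + 4 * (schauderConst E α Λ * H)
  have hKw1 : 0 ≤ GF * T := by positivity
  have hKw2 : 0 ≤ schauderConst E α Λ * H := by positivity
  have hmb := fun t (ht : t ∈ Icc 0 T) => mul_cutoff_bounds hη (D.sol.smooth t ht)
    (Metric.isClosed_closedBall (x := x₀) (ε := ρ + δ / 2)) hηC hN hq
    (fun x hx => q0.le x (hSh (hCS hx))) (fun x hx => q1.le x (hSh (hCS hx)))
    (fun x hx => q2.le x (hSh (hCS hx))) (fun x hx => n0 t ht x (hCS hx))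
    (fun x hx => n1 t ht x (hCS hx)) (fun x hx => n2 t ht x (hCS hx))
  have huniq : ∀ t ∈ Icc 0 T, (fun x => η x * u t x) = w t :=
    IsSol.unique (Λ := Λ) (K := max (4 * (q * N)) Kw) (fun x => isDegElliptic_ellOp e _) hA'le
      (fun x => by simp [hb']; linarith) hw hwsol
      (fun t ht x => ((hmb t ht).1 x).trans (le_max_left _ _))
      (fun t ht x => ((hmb t ht).2.1 x).trans (le_max_left _ _))
      (fun t ht x => ((hmb t ht).2.2 x).trans (le_max_left _ _))
      (fun t ht x => ((hwb t ht).1 x).trans (le_max_of_le_right (by simp only [Kw]; linarith)))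
      (fun t ht x => ((hwb t ht).2.1 x).trans (le_max_of_le_right (by simp only [Kw]; linarith)))
      (fun t ht x => ((hwb t ht).2.2.1 x).trans (le_max_of_le_right le_rfl))
  have hD2 : ∀ t ∈ Icc 0 T, ∀ x ∈ Metric.closedBall x₀ ρ, D2 (u t) x = D2 (w t) x := by
    intro t ht x hx
    rw [← huniq t ht]
    have hev : u t =ᶠ[𝓝 x] fun x => η x * u t x := by
      have : Metric.ball x₀ (ρ + δ / 4) ∈ 𝓝 x := Metric.isOpen_ball.mem_nhds
        (Metric.mem_ball.2 (by have := Metric.mem_closedBall.1 hx; linarith))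
      filter_upwards [this] with y hy
      rw [hη1 y (by rw [← dist_eq_norm]; exact (Metric.mem_ball.1 hy).le), one_mul]
    unfold D2
    exact hev.fderiv.fderiv_eq
  intro t ht x hx y hy
  rw [hD2 t ht x hx, hD2 t ht y hy]
  exact (hwb t ht).2.2.2 x y

end Interior

section Interior

theorem iterate_radii {R : ℝ} (hR : 0 < R) {k : ℕ} (hk : k ≠ 0) :
    ∃ C : ℝ, 0 ≤ C ∧ ∀ (P : ℝ → ℝ → Prop) (B K₀ : ℝ), 0 ≤ B → 0 ≤ K₀ → (∀ ρ, ρ ≤ R → P ρ K₀) →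
      (∀ ρ δ K, 0 ≤ ρ → 0 < δ → ρ + δ ≤ R → 0 ≤ K → P (ρ + δ) K → P ρ (K / 2 + B / δ ^ k)) →
      ∀ n : ℕ, ∃ S, S ≤ C * B ∧ P (R / 2) (K₀ / 2 ^ n + S) := by
  set θ : ℝ := (2 / 3 : ℝ) ^ ((k : ℝ)⁻¹) with hθ
  have hθk : θ ^ k = 2 / 3 := Real.rpow_inv_natCast_pow (by norm_num) hk
  have hθ0 : 0 < θ := by positivity
  have hθ1 : θ < 1 := Real.rpow_lt_one (by norm_num) (by norm_num) (by positivity)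
  set d : ℝ := R / 2 * (1 - θ) with hd
  have hd0 : 0 < d := mul_pos (by linarith) (by linarith)
  set c : ℝ := 1 / d ^ k with hc
  have hc0 : 0 < c := by positivity
  refine ⟨4 * c, by positivity, fun P B K₀ hB hK₀ h0 hstep => ?_⟩
  have hind : ∀ (n : ℕ) (K : ℝ), 0 ≤ K → P (R / 2 + R / 2 * (1 - θ ^ n)) K →
      P (R / 2) (K / 2 ^ n + c * B * ∑ j ∈ Finset.range n, (3 / 4 : ℝ) ^ j) := by
    intro n
    induction n with
    | zero => intro K _ h; simpa using h
    | succ n ih =>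
      intro K hK h
      have hp : θ ^ n ≤ 1 := pow_le_one₀ hθ0.le hθ1.le
      have hp0 : 0 < θ ^ n := by positivity
      have h1 := hstep (R / 2 + R / 2 * (1 - θ ^ n)) (d * θ ^ n) K
        (by nlinarith) (by positivity) (by
          have : 0 ≤ R / 2 * θ ^ (n + 1) := by positivity
          rw [pow_succ] at this
          rw [hd]; nlinarith) hK (by
          convert h using 1
          rw [hd, pow_succ]; ring)
      have e1 : B / (d * θ ^ n) ^ k = c * B * (3 / 2) ^ n := by
        rw [mul_pow, ← pow_mul, mul_comm n k, pow_mul, hθk, hc, div_pow, div_pow]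
        field_simp
      have h2 := ih _ (by rw [e1]; positivity) h1
      rw [e1] at h2
      convert h2 using 1
      rw [Finset.sum_range_succ, pow_succ]
      have : (3 / 4 : ℝ) ^ n = (3 / 2) ^ n / 2 ^ n := by rw [← div_pow]; norm_num
      rw [this]
      field_simp
      ring
  intro n
  refine ⟨_, ?_, hind n K₀ hK₀ (h0 _ (by
    have : 0 ≤ R / 2 * θ ^ n := by positivity
    linarith))⟩
  have : ∑ j ∈ Finset.range n, (3 / 4 : ℝ) ^ j ≤ 4 := by
    have := (summable_geometric_of_lt_one (r := (3 / 4 : ℝ)) (by norm_num)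
      (by norm_num)).sum_le_tsum
      (Finset.range n) (fun i _ => by positivity)
    rw [tsum_geometric_of_lt_one (by norm_num) (by norm_num)] at this
    norm_num at this
    exact this
  have := mul_le_mul_of_nonneg_left this (show 0 ≤ c * B by positivity)
  linarith

variable {E : Type*} [NormedAddCommGroup E] [InnerProductSpace ℝ E] [FiniteDimensional ℝ E]
  [MeasurableSpace E] [BorelSpace E] {ι : Type*} [Fintype ι]

set_option maxHeartbeats 1000000 in
theorem interior_step {α Λ J : ℝ} (hα : 0 < α) (hα1 : α < 1) (hΛ : 1 ≤ Λ) (hJ : 0 ≤ J)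
    (e : OrthonormalBasis ι ℝ E) :
    ∃ R : ℝ, 0 < R ∧ R ≤ 1 / 4 ∧ ∃ D : ℝ, 0 ≤ D ∧ ∃ k : ℕ, k ≠ 0 ∧
      ∀ (T M F : ℝ) (x₀ : E) (A : E → Bil E →L[ℝ] ℝ) (b : E → E) (f u : ℝ → E → ℝ),
        0 ≤ T → 0 ≤ M → 0 ≤ F → IntData e α Λ J T M F (Metric.closedBall x₀ R) A b f u →
        ∀ ρ δ K, 0 ≤ ρ → 0 < δ → ρ + δ ≤ R → 0 ≤ K → HoldOn α T u x₀ (ρ + δ) K →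
          HoldOn α T u x₀ ρ (K / 2 + D * (M + F) / δ ^ k) := by
  set C₀ := schauderConst E α Λ
  have hC₀ : 0 ≤ C₀ := schauderConst_nonneg hα hα1 hΛ
  obtain ⟨Cη, hCη, hcut⟩ := exists_cutoff E
  obtain ⟨R, hR0, hR1, -, hRs⟩ := exists_small_rpow hα Λ (r := 1 / 4)
    (ε := min 1 (1 / (4 * (C₀ + 1)))) (by norm_num) (by positivity)
  set a₀ := Λ * R ^ α with ha₀
  have ha0 : 0 ≤ a₀ := by positivity
  have ha1 : a₀ ≤ 1 := hRs.trans (min_le_left _ _)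
  have ha4 : C₀ * a₀ ≤ 1 / 4 := by
    have h1 : a₀ ≤ 1 / (4 * (C₀ + 1)) := hRs.trans (min_le_right _ _)
    rw [le_div_iff₀ (by positivity)] at h1
    nlinarith
  set L₁ := Λ + 1 + 2 * J + 24 * Λ with hL₁
  set B := C₀ * L₁ * (512 * Cη) with hB
  have hL₁0 : 2 ≤ L₁ := by linarith
  have hB0 : 0 ≤ B := by positivity
  set c : ℝ := max 4 ((20 * B + 1) ^ (α⁻¹)) with hc
  have hc4 : 4 ≤ c := le_max_left _ _
  have hcα : 20 * B ≤ c ^ α := by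
    have h1 : ((20 * B + 1) ^ (α⁻¹)) ^ α ≤ c ^ α :=
      Real.rpow_le_rpow (by positivity) (le_max_right _ _) hα.le
    rw [Real.rpow_inv_rpow (by positivity) hα.ne'] at h1
    linarith
  obtain ⟨m, hm⟩ := exists_nat_ge (6 / α + 1)
  have hm1 : 1 ≤ m := by
    have : (1 : ℝ) ≤ m := by
      have : 0 < 6 / α := by positivity
      linarith
    exact_mod_cast this
  have hmα : 6 ≤ m * α := by
    have : 6 / α ≤ m := by linarith
    rwa [div_le_iff₀ hα] at this
  refine ⟨R, hR0, hR1, 10 * B * c ^ 2 + B, by positivity, 2 * m + 6, by omega, ?_⟩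
  intro T M F x₀ A b f u hT hM hF D ρ δ K hρ hδ hρR hK hH
  have hδ1 : δ ≤ 1 / 2 := by linarith
  obtain ⟨η, hη, hη1, hη0, hηn, hηl, q0, q1, q2⟩ := hcut α x₀ (ρ + δ / 4) (ρ + δ / 2) hα1.le
    (by linarith) (by linarith) (by linarith)
  set q := 512 * Cη / δ ^ 6 with hq
  have hqle : Cη / ((ρ + δ / 2) ^ 2 - (ρ + δ / 4) ^ 2) ^ 3 ≤ q := by
    have h1 : δ ^ 2 / 8 ≤ (ρ + δ / 2) ^ 2 - (ρ + δ / 4) ^ 2 := by nlinarith [mul_nonneg hρ hδ.le]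
    have h2 : (δ ^ 2 / 8) ^ 3 ≤ ((ρ + δ / 2) ^ 2 - (ρ + δ / 4) ^ 2) ^ 3 :=
      pow_le_pow_left₀ (by positivity) h1 3
    refine (div_le_div_of_nonneg_left (by linarith) (by positivity) h2).trans_eq ?_
    rw [hq]
    field_simp
    ring
  have hq1 : 1 ≤ q := by
    rw [hq, le_div_iff₀ (by positivity)]
    have : δ ^ 6 ≤ 1 := pow_le_one₀ hδ.le (by linarith)
    linarith
  set h := δ ^ m / c with hh
  have hδm : δ ^ m ≤ δ := pow_le_of_le_one hδ.le (by linarith) (by omega)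
  have hh0 : 0 < h := by positivity
  have hhδ : h ≤ δ / 4 := by
    rw [hh]
    exact div_le_div₀ hδ.le hδm (by norm_num) hc4
  have hhα : C₀ * L₁ * q * (5 * h ^ α) ≤ 1 / 4 := by
    have h1 : h ^ α = (δ ^ m) ^ α / c ^ α := Real.div_rpow (by positivity) (by positivity) _
    have h2 : (δ ^ m) ^ α ≤ δ ^ 6 := by
      rw [← Real.rpow_natCast δ m, ← Real.rpow_mul hδ.le, ← Real.rpow_natCast δ 6]
      exact Real.rpow_le_rpow_of_exponent_ge hδ (by linarith) (by exact_mod_cast hmα)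
    have h3 : h ^ α * (20 * B) ≤ δ ^ 6 := by
      have hcp : 0 < c ^ α := by positivity
      calc h ^ α * (20 * B) ≤ h ^ α * c ^ α := by gcongr
        _ = (δ ^ m) ^ α := by rw [h1]; field_simp
        _ ≤ _ := h2
    have h4 : C₀ * L₁ * q = B / δ ^ 6 := by rw [hq, hB]; ring
    rw [h4, div_mul_eq_mul_div, div_le_iff₀ (by positivity)]
    linarith
  set N := 10 * M / h ^ 2 + 5 * K * h ^ α with hN
  have hN0 : 0 ≤ N := by positivity
  have h_int := fun t (ht : t ∈ Icc 0 T) x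
    (hx : x ∈ Metric.closedBall x₀ (ρ + 3 / 4 * δ)) =>
    interp_ball hα hM hK hh0 hhδ (by linarith) (D.sol.smooth t ht)
      (fun x hx => D.uM t ht x (Metric.closedBall_subset_closedBall hρR hx))
      (fun x hx y hy => hH t ht x hx y hy) hx
  have main := interior_core hα hα1 hΛ hJ hF hT (by linarith) hρ hδ hρR ha₀.ge hK hN0 D hH
    (fun t ht x hx => (h_int t ht x hx).1) (fun t ht x hx => (h_int t ht x hx).2.1)
    (fun t ht x hx => (h_int t ht x hx).2.2) hη hη1 hη0
    (fun x => by rw [abs_of_nonneg (hηn x)]; exact hηl x) (q0.mono hqle) (q1.mono hqle)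
    (q2.mono hqle)
  intro t ht x hx y hy
  refine (main t ht x hx y hy).trans (mul_le_mul_of_nonneg_right ?_ (by positivity))
  have g1 : C₀ * (a₀ * K + (Λ + q * a₀) * N + (2 * q * (F + J * N) + 24 * Λ * q * N)) ≤
      C₀ * a₀ * K + C₀ * L₁ * q * N + C₀ * (2 * q * F) := by
    have : (Λ + q * a₀) * N ≤ (Λ * q + q) * N := by
      gcongr
      · nlinarith
      · nlinarith
    have := mul_le_mul_of_nonneg_left this hC₀
    rw [hL₁]
    linarith
  have g2 : C₀ * a₀ * K ≤ 1 / 4 * K := mul_le_mul_of_nonneg_right ha4 hK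
  have g3 : C₀ * L₁ * q * N ≤ C₀ * L₁ * q * (10 * M / h ^ 2) + 1 / 4 * K := by
    have := mul_le_mul_of_nonneg_right hhα hK
    rw [hN]
    linarith
  have hpow : δ ^ (2 * m + 6) = (δ ^ m) ^ 2 * δ ^ 6 := by
    rw [pow_add, ← pow_mul, mul_comm m 2]
  have g4 : C₀ * L₁ * q * (10 * M / h ^ 2) = 10 * B * c ^ 2 * M / δ ^ (2 * m + 6) := by
    rw [hh, hq, hB, hpow]
    field_simp
  have g5 : C₀ * (2 * q * F) ≤ B * F / δ ^ (2 * m + 6) := by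
    have h1 : C₀ * (2 * q * F) ≤ C₀ * L₁ * q * F := by
      have : 0 ≤ C₀ * q * F := by positivity
      nlinarith
    have h2 : C₀ * L₁ * q * F = B * F / δ ^ 6 := by rw [hq, hB]; ring
    refine h1.trans (h2.le.trans ?_)
    refine div_le_div_of_nonneg_left (by positivity) (by positivity) ?_
    exact pow_le_pow_of_le_one hδ.le (by linarith) (by omega)
  have g6 : (10 * B * c ^ 2 + B) * (M + F) / δ ^ (2 * m + 6) =
      10 * B * c ^ 2 * M / δ ^ (2 * m + 6) + B * F / δ ^ (2 * m + 6) +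
        (10 * B * c ^ 2 * F + B * M) / δ ^ (2 * m + 6) := by ring
  have g7 : 0 ≤ (10 * B * c ^ 2 * F + B * M) / δ ^ (2 * m + 6) := by positivity
  rw [g6]
  linarith

/-- Interior Schauder estimate up to the initial time. -/
theorem interior_estimate {α Λ J : ℝ} (hα : 0 < α) (hα1 : α < 1) (hΛ : 1 ≤ Λ) (hJ : 0 ≤ J)
    (e : OrthonormalBasis ι ℝ E) :
    ∃ R : ℝ, 0 < R ∧ R ≤ 1 / 4 ∧ ∃ C : ℝ, 0 ≤ C ∧
      ∀ (T M F K₀ : ℝ) (x₀ : E) (A : E → Bil E →L[ℝ] ℝ) (b : E → E) (f u : ℝ → E → ℝ),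
        0 ≤ T → 0 ≤ M → 0 ≤ F → IntData e α Λ J T M F (Metric.closedBall x₀ R) A b f u →
        HoldOn α T u x₀ R K₀ →
        ∀ t ∈ Icc 0 T, C2BoundOn α (C * (M + F)) (Metric.closedBall x₀ (R / 4)) (u t) := by
  obtain ⟨R, hR, hR1, D, hD, k, hk, hstep⟩ := interior_step hα hα1 hΛ hJ e
  obtain ⟨C, hC, hiter⟩ := iterate_radii hR hk
  refine ⟨R, hR, hR1, 10 / (R / 8) ^ 2 + 5 * (C * D), by positivity, ?_⟩
  intro T M F K₀ x₀ A b f u hT hM hF dat hK₀ t ht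
  have hit := hiter (HoldOn α T u x₀) (D * (M + F)) (max K₀ 0) (by positivity) (le_max_right _ _)
    (fun ρ hρ t ht x hx y hy => (hK₀ t ht x (Metric.closedBall_subset_closedBall hρ hx) y
      (Metric.closedBall_subset_closedBall hρ hy)).trans
      (mul_le_mul_of_nonneg_right (le_max_left _ _) (by positivity)))
    (fun ρ δ K h1 h2 h3 h4 h5 => hstep T M F x₀ A b f u hT hM hF dat ρ δ K h1 h2 h3 h4 h5)
  have hH : HoldOn α T u x₀ (R / 2) (C * (D * (M + F))) := by
    intro t ht x hx y hy
    have hlim : Tendsto (fun n : ℕ => (max K₀ 0 / 2 ^ n + C * (D * (M + F))) * ‖x - y‖ ^ α) atTop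
        (𝓝 ((0 + C * (D * (M + F))) * ‖x - y‖ ^ α)) := by
      refine Tendsto.mul_const _ (Tendsto.add_const _ ?_)
      exact tendsto_const_nhds.div_atTop (tendsto_pow_atTop_atTop_of_one_lt (by norm_num))
    rw [zero_add] at hlim
    refine ge_of_tendsto' hlim fun n => ?_
    obtain ⟨S, hS, hP⟩ := hit n
    exact (hP t ht x hx y hy).trans (mul_le_mul_of_nonneg_right (by linarith) (by positivity))
  have hle : C * (D * (M + F)) ≤ (10 / (R / 8) ^ 2 + 5 * (C * D)) * (M + F) := by
    have : 0 ≤ 10 / (R / 8) ^ 2 * (M + F) + 4 * (C * (D * (M + F))) := by positivity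
    linarith
  have h_int := fun x (hx : x ∈ Metric.closedBall x₀ (R / 4)) =>
    interp_ball (ρ := 0) (δ := R / 2) (h := R / 8) hα hM
      (show 0 ≤ C * (D * (M + F)) by positivity) (by linarith) (by linarith) (by linarith)
      (dat.sol.smooth t ht)
      (fun x hx => dat.uM t ht x (Metric.closedBall_subset_closedBall (by linarith) hx))
      (fun x hx y hy => hH t ht x (Metric.closedBall_subset_closedBall (by linarith) hx) y
        (Metric.closedBall_subset_closedBall (by linarith) hy))
      (Metric.closedBall_subset_closedBall (by linarith) hx)
  have hle2 : 10 * M / (R / 8) ^ 2 + 5 * (C * (D * (M + F))) * (R / 8) ^ α ≤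
      (10 / (R / 8) ^ 2 + 5 * (C * D)) * (M + F) := by
    have h1 : (R / 8) ^ α ≤ 1 := Real.rpow_le_one (by linarith) (by linarith) hα.le
    have h2 : 5 * (C * (D * (M + F))) * (R / 8) ^ α ≤ 5 * (C * (D * (M + F))) :=
      mul_le_of_le_one_right (by positivity) h1
    have h3 : 0 ≤ 10 / (R / 8) ^ 2 * F := by positivity
    have h4 : 10 * M / (R / 8) ^ 2 = 10 / (R / 8) ^ 2 * M := by ring
    rw [h4]
    linarith
  exact ⟨fun x hx => (h_int x hx).1.trans hle2, fun x hx => (h_int x hx).2.1.trans hle2,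
    fun x hx => (h_int x hx).2.2.trans hle2, fun x hx y hy =>
      (hH t ht x (Metric.closedBall_subset_closedBall (by linarith) hx) y
        (Metric.closedBall_subset_closedBall (by linarith) hy)).trans
        (mul_le_mul_of_nonneg_right hle (by positivity))⟩

end Interior

section Ellipticity

open scoped InnerProductSpace

variable {E : Type*} [NormedAddCommGroup E] [InnerProductSpace ℝ E] [FiniteDimensional ℝ E]
  {ι : Type*} [Fintype ι]

theorem exists_symmetric_sqrt {a : E →L[ℝ] E} (hs : ∀ v w, ⟪a v, w⟫_ℝ = ⟪v, a w⟫_ℝ)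
    (hp : ∀ v, 0 ≤ ⟪a v, v⟫_ℝ) :
    ∃ σ : E →L[ℝ] E, (∀ v w, ⟪σ v, w⟫_ℝ = ⟪v, σ w⟫_ℝ) ∧ ∀ v, σ (σ v) = a v := by
  have hT : (a : E →ₗ[ℝ] E).IsSymmetric := hs
  set u := hT.eigenvectorBasis rfl
  set l := hT.eigenvalues rfl
  have hl : ∀ i, a (u i) = l i • u i := fun i => hT.apply_eigenvectorBasis rfl i
  have hl0 : ∀ i, 0 ≤ l i := fun i => by
    have := hp (u i)
    rw [hl, real_inner_smul_left, real_inner_self_eq_norm_sq, u.norm_eq_one] at this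
    simpa using this
  set σ : E →L[ℝ] E := ∑ i, Real.sqrt (l i) • (innerSL ℝ (u i)).smulRight (u i)
  have hσ : ∀ v, σ v = ∑ i, (Real.sqrt (l i) * ⟪u i, v⟫_ℝ) • u i := fun v => by
    simp [σ, smul_smul]
  have hσu : ∀ i, σ (u i) = Real.sqrt (l i) • u i := fun i => by
    rw [hσ, Finset.sum_eq_single i]
    · simp [u.norm_eq_one]
    · intro j _ hj
      rw [u.inner_eq_zero hj]; simp
    · simp
  refine ⟨σ, fun v w => ?_, fun v => ?_⟩
  · rw [hσ, hσ, sum_inner, inner_sum]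
    refine Finset.sum_congr rfl fun i _ => ?_
    rw [real_inner_smul_left, real_inner_smul_right, real_inner_comm v (u i)]
    ring
  · have : (σ.comp σ : E →L[ℝ] E) = a := by
      apply ContinuousLinearMap.coe_injective
      refine u.toBasis.ext fun i => ?_
      simp only [OrthonormalBasis.coe_toBasis, ContinuousLinearMap.coe_coe,
        ContinuousLinearMap.comp_apply, hσu, map_smul, hl, smul_smul, Real.mul_self_sqrt (hl0 i)]
    exact congrArg (fun L : E →L[ℝ] E => L v) this

variable [MeasurableSpace E] [BorelSpace E]

theorem ellOp_eq_sum_adjoint (e : OrthonormalBasis ι ℝ E) {σ τ : E →L[ℝ] E}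
    (hτ : ∀ v w, ⟪σ v, w⟫_ℝ = ⟪v, τ w⟫_ℝ) (B : Bil E) :
    ellOp e σ B = 1 / 2 * ∑ k, B.left (e k) (σ (τ (e k))) := by
  rw [ellOp_apply]
  congr 1
  have h1 : ∀ k, B.left (σ (e k)) (σ (e k)) = ∑ j, ⟪e j, σ (e k)⟫_ℝ * B.left (e j) (σ (e k)) := by
    intro k
    have hl : B.left (∑ j, ⟪e j, σ (e k)⟫_ℝ • e j) =
        ∑ j, ⟪e j, σ (e k)⟫_ℝ • B.left (e j) := by
      have := map_sum (show E →L[ℝ] E →L[ℝ] ℝ from B) (fun j => ⟪e j, σ (e k)⟫_ℝ • e j) Finset.univ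
      refine this.trans (Finset.sum_congr rfl fun j _ => ?_)
      exact B.left_smul _ _
    conv_lhs => rw [← e.sum_repr' (σ (e k)), hl]
    rw [e.sum_repr' (σ (e k)), sum_apply]
    simp
  simp_rw [h1]
  rw [Finset.sum_comm]
  refine Finset.sum_congr rfl fun j _ => ?_
  conv_rhs => rw [← e.sum_repr' (τ (e j)), map_sum, map_sum]
  refine Finset.sum_congr rfl fun k _ => ?_
  rw [map_smul, map_smul, smul_eq_mul, ← hτ, real_inner_comm]

theorem exists_ellOp_of_bounds (e : OrthonormalBasis ι ℝ E) {a : E →L[ℝ] E} {Λ : ℝ} (hΛ : 0 < Λ)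
    (hs : ∀ v w, ⟪a v, w⟫_ℝ = ⟪v, a w⟫_ℝ) (hlo : ∀ v, ‖v‖ ^ 2 ≤ Λ ^ 2 * ⟪a v, v⟫_ℝ)
    (hhi : ∀ v, ⟪a v, v⟫_ℝ ≤ Λ ^ 2 * ‖v‖ ^ 2) :
    ∃ σ : E ≃L[ℝ] E, ‖(σ : E →L[ℝ] E)‖ ≤ Λ ∧ ‖(σ.symm : E →L[ℝ] E)‖ ≤ Λ ∧
      ∀ B, ellOp e (σ : E →L[ℝ] E) B = 1 / 2 * ∑ k, B.left (e k) (a (e k)) := by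
  obtain ⟨σ, hσs, hσ⟩ := exists_symmetric_sqrt hs fun v =>
    nonneg_of_mul_nonneg_right ((sq_nonneg _).trans (hlo v)) (by positivity)
  have hn : ∀ v, ‖σ v‖ ^ 2 = ⟪a v, v⟫_ℝ := fun v => by
    rw [← real_inner_self_eq_norm_sq, ← hσ, hσs (σ v) v]
  have hup : ∀ v, ‖σ v‖ ≤ Λ * ‖v‖ := fun v =>
    abs_le_of_sq_le_sq' (by rw [hn, mul_pow]; exact hhi v) (by positivity) |>.2
  have hdn : ∀ v, ‖v‖ ≤ Λ * ‖σ v‖ := fun v =>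
    abs_le_of_sq_le_sq' (by rw [mul_pow, hn]; exact hlo v) (by positivity) |>.2
  have hinj : Function.Injective (σ : E →ₗ[ℝ] E) := by
    rw [← LinearMap.ker_eq_bot, LinearMap.ker_eq_bot']
    intro v hv
    have := hdn v
    rw [show σ v = 0 from hv, norm_zero, mul_zero] at this
    exact norm_le_zero_iff.1 this
  let σ' : E ≃L[ℝ] E := (LinearEquiv.ofInjectiveEndo (σ : E →ₗ[ℝ] E) hinj).toContinuousLinearEquiv
  have hσ' : (σ' : E →L[ℝ] E) = σ := by ext v; rfl
  refine ⟨σ', ?_, ?_, fun B => ?_⟩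
  · rw [hσ']
    exact σ.opNorm_le_bound hΛ.le hup
  · refine ContinuousLinearMap.opNorm_le_bound _ hΛ.le fun v => ?_
    have h1 := hdn (σ'.symm v)
    have h2 : σ (σ'.symm v) = v := σ'.apply_symm_apply v
    rw [h2] at h1
    exact h1
  · rw [hσ', ellOp_eq_sum_adjoint e hσs]
    simp only [hσ]

theorem exists_ellOp_convex (e : OrthonormalBasis ι ℝ E) {Λ s : ℝ} (hΛ : 0 < Λ) (hs0 : 0 ≤ s)
    (hs1 : s ≤ 1) {σ τ : E ≃L[ℝ] E} (hσ : ‖(σ : E →L[ℝ] E)‖ ≤ Λ)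
    (hσ' : ‖(σ.symm : E →L[ℝ] E)‖ ≤ Λ) (hτ : ‖(τ : E →L[ℝ] E)‖ ≤ Λ)
    (hτ' : ‖(τ.symm : E →L[ℝ] E)‖ ≤ Λ) :
    ∃ ρ : E ≃L[ℝ] E, ‖(ρ : E →L[ℝ] E)‖ ≤ Λ ∧ ‖(ρ.symm : E →L[ℝ] E)‖ ≤ Λ ∧
      ellOp e (ρ : E →L[ℝ] E) =
        (1 - s) • ellOp e (σ : E →L[ℝ] E) + s • ellOp e (τ : E →L[ℝ] E) := by
  have key : ∀ σ : E ≃L[ℝ] E, ‖(σ : E →L[ℝ] E)‖ ≤ Λ → ‖(σ.symm : E →L[ℝ] E)‖ ≤ Λ →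
      ∃ a : E →L[ℝ] E, (∀ v w, ⟪a v, w⟫_ℝ = ⟪v, a w⟫_ℝ) ∧ (∀ v, ‖v‖ ^ 2 ≤ Λ ^ 2 * ⟪a v, v⟫_ℝ) ∧
        (∀ v, ⟪a v, v⟫_ℝ ≤ Λ ^ 2 * ‖v‖ ^ 2) ∧
        ∀ B, ellOp e (σ : E →L[ℝ] E) B = 1 / 2 * ∑ k, B.left (e k) (a (e k)) := by
    intro σ hσ hσ'
    set S := (σ : E →L[ℝ] E) with hS
    set S' := ContinuousLinearMap.adjoint S with hS'
    have hadj : ∀ v w, ⟪S v, w⟫_ℝ = ⟪v, S' w⟫_ℝ := fun v w =>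
      (ContinuousLinearMap.adjoint_inner_right S v w).symm
    have hq : ∀ v w, ⟪S (S' v), w⟫_ℝ = ⟪S' v, S' w⟫_ℝ := fun v w => hadj _ _
    refine ⟨S.comp S', fun v w => ?_, fun v => ?_, fun v => ?_, ellOp_eq_sum_adjoint e hadj⟩
    · show ⟪S (S' v), w⟫_ℝ = ⟪v, S (S' w)⟫_ℝ
      rw [hq, real_inner_comm (S (S' w)) v, hq, real_inner_comm]
    · show ‖v‖ ^ 2 ≤ Λ ^ 2 * ⟪S (S' v), v⟫_ℝ
      rw [hq, real_inner_self_eq_norm_sq, ← mul_pow]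
      refine pow_le_pow_left₀ (norm_nonneg _) ?_ 2
      have h1 : ‖v‖ ^ 2 = ⟪(σ.symm : E →L[ℝ] E) v, S' v⟫_ℝ := by
        rw [← hadj, ← real_inner_self_eq_norm_sq]
        congr 1
        exact (σ.apply_symm_apply v).symm
      have h2 := real_inner_le_norm ((σ.symm : E →L[ℝ] E) v) (S' v)
      have h3 := ((σ.symm : E →L[ℝ] E).le_opNorm v).trans
        (mul_le_mul_of_nonneg_right hσ' (norm_nonneg _))
      rcases (norm_nonneg v).eq_or_lt with h0 | h0
      · rw [← h0]; positivity
      · refine le_of_mul_le_mul_right ?_ h0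
        calc ‖v‖ * ‖v‖ = ‖v‖ ^ 2 := by ring
          _ ≤ _ := h1.le.trans h2
          _ ≤ Λ * ‖v‖ * ‖S' v‖ := mul_le_mul_of_nonneg_right h3 (norm_nonneg _)
          _ = _ := by ring
    · show ⟪S (S' v), v⟫_ℝ ≤ Λ ^ 2 * ‖v‖ ^ 2
      rw [hq, real_inner_self_eq_norm_sq, ← mul_pow]
      refine pow_le_pow_left₀ (norm_nonneg _) ?_ 2
      refine (S'.le_opNorm v).trans (mul_le_mul_of_nonneg_right ?_ (norm_nonneg _))
      rw [hS', LinearIsometryEquiv.norm_map]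
      exact hσ
  obtain ⟨a, a1, a2, a3, a4⟩ := key σ hσ hσ'
  obtain ⟨c, c1, c2, c3, c4⟩ := key τ hτ hτ'
  have hin : ∀ v w, ⟪((1 - s) • a + s • c) v, w⟫_ℝ = (1 - s) * ⟪a v, w⟫_ℝ + s * ⟪c v, w⟫_ℝ :=
    fun v w => by
      simp [inner_add_left, real_inner_smul_left]
  have hin' : ∀ v w, ⟪v, ((1 - s) • a + s • c) w⟫_ℝ = (1 - s) * ⟪v, a w⟫_ℝ + s * ⟪v, c w⟫_ℝ :=
    fun v w => by
      simp [inner_add_right, real_inner_smul_right]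
  have hs2 : 0 ≤ 1 - s := by linarith
  obtain ⟨ρ, r1, r2, r3⟩ := exists_ellOp_of_bounds e (a := (1 - s) • a + s • c) hΛ
    (fun v w => by rw [hin, hin', a1, c1])
    (fun v => by
      rw [hin]
      have := mul_le_mul_of_nonneg_left (a2 v) hs2
      have := mul_le_mul_of_nonneg_left (c2 v) hs0
      linarith)
    (fun v => by
      rw [hin]
      have := mul_le_mul_of_nonneg_left (a3 v) hs2
      have := mul_le_mul_of_nonneg_left (c3 v) hs0
      linarith)
  refine ⟨ρ, r1, r2, ContinuousLinearMap.ext fun B => ?_⟩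
  rw [r3]
  simp only [add_apply, smul_apply, smul_eq_mul, a4, c4, map_add,
    map_smul, Finset.sum_add_distrib, ← Finset.mul_sum]
  ring

end Ellipticity

section Continuity

variable {E : Type*} [NormedAddCommGroup E] [InnerProductSpace ℝ E] [FiniteDimensional ℝ E]
  [MeasurableSpace E] [BorelSpace E] {ι : Type*} [Fintype ι]

theorem HB.of_lipschitz_univ {G : Type*} [NormedAddCommGroup G] {α m : ℝ} (hα : 0 ≤ α)
    (hα1 : α ≤ 1) (hm : 0 ≤ m) {g : E → G} (h0 : ∀ x, ‖g x‖ ≤ m)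
    (h1 : ∀ x y, ‖g x - g y‖ ≤ m * ‖x - y‖) : HB α univ (2 * m) g where
  le x _ := (h0 x).trans (by linarith)
  holder x _ y _ := by
    rcases le_total ‖x - y‖ 1 with h | h
    · rcases (norm_nonneg (x - y)).eq_or_lt with h' | h'
      · have := h1 x y
        rw [← h', mul_zero] at this
        exact this.trans (by positivity)
      · have := Real.rpow_le_rpow_of_exponent_ge h' h hα1
        rw [Real.rpow_one] at this
        have := mul_le_mul_of_nonneg_left this hm
        have h2 : 0 ≤ m * ‖x - y‖ ^ α := by positivity
        linarith [h1 x y]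
    · have h2 := Real.one_le_rpow h hα
      have h3 := (norm_sub_le (g x) (g y)).trans (add_le_add (h0 x) (h0 y))
      nlinarith

/-- A time dependent function with uniform second order Hölder bounds on the whole space. -/
structure Reg (α T K : ℝ) (u : ℝ → E → ℝ) : Prop where
  smooth : ∀ t ∈ Icc 0 T, ContDiff ℝ 2 (u t)
  bound : ∀ t ∈ Icc 0 T, C2BoundOn α K univ (u t)
  c1 : ∀ x, ContinuousOn (fun t => fderiv ℝ (u t) x) (Icc 0 T)
  c2 : ∀ x, ContinuousOn (fun t => D2 (u t) x) (Icc 0 T)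

variable {α Λ T K : ℝ}

theorem Reg.zero (hK : 0 ≤ K) : Reg α T K (fun _ (_ : E) => 0) := by
  have h1 : ∀ x : E, fderiv ℝ (fun _ : E => (0 : ℝ)) x = 0 := fun x => by
    rw [fderiv_fun_const]; rfl
  have h2 : ∀ x : E, D2 (fun _ : E => (0 : ℝ)) x = 0 := fun x =>
    (eq_zero_of_closed (S := ∅) isClosed_empty (η := fun _ : E => (0 : ℝ)) (fun _ _ => rfl)
      (by simp)).2
  exact ⟨fun _ _ => contDiff_const, fun _ _ => ⟨fun x _ => by simpa using hK,
    fun x _ => by rw [h1]; simpa using hK, fun x _ => by rw [h2]; simpa using hK,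
    fun x _ y _ => by rw [h2, h2, sub_self, norm_zero]; positivity⟩,
    fun x => continuousOn_const, fun x => continuousOn_const⟩

theorem Reg.mono {K' : ℝ} {u : ℝ → E → ℝ} (h : Reg α T K u) (hK : K ≤ K') : Reg α T K' u :=
  ⟨h.smooth, fun t ht => (h.bound t ht).mono Subset.rfl hK, h.c1, h.c2⟩

theorem Reg.add {K' : ℝ} {u v : ℝ → E → ℝ} (hu : Reg α T K u) (hv : Reg α T K' v) :
    Reg α T (K + K') (fun t x => u t x + v t x) where
  smooth t ht := (hu.smooth t ht).add (hv.smooth t ht)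
  bound t ht := by
    refine ⟨fun x hx => ?_, fun x hx => ?_, fun x hx => ?_, fun x hx y hy => ?_⟩
    · exact (abs_add_le _ _).trans (add_le_add ((hu.bound t ht).abs_le x hx)
        ((hv.bound t ht).abs_le x hx))
    · rw [fderiv_add_of_C2 (hu.smooth t ht) (hv.smooth t ht)]
      exact (norm_add_le _ _).trans (add_le_add ((hu.bound t ht).fderiv_le x hx)
        ((hv.bound t ht).fderiv_le x hx))
    · rw [D2_add (hu.smooth t ht) (hv.smooth t ht)]
      exact (norm_add_le _ _).trans (add_le_add ((hu.bound t ht).D2_le x hx)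
        ((hv.bound t ht).D2_le x hx))
    · rw [D2_add (hu.smooth t ht) (hv.smooth t ht), D2_add (hu.smooth t ht) (hv.smooth t ht),
        add_sub_add_comm, add_mul]
      exact (norm_add_le _ _).trans (add_le_add ((hu.bound t ht).holder x hx y hy)
        ((hv.bound t ht).holder x hx y hy))
  c1 x := ((hu.c1 x).add (hv.c1 x)).congr fun t ht => by
    rw [fderiv_add_of_C2 (hu.smooth t ht) (hv.smooth t ht)]; rfl
  c2 x := ((hu.c2 x).add (hv.c2 x)).congr fun t ht => by
    rw [D2_add (hu.smooth t ht) (hv.smooth t ht)]; rfl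

theorem Reg.neg {u : ℝ → E → ℝ} (hu : Reg α T K u) : Reg α T K (fun t x => - u t x) := by
  have e : (fun t x => - u t x) = fun t x => (-1) * u t x := by ext t x; ring
  have d1 : ∀ t ∈ Icc 0 T, ∀ x, fderiv ℝ (fun x => (-1) * u t x) x = - fderiv ℝ (u t) x :=
    fun t ht x => by
      rw [fderiv_const_mul_of_C2 (hu.smooth t ht)]; exact neg_one_smul ℝ _
  have d2 : ∀ t ∈ Icc 0 T, ∀ x, D2 (fun x => (-1) * u t x) x = - D2 (u t) x :=
    fun t ht x => by
      rw [D2_const_mul (hu.smooth t ht)]; exact neg_one_smul ℝ _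
  rw [e]
  refine ⟨fun t ht => contDiff_const.mul (hu.smooth t ht), fun t ht => ⟨fun x hx => ?_,
    fun x hx => ?_, fun x hx => ?_, fun x hx y hy => ?_⟩, fun x => ?_, fun x => ?_⟩
  · rw [neg_one_mul, abs_neg]; exact (hu.bound t ht).abs_le x hx
  · rw [d1 t ht, norm_neg]; exact (hu.bound t ht).fderiv_le x hx
  · rw [d2 t ht, norm_neg]; exact (hu.bound t ht).D2_le x hx
  · rw [d2 t ht, d2 t ht, ← neg_sub', norm_neg]; exact (hu.bound t ht).holder x hx y hy
  · exact (hu.c1 x).neg.congr fun t ht => d1 t ht x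
  · exact (hu.c2 x).neg.congr fun t ht => d2 t ht x

theorem Reg.sub {K' : ℝ} {u v : ℝ → E → ℝ} (hu : Reg α T K u) (hv : Reg α T K' v) :
    Reg α T (K + K') (fun t x => u t x - v t x) := by
  simpa only [sub_eq_add_neg] using hu.add hv.neg

theorem Reg.hb (hα : 0 ≤ α) (hα1 : α ≤ 1) {u : ℝ → E → ℝ} (hu : Reg α T K u) {t : ℝ}
    (ht : t ∈ Icc 0 T) :
    HB α univ (2 * K) (u t) ∧ HB α univ (2 * K) (fderiv ℝ (u t)) ∧
      HB α univ (2 * K) (D2 (u t)) := by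
  have b := hu.bound t ht
  have hK : 0 ≤ K := (abs_nonneg _).trans (b.abs_le 0 (mem_univ _))
  refine ⟨HB.of_lipschitz_univ hα hα1 hK (fun x => b.abs_le x (mem_univ _)) fun x y =>
      convex_univ.norm_image_sub_le_of_norm_hasFDerivWithin_le
        (fun x _ => (hasFDerivAt_of_C2 (hu.smooth t ht) x).hasFDerivWithinAt)
        b.fderiv_le (mem_univ y) (mem_univ x),
    HB.of_lipschitz_univ hα hα1 hK (fun x => b.fderiv_le x (mem_univ _)) fun x y =>
      convex_univ.norm_image_sub_le_of_norm_hasFDerivWithin_le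
        (fun x _ => (hasFDerivAt_fderiv_of_C2 (hu.smooth t ht) x).hasFDerivWithinAt)
        b.D2_le (mem_univ y) (mem_univ x),
    HB.mono ⟨b.D2_le, b.holder⟩ (by linarith)⟩

theorem Reg.holderSource_Lop (hα : 0 ≤ α) (hα1 : α ≤ 1) {u : ℝ → E → ℝ} (hu : Reg α T K u) {m : ℝ}
    {A : E → Bil E →L[ℝ] ℝ} {b : E → E} (hA : HB α univ m A) (hb : HB α univ m b) :
    HolderSource α T (8 * m * K) (8 * m * K) (fun t => Lop A b (u t)) := by
  have h : ∀ t ∈ Icc 0 T, HB α univ (8 * m * K) (Lop A b (u t)) := fun t ht => by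
    obtain ⟨-, h1, h2⟩ := hu.hb hα hα1 ht
    exact ((hA.prod isProd_apply h2).add (h1.prod isProd_apply hb)).mono (le_of_eq (by ring))
  exact ⟨fun t ht x => (h t ht).le x (mem_univ _),
    fun t ht x y => (h t ht).holder x (mem_univ _) y (mem_univ _), fun x =>
      ((A x).continuous.comp_continuousOn (hu.c2 x)).add
        ((hu.c1 x).clm_apply continuousOn_const)⟩

theorem IsSol.reg (hα : 0 < α) {e : OrthonormalBasis ι ℝ E} {A : E → Bil E →L[ℝ] ℝ}
    {b : E → E} (hc : CoefOn e α Λ univ A b) {F : ℝ} {f u : ℝ → E → ℝ} (hu : IsSol A b T f u)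
    (hf : ∀ t ∈ Icc 0 T, ∀ x, |f t x| ≤ F) (hK : 0 ≤ K)
    (hb : ∀ t ∈ Icc 0 T, C2BoundOn α K univ (u t)) : Reg α T K u := by
  have h : ∀ x, _ := fun x => continuousOn_derivs (x := x) hα hK one_pos hu.smooth
    (fun t ht => (hb t ht).mono (subset_univ _) le_rfl)
    (fun y _ => (hu.isSolOn univ).lipschitz_time (mem_univ y) (hc.hA.le y (mem_univ _))
      (hc.hb.le y (mem_univ _)) (fun t ht => (hb t ht).fderiv_le y (mem_univ _))
      (fun t ht => (hb t ht).D2_le y (mem_univ _)) fun t ht => hf t ht y)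
  exact ⟨hu.smooth, hb, fun x => (h x).2.1, fun x => (h x).2.2⟩

/-- Global Schauder estimate. -/
theorem global_estimate (hα : 0 < α) (hα1 : α < 1) (hΛ : 1 ≤ Λ) (e : OrthonormalBasis ι ℝ E) :
    ∃ C : ℝ, 0 ≤ C ∧ ∀ (T F K : ℝ) (A : E → Bil E →L[ℝ] ℝ) (b : E → E) (f u : ℝ → E → ℝ),
      0 ≤ T → 0 ≤ F → CoefOn e α Λ univ A b → HolderSource α T F F f → IsSol A b T f u →
      Reg α T K u → Reg α T (C * (1 + T) * F) u := by
  obtain ⟨R, hR, hR1, C, hC, h⟩ := interior_estimate (J := 0) hα hα1 hΛ le_rfl e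
  refine ⟨C + 2 * C / (R / 4) ^ α, by positivity, fun T F K A b f u hT hF hc hf hu hr => ?_⟩
  have hmax : ∀ t ∈ Icc 0 T, ∀ x, |u t x| ≤ F * T := fun t ht x => by
    refine (hu.abs_le (Λ := Λ) (K := K) (g := fun t => F * t) (g' := fun _ => F)
      (fun x => ?_) (fun x => hc.hA.le x (mem_univ _)) (fun x => hc.hb.le x (mem_univ _))
      (fun t ht x => (hr.bound t ht).abs_le x (mem_univ _))
      (fun t ht x => (hr.bound t ht).fderiv_le x (mem_univ _))
      (fun t ht x => (hr.bound t ht).D2_le x (mem_univ _))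
      (fun t => by simpa using (hasDerivAt_id t).const_mul F) (by simp) hf.abs_le
      ⟨F, hf.abs_le⟩ t ht x).trans (mul_le_mul_of_nonneg_left ht.2 hF)
    obtain ⟨σ, -, -, hσ⟩ := hc.ell x (mem_univ _)
    rw [hσ]
    exact isDegElliptic_ellOp e _
  have hloc : ∀ x₀, ∀ t ∈ Icc 0 T,
      C2BoundOn α (C * (1 + T) * F) (Metric.closedBall x₀ (R / 4)) (u t) := fun x₀ t ht => by
    have hd : IntData e α Λ 0 T (F * T) F (Metric.closedBall x₀ R) A b f u :=
      ⟨⟨fun x _ => hc.ell x (mem_univ _), hc.hA.mono_set (subset_univ _),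
        hc.hb.mono_set (subset_univ _)⟩, hu.isSolOn _, fun t ht x _ => hmax t ht x,
        fun t ht x _ => hf.abs_le t ht x,
        fun t ht x _ y _ => (hf.holder t ht x y).trans (by simp), fun x _ => hf.cont x⟩
    exact (h T (F * T) F K x₀ A b f u hT (by positivity) hF hd
      (fun t ht x _ y _ => (hr.bound t ht).holder x (mem_univ _) y (mem_univ _)) t ht).mono
      Subset.rfl (le_of_eq (by ring))
  have hself : ∀ x : E, x ∈ Metric.closedBall x (R / 4) := fun x =>
    Metric.mem_closedBall_self (by linarith)
  have hX : 0 ≤ C * (1 + T) * F := by positivity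
  have hle : C * (1 + T) * F ≤ (C + 2 * C / (R / 4) ^ α) * (1 + T) * F := by
    have : 0 ≤ 2 * C / (R / 4) ^ α * (1 + T) * F := by positivity
    linarith
  refine ⟨hr.smooth, fun t ht => ⟨fun x _ => ((hloc x t ht).abs_le x (hself x)).trans hle,
    fun x _ => ((hloc x t ht).fderiv_le x (hself x)).trans hle,
    fun x _ => ((hloc x t ht).D2_le x (hself x)).trans hle, fun x _ y _ => ?_⟩, hr.c1, hr.c2⟩
  by_cases hxy : ‖x - y‖ ≤ R / 4
  · refine ((hloc x t ht).holder x (hself x) y ?_).trans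
      (mul_le_mul_of_nonneg_right hle (by positivity))
    rwa [Metric.mem_closedBall, dist_eq_norm, norm_sub_rev]
  · push Not at hxy
    have h1 : (R / 4) ^ α ≤ ‖x - y‖ ^ α := Real.rpow_le_rpow (by linarith) hxy.le hα.le
    have h2 := (norm_sub_le (D2 (u t) x) (D2 (u t) y)).trans
      (add_le_add ((hloc x t ht).D2_le x (hself x)) ((hloc y t ht).D2_le y (hself y)))
    have h3 : 2 * (C * (1 + T) * F) ≤ 2 * C / (R / 4) ^ α * (1 + T) * F * ‖x - y‖ ^ α := by
      have hp : 0 < (R / 4) ^ α := by positivity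
      have e1 : 2 * C / (R / 4) ^ α * (1 + T) * F * ‖x - y‖ ^ α =
        2 * (C * (1 + T) * F) * (‖x - y‖ ^ α / (R / 4) ^ α) := by ring
      rw [e1]
      exact le_mul_of_one_le_right (by positivity) ((one_le_div hp).2 h1)
    have h4 : 0 ≤ C * (1 + T) * F * ‖x - y‖ ^ α := by positivity
    linarith

end Continuity

section Continuity

variable {E : Type*} [NormedAddCommGroup E] [InnerProductSpace ℝ E] [FiniteDimensional ℝ E]
  [MeasurableSpace E] [BorelSpace E] {ι : Type*} [Fintype ι]

theorem C2BoundOn.of_tendsto {ι' : Type*} {l : Filter ι'} [l.NeBot] {α K : ℝ} {S : Set E}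
    {φ' : ι' → E → ℝ} {φ : E → ℝ} (h : ∀ᶠ n in l, C2BoundOn α K S (φ' n))
    (h0 : ∀ x, Tendsto (fun n => φ' n x) l (𝓝 (φ x)))
    (h1 : ∀ x, Tendsto (fun n => fderiv ℝ (φ' n) x) l (𝓝 (fderiv ℝ φ x)))
    (h2 : ∀ x, Tendsto (fun n => D2 (φ' n) x) l (𝓝 (D2 φ x))) : C2BoundOn α K S φ where
  abs_le x hx := le_of_tendsto (h0 x).abs (h.mono fun _ h => h.abs_le x hx)
  fderiv_le x hx := le_of_tendsto (h1 x).norm (h.mono fun _ h => h.fderiv_le x hx)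
  D2_le x hx := le_of_tendsto (h2 x).norm (h.mono fun _ h => h.D2_le x hx)
  holder x hx y hy := le_of_tendsto ((h2 x).sub (h2 y)).norm
    (h.mono fun _ h => h.holder x hx y hy)

theorem IsSol.add {A : E → Bil E →L[ℝ] ℝ} {b : E → E} {T : ℝ} {f g u v : ℝ → E → ℝ}
    (hu : IsSol A b T f u) (hv : IsSol A b T g v) :
    IsSol A b T (fun t x => f t x + g t x) (fun t x => u t x + v t x) where
  init x := by rw [hu.init, hv.init, add_zero]
  smooth t ht := (hu.smooth t ht).add (hv.smooth t ht)
  eqn t ht x := ((hu.eqn t ht x).add (hv.eqn t ht x)).congr_deriv (by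
    rw [Lop_add (hu.smooth t ht) (hv.smooth t ht)]; ring)

theorem IsSol.congr_source {A : E → Bil E →L[ℝ] ℝ} {b : E → E} {T : ℝ} {f g u : ℝ → E → ℝ}
    (hu : IsSol A b T f u) (h : ∀ t ∈ Icc 0 T, ∀ x, f t x = g t x) : IsSol A b T g u where
  init := hu.init
  smooth := hu.smooth
  eqn t ht x := by rw [← h t ht x]; exact hu.eqn t ht x

theorem IsSol.change_coef {A A' : E → Bil E →L[ℝ] ℝ} {b b' : E → E} {T : ℝ} {f u : ℝ → E → ℝ}
    (hu : IsSol A b T f u) :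
    IsSol A' b' T (fun t x => f t x - Lop (fun x => A' x - A x) (fun x => b' x - b x) (u t) x) u
    where
  init := hu.init
  smooth := hu.smooth
  eqn t ht x := (hu.eqn t ht x).congr_deriv (by
    simp only [Lop, sub_apply, map_sub]; ring)

variable {α Λ T : ℝ}

theorem continuity_step (hα : 0 < α) (hα1 : α < 1) (hT : 0 ≤ T) {e : OrthonormalBasis ι ℝ E}
    {A A' : E → Bil E →L[ℝ] ℝ} {b b' : E → E} {c κ : ℝ} (hc : 0 ≤ c) (hκ : 0 ≤ κ)
    (hA' : CoefOn e α Λ univ A' b')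
    (hQA : HB α univ κ (fun x => A' x - A x)) (hQb : HB α univ κ (fun x => b' x - b x))
    (hcκ : 8 * κ * c ≤ 1 / 2)
    (hS : ∀ (F : ℝ) (f : ℝ → E → ℝ), 0 ≤ F → HolderSource α T F F f →
      ∃ u, IsSol A b T f u ∧ Reg α T (c * F) u) {F : ℝ} {f : ℝ → E → ℝ} (hF : 0 ≤ F)
    (hf : HolderSource α T F F f) : ∃ u, IsSol A' b' T f u ∧ Reg α T (2 * (c * F)) u := by
  set Q : (E → ℝ) → E → ℝ := Lop (fun x => A' x - A x) (fun x => b' x - b x) with hQ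
  have hcF : 0 ≤ c * F := by positivity
  have hpow : ∀ n : ℕ, 0 ≤ c * F / 2 ^ n := fun n => by positivity
  have hstep : ∀ (n : ℕ) (w : {w : ℝ → E → ℝ // Reg α T (c * F / 2 ^ n) w}),
      ∃ w' : {w : ℝ → E → ℝ // Reg α T (c * F / 2 ^ (n + 1)) w},
        IsSol A b T (fun t => Q (w.1 t)) w'.1 := by
    rintro n ⟨w, hw⟩
    have h1 := hw.holderSource_Lop hα.le hα1.le hQA hQb
    obtain ⟨w', h2, h3⟩ := hS (8 * κ * (c * F / 2 ^ n)) _ (by have := hpow n; positivity) h1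
    refine ⟨⟨w', h3.mono ?_⟩, h2⟩
    have := mul_le_mul_of_nonneg_right hcκ (hpow n)
    rw [pow_succ]
    calc c * (8 * κ * (c * F / 2 ^ n)) = 8 * κ * c * (c * F / 2 ^ n) := by ring
      _ ≤ 1 / 2 * (c * F / 2 ^ n) := this
      _ = _ := by field_simp
  obtain ⟨w0, hw0, hw0r⟩ := hS F f hF hf
  choose stp hstp using hstep
  let w : ∀ n : ℕ, {w : ℝ → E → ℝ // Reg α T (c * F / 2 ^ n) w} := fun n =>
    Nat.rec ⟨w0, by simpa using hw0r⟩ (fun n w => stp n w) n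
  have hws : ∀ n, IsSol A b T (fun t => Q ((w n).1 t)) (w (n + 1)).1 := fun n => hstp n (w n)
  let U : ℕ → ℝ → E → ℝ := fun n =>
    Nat.rec (w 0).1 (fun n u => fun t x => u t x + (w (n + 1)).1 t x) n
  have hUr : ∀ n, Reg α T (2 * (c * F) - c * F / 2 ^ n) (U n) := fun n => by
    induction n with
    | zero => exact (w 0).2.mono (le_of_eq (by ring))
    | succ n ih =>
      refine (ih.add (w (n + 1)).2).mono (le_of_eq ?_)
      rw [pow_succ]; field_simp; ring
  have hUs : ∀ n, IsSol A' b' T (fun t x => f t x - Q ((w n).1 t) x) (U n) := fun n => by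
    induction n with
    | zero => exact hw0.change_coef
    | succ n ih =>
      exact (ih.add ((hws n).change_coef (A' := A') (b' := b'))).congr_source
        fun t ht x => by simp only [hQ]; ring
  have hUr' : ∀ n, Reg α T (2 * (c * F)) (U n) := fun n => (hUr n).mono (by linarith [hpow n])
  have hQs : ∀ n, ∀ t ∈ Icc 0 T, ∀ x, |Q ((w n).1 t) x| ≤ 8 * κ * (c * F / 2 ^ n) := fun n =>
    ((w n).2.holderSource_Lop hα.le hα1.le hQA hQb).abs_le
  have hz : Tendsto (fun n : ℕ => 8 * κ * (c * F / 2 ^ n)) atTop (𝓝 0) := by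
    have := (tendsto_pow_atTop_nhds_zero_of_lt_one (r := (1 / 2 : ℝ)) (by norm_num)
      (by norm_num)).const_mul (8 * κ * (c * F))
    rw [mul_zero] at this
    refine this.congr fun n => ?_
    rw [div_pow, one_pow]; ring
  have hz' := hz.mono_left Nat.hyperfilter_le_atTop
  have hQ0 : ∀ n, 8 * κ * (c * F / 2 ^ n) ≤ 8 * κ * (c * F) := fun n =>
    mul_le_mul_of_nonneg_left (div_le_self hcF (one_le_pow₀ (by norm_num))) (by positivity)
  have hex : ∀ t x, ∃ y, t ∈ Icc 0 T → Tendsto (fun n => U n t x) (hyperfilter ℕ) (𝓝 y) := by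
    intro t x
    by_cases ht : t ∈ Icc 0 T
    · obtain ⟨y, hy⟩ := exists_tendsto_of_bounded (hyperfilter ℕ) (f := fun n => U n t x)
        (C := 2 * (c * F))
        (Eventually.of_forall fun n => ((hUr' n).bound t ht).abs_le x (mem_univ _))
      exact ⟨y, fun _ => hy⟩
    · exact ⟨0, fun h => absurd h ht⟩
  choose u hu using hex
  have hlim := IsSol.limit (l := hyperfilter ℕ) (A' := fun _ => A') (b' := fun _ => b')
    (A := A') (b := b') (f := f) (u := u) hα hT (Eventually.of_forall hUs)
    (fun x => tendsto_const_nhds) (fun x => tendsto_const_nhds)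
    (fun t ht x => by
      have h1 : Tendsto (fun n => Q ((w n).1 t) x) (hyperfilter ℕ) (𝓝 0) :=
        squeeze_zero_norm (fun n => hQs n t ht x) hz'
      simpa using (tendsto_const_nhds (x := f t x)).sub h1)
    (fun t ht x => hu t x ht)
    (fun x₀ => ⟨1, one_pos, max (2 * (c * F)) (max Λ (F + 8 * κ * (c * F))),
      le_max_of_le_left (by positivity), Eventually.of_forall fun n =>
      ⟨fun t ht => ((hUr' n).bound t ht).mono (subset_univ _) (le_max_left _ _),
        fun x _ => ⟨le_max_of_le_right (le_max_of_le_left (hA'.hA.le x (mem_univ _))),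
          le_max_of_le_right (le_max_of_le_left (hA'.hb.le x (mem_univ _))), fun t ht =>
          le_max_of_le_right (le_max_of_le_right ((abs_sub _ _).trans
            (add_le_add (hf.abs_le t ht x) ((hQs n t ht x).trans (hQ0 n)))))⟩⟩⟩)
    (fun x t ht ε hε => by
      obtain ⟨δ, hδ, h1⟩ := Metric.continuousOn_iff.1 (hf.cont x) t ht (ε / 2) (by linarith)
      refine ⟨δ, hδ, ?_⟩
      filter_upwards [hz'.eventually (gt_mem_nhds (show (0 : ℝ) < ε / 4 by linarith))] with n hn
        s hs hst
      have h2 := h1 s hs (by rwa [Real.dist_eq])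
      rw [Real.dist_eq] at h2
      have h3 := hQs n s hs x
      have h4 := hQs n t ht x
      rw [abs_le] at h3 h4 ⊢
      rw [abs_lt] at h2
      constructor <;> linarith [h2.1, h2.2, h3.1, h3.2, h4.1, h4.2])
  refine ⟨u, hlim.1, hlim.1.reg hα hA' hf.abs_le (by positivity) fun t ht => ?_⟩
  exact C2BoundOn.of_tendsto (Eventually.of_forall fun n => (hUr' n).bound t ht)
    (fun x => hu t x ht) (fun x => (hlim.2 t ht x).1) (fun x => (hlim.2 t ht x).2)

theorem CoefOn.mono {e : OrthonormalBasis ι ℝ E} {Λ' : ℝ} {S : Set E} {A : E → Bil E →L[ℝ] ℝ}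
    {b : E → E} (h : CoefOn e α Λ S A b) (hΛ : Λ ≤ Λ') : CoefOn e α Λ' S A b :=
  ⟨fun x hx => by
    obtain ⟨σ, h1, h2, h3⟩ := h.ell x hx
    exact ⟨σ, h1.trans hΛ, h2.trans hΛ, h3⟩, h.hA.mono hΛ, h.hb.mono hΛ⟩

theorem CoefOn.path {e : OrthonormalBasis ι ℝ E} {A : E → Bil E →L[ℝ] ℝ}
    {b : E → E} (h : CoefOn e α Λ univ A b) (hΛ : 1 ≤ Λ)
    (hid : ‖ellOp e (ContinuousLinearMap.id ℝ E)‖ ≤ Λ) {s : ℝ} (hs0 : 0 ≤ s) (hs1 : s ≤ 1) :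
    CoefOn e α Λ univ (fun x => (1 - s) • ellOp e (ContinuousLinearMap.id ℝ E) + s • A x)
      (fun x => s • b x) where
  ell x hx := by
    obtain ⟨τ, h1, h2, h3⟩ := h.ell x hx
    have hI : ‖((ContinuousLinearEquiv.refl ℝ E : E ≃L[ℝ] E) : E →L[ℝ] E)‖ ≤ Λ :=
      ContinuousLinearMap.norm_id_le.trans hΛ
    obtain ⟨ρ, h4, h5, h6⟩ := exists_ellOp_convex e (by linarith) hs0 hs1 hI hI h1 h2
    exact ⟨ρ, h4, h5, by rw [h6, h3]; rfl⟩
  hA := by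
    refine ⟨fun x hx => (norm_add_le _ _).trans ?_, fun x hx y hy => ?_⟩
    · rw [norm_smul, norm_smul, Real.norm_of_nonneg hs0, Real.norm_of_nonneg (sub_nonneg.2 hs1)]
      nlinarith [h.hA.le x hx]
    · rw [add_sub_add_left_eq_sub, show s • A x - s • A y = s • (A x - A y) from
        (smul_sub _ _ _).symm, norm_smul, Real.norm_of_nonneg hs0]
      exact (mul_le_of_le_one_left (norm_nonneg _) hs1).trans (h.hA.holder x hx y hy)
  hb := by
    refine ⟨fun x hx => ?_, fun x hx y hy => ?_⟩
    · rw [norm_smul, Real.norm_of_nonneg hs0]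
      exact (mul_le_of_le_one_left (norm_nonneg _) hs1).trans (h.hb.le x hx)
    · rw [← smul_sub, norm_smul, Real.norm_of_nonneg hs0]
      exact (mul_le_of_le_one_left (norm_nonneg _) hs1).trans (h.hb.holder x hx y hy)

theorem HB.const_smul {G : Type*} [NormedAddCommGroup G] [NormedSpace ℝ G] {S : Set E} {m c : ℝ}
    {g : E → G} (h : HB α S m g) (hc : 0 ≤ c) : HB α S (c * m) (fun x => c • g x) where
  le x hx := by
    rw [norm_smul, Real.norm_of_nonneg hc]
    exact mul_le_mul_of_nonneg_left (h.le x hx) hc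
  holder x hx y hy := by
    rw [← smul_sub, norm_smul, Real.norm_of_nonneg hc, mul_assoc]
    exact mul_le_mul_of_nonneg_left (h.holder x hx y hy) hc

/-- Solvability of the linear Cauchy problem with bounded Hölder coefficients. -/
theorem exists_isSol_global (hα : 0 < α) (hα1 : α < 1) (hT : 0 ≤ T)
    {e : OrthonormalBasis ι ℝ E} {A : E → Bil E →L[ℝ] ℝ} {b : E → E}
    (hc : CoefOn e α Λ univ A b) {F : ℝ} {f : ℝ → E → ℝ} (hF : 0 ≤ F)
    (hf : HolderSource α T F F f) : ∃ u, IsSol A b T f u ∧ ∃ K, Reg α T K u := by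
  set I := ellOp e (ContinuousLinearMap.id ℝ E) with hI
  set Λ' := max Λ (max 1 ‖I‖) with hΛ'
  have hΛ1 : 1 ≤ Λ' := le_max_of_le_right (le_max_left _ _)
  have hid : ‖I‖ ≤ Λ' := le_max_of_le_right (le_max_right _ _)
  have hc' := hc.mono (le_max_left Λ (max 1 ‖I‖))
  obtain ⟨C, hC, hest⟩ := global_estimate hα hα1 hΛ1 e
  set c := C * (1 + T) with hcdef
  have hc0 : 0 ≤ c := by positivity
  obtain ⟨N, hN⟩ := exists_nat_gt (8 * (2 * Λ') * c * 2)
  have hN0 : (0 : ℝ) < N := lt_of_le_of_lt (by positivity) hN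
  have key : ∀ k : ℕ, k ≤ N → ∀ (F : ℝ) (f : ℝ → E → ℝ), 0 ≤ F → HolderSource α T F F f →
      ∃ u, IsSol (fun x => (1 - (k / N : ℝ)) • I + (k / N : ℝ) • A x)
        (fun x => (k / N : ℝ) • b x) T f u ∧ Reg α T (c * F) u := by
    intro k hk
    induction k with
    | zero =>
      intro F f hF hf
      have hp := hc'.path hΛ1 hid (s := 0) le_rfl zero_le_one
      have hid' : ‖((ContinuousLinearEquiv.refl ℝ E : E ≃L[ℝ] E) : E →L[ℝ] E)‖ ≤ Λ' :=
        ContinuousLinearMap.norm_id_le.trans hΛ1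
      obtain ⟨u, hu, hb⟩ := exists_isSol_const hα hα1 hΛ1 hT hF hF e hid' hid' hf
      have hcoef : IsSol (fun x => (1 - (0 : ℝ)) • I + (0 : ℝ) • A x)
          (fun x => (0 : ℝ) • b x) T f u := by
        simp only [sub_zero, one_smul, zero_smul, add_zero]
        exact hu
      have hS := schauderConst_nonneg (E := E) hα hα1 hΛ1
      have h0 : 0 ≤ F * T := by positivity
      have h1 : 0 ≤ schauderConst E α Λ' * F := by positivity
      have hr := hcoef.reg hα hp (F := F) (K := 8 * (F * T) + 4 * (schauderConst E α Λ' * F))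
        hf.abs_le (by positivity) fun t ht => ⟨fun x _ => ((hb t ht).1 x).trans (by linarith),
          fun x _ => ((hb t ht).2.1 x).trans (by linarith), fun x _ => (hb t ht).2.2.1 x,
          fun x _ y _ => ((hb t ht).2.2.2 x y).trans
            (mul_le_mul_of_nonneg_right (by linarith) (by positivity))⟩
      simp only [Nat.cast_zero, zero_div]
      exact ⟨u, hcoef, hest T F _ _ _ f u hT hF hp hf hcoef hr⟩
    | succ k ih =>
      intro F f hF hf
      have hs0 : (0 : ℝ) ≤ ((k + 1 : ℕ) : ℝ) / N := by positivity
      have hs1 : ((k + 1 : ℕ) : ℝ) / N ≤ 1 := (div_le_one hN0).2 (by exact_mod_cast hk)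
      have hp := hc'.path hΛ1 hid hs0 hs1
      have hd : ((k + 1 : ℕ) : ℝ) / N = k / N + 1 / N := by push_cast; ring
      have hN1 : (0 : ℝ) ≤ 1 / N := by positivity
      have hQA : HB α univ (1 / N * (2 * Λ')) (fun x =>
          ((1 - ((k + 1 : ℕ) / N : ℝ)) • I + ((k + 1 : ℕ) / N : ℝ) • A x)
            - ((1 - (k / N : ℝ)) • I + (k / N : ℝ) • A x)) := by
        have h1 := ((hc'.hA.sub (HB.const (S := univ) (by linarith) hid)).mono
          (le_of_eq (two_mul Λ').symm)).const_smul hN1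
        refine h1.congr fun x _ => ?_
        rw [hd]; module
      have hQb : HB α univ (1 / N * (2 * Λ')) (fun x =>
          ((k + 1 : ℕ) / N : ℝ) • b x - (k / N : ℝ) • b x) := by
        have h1 := (hc'.hb.mono (show Λ' ≤ 2 * Λ' by linarith)).const_smul hN1
        refine h1.congr fun x _ => ?_
        rw [hd]; module
      obtain ⟨u, hu, hr⟩ := continuity_step hα hα1 hT hc0 (by positivity) hp hQA hQb
        (by
          rw [show 8 * (1 / (N : ℝ) * (2 * Λ')) * c = (8 * (2 * Λ') * c) / N by ring,
            div_le_iff₀ hN0]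
          linarith) (ih (by omega)) hF hf
      exact ⟨u, hu, hest T F _ _ _ f u hT hF hp hf hu hr⟩
  obtain ⟨u, hu, hr⟩ := key N le_rfl F f hF hf
  rw [div_self hN0.ne'] at hu
  simp only [sub_self, zero_smul, zero_add, one_smul] at hu
  exact ⟨u, hu, _, hr⟩

end Continuity

section Semilinear

variable {E : Type*} [NormedAddCommGroup E] [InnerProductSpace ℝ E] [FiniteDimensional ℝ E]
  [MeasurableSpace E] [BorelSpace E] {ι : Type*} [Fintype ι] {α Λ T : ℝ}

theorem IsSol.sub {A : E → Bil E →L[ℝ] ℝ} {b : E → E} {f g u v : ℝ → E → ℝ}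
    (hu : IsSol A b T f u) (hv : IsSol A b T g v) :
    IsSol A b T (fun t x => f t x - g t x) (fun t x => u t x - v t x) where
  init x := by rw [hu.init, hv.init, sub_zero]
  smooth t ht := (hu.smooth t ht).sub (hv.smooth t ht)
  eqn t ht x := ((hu.eqn t ht x).sub (hv.eqn t ht x)).congr_deriv (by
    rw [Lop_sub (hu.smooth t ht) (hv.smooth t ht)]; ring)

theorem holder_interp {h K M : ℝ} (hα : 0 ≤ α) (hα1 : α ≤ 1) (hh : 0 < h) (hM : 0 ≤ M) (hK : 0 ≤ K)
    {φ : E → ℝ} (h0 : ∀ x, |φ x| ≤ M) (h1 : ∀ x y, |φ x - φ y| ≤ K * ‖x - y‖) (x y : E) :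
    |φ x - φ y| ≤ (h ^ (1 - α) * K + 2 * M / h ^ α) * ‖x - y‖ ^ α := by
  have hp : 0 < h ^ α := by positivity
  rcases le_total ‖x - y‖ h with hxy | hxy
  · rcases (norm_nonneg (x - y)).eq_or_lt with h' | h'
    · have := h1 x y
      rw [← h', mul_zero] at this
      exact this.trans (by positivity)
    · have h2 : ‖x - y‖ = ‖x - y‖ ^ (1 - α) * ‖x - y‖ ^ α := by
        rw [← Real.rpow_add h', sub_add_cancel, Real.rpow_one]
      have h3 : ‖x - y‖ ^ (1 - α) ≤ h ^ (1 - α) :=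
        Real.rpow_le_rpow h'.le hxy (by linarith)
      have h5 : 0 ≤ ‖x - y‖ ^ α := by positivity
      have h6 : 0 ≤ 2 * M / h ^ α * ‖x - y‖ ^ α := by positivity
      have h4 : K * ‖x - y‖ ≤ h ^ (1 - α) * K * ‖x - y‖ ^ α := by
        calc K * ‖x - y‖ = ‖x - y‖ ^ (1 - α) * (K * ‖x - y‖ ^ α) := by
              conv_lhs => rw [h2]
              ring
          _ ≤ h ^ (1 - α) * (K * ‖x - y‖ ^ α) := mul_le_mul_of_nonneg_right h3 (by positivity)
          _ = _ := by ring
      linarith [h1 x y]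
  · have h2 : h ^ α ≤ ‖x - y‖ ^ α := Real.rpow_le_rpow hh.le hxy hα
    have h3 : |φ x - φ y| ≤ 2 * M := (abs_sub _ _).trans (by linarith [h0 x, h0 y])
    have h4 : 2 * M ≤ 2 * M / h ^ α * ‖x - y‖ ^ α := by
      rw [div_mul_eq_mul_div, le_div_iff₀ hp]
      exact mul_le_mul_of_nonneg_left h2 (by linarith)
    have h6 : 0 ≤ h ^ (1 - α) * K * ‖x - y‖ ^ α := by positivity
    linarith

theorem Reg.lipschitz {K : ℝ} {u : ℝ → E → ℝ} (hu : Reg α T K u) {t : ℝ} (ht : t ∈ Icc 0 T)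
    (x y : E) : |u t x - u t y| ≤ K * ‖x - y‖ :=
  convex_univ.norm_image_sub_le_of_norm_hasFDerivWithin_le
    (fun x _ => (hasFDerivAt_of_C2 (hu.smooth t ht) x).hasFDerivWithinAt)
    (hu.bound t ht).fderiv_le (mem_univ y) (mem_univ x)

theorem IsSol.lipschitz_time {K F : ℝ} {e : OrthonormalBasis ι ℝ E} {A : E → Bil E →L[ℝ] ℝ}
    {b : E → E} {f u : ℝ → E → ℝ} (hu : IsSol A b T f u) (hc : CoefOn e α Λ univ A b)
    (hr : Reg α T K u) (hf : ∀ t ∈ Icc 0 T, ∀ x, |f t x| ≤ F) (x : E) :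
    ∀ s ∈ Icc 0 T, ∀ t ∈ Icc 0 T, |u t x - u s x| ≤ (2 * Λ * K + F) * |t - s| :=
  (hu.isSolOn univ).lipschitz_time (mem_univ x) (hc.hA.le x (mem_univ _))
    (hc.hb.le x (mem_univ _)) (fun t ht => (hr.bound t ht).fderiv_le x (mem_univ _))
    (fun t ht => (hr.bound t ht).D2_le x (mem_univ _)) fun t ht => hf t ht x

theorem continuousOn_of_lipschitz_abs {C : ℝ} {g : ℝ → ℝ} {S : Set ℝ}
    (h : ∀ s ∈ S, ∀ t ∈ S, |g t - g s| ≤ C * |t - s|) : ContinuousOn g S := by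
  refine (LipschitzOnWith.of_dist_le_mul (K := C.toNNReal) fun s hs t ht => ?_).continuousOn
  rw [Real.dist_eq, Real.dist_eq]
  exact (h t ht s hs).trans (mul_le_mul_of_nonneg_right (Real.le_coe_toNNReal C) (abs_nonneg _))

/-- Solvability of the semilinear Cauchy problem with a bounded Lipschitz nonlinearity. -/
theorem exists_isSol_semilinear (hα : 0 < α) (hα1 : α < 1) (hT : 0 ≤ T) (hΛ : 1 ≤ Λ)
    {e : OrthonormalBasis ι ℝ E} {A : E → Bil E →L[ℝ] ℝ} {b : E → E}
    (hc : CoefOn e α Λ univ A b) {Γ : ℝ} (hΓ : 0 ≤ Γ) {G : E → ℝ → ℝ}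
    (hG0 : ∀ x y, |G x y| ≤ Γ) (hG1 : ∀ x y y', |G x y - G x y'| ≤ Γ * |y - y'|)
    (hG2 : ∀ x x' y, |G x y - G x' y| ≤ Γ * ‖x - x'‖ ^ α) :
    ∃ u, IsSol A b T (fun t x => G x (u t x)) u ∧ ∃ K, Reg α T K u := by
  obtain ⟨C, hC, hest⟩ := global_estimate hα hα1 hΛ e
  set c := C * (1 + T) with hcdef
  have hc0 : 0 ≤ c := by positivity
  obtain ⟨h, hh, -, -, hhs⟩ := exists_small_rpow (show 0 < 1 - α by linarith) (c * Γ) one_pos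
    (show (0 : ℝ) < 1 / 2 by norm_num)
  set M := Γ * T with hM
  have hM0 : 0 ≤ M := by positivity
  set B := Γ + Γ * (2 * M / h ^ α) with hB
  have hB0 : 0 ≤ B := by positivity
  set K := 2 * (c * B) with hK
  have hK0 : 0 ≤ K := by positivity
  have hell : ∀ x, IsDegElliptic (A x) := fun x => by
    obtain ⟨σ, -, -, hσ⟩ := hc.ell x (mem_univ _)
    rw [hσ]
    exact isDegElliptic_ellOp e _
  have hAb := fun x => hc.hA.le x (mem_univ _)
  have hbb := fun x => hc.hb.le x (mem_univ _)
  have hstep : ∀ w : {w : ℝ → E → ℝ // Reg α T K w ∧ (∀ t ∈ Icc 0 T, ∀ x, |w t x| ≤ M) ∧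
      ∀ x, ContinuousOn (fun t => w t x) (Icc 0 T)},
      ∃ w' : {w : ℝ → E → ℝ // Reg α T K w ∧ (∀ t ∈ Icc 0 T, ∀ x, |w t x| ≤ M) ∧
      ∀ x, ContinuousOn (fun t => w t x) (Icc 0 T)},
      IsSol A b T (fun t x => G x (w.1 t x)) w'.1 := by
    rintro ⟨w, hw1, hw2, hw3⟩
    set F := B + Γ * (h ^ (1 - α) * K) with hF
    have hF0 : 0 ≤ F := by positivity
    have hs : HolderSource α T F F (fun t x => G x (w t x)) := by
      refine ⟨fun t ht x => (hG0 _ _).trans ?_, fun t ht x y => ?_, fun x => ?_⟩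
      · have h1 : 0 ≤ Γ * (2 * M / h ^ α) := by positivity
        have h2 : 0 ≤ Γ * (h ^ (1 - α) * K) := by positivity
        linarith
      · have h1 := holder_interp hα.le hα1.le hh hM0 hK0 (hw2 t ht) (hw1.lipschitz ht) x y
        calc |G x (w t x) - G y (w t y)| ≤ |G x (w t x) - G y (w t x)| +
              |G y (w t x) - G y (w t y)| := abs_sub_le _ _ _
          _ ≤ Γ * ‖x - y‖ ^ α + Γ * ((h ^ (1 - α) * K + 2 * M / h ^ α) * ‖x - y‖ ^ α) :=
            add_le_add (hG2 _ _ _) ((hG1 _ _ _).trans (mul_le_mul_of_nonneg_left h1 hΓ))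
          _ = _ := by rw [hF, hB]; ring
      · have hl : ContinuousOn (G x) univ :=
          continuousOn_of_lipschitz_abs fun s _ t _ => hG1 x t s
        exact hl.comp (hw3 x) fun _ _ => mem_univ _
    obtain ⟨w', hw', K', hr'⟩ := exists_isSol_global hα hα1 hT hc hF0 hs
    have hr : Reg α T K w' := by
      refine (hest T F K' A b _ w' hT hF0 hc hs hw' hr').mono ?_
      have := mul_le_mul_of_nonneg_right hhs hK0
      calc C * (1 + T) * F = c * B + c * Γ * h ^ (1 - α) * K := by rw [hF]; ring
        _ ≤ c * B + 1 / 2 * K := by linarith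
        _ = K := by rw [hK]; ring
    refine ⟨⟨w', hr, fun t ht x => ?_, fun x => continuousOn_of_lipschitz_abs
      (hw'.lipschitz_time hc hr hs.abs_le x)⟩, hw'⟩
    exact (hw'.abs_le hell hAb hbb (g := fun t => Γ * t) (g' := fun _ => Γ)
      (fun t ht x => (hr.bound t ht).abs_le x (mem_univ _))
      (fun t ht x => (hr.bound t ht).fderiv_le x (mem_univ _))
      (fun t ht x => (hr.bound t ht).D2_le x (mem_univ _))
      (fun t => by simpa using (hasDerivAt_id t).const_mul Γ) (by simp) (fun t ht x => hG0 _ _)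
      ⟨Γ, fun t ht x => hG0 _ _⟩ t ht x).trans (mul_le_mul_of_nonneg_left ht.2 hΓ)
  choose stp hstp using hstep
  let w : ℕ → {w : ℝ → E → ℝ // Reg α T K w ∧ (∀ t ∈ Icc 0 T, ∀ x, |w t x| ≤ M) ∧
      ∀ x, ContinuousOn (fun t => w t x) (Icc 0 T)} := fun n =>
    Nat.rec ⟨fun _ _ => 0, Reg.zero hK0, fun _ _ _ => by simpa using hM0,
      fun _ => continuousOn_const⟩ (fun _ w => stp w) n
  have hws : ∀ n, IsSol A b T (fun t x => G x ((w n).1 t x)) (w (n + 1)).1 := fun n => hstp (w n)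
  set θ := 2 * Γ + 1 with hθ
  have hθ0 : 0 < θ := by linarith
  have hdiff : ∀ n, ∀ t ∈ Icc 0 T, ∀ x,
      |(w (n + 1)).1 t x - (w n).1 t x| ≤ 2 * M / 2 ^ n * Real.exp (θ * t) := by
    intro n
    induction n with
    | zero =>
      intro t ht x
      have h1 := (w 1).2.2.1 t ht x
      have h2 := (w 0).2.2.1 t ht x
      have h3 : 1 ≤ Real.exp (θ * t) := Real.one_le_exp (mul_nonneg hθ0.le ht.1)
      calc |(w (0 + 1)).1 t x - (w 0).1 t x| ≤ 2 * M := (abs_sub _ _).trans (by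
            rw [zero_add]; linarith)
        _ ≤ 2 * M * Real.exp (θ * t) := le_mul_of_one_le_right (by positivity) h3
        _ = _ := by simp
    | succ n ih =>
      intro t ht x
      have hs := (hws (n + 1)).sub (hws n)
      have hr := (w (n + 2)).2.1.sub (w (n + 1)).2.1
      set D := 2 * M / 2 ^ n with hD
      have hD0 : 0 ≤ D := by positivity
      have h1 := hs.abs_le hell hAb hbb
        (g := fun t => Γ * D / θ * (Real.exp (θ * t) - 1))
        (g' := fun t => Γ * (D * Real.exp (θ * t)))
        (fun t ht x => (hr.bound t ht).abs_le x (mem_univ _))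
        (fun t ht x => (hr.bound t ht).fderiv_le x (mem_univ _))
        (fun t ht x => (hr.bound t ht).D2_le x (mem_univ _))
        (fun t => by
          have h2 := ((((hasDerivAt_id t).const_mul θ).exp).sub_const 1).const_mul (Γ * D / θ)
          refine h2.congr_deriv ?_
          simp only [id]
          field_simp)
        (by simp) (fun t ht x => (hG1 _ _ _).trans (mul_le_mul_of_nonneg_left (ih t ht x) hΓ))
        ⟨Γ + Γ, fun t ht x => (abs_sub _ _).trans (add_le_add (hG0 _ _) (hG0 _ _))⟩ t ht x
      refine h1.trans ?_
      have h3 : Γ / θ ≤ 1 / 2 := by rw [div_le_div_iff₀ hθ0 two_pos]; linarith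
      have h4 := Real.exp_pos (θ * t)
      calc Γ * D / θ * (Real.exp (θ * t) - 1) ≤ Γ * D / θ * Real.exp (θ * t) :=
            mul_le_mul_of_nonneg_left (by linarith) (by positivity)
        _ = Γ / θ * (D * Real.exp (θ * t)) := by ring
        _ ≤ 1 / 2 * (D * Real.exp (θ * t)) := mul_le_mul_of_nonneg_right h3 (by positivity)
        _ = _ := by rw [hD, pow_succ]; field_simp
  have hz : Tendsto (fun n : ℕ => 2 * M / 2 ^ n * Real.exp (θ * T)) (hyperfilter ℕ) (𝓝 0) := by
    have := (tendsto_pow_atTop_nhds_zero_of_lt_one (r := (1 / 2 : ℝ)) (by norm_num)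
      (by norm_num)).const_mul (2 * M * Real.exp (θ * T))
    rw [mul_zero] at this
    refine (this.congr fun n => ?_).mono_left Nat.hyperfilter_le_atTop
    rw [div_pow, one_pow]; ring
  have hex : ∀ t x, ∃ y, t ∈ Icc 0 T →
      Tendsto (fun n => (w (n + 1)).1 t x) (hyperfilter ℕ) (𝓝 y) := by
    intro t x
    by_cases ht : t ∈ Icc 0 T
    · obtain ⟨y, hy⟩ := exists_tendsto_of_bounded (hyperfilter ℕ)
        (f := fun n => (w (n + 1)).1 t x)
        (C := M) (Eventually.of_forall fun n => (w (n + 1)).2.2.1 t ht x)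
      exact ⟨y, fun _ => hy⟩
    · exact ⟨0, fun h => absurd h ht⟩
  choose u hu using hex
  have hu' : ∀ t ∈ Icc 0 T, ∀ x, Tendsto (fun n => (w n).1 t x) (hyperfilter ℕ) (𝓝 (u t x)) := by
    intro t ht x
    have h1 : Tendsto (fun n => (w (n + 1)).1 t x - (w n).1 t x) (hyperfilter ℕ) (𝓝 0) :=
      squeeze_zero_norm (fun n => (hdiff n t ht x).trans (mul_le_mul_of_nonneg_left
        (Real.exp_le_exp.2 (mul_le_mul_of_nonneg_left ht.2 hθ0.le)) (by positivity))) hz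
    simpa using (hu t x ht).sub h1
  have hGc : ∀ x, Continuous (G x) := fun x => continuousOn_univ.1
    (continuousOn_of_lipschitz_abs fun s _ t _ => hG1 x t s)
  have hLt : ∀ n, ∀ x, ∀ s ∈ Icc 0 T, ∀ t ∈ Icc 0 T,
      |(w n).1 t x - (w n).1 s x| ≤ (2 * Λ * K + Γ) * |t - s| := by
    intro n x s hs t ht
    cases n with
    | zero =>
      have h0 : (w 0).1 t x - (w 0).1 s x = 0 := sub_self (0 : ℝ)
      rw [h0, abs_zero]; positivity
    | succ n =>
      exact (hws n).lipschitz_time hc (w (n + 1)).2.1 (fun t ht x => hG0 _ _) x s hs t ht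
  have hlim := IsSol.limit (l := hyperfilter ℕ) (A' := fun _ => A) (b' := fun _ => b)
    (A := A) (b := b) (f := fun t x => G x (u t x)) (u := u) hα hT (Eventually.of_forall hws)
    (fun x => tendsto_const_nhds) (fun x => tendsto_const_nhds)
    (fun t ht x => ((hGc x).tendsto _).comp (hu' t ht x))
    (fun t ht x => hu t x ht)
    (fun x₀ => ⟨1, one_pos, max K (max Λ Γ), le_max_of_le_left hK0,
      Eventually.of_forall fun n =>
      ⟨fun t ht => ((w (n + 1)).2.1.bound t ht).mono (subset_univ _) (le_max_left _ _),
        fun x _ => ⟨le_max_of_le_right (le_max_of_le_left (hAb x)),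
          le_max_of_le_right (le_max_of_le_left (hbb x)), fun t ht =>
          le_max_of_le_right (le_max_of_le_right (hG0 _ _))⟩⟩⟩)
    (fun x t ht ε hε => by
      set Q := Γ * (2 * Λ * K + Γ) + 1 with hQ
      have hQ0 : 0 < Q := by positivity
      refine ⟨ε / Q, by positivity, Eventually.of_forall fun n s hs hst => ?_⟩
      calc _ ≤ Γ * |(w n).1 s x - (w n).1 t x| := hG1 _ _ _
        _ ≤ Γ * ((2 * Λ * K + Γ) * |s - t|) :=
          mul_le_mul_of_nonneg_left (hLt n x t ht s hs) hΓ
        _ ≤ Q * |s - t| := by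
          rw [← mul_assoc]; exact mul_le_mul_of_nonneg_right (by linarith) (abs_nonneg _)
        _ ≤ Q * (ε / Q) := mul_le_mul_of_nonneg_left hst.le hQ0.le
        _ = ε := by field_simp)
  refine ⟨u, hlim.1, K, hlim.1.reg hα hc (fun t ht x => hG0 _ _) hK0 fun t ht => ?_⟩
  exact C2BoundOn.of_tendsto (Eventually.of_forall fun n => (w (n + 1)).2.1.bound t ht)
    (fun x => hu t x ht) (fun x => (hlim.2 t ht x).1) (fun x => (hlim.2 t ht x).2)

end Semilinear

section Retraction

variable {E : Type*} [NormedAddCommGroup E] [InnerProductSpace ℝ E] [FiniteDimensional ℝ E]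
  [MeasurableSpace E] [BorelSpace E] {ι : Type*} [Fintype ι]

/-- The radial retraction onto a closed ball. -/
noncomputable def radial (x₀ : E) (r : ℝ) (x : E) : E := x₀ + (r / max r ‖x - x₀‖) • (x - x₀)

variable {x₀ : E} {r : ℝ}

theorem radial_mem (hr : 0 < r) (x : E) : radial x₀ r x ∈ Metric.closedBall x₀ r := by
  have hm : 0 < max r ‖x - x₀‖ := hr.trans_le (le_max_left _ _)
  rw [Metric.mem_closedBall, dist_eq_norm, radial, add_sub_cancel_left, norm_smul,
    Real.norm_of_nonneg (by positivity), div_mul_eq_mul_div, div_le_iff₀ hm]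
  exact mul_le_mul_of_nonneg_left (le_max_right _ _) hr.le

theorem radial_eq_self (hr : 0 < r) {x : E} (hx : x ∈ Metric.closedBall x₀ r) :
    radial x₀ r x = x := by
  rw [Metric.mem_closedBall, dist_eq_norm] at hx
  rw [radial, max_eq_left hx, div_self hr.ne', one_smul, add_sub_cancel]

theorem norm_radial_sub_le (hr : 0 < r) (x y : E) :
    ‖radial x₀ r x - radial x₀ r y‖ ≤ 2 * ‖x - y‖ := by
  set X := x - x₀
  set Y := y - x₀
  have hXY : x - y = X - Y := by simp [X, Y]
  set a := max r ‖X‖ with ha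
  set c := max r ‖Y‖ with hc
  have ha0 : 0 < a := hr.trans_le (le_max_left _ _)
  have hc0 : 0 < c := hr.trans_le (le_max_left _ _)
  have e : radial x₀ r x - radial x₀ r y = (r / a) • (X - Y) + (r / a - r / c) • Y := by
    simp only [radial]
    module
  have h1 : r / a ≤ 1 := (div_le_one ha0).2 (le_max_left _ _)
  have h2 : |c - a| ≤ ‖X - Y‖ := by
    calc |c - a| ≤ |‖Y‖ - ‖X‖| := by
          have := abs_max_sub_max_le_max r ‖Y‖ r ‖X‖
          simpa using this
      _ ≤ ‖Y - X‖ := abs_norm_sub_norm_le _ _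
      _ = _ := norm_sub_rev _ _
  have h3 : |r / a - r / c| * ‖Y‖ ≤ ‖X - Y‖ := by
    have : r / a - r / c = r / a * ((c - a) / c) := by field_simp
    rw [this, abs_mul, abs_of_pos (div_pos hr ha0), abs_div, abs_of_pos hc0]
    have hY : ‖Y‖ ≤ c := le_max_right _ _
    calc r / a * (|c - a| / c) * ‖Y‖ ≤ 1 * (|c - a| / c) * c := by gcongr
      _ = |c - a| := by field_simp
      _ ≤ _ := h2
  rw [e, hXY]
  refine (norm_add_le _ _).trans ?_
  rw [norm_smul, norm_smul, Real.norm_of_nonneg (by positivity), Real.norm_eq_abs]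
  have : r / a * ‖X - Y‖ ≤ 1 * ‖X - Y‖ := by gcongr
  linarith

theorem HB.retract {G : Type*} [NormedAddCommGroup G] {α m : ℝ} (hα : 0 ≤ α) (hα1 : α ≤ 1)
    (hr : 0 < r) {g : E → G} (h : HB α (Metric.closedBall x₀ r) m g) :
    HB α univ (2 * m) (fun x => g (radial x₀ r x)) where
  le x _ := by
    have := h.le _ (radial_mem hr x)
    have := norm_nonneg (g (radial x₀ r x))
    linarith
  holder x _ y _ := by
    have hm : 0 ≤ m := (norm_nonneg _).trans (h.le _ (radial_mem hr x))
    refine (h.holder _ (radial_mem hr x) _ (radial_mem hr y)).trans ?_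
    have h1 : ‖radial x₀ r x - radial x₀ r y‖ ^ α ≤ 2 * ‖x - y‖ ^ α := by
      calc _ ≤ (2 * ‖x - y‖) ^ α :=
            Real.rpow_le_rpow (norm_nonneg _) (norm_radial_sub_le hr x y) hα
        _ = 2 ^ α * ‖x - y‖ ^ α := Real.mul_rpow (by norm_num) (norm_nonneg _)
        _ ≤ _ := by
          gcongr
          calc (2 : ℝ) ^ α ≤ 2 ^ (1 : ℝ) :=
                Real.rpow_le_rpow_of_exponent_le (by norm_num) hα1
            _ = 2 := Real.rpow_one 2
    calc _ ≤ m * (2 * ‖x - y‖ ^ α) := by gcongr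
      _ = _ := by ring

theorem CoefOn.retract {e : OrthonormalBasis ι ℝ E} {α Λ : ℝ} (hα : 0 ≤ α) (hα1 : α ≤ 1)
    (hr : 0 < r) {A : E → Bil E →L[ℝ] ℝ} {b : E → E}
    (h : CoefOn e α Λ (Metric.closedBall x₀ r) A b) :
    CoefOn e α (2 * Λ) univ (fun x => A (radial x₀ r x)) (fun x => b (radial x₀ r x)) where
  ell x _ := by
    obtain ⟨σ, h1, h2, h3⟩ := h.ell _ (radial_mem hr x)
    have := norm_nonneg (σ : E →L[ℝ] E)
    exact ⟨σ, by linarith, by linarith, h3⟩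
  hA := h.hA.retract hα hα1 hr
  hb := h.hb.retract hα hα1 hr

theorem CoefOn.mono_set {e : OrthonormalBasis ι ℝ E} {α Λ : ℝ} {S S' : Set E}
    {A : E → Bil E →L[ℝ] ℝ} {b : E → E} (h : CoefOn e α Λ S A b) (hS : S' ⊆ S) :
    CoefOn e α Λ S' A b :=
  ⟨fun x hx => h.ell x (hS hx), h.hA.mono_set hS, h.hb.mono_set hS⟩

theorem CoefOn.congr {e : OrthonormalBasis ι ℝ E} {α Λ : ℝ} {S : Set E}
    {A A' : E → Bil E →L[ℝ] ℝ} {b b' : E → E} (h : CoefOn e α Λ S A b) (hA : ∀ x ∈ S, A' x = A x)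
    (hb : ∀ x ∈ S, b' x = b x) : CoefOn e α Λ S A' b' :=
  ⟨fun x hx => by rw [hA x hx]; exact h.ell x hx, h.hA.congr hA, h.hb.congr hb⟩

theorem CoefOn.isDegElliptic {e : OrthonormalBasis ι ℝ E} {α Λ : ℝ} {S : Set E}
    {A : E → Bil E →L[ℝ] ℝ} {b : E → E} (h : CoefOn e α Λ S A b) {x : E} (hx : x ∈ S) :
    IsDegElliptic (A x) := by
  obtain ⟨σ, -, -, h3⟩ := h.ell x hx
  rw [h3]
  exact isDegElliptic_ellOp _ _

theorem IsSol.restrict {A : E → Bil E →L[ℝ] ℝ} {b : E → E} {T T' : ℝ} {f u : ℝ → E → ℝ}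
    (h : IsSol A b T f u) (hT : T' ≤ T) : IsSol A b T' f u :=
  ⟨h.init, fun t ht => h.smooth t (Icc_subset_Icc_right hT ht),
    fun t ht x => (h.eqn t (Icc_subset_Icc_right hT ht) x).mono (Icc_subset_Icc_right hT)⟩

/-- A solution with Hölder continuous coefficients near a point has locally Hölder continuous second
derivatives, with the exponent of the coefficients. -/
theorem exists_holdOn {κ κ' Λ T F K : ℝ} (hκ : 0 < κ) (hκ1 : κ < 1) (hT : 0 ≤ T)
    (hF : 0 ≤ F) (hK : 0 ≤ K) {e : OrthonormalBasis ι ℝ E} {A : E → Bil E →L[ℝ] ℝ} {b : E → E}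
    {f u : ℝ → E → ℝ} (x₀ : E)
    (hc : CoefOn e κ Λ (Metric.closedBall x₀ (1 / 2)) A b)
    (hu : IsSolOn (Metric.closedBall x₀ (1 / 2)) A b T f u) (hr : Reg κ' T K u)
    (hu0 : ∀ x, ContinuousOn (fun t => u t x) (Icc 0 T))
    (hf : ∀ t ∈ Icc 0 T, HB κ (Metric.closedBall x₀ (1 / 2)) F (f t))
    (hfc : ∀ x, ContinuousOn (fun t => f t x) (Icc 0 T)) {R : ℝ} (hR : R ≤ 1 / 4) :
    ∃ K', HoldOn κ T u x₀ R K' := by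
  set S := Metric.closedBall x₀ (1 / 2 : ℝ) with hS
  set S' := Metric.closedBall x₀ (2 / 5 : ℝ) with hS'
  have hSS : S' ⊆ S := Metric.closedBall_subset_closedBall (by norm_num)
  obtain ⟨C, hC, hcut⟩ := exists_cutoff E
  obtain ⟨η, hη, hη1, hη0, -, -, q0, q1, q2⟩ := hcut κ x₀ (1 / 3) (2 / 5) hκ1.le (by norm_num)
    (by norm_num) (by norm_num)
  set q := C / ((2 / 5 : ℝ) ^ 2 - (1 / 3) ^ 2) ^ 3
  have hq : 0 ≤ q := by
    have : (0 : ℝ) < (2 / 5 : ℝ) ^ 2 - (1 / 3) ^ 2 := by norm_num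
    positivity
  have hz : ∀ x, x ∉ S' → η x = 0 := fun x hx => hη0 x (by
    rw [hS', Metric.mem_closedBall, dist_eq_norm, not_le] at hx
    exact hx.le)
  have hzS : ∀ x, x ∉ S → η x = 0 := fun x hx => hz x fun h => hx (hSS h)
  have hr2 : (0 : ℝ) < 1 / 2 := by norm_num
  set A' : E → Bil E →L[ℝ] ℝ := fun x => A (radial x₀ (1 / 2) x)
  set b' : E → E := fun x => b (radial x₀ (1 / 2) x)
  have hc' : CoefOn e κ (2 * Λ) univ A' b' := hc.retract hκ.le hκ1.le hr2
  have hΛ0 : 0 ≤ Λ := (norm_nonneg _).trans (hc.hb.le x₀ (Metric.mem_closedBall_self hr2.le))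
  have hw := hu.mul_cutoff (A' := A') (b' := b') Metric.isClosed_closedBall hη hzS
  set N := 2 * q * F + 24 * (2 * Λ) * q * K with hN
  have hN0 : 0 ≤ N := by positivity
  have hlow : ∀ t ∈ Icc 0 T, HB κ S N (fun x => cutSource A A' b b' η f u t x) := by
    intro t ht
    obtain ⟨g1, g2⟩ := HB.of_C2 hκ1.le (x₀ := x₀) (R := 1 / 2) le_rfl hK (hr.smooth t ht)
      (fun x _ => (hr.bound t ht).abs_le x trivial) (fun x _ => (hr.bound t ht).fderiv_le x trivial)
      (fun x _ => (hr.bound t ht).D2_le x trivial)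
    refine (HB.cutLow (hc'.hA.mono_set (subset_univ S)) (hc.hb.mono (by linarith))
      (hc'.hb.mono_set (subset_univ S)) q0 q1 q2 (hf t ht) g1 g2).congr fun x hx => ?_
    have : A' x = A x := by simp only [A', radial_eq_self hr2 hx]
    simp [cutSource, this]
  have hsrc : HolderSource κ T N N (cutSource A A' b b' η f u) := by
    refine ⟨fun t ht x => ?_, fun t ht x y => ?_, fun x => ?_⟩
    · by_cases hx : x ∈ S
      · exact (hlow t ht).le x hx
      · rw [cutSource_eq_zero Metric.isClosed_closedBall hzS _ _ _ _ _ _ _ hx, abs_zero]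
        exact hN0
    · refine holder_of_holder_closedBall hκ hN0 (R := 1 / 2) (ρ := 2 / 5) (x₀ := x₀) (by norm_num)
        (fun x hx => ?_) (fun x hx y hy => (hlow t ht).holder x hx y hy) x y
      exact cutSource_eq_zero Metric.isClosed_closedBall hz _ _ _ _ _ _ _ hx
    · exact continuousOn_cutSource (hfc x) (hu0 x) (hr.c1 x) (hr.c2 x)
  obtain ⟨w, hw', K₁, hK₁⟩ := exists_isSol_global hκ hκ1 hT hc' hN0 hsrc
  have hbd := fun t (ht : t ∈ Icc 0 T) => mul_cutoff_bounds hη (hr.smooth t ht)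
    (S := S) Metric.isClosed_closedBall hzS hK hq (fun x hx => q0.le x hx)
    (fun x hx => q1.le x hx) (fun x hx => q2.le x hx)
    (fun x _ => (hr.bound t ht).abs_le x trivial) (fun x _ => (hr.bound t ht).fderiv_le x trivial)
    (fun x _ => (hr.bound t ht).D2_le x trivial)
  set K₂ := max (4 * (q * K)) K₁
  have huniq := IsSol.unique (fun x => hc'.isDegElliptic (mem_univ x))
      (fun x => hc'.hA.le x trivial)
    (fun x => hc'.hb.le x trivial) hw hw' (K := K₂)
    (fun t ht x => ((hbd t ht).1 x).trans (le_max_left _ _))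
    (fun t ht x => ((hbd t ht).2.1 x).trans (le_max_left _ _))
    (fun t ht x => ((hbd t ht).2.2 x).trans (le_max_left _ _))
    (fun t ht x => ((hK₁.bound t ht).abs_le x trivial).trans (le_max_right _ _))
    (fun t ht x => ((hK₁.bound t ht).fderiv_le x trivial).trans (le_max_right _ _))
    (fun t ht x => ((hK₁.bound t ht).D2_le x trivial).trans (le_max_right _ _))
  have hD : ∀ t ∈ Icc 0 T, ∀ x ∈ Metric.closedBall x₀ R, D2 (u t) x = D2 (w t) x := by
    intro t ht x hx
    have hx' : x ∈ Metric.ball x₀ (1 / 3) := by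
      rw [Metric.mem_closedBall] at hx
      rw [Metric.mem_ball]
      linarith
    have hev : w t =ᶠ[𝓝 x] u t := by
      filter_upwards [Metric.isOpen_ball.mem_nhds hx'] with y hy
      rw [← huniq t ht]
      rw [Metric.mem_ball, dist_eq_norm] at hy
      simp [hη1 y hy.le]
    exact (hev.fderiv.fderiv_eq).symm
  exact ⟨K₁, fun t ht x hx y hy => by
    rw [hD t ht x hx, hD t ht y hy]
    exact (hK₁.bound t ht).holder x trivial y trivial⟩

end Retraction

section Capped

variable {E : Type*} [NormedAddCommGroup E] [InnerProductSpace ℝ E] [FiniteDimensional ℝ E]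
  [MeasurableSpace E] [BorelSpace E] {ι : Type*} [Fintype ι]

theorem abs_rpow_sub_rpow_le {p Y x y : ℝ} (hp : 1 ≤ p) (hx : x ∈ Icc 0 Y) (hy : y ∈ Icc 0 Y) :
    |x ^ p - y ^ p| ≤ p * Y ^ (p - 1) * |x - y| := by
  refine (convex_Icc 0 Y).norm_image_sub_le_of_norm_hasDerivWithin_le
    (f' := fun x => p * x ^ (p - 1))
    (fun z _ => (Real.hasDerivAt_rpow_const (Or.inr hp)).hasDerivWithinAt) (fun z hz => ?_) hy hx
  rw [Real.norm_eq_abs, abs_of_nonneg (mul_nonneg (by linarith) (Real.rpow_nonneg hz.1 _))]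
  exact mul_le_mul_of_nonneg_left (Real.rpow_le_rpow hz.1 hz.2 (by linarith)) (by linarith)

theorem Lop_mul_add_const {A : E → Bil E →L[ℝ] ℝ} {b : E → E} {φ : E → ℝ} (hφ : ContDiff ℝ 2 φ)
    (c k : ℝ) (x : E) : Lop A b (fun x => c * φ x + k) x = c * Lop A b φ x := by
  have h0 : Lop A b (fun _ => k) x = 0 := by
    have h1 : fderiv ℝ (fun _ : E => k) = fun _ => 0 := by ext1 y; simp
    have h2 : D2 (fun _ : E => k) x = 0 := by
      unfold D2
      rw [h1]
      simp
      rfl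
    simp [Lop, h1, h2]
  rw [Lop_add (hφ := contDiff_const.mul hφ) (hψ := contDiff_const), Lop_const_mul hφ, h0, add_zero]

/-- Truncation to the interval `[0, Y]`. -/
noncomputable def clip (Y y : ℝ) : ℝ := max 0 (min y Y)

theorem clip_mem {Y : ℝ} (hY : 0 ≤ Y) (y : ℝ) : clip Y y ∈ Icc 0 Y :=
  ⟨le_max_left _ _, max_le hY (min_le_right _ _)⟩

theorem clip_eq_self {Y y : ℝ} (hy : y ∈ Icc 0 Y) : clip Y y = y := by
  rw [clip, min_eq_left hy.2, max_eq_right hy.1]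

theorem abs_clip_sub_le (Y y y' : ℝ) : |clip Y y - clip Y y'| ≤ |y - y'| := by
  have h1 := abs_max_sub_max_le_max 0 (min y Y) 0 (min y' Y)
  have h2 := abs_min_sub_min_le_max y Y y' Y
  simp only [sub_self, abs_zero, abs_nonneg, sup_of_le_right, sup_of_le_left] at h1 h2
  exact h1.trans h2

/-- The logistic nonlinearity, truncated and modified by a penalty pushing up to `M`. -/
noncomputable def capSource (al be m : E → ℝ) (p N M Y : ℝ) (x : E) (y : ℝ) : ℝ :=
  be x * clip Y y - al x * clip Y y ^ p + N * m x * (M - clip Y y)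

theorem capSource_bounds {κ Λ p N M Y : ℝ} {al be m : E → ℝ} (hal : HB κ univ Λ al)
    (hbe : HB κ univ Λ be) (hm : HB κ univ 2 m) (hp : 1 ≤ p) (hN : 0 ≤ N) (hM : 0 ≤ M)
    (hY : 0 ≤ Y) :
    ∃ Γ : ℝ, 0 ≤ Γ ∧ (∀ x y, |capSource al be m p N M Y x y| ≤ Γ) ∧
      (∀ x y y', |capSource al be m p N M Y x y - capSource al be m p N M Y x y'| ≤ Γ * |y - y'|) ∧
      ∀ x x' y, |capSource al be m p N M Y x y - capSource al be m p N M Y x' y| ≤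
        Γ * ‖x - x'‖ ^ κ := by
  have hΛ : 0 ≤ Λ := (norm_nonneg _).trans (hal.le 0 trivial)
  set P := p * Y ^ (p - 1) with hP
  have hP0 : 0 ≤ P := mul_nonneg (by linarith) (Real.rpow_nonneg hY _)
  have hYp : 0 ≤ Y ^ p := Real.rpow_nonneg hY _
  have hc : ∀ y, |clip Y y| ≤ Y := fun y => by
    rw [abs_of_nonneg (clip_mem hY y).1]; exact (clip_mem hY y).2
  have hcp : ∀ y, |clip Y y ^ p| ≤ Y ^ p := fun y => by
    rw [abs_of_nonneg (Real.rpow_nonneg (clip_mem hY y).1 _)]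
    exact Real.rpow_le_rpow (clip_mem hY y).1 (clip_mem hY y).2 (by linarith)
  have hcM : ∀ y, |M - clip Y y| ≤ M + Y := fun y => by
    have := abs_sub M (clip Y y)
    have := hc y
    have := abs_of_nonneg hM
    linarith
  have hal0 : ∀ x, |al x| ≤ Λ := fun x => hal.le x trivial
  have hbe0 : ∀ x, |be x| ≤ Λ := fun x => hbe.le x trivial
  have hm0 : ∀ x, |m x| ≤ 2 := fun x => hm.le x trivial
  have habs : ∀ a b c : ℝ, |a - b + c| ≤ |a| + |b| + |c| := fun a b c =>
    (abs_add_le _ _).trans (by linarith [abs_sub a b])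
  have hprod : ∀ {a b B C : ℝ}, |a| ≤ B → |b| ≤ C → |a * b| ≤ B * C := fun {a b B C} h1 h2 => by
    rw [abs_mul]
    exact mul_le_mul h1 h2 (abs_nonneg _) ((abs_nonneg _).trans h1)
  refine ⟨Λ * Y + Λ * Y ^ p + N * 2 * (M + Y) + (Λ + Λ * P + N * 2), by positivity,
    fun x y => ?_, fun x y y' => ?_, fun x x' y => ?_⟩
  · refine (habs _ _ _).trans ?_
    have h1 := hprod (hbe0 x) (hc y)
    have h2 := hprod (hal0 x) (hcp y)
    have h3 := hprod (hprod (abs_of_nonneg hN).le (hm0 x)) (hcM y)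
    have : 0 ≤ Λ + Λ * P + N * 2 := by positivity
    linarith
  · have e : capSource al be m p N M Y x y - capSource al be m p N M Y x y' =
        be x * (clip Y y - clip Y y') - al x * (clip Y y ^ p - clip Y y' ^ p) +
          N * m x * (clip Y y' - clip Y y) := by
      simp only [capSource]; ring
    rw [e]
    refine (habs _ _ _).trans ?_
    have hd := abs_clip_sub_le Y y y'
    have h1 := hprod (hbe0 x) hd
    have h2 := hprod (hal0 x) ((abs_rpow_sub_rpow_le hp (clip_mem hY y) (clip_mem hY y')).trans
      (mul_le_mul_of_nonneg_left hd hP0))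
    have h3 := hprod (hprod (abs_of_nonneg hN).le (hm0 x)) ((abs_sub_comm _ _).trans_le hd)
    have : 0 ≤ (Λ * Y + Λ * Y ^ p + N * 2 * (M + Y)) * |y - y'| := by positivity
    linarith
  · have e : capSource al be m p N M Y x y - capSource al be m p N M Y x' y =
        (be x - be x') * clip Y y - (al x - al x') * clip Y y ^ p +
          N * (m x - m x') * (M - clip Y y) := by
      simp only [capSource]; ring
    rw [e]
    refine (habs _ _ _).trans ?_
    have h1 := hprod (hbe.holder x trivial x' trivial) (hc y)
    have h2 := hprod (hal.holder x trivial x' trivial) (hcp y)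
    have h3 := hprod (hprod (abs_of_nonneg hN).le (hm.holder x trivial x' trivial)) (hcM y)
    have : 0 ≤ (Λ + Λ * P + N * 2) * ‖x - x'‖ ^ κ := by positivity
    linarith

/-- The capped semilinear problem has a solution between `0` and `M * exp (K * t)`. -/
theorem exists_isSol_capped {κ Λ p N M K Y T : ℝ} (hκ : 0 < κ) (hκ1 : κ < 1) (hT : 0 ≤ T)
    (hΛ : 1 ≤ Λ) {e : OrthonormalBasis ι ℝ E} {A : E → Bil E →L[ℝ] ℝ} {b : E → E}
    (hc : CoefOn e κ Λ univ A b) {al be m : E → ℝ} (hal : HB κ univ Λ al)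
    (hbe : HB κ univ Λ be) (hm : HB κ univ 2 m) (hp : 1 ≤ p) (hN : 0 ≤ N) (hM : 0 ≤ M)
    (hK : 0 ≤ K) (hY : M * Real.exp (K * T) ≤ Y) (hal0 : ∀ x, 0 ≤ al x) (hbeK : ∀ x, be x ≤ K)
    (hm0 : ∀ x, 0 ≤ m x) :
    ∃ u, IsSol A b T (fun t x => capSource al be m p N M Y x (u t x)) u ∧ (∃ K', Reg κ T K' u) ∧
      ContinuousOn (fun q : ℝ × E => u q.1 q.2) (Icc 0 T ×ˢ univ) ∧
      ∀ t ∈ Icc 0 T, ∀ x, 0 ≤ u t x ∧ u t x ≤ M * Real.exp (K * t) := by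
  have hY0 : 0 ≤ Y := le_trans (by positivity) hY
  obtain ⟨Γ, hΓ, hG0, hG1, hG2⟩ := capSource_bounds hal hbe hm hp hN hM hY0
  obtain ⟨u, hu, K', hr⟩ := exists_isSol_semilinear hκ hκ1 hT hΛ hc hΓ hG0 hG1 hG2
  have hjoint : ContinuousOn (fun q : ℝ × E => u q.1 q.2) (Icc 0 T ×ˢ univ) :=
    continuousOn_of_lipschitz_time (fun t ht => (hu.smooth t ht).continuous) fun x₀ =>
      ⟨1, one_pos, _, fun x _ => hu.lipschitz_time hc hr (fun t _ x => hG0 x (u t x)) x⟩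
  have hb0 : ∀ t ∈ Icc 0 T, ∀ x, |u t x| ≤ K' := fun t ht x => (hr.bound t ht).abs_le x trivial
  have hell : ∀ x, IsDegElliptic (A x) := fun x => hc.isDegElliptic (mem_univ x)
  have hlow : ∀ t ∈ Icc 0 T, ∀ x, (-1) * u t x + 0 ≤ 0 := by
    refine max_principle_whole (M := K') hell (fun x => hc.hA.le x trivial)
      (fun x => hc.hb.le x trivial) (z := fun t x => (-1) * u t x + 0) ?_ ?_ ?_ ?_ ?_
    · exact (continuousOn_const.mul hjoint).add continuousOn_const
    · intro t ht x
      have := neg_abs_le (u t x)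
      linarith [hb0 t ht x]
    · intro x
      simp [hu.init x]
    · exact fun t ht => (contDiff_const.mul (hu.smooth t ht)).add contDiff_const
    · intro t ht x hz
      refine ⟨_, ((hu.eqn t ht x).const_mul (-1)).add_const 0, ?_⟩
      rw [Lop_mul_add_const (hu.smooth t ht)]
      have hcl : clip Y (u t x) = 0 := by
        rw [clip, max_eq_left]
        exact (min_le_left _ _).trans (by linarith)
      have : 0 ≤ capSource al be m p N M Y x (u t x) := by
        have := mul_nonneg (mul_nonneg hN (hm0 x)) hM
        simp only [capSource, hcl, Real.zero_rpow (show p ≠ 0 by linarith)]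
        linarith
      linarith
  have hup : ∀ t ∈ Icc 0 T, ∀ x, Real.exp (-K * t) * u t x + (-M) ≤ 0 := by
    refine max_principle_whole (M := K') hell (fun x => hc.hA.le x trivial)
      (fun x => hc.hb.le x trivial) (z := fun t x => Real.exp (-K * t) * u t x + (-M)) ?_ ?_ ?_ ?_ ?_
    · refine (ContinuousOn.mul ?_ hjoint).add continuousOn_const
      exact Continuous.continuousOn (by fun_prop)
    · intro t ht x
      have h1 : Real.exp (-K * t) ≤ 1 := Real.exp_le_one_iff.2 (by nlinarith [ht.1])
      have h2 : Real.exp (-K * t) * u t x ≤ 1 * K' := by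
        have := hlow t ht x
        have h3 := (le_abs_self _).trans (hb0 t ht x)
        exact mul_le_mul h1 h3 (by linarith) zero_le_one
      linarith
    · intro x
      simp [hu.init x, hM]
    · exact fun t ht => (contDiff_const.mul (hu.smooth t ht)).add contDiff_const
    · intro t ht x hz
      have hexp : HasDerivWithinAt (fun s : ℝ => Real.exp (-K * s)) (Real.exp (-K * t) * (-K * 1))
          (Icc 0 T) t := (((hasDerivAt_id t).const_mul (-K)).exp).hasDerivWithinAt
      refine ⟨_, (hexp.mul (hu.eqn t ht x)).add_const (-M), ?_⟩
      rw [Lop_mul_add_const (hu.smooth t ht)]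
      set E' := Real.exp (-K * t) with hE'
      have hEpos : 0 < E' := Real.exp_pos _
      have hE1 : E' ≤ 1 := Real.exp_le_one_iff.2 (by nlinarith [ht.1])
      have hz' : M < E' * u t x := by
        have hz2 : 0 < E' * u t x + (-M) := hz
        linarith
      have hu0 : 0 ≤ u t x := by have := hlow t ht x; linarith
      have huM : M ≤ u t x := by nlinarith
      have hYM : M ≤ Y := by
        have : 1 ≤ Real.exp (K * T) := Real.one_le_exp (by positivity)
        nlinarith
      have hclM : M ≤ clip Y (u t x) := le_max_of_le_right (le_min huM hYM)
      have hclu : clip Y (u t x) ≤ u t x := max_le hu0 (min_le_left _ _)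
      have hG : capSource al be m p N M Y x (u t x) ≤ K * u t x := by
        have h1 : be x * clip Y (u t x) ≤ K * u t x :=
          (mul_le_mul_of_nonneg_right (hbeK x) (by linarith)).trans
            (mul_le_mul_of_nonneg_left hclu hK)
        have h2 : 0 ≤ al x * clip Y (u t x) ^ p :=
          mul_nonneg (hal0 x) (Real.rpow_nonneg (by linarith) _)
        have h3 : N * m x * (M - clip Y (u t x)) ≤ 0 :=
          mul_nonpos_of_nonneg_of_nonpos (mul_nonneg hN (hm0 x)) (by linarith)
        simp only [capSource]
        linarith
      have := mul_le_mul_of_nonneg_left hG hEpos.le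
      linarith
  refine ⟨u, hu, ⟨K', hr⟩, hjoint, fun t ht x => ⟨by have := hlow t ht x; linarith, ?_⟩⟩
  have h1 := hup t ht x
  have h2 : Real.exp (-K * t) * Real.exp (K * t) = 1 := by rw [← Real.exp_add]; simp
  have h3 := mul_le_mul_of_nonneg_right (show Real.exp (-K * t) * u t x ≤ M by linarith)
    (Real.exp_pos (K * t)).le
  have h4 : Real.exp (-K * t) * u t x * Real.exp (K * t) = u t x := by
    rw [mul_right_comm, h2, one_mul]
  linarith

end Capped

section Approximation

variable {E : Type*} [NormedAddCommGroup E] [InnerProductSpace ℝ E] [FiniteDimensional ℝ E]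
  [MeasurableSpace E] [BorelSpace E] {ι : Type*} [Fintype ι]

/-- Coefficients that are Hölder continuous on every ball, with an exponent depending on the
ball. -/
def LocalCoef (e : OrthonormalBasis ι ℝ E) (A : E → Bil E →L[ℝ] ℝ) (b : E → E) (al be : E → ℝ) :
    Prop :=
  ∀ r : ℝ, 0 < r → ∃ κ Λ : ℝ, 0 < κ ∧ κ < 1 ∧ 1 ≤ Λ ∧ CoefOn e κ Λ (Metric.closedBall 0 r) A b ∧
    HB κ (Metric.closedBall 0 r) Λ al ∧ HB κ (Metric.closedBall 0 r) Λ be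

/-- A bounded subsolution of the semilinear equation with zero initial values. -/
structure IsSubsol (A : E → Bil E →L[ℝ] ℝ) (b : E → E) (al be : E → ℝ) (p M : ℝ)
    (w : ℝ → E → ℝ) : Prop where
  cont : ContinuousOn (fun q : ℝ × E => w q.1 q.2) (Ici 0 ×ˢ univ)
  nonneg : ∀ t, 0 ≤ t → ∀ x, 0 ≤ w t x
  le : ∀ t, 0 ≤ t → ∀ x, w t x ≤ M
  init : ∀ x, w 0 x = 0
  smooth : ∀ t, 0 < t → ContDiff ℝ 2 (w t)
  eqn : ∀ t, 0 < t → ∀ x, ∃ wt, HasDerivAt (fun s => w s x) wt t ∧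
    wt ≤ Lop A b (w t) x + (be x * w t x - al x * w t x ^ p)

theorem exists_outer_cutoff (E : Type*) [NormedAddCommGroup E] [InnerProductSpace ℝ E]
    [FiniteDimensional ℝ E] {r R : ℝ} (hr : 0 < r) (hR : r < R) :
    ∃ φ : E → ℝ, ContDiff ℝ 2 φ ∧ (∀ x, 0 ≤ φ x) ∧ (∀ x, ‖x‖ ≤ r → φ x = 0) ∧
      ∀ x, R ≤ ‖x‖ → φ x = 1 := by
  let B : ContDiffBump (0 : E) := ⟨r, R, hr, hR⟩
  refine ⟨fun x => 1 - B x, contDiff_const.sub B.contDiff, fun x => sub_nonneg.2 B.le_one,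
    fun x hx => ?_, fun x hx => ?_⟩
  · beta_reduce
    rw [B.one_of_mem_closedBall (by simpa using hx), sub_self]
  · beta_reduce
    rw [B.zero_of_le_dist (by simpa using hx), sub_zero]

/-- A solution of the capped problem dominates the subsolution up to a small error. -/
theorem IsSubsol.le_capped {κ Λ p N M K Y T ε r : ℝ} {e : OrthonormalBasis ι ℝ E}
    {A : E → Bil E →L[ℝ] ℝ} {b : E → E} (hc : CoefOn e κ Λ univ A b) {al be m : E → ℝ}
    (hp : 1 ≤ p) (hN : 0 ≤ N) (hM : 0 ≤ M) (hK : 0 ≤ K)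
    (hY : M * Real.exp (K * T) ≤ Y) (hal0 : ∀ x, 0 ≤ al x) (hbeK : ∀ x, be x ≤ K) (hε : 0 < ε)
    {w u : ℝ → E → ℝ} {φ : E → ℝ} (hφ : ContDiff ℝ 2 φ) (hφ0 : ∀ x, 0 ≤ φ x)
    (hφ1 : ∀ x, r ≤ ‖x‖ → φ x = 1) (hφN : ∀ x, ‖x‖ ≤ r → M * |Lop A b φ x| ≤ N * m x * ε)
    (hm0 : ∀ x, 0 ≤ m x) {A' : E → Bil E →L[ℝ] ℝ} {b' : E → E} {al' be' : E → ℝ}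
    (hw : IsSubsol A' b' al' be' p M w)
    (hA : ∀ x, ‖x‖ ≤ r → A x = A' x) (hb : ∀ x, ‖x‖ ≤ r → b x = b' x)
    (hal : ∀ x, ‖x‖ ≤ r → al x = al' x) (hbe : ∀ x, ‖x‖ ≤ r → be x = be' x)
    (hu : IsSol A b T (fun t x => capSource al be m p N M Y x (u t x)) u)
    (huc : ContinuousOn (fun q : ℝ × E => u q.1 q.2) (Icc 0 T ×ˢ univ))
    (hub : ∀ t ∈ Icc 0 T, ∀ x, 0 ≤ u t x ∧ u t x ≤ M * Real.exp (K * t)) :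
    ∀ t ∈ Icc 0 T, ∀ x ∈ Metric.closedBall 0 r,
      Real.exp (-(K + 1) * t) * (w t x - u t x) + (-ε) - M * φ x ≤ 0 := by
  refine max_principle_compact (A := A) (b := b) (fun x => hc.isDegElliptic (mem_univ x))
    (isCompact_closedBall 0 r)
    (z := fun t x => Real.exp (-(K + 1) * t) * (w t x - u t x) + (-ε) - M * φ x) ?_ ?_
  · have hw' := hw.cont.mono (show Icc 0 T ×ˢ Metric.closedBall (0 : E) r ⊆ Ici 0 ×ˢ univ from
      fun q hq => ⟨hq.1.1, trivial⟩)
    have hu' := huc.mono (show Icc 0 T ×ˢ Metric.closedBall (0 : E) r ⊆ Icc 0 T ×ˢ univ from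
      fun q hq => ⟨hq.1, trivial⟩)
    have h1 : Continuous fun q : ℝ × E => Real.exp (-(K + 1) * q.1) := by fun_prop
    have h2 : Continuous fun q : ℝ × E => M * φ q.2 :=
      continuous_const.mul (hφ.continuous.comp continuous_snd)
    exact ((h1.continuousOn.mul (hw'.sub hu')).add continuousOn_const).sub h2.continuousOn
  · intro t ht x hx hz
    have hxr : ‖x‖ ≤ r := by simpa using hx
    have ht0 : 0 < t := by
      rcases ht.1.eq_or_lt with h | h
      · exfalso
        rw [← h] at hz
        simp only [hw.init, hu.init] at hz
        have := mul_nonneg hM (hφ0 x)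
        linarith
      · exact h
    set E' := Real.exp (-(K + 1) * t) with hE'
    have hEpos : 0 < E' := Real.exp_pos _
    have hE1 : E' ≤ 1 := Real.exp_le_one_iff.2 (by nlinarith)
    obtain ⟨hu0, hu1⟩ := hub t ht x
    have hwM := hw.le t ht.1 x
    have hw0 := hw.nonneg t ht.1 x
    have hMφ := mul_nonneg hM (hφ0 x)
    have hz1 : ε + M * φ x < E' * (w t x - u t x) := by
      have : 0 < E' * (w t x - u t x) + (-ε) - M * φ x := hz
      linarith
    have hwu : 0 < w t x - u t x := by
      by_contra! h
      have := mul_nonpos_of_nonneg_of_nonpos hEpos.le h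
      linarith
    have hxlt : ‖x‖ < r := by
      rcases hxr.eq_or_lt with h | h
      · exfalso
        rw [hφ1 x h.ge] at hz1
        nlinarith
      · exact h
    have hYT : M * Real.exp (K * t) ≤ Y := by
      refine le_trans ?_ hY
      gcongr
      exact ht.2
    have hcl : clip Y (u t x) = u t x := clip_eq_self ⟨hu0, hu1.trans hYT⟩
    obtain ⟨wt, hwt, hwle⟩ := hw.eqn t ht0 x
    have hsm : ContDiff ℝ 2 (fun x => w t x - u t x) := (hw.smooth t ht0).sub (hu.smooth t ht)
    have hexp : HasDerivWithinAt (fun s : ℝ => Real.exp (-(K + 1) * s)) (E' * (-(K + 1) * 1))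
        (Icc 0 T) t := (((hasDerivAt_id t).const_mul (-(K + 1))).exp).hasDerivWithinAt
    refine ⟨ht0, ?_, ((contDiff_const.mul hsm).add contDiff_const).sub (contDiff_const.mul hφ), _,
      ((hexp.mul (hwt.hasDerivWithinAt.sub (hu.eqn t ht x))).add_const (-ε)).sub_const (M * φ x),
      ?_⟩
    · rw [mem_interior_iff_mem_nhds]
      exact mem_of_superset (Metric.isOpen_ball.mem_nhds (by simpa using hxlt))
        Metric.ball_subset_closedBall
    rw [Lop_sub ((contDiff_const.mul hsm).add contDiff_const) (contDiff_const.mul hφ),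
      Lop_mul_add_const hsm, Lop_const_mul hφ, Lop_sub (hw.smooth t ht0) (hu.smooth t ht)]
    have hLw : Lop A' b' (w t) x = Lop A b (w t) x := by
      simp only [Lop, hA x hxr, hb x hxr]
    rw [hLw, ← hal x hxr, ← hbe x hxr] at hwle
    simp only [Pi.sub_apply, capSource, hcl]
    have hpow : u t x ^ p ≤ w t x ^ p := Real.rpow_le_rpow hu0 (by linarith) (by linarith)
    have h1 : al x * u t x ^ p ≤ al x * w t x ^ p := mul_le_mul_of_nonneg_left hpow (hal0 x)
    have h2 : be x * (w t x - u t x) ≤ K * (w t x - u t x) :=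
      mul_le_mul_of_nonneg_right (hbeK x) hwu.le
    have hNm : 0 ≤ N * m x := mul_nonneg hN (hm0 x)
    have h3 : N * m x * ε ≤ E' * (N * m x * (M - u t x)) := by
      have : ε ≤ E' * (M - u t x) :=
        (by linarith : ε ≤ E' * (w t x - u t x)).trans
          (mul_le_mul_of_nonneg_left (by linarith) hEpos.le)
      calc _ ≤ N * m x * (E' * (M - u t x)) := mul_le_mul_of_nonneg_left this hNm
        _ = _ := by ring
    have h4 := hφN x hxr
    have h5 : M * Lop A b φ x ≤ M * |Lop A b φ x| := mul_le_mul_of_nonneg_left (le_abs_self _) hM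
    have h6 : wt - (Lop A b (u t) x + (be x * u t x - al x * u t x ^ p + N * m x * (M - u t x))) ≤
        Lop A b (w t) x - Lop A b (u t) x + K * (w t x - u t x) - N * m x * (M - u t x) := by
      linarith
    have h7 := mul_le_mul_of_nonneg_left h6 hEpos.le
    have h8 : 0 < E' * (w t x - u t x) := mul_pos hEpos hwu
    linarith

/-- Solutions of the semilinear equation on large balls that dominate the subsolution up to a small
error. -/
theorem IsSubsol.exists_approx {p M K : ℝ} {e : OrthonormalBasis ι ℝ E} {A : E → Bil E →L[ℝ] ℝ}
    {b : E → E} {al be : E → ℝ} (hloc : LocalCoef e A b al be) (hp : 1 ≤ p) (hM : 0 ≤ M)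
    (hK : 0 ≤ K) (hal0 : ∀ x, 0 ≤ al x) (hbeK : ∀ x, be x ≤ K) {w : ℝ → E → ℝ}
    (hw : IsSubsol A b al be p M w) {n : ℝ} (hn : 0 < n) :
    ∃ (A' : E → Bil E →L[ℝ] ℝ) (b' : E → E) (f u : ℝ → E → ℝ), IsSol A' b' n f u ∧
      (∀ x ∈ Metric.closedBall (0 : E) n, A' x = A x ∧ b' x = b x ∧
        ∀ t ∈ Icc 0 n, f t x = be x * u t x - al x * u t x ^ p) ∧
      (∃ κ K', Reg κ n K' u) ∧ ContinuousOn (fun q : ℝ × E => u q.1 q.2) (Icc 0 n ×ˢ univ) ∧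
      (∀ x, ContinuousOn (fun t => f t x) (Icc 0 n)) ∧
      (∀ t ∈ Icc 0 n, ∀ x, 0 ≤ u t x ∧ u t x ≤ M * Real.exp (K * t)) ∧
      ∀ t ∈ Icc 0 n, ∀ x ∈ Metric.closedBall (0 : E) n,
        w t x ≤ u t x + Real.exp ((K + 1) * t) / n := by
  have hr : 0 < n + 2 := by linarith
  obtain ⟨κ, Λ, hκ, hκ1, hΛ, hc, hal, hbe⟩ := hloc (n + 2) hr
  set P : E → E := radial 0 (n + 2) with hP
  have hPx : ∀ x : E, ‖x‖ ≤ n + 2 → P x = x := fun x hx =>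
    radial_eq_self hr (by simpa using hx)
  have hc' := hc.retract hκ.le hκ1.le hr
  have hal' := hal.retract hκ.le hκ1.le hr
  have hbe' := hbe.retract hκ.le hκ1.le hr
  set m : E → ℝ := fun x => clip 1 (‖x‖ - n) with hm
  have hmm := fun x : E => clip_mem zero_le_one (‖x‖ - n)
  have hmHB : HB κ univ 2 m := by
    have := HB.of_lipschitz_univ (α := κ) (m := 1) hκ.le hκ1.le zero_le_one (g := m)
      (fun x => by rw [Real.norm_eq_abs, abs_of_nonneg (hmm x).1]; exact (hmm x).2)
      (fun x y => by
        refine (abs_clip_sub_le _ _ _).trans ?_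
        rw [sub_sub_sub_cancel_right, one_mul]
        exact abs_norm_sub_norm_le _ _)
    simpa using this
  obtain ⟨φ, hφ, hφ0, hφz, hφ1⟩ := exists_outer_cutoff E (r := n + 1) (R := n + 2) (by linarith)
    (by linarith)
  set A' : E → Bil E →L[ℝ] ℝ := fun x => A (P x)
  set b' : E → E := fun x => b (P x)
  obtain ⟨C₁, hC₁⟩ := (isCompact_closedBall (0 : E) (n + 2)).exists_bound_of_continuousOn
    (continuous_fderiv_of_C2 hφ).continuousOn
  obtain ⟨C₂, hC₂⟩ := (isCompact_closedBall (0 : E) (n + 2)).exists_bound_of_continuousOn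
    (continuous_D2 hφ).continuousOn
  set C := max C₁ C₂
  have hCL : ∀ x : E, ‖x‖ ≤ n + 2 → |Lop A' b' φ x| ≤ 2 * (2 * Λ) * C := fun x hx =>
    abs_Lop_le (by linarith) (hc'.hA.le x trivial) (hc'.hb.le x trivial)
      ((hC₁ x (by simpa using hx)).trans (le_max_left _ _))
      ((hC₂ x (by simpa using hx)).trans (le_max_right _ _))
  have hC0 : 0 ≤ C := (norm_nonneg _).trans
    ((hC₁ 0 (by simpa using hr.le)).trans (le_max_left _ _))
  set N := M * (2 * (2 * Λ) * C) * n with hN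
  have hN0 : 0 ≤ N := by positivity
  have hφN : ∀ x : E, ‖x‖ ≤ n + 2 → M * |Lop A' b' φ x| ≤ N * m x * (1 / n) := by
    intro x hx
    rcases lt_or_ge ‖x‖ (n + 1) with h | h
    · have hev : φ =ᶠ[𝓝 x] fun _ => 0 := by
        filter_upwards [(isOpen_lt continuous_norm continuous_const).mem_nhds h] with y hy
        exact hφz y (le_of_lt hy)
      have h1 : fderiv ℝ φ x = 0 := by rw [hev.fderiv_eq]; simp
      have h2 : D2 φ x = 0 := by
        have : fderiv ℝ φ =ᶠ[𝓝 x] fun _ => 0 := by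
          refine hev.fderiv.trans (Eventually.of_forall fun y => ?_)
          simp
        exact this.fderiv_eq.trans (by simp; rfl)
      simp only [Lop, h1, h2, map_zero, zero_apply, add_zero, abs_zero, mul_zero]
      have := (hmm x).1
      exact mul_nonneg (mul_nonneg hN0 this) (by positivity)
    · have h1 : m x = 1 := by
        simp only [hm, clip]
        rw [min_eq_right (by linarith), max_eq_right zero_le_one]
      have h2 : N * m x * (1 / n) = M * (2 * (2 * Λ) * C) := by
        rw [h1, hN]; field_simp
      rw [h2]
      exact mul_le_mul_of_nonneg_left (hCL x hx) hM
  obtain ⟨u, hu, ⟨K', hreg⟩, huc, hub⟩ := exists_isSol_capped (T := n) (Y := M * Real.exp (K * n))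
    hκ hκ1 hn.le (by linarith) hc' hal' hbe' hmHB hp hN0 hM hK le_rfl (fun x => hal0 _)
    (fun x => hbeK _) (fun x => (hmm x).1)
  have hcomp := IsSubsol.le_capped hc' hp hN0 hM hK le_rfl (fun x => hal0 (P x))
    (fun x => hbeK (P x)) (ε := 1 / n) (by positivity) hφ hφ0 hφ1 hφN (fun x => (hmm x).1) hw
    (fun x hx => by simp only [A', hPx x hx]) (fun x hx => by simp only [b', hPx x hx])
    (fun x hx => by simp only [hPx x hx]) (fun x hx => by simp only [hPx x hx]) hu huc hub
  have hut : ∀ x, ContinuousOn (fun t => u t x) (Icc 0 n) := fun x t ht =>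
    (hu.eqn t ht x).continuousWithinAt
  refine ⟨A', b', _, u, hu, fun x hx => ?_, ⟨κ, K', hreg⟩, huc, fun x => ?_, hub,
    fun t ht x hx => ?_⟩
  · have hx' : ‖x‖ ≤ n := by simpa using hx
    have hx2 := hPx x (by linarith)
    refine ⟨by simp only [A', hx2], by simp only [b', hx2], fun t ht => ?_⟩
    have hcl : clip (M * Real.exp (K * n)) (u t x) = u t x := by
      refine clip_eq_self ⟨(hub t ht x).1, (hub t ht x).2.trans ?_⟩
      gcongr
      exact ht.2
    have hmz : m x = 0 := by
      simp only [hm, clip]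
      exact max_eq_left ((min_le_left _ _).trans (by linarith))
    simp only [capSource, hcl, hmz]
    rw [← hP, hx2]
    ring
  · simp only [capSource, clip]
    have h1 : ContinuousOn (fun t => max 0 (min (u t x) (M * Real.exp (K * n)))) (Icc 0 n) :=
      continuousOn_const.sup ((hut x).inf continuousOn_const)
    exact ((continuousOn_const.mul h1).sub (continuousOn_const.mul
      (h1.rpow_const fun _ _ => Or.inr (by linarith)))).add
        (continuousOn_const.mul (continuousOn_const.sub h1))
  · have hx' : ‖x‖ ≤ n := by simpa using hx
    have h1 := hcomp t ht x (by simp only [Metric.mem_closedBall, dist_zero_right]; linarith)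
    rw [hφz x (by linarith), mul_zero, sub_zero] at h1
    have h2 : Real.exp ((K + 1) * t) * Real.exp (-(K + 1) * t) = 1 := by
      rw [← Real.exp_add, Real.exp_eq_one_iff]; ring
    have h3 := mul_le_mul_of_nonneg_left
      (show Real.exp (-(K + 1) * t) * (w t x - u t x) ≤ 1 / n by linarith)
      (Real.exp_pos ((K + 1) * t)).le
    rw [← mul_assoc, h2, one_mul] at h3
    have h4 : Real.exp ((K + 1) * t) * (1 / n) = Real.exp ((K + 1) * t) / n := by ring
    linarith

end Approximation

section Limit

variable {E : Type*} [NormedAddCommGroup E] [InnerProductSpace ℝ E] [FiniteDimensional ℝ E]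
  [MeasurableSpace E] [BorelSpace E] {ι : Type*} [Fintype ι]

/-- A solution of an equation which agrees with the semilinear one on the ball of radius `n`. -/
structure IsApprox (A : E → Bil E →L[ℝ] ℝ) (b : E → E) (al be : E → ℝ) (p M K n : ℝ)
    (A' : E → Bil E →L[ℝ] ℝ) (b' : E → E) (f u : ℝ → E → ℝ) : Prop where
  sol : IsSol A' b' n f u
  eq : ∀ x ∈ Metric.closedBall (0 : E) n, A' x = A x ∧ b' x = b x ∧
    ∀ t ∈ Icc 0 n, f t x = be x * u t x - al x * u t x ^ p
  reg : ∃ κ K', Reg κ n K' u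
  fc : ∀ x, ContinuousOn (fun t => f t x) (Icc 0 n)
  bd : ∀ t ∈ Icc 0 n, ∀ x, 0 ≤ u t x ∧ u t x ≤ M * Real.exp (K * t)

theorem abs_logistic_sub_le {a₁ a₂ c₁ c₂ p Y Λ H y₁ y₂ : ℝ} (hp : 1 ≤ p) (h1 : y₁ ∈ Icc 0 Y)
    (h2 : y₂ ∈ Icc 0 Y) (ha : |a₁| ≤ Λ) (hc : |c₁| ≤ Λ)
    (ha' : |a₁ - a₂| ≤ Λ * H) (hc' : |c₁ - c₂| ≤ Λ * H) :
    |(c₁ * y₁ - a₁ * y₁ ^ p) - (c₂ * y₂ - a₂ * y₂ ^ p)| ≤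
      (Λ * Y + Λ * Y ^ p) * H + (Λ + Λ * (p * Y ^ (p - 1))) * |y₁ - y₂| := by
  have hY : 0 ≤ Y := h1.1.trans h1.2
  have e : (c₁ * y₁ - a₁ * y₁ ^ p) - (c₂ * y₂ - a₂ * y₂ ^ p) =
      (c₁ - c₂) * y₂ - (a₁ - a₂) * y₂ ^ p + (c₁ * (y₁ - y₂) - a₁ * (y₁ ^ p - y₂ ^ p)) := by ring
  have habs : ∀ a b c d : ℝ, |a - b + (c - d)| ≤ |a| + |b| + (|c| + |d|) := fun a b c d =>
    (abs_add_le _ _).trans (add_le_add (abs_sub a b) (abs_sub c d))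
  have hprod : ∀ {a b B C : ℝ}, |a| ≤ B → |b| ≤ C → |a * b| ≤ B * C := fun {a b B C} h1 h2 => by
    rw [abs_mul]
    exact mul_le_mul h1 h2 (abs_nonneg _) ((abs_nonneg _).trans h1)
  rw [e]
  refine (habs _ _ _ _).trans ?_
  have i1 := hprod hc' (show |y₂| ≤ Y by rw [abs_of_nonneg h2.1]; exact h2.2)
  have i2 := hprod ha' (show |y₂ ^ p| ≤ Y ^ p by
    rw [abs_of_nonneg (Real.rpow_nonneg h2.1 _)]
    exact Real.rpow_le_rpow h2.1 h2.2 (by linarith))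
  have i3 := hprod hc (le_refl |y₁ - y₂|)
  have i4 := hprod ha (abs_rpow_sub_rpow_le hp h1 h2)
  linarith

theorem abs_logistic_le {a c p Y Λ y : ℝ} (hp : 1 ≤ p) (h : y ∈ Icc 0 Y) (ha : |a| ≤ Λ)
    (hc : |c| ≤ Λ) : |c * y - a * y ^ p| ≤ Λ * Y + Λ * Y ^ p := by
  have hΛ : 0 ≤ Λ := (abs_nonneg _).trans ha
  refine (abs_sub _ _).trans ?_
  rw [abs_mul, abs_mul, abs_of_nonneg h.1, abs_of_nonneg (Real.rpow_nonneg h.1 p)]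
  have := Real.rpow_le_rpow h.1 h.2 (by linarith : 0 ≤ p)
  have h2 := h.2
  have h0 := h.1
  gcongr

theorem Reg.restrict {α T T' K : ℝ} {u : ℝ → E → ℝ} (h : Reg α T K u) (hT : T' ≤ T) :
    Reg α T' K u :=
  ⟨fun t ht => h.smooth t (Icc_subset_Icc_right hT ht),
    fun t ht => h.bound t (Icc_subset_Icc_right hT ht),
    fun x => (h.c1 x).mono (Icc_subset_Icc_right hT),
    fun x => (h.c2 x).mono (Icc_subset_Icc_right hT)⟩

/-- Uniform local estimates for the approximate solutions. -/
theorem IsApprox.local_bound {e : OrthonormalBasis ι ℝ E} {A : E → Bil E →L[ℝ] ℝ} {b : E → E}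
    {al be : E → ℝ} (hloc : LocalCoef e A b al be) {p M K : ℝ} (hp : 1 ≤ p) (hM : 0 ≤ M)
    (hK : 0 ≤ K) {T : ℝ} (hT : 0 ≤ T) (x₀ : E) :
    ∃ κ > 0, ∃ r > 0, ∃ C, 0 ≤ C ∧ ∃ L, 0 ≤ L ∧ ∀ n A' b' f u, T ≤ n → ‖x₀‖ + 1 ≤ n →
      IsApprox A b al be p M K n A' b' f u →
      (∀ t ∈ Icc 0 T, C2BoundOn κ C (Metric.closedBall x₀ r) (u t)) ∧
      (∀ x ∈ Metric.closedBall x₀ r, ‖A' x‖ ≤ C ∧ ‖b' x‖ ≤ C ∧ ∀ t ∈ Icc 0 T, |f t x| ≤ C) ∧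
      ∀ s ∈ Icc 0 T, ∀ t ∈ Icc 0 T, |f s x₀ - f t x₀| ≤ L * |s - t| := by
  obtain ⟨κ, Λ, hκ, hκ1, hΛ, hc, hal, hbe⟩ := hloc (‖x₀‖ + 1) (by positivity)
  set Y := M * Real.exp (K * T) with hY
  have hY0 : 0 ≤ Y := by positivity
  set F := Λ * Y + Λ * Y ^ p with hF
  set J := Λ + Λ * (p * Y ^ (p - 1)) with hJ
  have hYp : 0 ≤ Y ^ p := Real.rpow_nonneg hY0 _
  have hYp1 : 0 ≤ Y ^ (p - 1) := Real.rpow_nonneg hY0 _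
  have hF0 : 0 ≤ F := by positivity
  have hJ0 : 0 ≤ J := by positivity
  obtain ⟨R, hR, hR1, C, hC, h_int⟩ := interior_estimate hκ hκ1 hΛ hJ0 e
  have hC1 : 0 ≤ C * (Y + F) := by positivity
  refine ⟨κ, hκ, R / 4, by positivity, C * (Y + F) + Λ + F, by positivity,
    J * (2 * Λ * (C * (Y + F)) + F), by positivity, ?_⟩
  intro n A' b' f u hTn hxn hap
  have hTs : Icc 0 T ⊆ Icc 0 n := Icc_subset_Icc_right hTn
  have hS1 : Metric.closedBall x₀ (1 / 2) ⊆ Metric.closedBall (0 : E) (‖x₀‖ + 1) :=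
    Metric.closedBall_subset_closedBall' (by rw [dist_zero_right]; linarith)
  have hS2 : Metric.closedBall (0 : E) (‖x₀‖ + 1) ⊆ Metric.closedBall 0 n :=
    Metric.closedBall_subset_closedBall hxn
  have hSR : Metric.closedBall x₀ R ⊆ Metric.closedBall x₀ (1 / 2) :=
    Metric.closedBall_subset_closedBall (by linarith)
  have hc' : CoefOn e κ Λ (Metric.closedBall x₀ (1 / 2)) A' b' :=
    (hc.mono_set hS1).congr (fun x hx => (hap.eq x (hS2 (hS1 hx))).1)
      (fun x hx => (hap.eq x (hS2 (hS1 hx))).2.1)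
  have hmem : ∀ t ∈ Icc 0 T, ∀ x, u t x ∈ Icc 0 Y := fun t ht x => by
    obtain ⟨h1, h2⟩ := hap.bd t (hTs ht) x
    refine ⟨h1, h2.trans ?_⟩
    rw [hY]
    gcongr
    exact ht.2
  have hfe : ∀ t ∈ Icc 0 T, ∀ x ∈ Metric.closedBall x₀ (1 / 2),
      f t x = be x * u t x - al x * u t x ^ p :=
    fun t ht x hx => (hap.eq x (hS2 (hS1 hx))).2.2 t (hTs ht)
  have hfF : ∀ t ∈ Icc 0 T, ∀ x ∈ Metric.closedBall x₀ (1 / 2), |f t x| ≤ F := by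
    intro t ht x hx
    rw [hfe t ht x hx]
    exact abs_logistic_le hp (hmem t ht x) (hal.le x (hS1 hx)) (hbe.le x (hS1 hx))
  have hfH : ∀ t ∈ Icc 0 T, ∀ x ∈ Metric.closedBall x₀ (1 / 2),
      ∀ y ∈ Metric.closedBall x₀ (1 / 2),
      |f t x - f t y| ≤ F * ‖x - y‖ ^ κ + J * |u t x - u t y| := by
    intro t ht x hx y hy
    rw [hfe t ht x hx, hfe t ht y hy]
    exact abs_logistic_sub_le hp (hmem t ht x) (hmem t ht y) (hal.le x (hS1 hx))
      (hbe.le x (hS1 hx)) (hal.holder x (hS1 hx) y (hS1 hy)) (hbe.holder x (hS1 hx) y (hS1 hy))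
  have hsol := hap.sol.restrict hTn
  have hfc : ∀ x, ContinuousOn (fun t => f t x) (Icc 0 T) := fun x => (hap.fc x).mono hTs
  obtain ⟨κ', K', hreg⟩ := hap.reg
  replace hreg := hreg.restrict hTn
  have hK' : 0 ≤ K' := (abs_nonneg _).trans
    ((hreg.bound 0 ⟨le_rfl, hT⟩).abs_le 0 trivial)
  have hhb : ∀ t ∈ Icc 0 T, HB κ (Metric.closedBall x₀ (1 / 2)) (F + J * K') (f t) := by
    intro t ht
    refine ⟨fun x hx => (hfF t ht x hx).trans (by nlinarith [mul_nonneg hJ0 hK']),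
      fun x hx y hy => (hfH t ht x hx y hy).trans ?_⟩
    have h1 := hreg.lipschitz ht x y
    have h2 : ‖x - y‖ ≤ ‖x - y‖ ^ κ := by
      refine Real.self_le_rpow_of_le_one (norm_nonneg _) ?_ hκ1.le
      rw [← dist_eq_norm]
      rw [Metric.mem_closedBall] at hx hy
      have := dist_triangle_right x y x₀
      linarith
    have h3 : J * |u t x - u t y| ≤ J * (K' * ‖x - y‖ ^ κ) :=
      mul_le_mul_of_nonneg_left (h1.trans (mul_le_mul_of_nonneg_left h2 hK')) hJ0
    linarith
  obtain ⟨K₀, hH⟩ := exists_holdOn hκ hκ1 hT (F := F + J * K') (by positivity) hK' x₀ hc'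
    (hsol.isSolOn _) hreg (fun x t ht => (hsol.eqn t ht x).continuousWithinAt) hhb hfc hR1
  have hdat : IntData e κ Λ J T Y F (Metric.closedBall x₀ R) A' b' f u :=
    ⟨hc'.mono_set hSR, hsol.isSolOn _, fun t ht x _ => by
      rw [abs_of_nonneg (hmem t ht x).1]; exact (hmem t ht x).2,
      fun t ht x hx => hfF t ht x (hSR hx),
      fun t ht x hx y hy => hfH t ht x (hSR hx) y (hSR hy), fun x _ => hfc x⟩
  have hmain := h_int T Y F K₀ x₀ A' b' f u hT hY0 hF0 hdat hH
  have hS4 : Metric.closedBall x₀ (R / 4) ⊆ Metric.closedBall x₀ (1 / 2) :=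
    Metric.closedBall_subset_closedBall (by linarith)
  have hx₀ : x₀ ∈ Metric.closedBall x₀ (R / 4) := Metric.mem_closedBall_self (by positivity)
  refine ⟨fun t ht => (hmain t ht).mono subset_rfl (by linarith), fun x hx => ⟨?_, ?_, ?_⟩, ?_⟩
  · exact (hc'.hA.le x (hS4 hx)).trans (by linarith)
  · exact (hc'.hb.le x (hS4 hx)).trans (by linarith)
  · exact fun t ht => (hfF t ht x (hS4 hx)).trans (by linarith)
  · intro s hs t ht
    have h1 := (hsol.isSolOn univ).lipschitz_time (x := x₀) trivial (hc'.hA.le x₀ (hS4 hx₀))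
      (hc'.hb.le x₀ (hS4 hx₀)) (fun t ht => (hmain t ht).fderiv_le x₀ hx₀)
      (fun t ht => (hmain t ht).D2_le x₀ hx₀) (fun t ht => hfF t ht x₀ (hS4 hx₀)) t ht s hs
    rw [hfe s hs x₀ (hS4 hx₀), hfe t ht x₀ (hS4 hx₀)]
    have h2 := abs_logistic_sub_le (H := 0) (a₁ := al x₀) (a₂ := al x₀) (c₁ := be x₀)
      (c₂ := be x₀) hp (hmem s hs x₀) (hmem t ht x₀) (hal.le x₀ (hS1 (hS4 hx₀)))
      (hbe.le x₀ (hS1 (hS4 hx₀))) (by simp) (by simp)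
    rw [mul_zero, zero_add] at h2
    refine h2.trans ?_
    rw [mul_assoc]
    exact mul_le_mul_of_nonneg_left h1 hJ0

/-- A global solution, with local bounds for its derivatives, of the semilinear equation. -/
theorem IsSubsol.exists_solution {p M K : ℝ} {e : OrthonormalBasis ι ℝ E}
    {A : E → Bil E →L[ℝ] ℝ} {b : E → E} {al be : E → ℝ} (hloc : LocalCoef e A b al be)
    (hp : 1 ≤ p) (hM : 0 ≤ M) (hK : 0 ≤ K) (hal0 : ∀ x, 0 ≤ al x) (hbeK : ∀ x, be x ≤ K)
    {w : ℝ → E → ℝ} (hw : IsSubsol A b al be p M w) :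
    ∃ u : ℝ → E → ℝ, (∀ T, 0 ≤ T →
        IsSol A b T (fun t x => be x * u t x - al x * u t x ^ p) u ∧
        ∀ x₀, ∃ κ > 0, ∃ r > 0, ∃ C, 0 ≤ C ∧ (∀ t ∈ Icc 0 T,
          C2BoundOn κ C (Metric.closedBall x₀ r) (u t)) ∧
          ∀ x ∈ Metric.closedBall x₀ r, ‖A x‖ ≤ C ∧ ‖b x‖ ≤ C ∧
            ∀ t ∈ Icc 0 T, |be x * u t x - al x * u t x ^ p| ≤ C) ∧
      ∀ t, 0 ≤ t → ∀ x, 0 ≤ u t x ∧ w t x ≤ u t x := by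
  have hex := fun n : ℕ => hw.exists_approx hloc hp hM hK hal0 hbeK (n := (n : ℝ) + 1)
    (by positivity)
  choose A' b' f u h1 h2 h3 _ h5 h6 h7 using hex
  have hap : ∀ n : ℕ, IsApprox A b al be p M K ((n : ℝ) + 1) (A' n) (b' n) (f n) (u n) :=
    fun n => ⟨h1 n, h2 n, h3 n, h5 n, h6 n⟩
  set l : Ultrafilter ℕ := hyperfilter ℕ
  have hl : (l : Filter ℕ) ≤ atTop := Nat.hyperfilter_le_atTop
  have hbig : ∀ c : ℝ, ∀ᶠ n : ℕ in (l : Filter ℕ), c ≤ (n : ℝ) + 1 := fun c =>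
    hl ((tendsto_natCast_atTop_atTop.eventually_ge_atTop c).mono fun n hn => by linarith)
  have hlim : ∀ t x, ∃ g, 0 ≤ t → Tendsto (fun n => u n t x) l (𝓝 g) := by
    intro t x
    by_cases ht : 0 ≤ t
    · obtain ⟨g, hg⟩ := exists_tendsto_of_bounded l (f := fun n => u n t x)
        (C := M * Real.exp (K * t)) ((hbig t).mono fun n hn => by
          obtain ⟨i1, i2⟩ := h6 n t ⟨ht, hn⟩ x
          rwa [Real.norm_of_nonneg i1])
      exact ⟨g, fun _ => hg⟩
    · exact ⟨0, fun h => absurd h ht⟩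
  choose U hU using hlim
  have hmem : ∀ x : E, ∀ᶠ n : ℕ in (l : Filter ℕ), x ∈ Metric.closedBall (0 : E) ((n : ℝ) + 1) :=
    fun x => (hbig ‖x‖).mono fun n hn => by simpa using hn
  refine ⟨U, fun T hT => ?_, fun t ht x => ⟨?_, ?_⟩⟩
  · have hA : ∀ x, Tendsto (fun n => A' n x) l (𝓝 (A x)) := fun x =>
      tendsto_const_nhds.congr' ((hmem x).mono fun n hn => (h2 n x hn).1.symm)
    have hb : ∀ x, Tendsto (fun n => b' n x) l (𝓝 (b x)) := fun x =>
      tendsto_const_nhds.congr' ((hmem x).mono fun n hn => (h2 n x hn).2.1.symm)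
    have hf : ∀ t ∈ Icc 0 T, ∀ x,
        Tendsto (fun n => f n t x) l (𝓝 (be x * U t x - al x * U t x ^ p)) := fun t ht x => by
      have hu := hU t x ht.1
      refine ((hu.const_mul (be x)).sub ((hu.rpow_const (Or.inr (by linarith))).const_mul
        (al x))).congr' ?_
      filter_upwards [hmem x, hbig T] with n hn hTn
      exact ((h2 n x hn).2.2 t ⟨ht.1, ht.2.trans hTn⟩).symm
    have hlb := fun x₀ => IsApprox.local_bound hloc hp hM hK hT x₀
    have hloc' : ∀ x₀ : E, ∃ κ > 0, ∃ r > 0, ∃ C, 0 ≤ C ∧ ∀ᶠ n in (l : Filter ℕ),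
        (∀ t ∈ Icc 0 T, C2BoundOn κ C (Metric.closedBall x₀ r) (u n t)) ∧
        ∀ x ∈ Metric.closedBall x₀ r, ‖A' n x‖ ≤ C ∧ ‖b' n x‖ ≤ C ∧
          ∀ t ∈ Icc 0 T, |f n t x| ≤ C := by
      intro x₀
      obtain ⟨κ, hκ, r, hr, C, hC, L, -, h⟩ := hlb x₀
      refine ⟨κ, hκ, r, hr, C, hC, ?_⟩
      filter_upwards [hbig T, hbig (‖x₀‖ + 1)] with n hn1 hn2
      obtain ⟨i1, i2, -⟩ := h _ _ _ _ _ hn1 hn2 (hap n)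
      exact ⟨i1, i2⟩
    obtain ⟨hs, hd⟩ := IsSol.limit_of_local hT ((hbig T).mono fun n hn => (h1 n).restrict hn) hA hb
      hf (fun t ht x => hU t x ht.1) hloc' (fun x t ht ε hε => by
        obtain ⟨κ, hκ, r, hr, C, hC, L, hL, h⟩ := hlb x
        refine ⟨ε / (L + 1), by positivity, ?_⟩
        filter_upwards [hbig T, hbig (‖x‖ + 1)] with n hn1 hn2 s hs hst
        refine ((h _ _ _ _ _ hn1 hn2 (hap n)).2.2 s hs t ht).trans ?_
        rw [lt_div_iff₀ (by positivity)] at hst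
        nlinarith [abs_nonneg (s - t)])
    refine ⟨hs, fun x₀ => ?_⟩
    obtain ⟨κ, hκ, r, hr, C, hC, h⟩ := hloc' x₀
    refine ⟨κ, hκ, r, hr, C, hC, fun t ht => ?_, fun x hx => ⟨?_, ?_, fun t ht => ?_⟩⟩
    · exact C2BoundOn.of_tendsto (h.mono fun n hn => hn.1 t ht)
        (fun x => hU t x ht.1) (fun x => (hd t ht x).1) (fun x => (hd t ht x).2)
    · exact le_of_tendsto (hA x).norm (h.mono fun n hn => (hn.2 x hx).1)
    · exact le_of_tendsto (hb x).norm (h.mono fun n hn => (hn.2 x hx).2.1)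
    · exact le_of_tendsto (hf t ht x).abs (h.mono fun n hn => (hn.2 x hx).2.2 t ht)
  · exact ge_of_tendsto (hU t x ht) ((hbig t).mono fun n hn => (h6 n t ⟨ht, hn⟩ x).1)
  · have hz : Tendsto (fun n : ℕ => u n t x + Real.exp ((K + 1) * t) / ((n : ℝ) + 1)) l
        (𝓝 (U t x + 0)) := by
      refine (hU t x ht).add (Tendsto.mono_left ?_ hl)
      exact tendsto_const_nhds.div_atTop
        (tendsto_atTop_add_const_right _ _ tendsto_natCast_atTop_atTop)
    rw [add_zero] at hz
    refine ge_of_tendsto hz ?_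
    filter_upwards [hbig t, hmem x] with n hn hx
    exact h7 n t ⟨ht, hn⟩ x hx

end Limit

section Classical

variable {E : Type*} [NormedAddCommGroup E] [InnerProductSpace ℝ E] [FiniteDimensional ℝ E]
  [MeasurableSpace E] [BorelSpace E] {ι : Type*} [Fintype ι]

/-- Lipschitz continuity in time of a locally controlled solution. -/
theorem IsSol.lipschitz_time_of_local {κ C r T : ℝ} {A : E → Bil E →L[ℝ] ℝ} {b : E → E}
    {f u : ℝ → E → ℝ} (h : IsSol A b T f u) {x₀ : E} (hC : 0 ≤ C)
    (hu : ∀ t ∈ Icc 0 T, C2BoundOn κ C (Metric.closedBall x₀ r) (u t))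
    (hc : ∀ x ∈ Metric.closedBall x₀ r, ‖A x‖ ≤ C ∧ ‖b x‖ ≤ C ∧ ∀ t ∈ Icc 0 T, |f t x| ≤ C)
    {x : E} (hx : x ∈ Metric.closedBall x₀ r) {s t : ℝ} (hs : s ∈ Icc 0 T) (ht : t ∈ Icc 0 T) :
    |u t x - u s x| ≤ (2 * C * C + C) * |t - s| := by
  obtain ⟨h1, h2, h3⟩ := hc x hx
  refine h.abs_sub_le (fun τ hτ => (abs_add_le _ _).trans (add_le_add ?_ (h3 τ hτ))) hs ht
  exact abs_Lop_le hC h1 h2 ((hu τ hτ).fderiv_le x hx) ((hu τ hτ).D2_le x hx)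

/-- A classical solution of the semilinear equation above a subsolution. -/
theorem IsSubsol.exists_classical {p M K : ℝ} {e : OrthonormalBasis ι ℝ E}
    {A : E → Bil E →L[ℝ] ℝ} {b : E → E} {al be : E → ℝ} (hloc : LocalCoef e A b al be)
    (hp : 1 ≤ p) (hM : 0 ≤ M) (hK : 0 ≤ K) (hal0 : ∀ x, 0 ≤ al x) (hbeK : ∀ x, be x ≤ K)
    {w : ℝ → E → ℝ} (hw : IsSubsol A b al be p M w) :
    ∃ u : ℝ → E → ℝ, ContinuousOn (fun q : ℝ × E => u q.1 q.2) (Ici 0 ×ˢ univ) ∧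
      (∀ t, 0 ≤ t → ∀ x, 0 ≤ u t x ∧ w t x ≤ u t x) ∧ (∀ x, u 0 x = 0) ∧
      (∀ t, 0 < t → ContDiff ℝ 2 (u t)) ∧ ∀ x, ∀ t, 0 < t →
        HasDerivAt (fun s => u s x)
          (Lop A b (u t) x + (be x * u t x - al x * u t x ^ p)) t ∧
        ContinuousAt (fun s => Lop A b (u s) x + (be x * u s x - al x * u s x ^ p)) t := by
  obtain ⟨u, h, hwu⟩ := hw.exists_solution hloc hp hM hK hal0 hbeK
  have hnhds : ∀ t : ℝ, 0 < t → Icc 0 (t + 1) ∈ 𝓝 t := fun t ht =>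
    Icc_mem_nhds ht (by linarith)
  have hmem : ∀ t : ℝ, 0 ≤ t → t ∈ Icc 0 (t + 1) := fun t ht => ⟨ht, by linarith⟩
  refine ⟨u, ?_, hwu, (h 0 le_rfl).1.init,
    fun t ht => (h (t + 1) (by linarith)).1.smooth t (hmem t ht.le), fun x t ht => ⟨?_, ?_⟩⟩
  · rintro ⟨t, x⟩ ⟨ht, -⟩
    have ht' : (0 : ℝ) ≤ t := ht
    obtain ⟨hs, hl⟩ := h (t + 1) (by linarith)
    have hc := continuousOn_of_lipschitz_time (fun s hs' => (hs.smooth s hs').continuous)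
      fun x₀ => by
        obtain ⟨κ, -, r, hr, C, hC, h1, h2⟩ := hl x₀
        exact ⟨r, hr, _, fun x hx s hs' t ht =>
          hs.lipschitz_time_of_local hC h1 h2 (Metric.ball_subset_closedBall hx) hs' ht⟩
    refine (hc (t, x) ⟨hmem t ht', mem_univ x⟩).mono_of_mem_nhdsWithin ?_
    refine mem_nhdsWithin.2 ⟨Iio (t + 1) ×ˢ univ, isOpen_Iio.prod isOpen_univ,
      ⟨lt_add_one t, mem_univ x⟩, ?_⟩
    rintro ⟨s, y⟩ ⟨⟨h1, -⟩, ⟨h2, -⟩⟩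
    exact ⟨⟨h2, le_of_lt h1⟩, mem_univ y⟩
  · exact ((h (t + 1) (by linarith)).1.eqn t (hmem t ht.le) x).hasDerivAt (hnhds t ht)
  · obtain ⟨hs, hl⟩ := h (t + 1) (by linarith)
    obtain ⟨κ, hκ, r, hr, C, hC, h1, h2⟩ := hl x
    obtain ⟨c0, c1, c2⟩ := continuousOn_derivs hκ hC hr hs.smooth h1
      fun y hy s hs' t ht => hs.lipschitz_time_of_local hC h1 h2 hy hs' ht
    have c0 := c0.continuousAt (hnhds t ht)
    have c1 := c1.continuousAt (hnhds t ht)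
    have c2 := c2.continuousAt (hnhds t ht)
    have c3 : ContinuousAt (fun s => A x (D2 (u s) x)) t := (A x).continuous.continuousAt.comp c2
    have c4 : ContinuousAt (fun s => fderiv ℝ (u s) x (b x)) t := c1.clm_apply continuousAt_const
    exact (c3.add c4).add ((c0.const_mul _).sub
      ((c0.rpow_const (Or.inr (by linarith))).const_mul _))

/-- Damping a bounded solution of the linear equation gives a subsolution of the semilinear
equation. -/
theorem isSubsol_exp_mul {p M k a₁ b₀ : ℝ} {A : E → Bil E →L[ℝ] ℝ} {b : E → E} {al be : E → ℝ}
    (hp : 1 < p) (hk : 0 ≤ k) (ha₁ : 0 ≤ a₁) (hal : ∀ x, al x ≤ a₁) (hbe : ∀ x, b₀ ≤ be x)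
    (hkM : a₁ * M ^ (p - 1) ≤ b₀ + k) {v : ℝ → E → ℝ}
    (hc : ContinuousOn (fun q : ℝ × E => v q.1 q.2) (Ici 0 ×ˢ univ))
    (hv : ∀ t, 0 ≤ t → ∀ x, 0 ≤ v t x ∧ v t x ≤ M) (h0 : ∀ x, v 0 x = 0)
    (hs : ∀ t, 0 < t → ContDiff ℝ 2 (v t))
    (he : ∀ t, 0 < t → ∀ x, HasDerivAt (fun s => v s x) (Lop A b (v t) x) t) :
    IsSubsol A b al be p M fun t x => Real.exp (-k * t) * v t x where
  cont := ContinuousOn.mul (by fun_prop) hc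
  nonneg t ht x := mul_nonneg (Real.exp_pos _).le (hv t ht x).1
  le t ht x := by
    have : Real.exp (-k * t) ≤ 1 := Real.exp_le_one_iff.2 (by nlinarith)
    calc _ ≤ 1 * v t x := mul_le_mul_of_nonneg_right this (hv t ht x).1
      _ ≤ M := by rw [one_mul]; exact (hv t ht x).2
  init x := by simp [h0 x]
  smooth t ht := contDiff_const.mul (hs t ht)
  eqn t ht x := by
    have hd : HasDerivAt (fun s : ℝ => Real.exp (-k * s)) (Real.exp (-k * t) * (-k)) t := by
      simpa using ((hasDerivAt_id t).const_mul (-k)).exp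
    refine ⟨_, hd.mul (he t ht x), ?_⟩
    have hL : Lop A b (fun x => Real.exp (-k * t) * v t x) x
        = Real.exp (-k * t) * Lop A b (v t) x := by
      simpa using Lop_mul_add_const (A := A) (b := b) (hs t ht) (Real.exp (-k * t)) 0 x
    rw [hL]
    have hE : Real.exp (-k * t) ≤ 1 := Real.exp_le_one_iff.2 (by nlinarith)
    have hE0 := Real.exp_pos (-k * t)
    obtain ⟨v0, v1⟩ := hv t ht.le x
    set w := Real.exp (-k * t) * v t x with hw
    have w0 : 0 ≤ w := mul_nonneg hE0.le v0
    have w1 : w ≤ M := by nlinarith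
    have hpw : w ^ p = w ^ (p - 1) * w := by
      rcases w0.eq_or_lt with h | h
      · rw [← h, Real.zero_rpow (by linarith), mul_zero]
      · nth_rw 3 [← Real.rpow_one w]
        rw [← Real.rpow_add h, sub_add_cancel]
    have h1 : w ^ (p - 1) ≤ M ^ (p - 1) := Real.rpow_le_rpow w0 w1 (by linarith)
    have h2 : 0 ≤ w ^ (p - 1) := by positivity
    have h3 : al x * w ^ (p - 1) ≤ a₁ * M ^ (p - 1) :=
      (mul_le_mul_of_nonneg_right (hal x) h2).trans (mul_le_mul_of_nonneg_left h1 ha₁)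
    have h4 : al x * w ^ (p - 1) * w ≤ (be x + k) * w :=
      mul_le_mul_of_nonneg_right (by linarith [hbe x]) w0
    rw [hpw]
    have : Real.exp (-k * t) * -k * v t x = -k * w := by rw [hw]; ring
    rw [this]
    linarith

end Classical

section Euclidean

open scoped RealInnerProductSpace

theorem HB.smul_const {E G : Type*} [NormedAddCommGroup E] [NormedAddCommGroup G]
    [NormedSpace ℝ G] {κ m : ℝ} {S : Set E} {f : E → ℝ} (h : HB κ S m f) (c : G) :
    HB κ S (m * ‖c‖) (fun x => f x • c) where
  le x hx := by
    rw [norm_smul]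
    exact mul_le_mul_of_nonneg_right (h.le x hx) (norm_nonneg _)
  holder x hx y hy := by
    rw [← sub_smul, norm_smul, mul_right_comm]
    exact mul_le_mul_of_nonneg_right (h.holder x hx y hy) (norm_nonneg _)

theorem HB.exists_sum {E G ι : Type*} [NormedAddCommGroup E] [NormedAddCommGroup G] {κ : ℝ}
    {S : Set E} (s : Finset ι) {g : ι → E → G} (h : ∀ i, ∃ m, HB κ S m (g i)) :
    ∃ m, HB κ S m (fun x => ∑ i ∈ s, g i x) := by
  classical
  induction s using Finset.induction_on with
  | empty => exact ⟨0, by simpa using HB.const le_rfl (by simp)⟩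
  | insert i s hi ih =>
    obtain ⟨m₁, h₁⟩ := h i
    obtain ⟨m₂, h₂⟩ := ih
    exact ⟨m₁ + m₂, (h₁.add h₂).congr fun x _ => Finset.sum_insert hi⟩

theorem HB.continuousOn {E G : Type*} [NormedAddCommGroup E] [NormedAddCommGroup G] {κ m : ℝ}
    {S : Set E} {f : E → G} (hκ : 0 < κ) (h : HB κ S m f) : ContinuousOn f S := by
  intro x hx
  refine tendsto_iff_norm_sub_tendsto_zero.2 ?_
  have hc : Continuous fun y : E => m * ‖y - x‖ ^ κ :=
    continuous_const.mul ((by fun_prop : Continuous fun y : E => ‖y - x‖).rpow_const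
      fun _ => Or.inr hκ.le)
  have ht : Tendsto (fun y : E => m * ‖y - x‖ ^ κ) (𝓝[S] x) (𝓝 0) := by
    have := (hc.tendsto x).mono_left (nhdsWithin_le_nhds (s := S))
    simpa [Real.zero_rpow hκ.ne'] using this
  exact squeeze_zero' (Eventually.of_forall fun _ => norm_nonneg _)
    (eventually_mem_nhdsWithin.mono fun y hy => h.holder y hy x hx) ht

variable {d : ℕ}

local notation "𝔼" => EuclideanSpace ℝ (Fin d)

theorem _root_.LocHolder.eventually_HB {f : 𝔼 → ℝ} (hf : LocHolder f) (r : ℝ) :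
    ∀ᶠ κ in 𝓝[>] (0 : ℝ), ∃ m, HB κ (Metric.closedBall 0 r) m f := by
  obtain ⟨κ₀, C, hκ₀, -, hC, h⟩ := hf _ (isCompact_closedBall 0 r)
  rcases lt_or_ge r 0 with hr | hr
  · refine Eventually.of_forall fun κ => ⟨0, ?_, ?_⟩ <;>
    · intro x hx
      rw [Metric.closedBall_eq_empty.2 hr] at hx
      exact hx.elim
  have h0 : (0 : 𝔼) ∈ Metric.closedBall 0 r := Metric.mem_closedBall_self hr
  filter_upwards [Ioo_mem_nhdsGT hκ₀] with κ hκ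
  set m₁ := |f 0| + C * r ^ κ₀
  set m₂ := C * (2 * r) ^ (κ₀ - κ)
  have hm₁ : 0 ≤ m₁ := by positivity
  have hm₂ : 0 ≤ m₂ := by positivity
  refine ⟨m₁ + m₂, fun x hx => ?_, fun x hx y hy => ?_⟩
  · have hxr : ‖x‖ ≤ r := by simpa using hx
    have h1 := h x hx 0 h0
    rw [sub_zero] at h1
    have h2 : ‖x‖ ^ κ₀ ≤ r ^ κ₀ := Real.rpow_le_rpow (norm_nonneg _) hxr hκ₀.le
    have h3 := mul_le_mul_of_nonneg_left h2 hC
    rw [Real.norm_eq_abs]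
    have h4 : |f x| ≤ |f 0| + |f x - f 0| := by
      simpa using abs_add_le (f 0) (f x - f 0)
    calc |f x| ≤ m₁ := by simp only [m₁]; linarith
      _ ≤ m₁ + m₂ := by linarith
  · have hd : ‖x - y‖ ≤ 2 * r := by
      have h1 : ‖x‖ ≤ r := by simpa using hx
      have h2 : ‖y‖ ≤ r := by simpa using hy
      linarith [norm_sub_le x y]
    have h1 : ‖x - y‖ ^ κ₀ ≤ (2 * r) ^ (κ₀ - κ) * ‖x - y‖ ^ κ := by
      have e : κ₀ = (κ₀ - κ) + κ := by ring
      nth_rw 1 [e]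
      rw [Real.rpow_add' (norm_nonneg _) (by linarith)]
      exact mul_le_mul_of_nonneg_right
        (Real.rpow_le_rpow (norm_nonneg _) hd (by linarith [hκ.2])) (by positivity)
    calc ‖f x - f y‖ ≤ C * ‖x - y‖ ^ κ₀ := h x hx y hy
      _ ≤ C * ((2 * r) ^ (κ₀ - κ) * ‖x - y‖ ^ κ) := mul_le_mul_of_nonneg_left h1 hC
      _ = m₂ * ‖x - y‖ ^ κ := by ring
      _ ≤ _ := mul_le_mul_of_nonneg_right (by linarith) (by positivity)

/-- The principal part with coefficient matrix `a`, acting on second derivatives. -/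
noncomputable def matBil (a : Fin d → Fin d → 𝔼 → ℝ) (x : 𝔼) : Bil 𝔼 →L[ℝ] ℝ :=
  (1 / 2 : ℝ) • ∑ i, ∑ j, a i j x •
    Bil.evalCLM (EuclideanSpace.single i (1 : ℝ)) (EuclideanSpace.single j (1 : ℝ))

/-- The vector field with components `b`. -/
noncomputable def vecField (b : Fin d → 𝔼 → ℝ) (x : 𝔼) : 𝔼 :=
  ∑ i, b i x • EuclideanSpace.single i (1 : ℝ)

/-- The linear map with matrix `a`. -/
noncomputable def matOp (a : Fin d → Fin d → 𝔼 → ℝ) (x : 𝔼) : 𝔼 →L[ℝ] 𝔼 :=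
  ∑ i, ∑ j, a i j x • (EuclideanSpace.proj i : 𝔼 →L[ℝ] ℝ).smulRight
    (EuclideanSpace.single j (1 : ℝ))

theorem matBil_apply (a : Fin d → Fin d → 𝔼 → ℝ) (x : 𝔼) (B : Bil 𝔼) :
    matBil a x B = 1 / 2 * ∑ i, ∑ j, a i j x *
      B.left (EuclideanSpace.single i 1) (EuclideanSpace.single j 1) := by
  simp [matBil]

theorem matOp_apply (a : Fin d → Fin d → 𝔼 → ℝ) (x v : 𝔼) :
    matOp a x v = ∑ i, ∑ j, (a i j x * v i) • EuclideanSpace.single j (1 : ℝ) := by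
  simp [matOp, smul_smul]

theorem inner_matOp (a : Fin d → Fin d → 𝔼 → ℝ) (x v w : 𝔼) :
    ⟪matOp a x v, w⟫ = ∑ i, ∑ j, a i j x * v i * w j := by
  simp [matOp_apply, sum_inner, real_inner_smul_left, EuclideanSpace.inner_single_left]

theorem matOp_single (a : Fin d → Fin d → 𝔼 → ℝ) (x : 𝔼) (k : Fin d) :
    matOp a x (EuclideanSpace.single k 1) = ∑ j, a k j x • EuclideanSpace.single j (1 : ℝ) := by
  rw [matOp_apply, Finset.sum_eq_single k]
  · simp
  · intro i _ hi
    simp [hi]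
  · simp

theorem Lop_eq (a : Fin d → Fin d → 𝔼 → ℝ) (b : Fin d → 𝔼 → ℝ) {φ : 𝔼 → ℝ}
    (hφ : ContDiff ℝ 2 φ) (x : 𝔼) :
    Lop (matBil a) (vecField b) φ x
      = (1 / 2) * ∑ i, ∑ j, a i j x * pd i (pd j φ) x + ∑ i, b i x * pd i φ x := by
  have h : ∀ i j, pd i (pd j φ) x
      = (D2 φ x).left (EuclideanSpace.single i 1) (EuclideanSpace.single j 1) := fun i j => by
    have := ((ContinuousLinearMap.apply ℝ ℝ (EuclideanSpace.single j (1 : ℝ) : 𝔼)).hasFDerivAt.comp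
      x (hasFDerivAt_fderiv_of_C2 hφ x)).fderiv
    exact congrArg (fun l : 𝔼 →L[ℝ] ℝ => l (EuclideanSpace.single i 1)) this
  simp only [Lop, matBil_apply, vecField, map_sum, map_smul, smul_eq_mul, h]
  rfl

theorem eventually_HB_matrix {a : Fin d → Fin d → 𝔼 → ℝ} (ha : ∀ i j, LocHolder (a i j)) (r : ℝ)
    {G : Type*} [NormedAddCommGroup G] [NormedSpace ℝ G] (c : Fin d → Fin d → G) :
    ∀ᶠ κ in 𝓝[>] (0 : ℝ), ∃ m, HB κ (Metric.closedBall 0 r) m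
      (fun x => ∑ i, ∑ j, a i j x • c i j) := by
  filter_upwards [eventually_all.2 fun i => eventually_all.2 fun j => (ha i j).eventually_HB r]
    with κ h
  refine HB.exists_sum _ fun i => HB.exists_sum _ fun j => ?_
  obtain ⟨m, hm⟩ := h i j
  exact ⟨_, hm.smul_const (c i j)⟩

theorem exists_elliptic_lower {a : Fin d → Fin d → 𝔼 → ℝ} {r : ℝ}
    (hc : ContinuousOn (matOp a) (Metric.closedBall 0 r))
    (ha : ∀ x ν : 𝔼, ν ≠ 0 → 0 < ∑ i, ∑ j, a i j x * ν i * ν j) :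
    ∃ c > 0, ∀ x ∈ Metric.closedBall (0 : 𝔼) r, ∀ v, c * ‖v‖ ^ 2 ≤ ⟪matOp a x v, v⟫ := by
  have hK : IsCompact (Metric.closedBall (0 : 𝔼) r ×ˢ Metric.sphere (0 : 𝔼) 1) :=
    (isCompact_closedBall _ _).prod (isCompact_sphere _ _)
  have hf : ContinuousOn (fun q : 𝔼 × 𝔼 => ⟪matOp a q.1 q.2, q.2⟫)
      (Metric.closedBall (0 : 𝔼) r ×ˢ Metric.sphere (0 : 𝔼) 1) :=
    ((hc.comp continuousOn_fst fun q hq => hq.1).clm_apply continuousOn_snd).inner continuousOn_snd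
  obtain ⟨c, hc0, h⟩ := hK.exists_forall_le' hf (a := 0) fun q hq => by
    rw [inner_matOp]
    exact ha _ _ (Metric.ne_of_mem_sphere hq.2 one_ne_zero)
  refine ⟨c, hc0, fun x hx v => ?_⟩
  rcases eq_or_ne v 0 with rfl | hv
  · simp
  have hn : 0 < ‖v‖ := norm_pos_iff.2 hv
  have := h (x, ‖v‖⁻¹ • v) ⟨hx, by simp [norm_smul, hn.ne']⟩
  simp only [map_smul, real_inner_smul_left, real_inner_smul_right] at this
  calc c * ‖v‖ ^ 2 ≤ ‖v‖⁻¹ * (‖v‖⁻¹ * ⟪matOp a x v, v⟫) * ‖v‖ ^ 2 := by gcongr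
    _ = _ := by field_simp

theorem localCoef_of_locHolder {a : Fin d → Fin d → 𝔼 → ℝ} {b : Fin d → 𝔼 → ℝ} {al be : 𝔼 → ℝ}
    (ha : ∀ i j, LocHolder (a i j)) (hb : ∀ i, LocHolder (b i))
    (hs : ∀ i j x, a i j x = a j i x)
    (hell : ∀ x ν : 𝔼, ν ≠ 0 → 0 < ∑ i, ∑ j, a i j x * ν i * ν j) (hal : LocHolder al)
    (hbe : LocHolder be) :
    LocalCoef (EuclideanSpace.basisFun (Fin d) ℝ) (matBil a) (vecField b) al be := by
  intro r hr
  obtain ⟨κ, ⟨hκ, hκ1⟩, ⟨m₁, h₁⟩, ⟨m₂, h₂⟩, hb', ⟨m₄, h₄⟩, ⟨m₅, h₅⟩⟩ :=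
    ((show ∀ᶠ κ in 𝓝[>] (0 : ℝ), κ ∈ Ioo (0 : ℝ) 1 from
      Ioo_mem_nhdsGT zero_lt_one).and ((eventually_HB_matrix ha r fun i j =>
      Bil.evalCLM (EuclideanSpace.single i (1 : ℝ)) (EuclideanSpace.single j (1 : ℝ))).and
      ((eventually_HB_matrix ha r fun i j => (EuclideanSpace.proj i : 𝔼 →L[ℝ] ℝ).smulRight
        (EuclideanSpace.single j (1 : ℝ) : 𝔼)).and ((eventually_all.2 fun i =>
      (hb i).eventually_HB r).and ((hal.eventually_HB r).and (hbe.eventually_HB r)))))).exists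
  obtain ⟨m₃, h₃⟩ : ∃ m, HB κ (Metric.closedBall 0 r) m (vecField b) :=
    HB.exists_sum _ fun i => by
      obtain ⟨m, hm⟩ := hb' i
      exact ⟨_, hm.smul_const _⟩
  have h₂' : HB κ (Metric.closedBall 0 r) m₂ (matOp a) := h₂
  obtain ⟨c, hc, hlow⟩ := exists_elliptic_lower (h₂'.continuousOn hκ) hell
  set Λ : ℝ := 1 + |m₁| + |m₂| + |m₃| + |m₄| + |m₅| + c⁻¹ with hΛ
  have hci : 0 < c⁻¹ := inv_pos.2 hc
  have q1 := abs_nonneg m₁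
  have q2 := abs_nonneg m₂
  have q3 := abs_nonneg m₃
  have q4 := abs_nonneg m₄
  have q5 := abs_nonneg m₅
  have hΛ1 : 1 ≤ Λ := by linarith
  have hΛ2 : Λ ≤ Λ ^ 2 := by nlinarith
  refine ⟨κ, Λ, hκ, hκ1, hΛ1, ⟨fun x hx => ?_, ?_, h₃.mono (by linarith [le_abs_self m₃])⟩,
    h₄.mono (by linarith [le_abs_self m₄]), h₅.mono (by linarith [le_abs_self m₅])⟩
  · obtain ⟨σ, s1, s2, s3⟩ := exists_ellOp_of_bounds (EuclideanSpace.basisFun (Fin d) ℝ)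
      (a := matOp a x) (by linarith : 0 < Λ) (fun v w => by
        rw [real_inner_comm (matOp a x w) v, inner_matOp, inner_matOp, Finset.sum_comm]
        refine Finset.sum_congr rfl fun i _ => Finset.sum_congr rfl fun j _ => ?_
        rw [hs j i]; ring) (fun v => by
        have h1 := hlow x hx v
        have h2 : ‖v‖ ^ 2 ≤ c⁻¹ * ⟪matOp a x v, v⟫ := by
          rw [le_inv_mul_iff₀ hc]; exact h1
        have h3 : 0 ≤ ⟪matOp a x v, v⟫ := le_trans (by positivity) h1
        exact h2.trans (mul_le_mul_of_nonneg_right (by linarith) h3)) (fun v => by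
        have h1 : ‖matOp a x‖ ≤ Λ ^ 2 := (h₂'.le x hx).trans (by linarith [le_abs_self m₂])
        calc ⟪matOp a x v, v⟫ ≤ ‖matOp a x v‖ * ‖v‖ := real_inner_le_norm _ _
          _ ≤ Λ ^ 2 * ‖v‖ * ‖v‖ := mul_le_mul_of_nonneg_right
            (((matOp a x).le_opNorm v).trans (mul_le_mul_of_nonneg_right h1 (norm_nonneg _)))
            (norm_nonneg _)
          _ = _ := by ring)
    refine ⟨σ, s1, s2, ContinuousLinearMap.ext fun B => ?_⟩
    rw [s3, matBil_apply]
    simp [matOp_single]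
  · have h := h₁.const_smul (c := 1 / 2) (by norm_num)
    exact h.mono (by linarith [le_abs_self m₁])

end Euclidean

end ParabolicExplosion

open ParabolicExplosion

/-- Theorem 3: if the diffusion corresponding to `L` explodes
(i.e. there is a nontrivial bounded nonnegative classical solution of `v_t = Lv`
with zero initial data), `sup α < ∞` and `inf β > −∞`, then there is a nontrivial
nonnegative classical solution of `u_t = Lu + βu − αu^p` with zero initial data. -/
theorem stmt_10 {d : ℕ} (hd : 1 ≤ d) (p : ℝ) (hp1 : 1 < p) (hp2 : p ≤ 2)
    (a : Fin d → Fin d → EuclideanSpace ℝ (Fin d) → ℝ)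
    (b : Fin d → EuclideanSpace ℝ (Fin d) → ℝ)
    (ha_holder : ∀ i j, LocHolder (a i j))
    (hb_holder : ∀ i, LocHolder (b i))
    (ha_symm : ∀ i j x, a i j x = a j i x)
    (ha_ell : ∀ (x ν : EuclideanSpace ℝ (Fin d)), ν ≠ 0 →
      0 < ∑ i, ∑ j, a i j x * ν i * ν j)
    (α β : EuclideanSpace ℝ (Fin d) → ℝ)
    (hα_holder : LocHolder α) (hβ_holder : LocHolder β)
    (hα_pos : ∀ x, 0 < α x)
    (hα_bdd : ∃ M : ℝ, ∀ x, α x ≤ M)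
    (hβ_bdd : ∃ M : ℝ, ∀ x, β x ≤ M)
    (hβ_lower : ∃ M : ℝ, ∀ x, M ≤ β x)
    (v : EuclideanSpace ℝ (Fin d) → ℝ → ℝ)
    (hv_bdd : ∃ M : ℝ, ∀ x t, 0 ≤ t → |v x t| ≤ M)
    (hv_cont : ContinuousOn (fun q : EuclideanSpace ℝ (Fin d) × ℝ => v q.1 q.2)
      (univ ×ˢ Ici (0 : ℝ)))
    (hv_nonneg : ∀ x t, 0 ≤ t → 0 ≤ v x t)
    (hv_x : ∀ t : ℝ, 0 < t → ContDiff ℝ 2 (fun x => v x t))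
    (hv_t : ∀ x, ContDiffOn ℝ 1 (fun s => v x s) (Ioi (0 : ℝ)))
    (hv_pde : ∀ x t, 0 < t →
      deriv (fun s => v x s) t =
        (1 / 2) * ∑ i, ∑ j, a i j x * pd i (pd j (fun y => v y t)) x
          + ∑ i, b i x * pd i (fun y => v y t) x)
    (hv_init : ∀ x, v x 0 = 0)
    (hv_nontriv : ∃ x t, 0 ≤ t ∧ v x t ≠ 0) :
    ∃ u : EuclideanSpace ℝ (Fin d) → ℝ → ℝ,
      ContinuousOn (fun q : EuclideanSpace ℝ (Fin d) × ℝ => u q.1 q.2)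
        (univ ×ˢ Ici (0 : ℝ)) ∧
      (∀ x t, 0 ≤ t → 0 ≤ u x t) ∧
      (∀ t : ℝ, 0 < t → ContDiff ℝ 2 (fun x => u x t)) ∧
      (∀ x, ContDiffOn ℝ 1 (fun s => u x s) (Ioi (0 : ℝ))) ∧
      (∀ x t, 0 < t →
        deriv (fun s => u x s) t =
          (1 / 2) * ∑ i, ∑ j, a i j x * pd i (pd j (fun y => u y t)) x
            + ∑ i, b i x * pd i (fun y => u y t) x
            + β x * u x t - α x * u x t ^ p) ∧
      (∀ x, u x 0 = 0) ∧
      (∃ x t, 0 ≤ t ∧ u x t ≠ 0) := by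
  obtain ⟨M, hM⟩ := hv_bdd
  obtain ⟨a₁, ha₁⟩ := hα_bdd
  obtain ⟨b₁, hb₁⟩ := hβ_bdd
  obtain ⟨b₀, hb₀⟩ := hβ_lower
  have hM0 : 0 ≤ M := (abs_nonneg _).trans (hM 0 0 le_rfl)
  have hc : ContinuousOn (fun q : ℝ × EuclideanSpace ℝ (Fin d) => v q.2 q.1) (Ici 0 ×ˢ univ) :=
    hv_cont.comp continuous_swap.continuousOn fun q hq => ⟨hq.2, hq.1⟩
  have hd : ∀ t, 0 < t → ∀ x, HasDerivAt (fun s => v x s)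
      (Lop (matBil a) (vecField b) (fun y => v y t) x) t := fun t ht x => by
    rw [Lop_eq a b (hv_x t ht), ← hv_pde x t ht]
    exact (((hv_t x).differentiableOn one_ne_zero).differentiableAt (Ioi_mem_nhds ht)).hasDerivAt
  have hw := isSubsol_exp_mul (k := max 0 (a₁ * M ^ (p - 1) - b₀)) hp1 (le_max_left _ _)
    ((hα_pos 0).le.trans (ha₁ 0)) ha₁ hb₀
    (by linarith [le_max_right 0 (a₁ * M ^ (p - 1) - b₀)]) (v := fun t x => v x t) hc
    (fun t ht x => ⟨hv_nonneg x t ht, (le_abs_self _).trans (hM x t ht)⟩) hv_init hv_x hd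
  obtain ⟨u, u1, u2, u3, u4, u5⟩ := hw.exists_classical
    (localCoef_of_locHolder ha_holder hb_holder ha_symm ha_ell hα_holder hβ_holder) hp1.le hM0
    (le_max_right b₁ 0) (fun x => (hα_pos x).le) fun x => (hb₁ x).trans (le_max_left _ _)
  refine ⟨fun x t => u t x, u1.comp continuous_swap.continuousOn fun q hq => ⟨hq.2, hq.1⟩,
    fun x t ht => (u2 t ht x).1, u4, fun x => ?_, fun x t ht => ?_, u3, ?_⟩
  · rw [show (1 : WithTop ℕ∞) = 0 + 1 from rfl, contDiffOn_succ_iff_deriv_of_isOpen isOpen_Ioi]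
    refine ⟨fun t ht => (u5 x t ht).1.differentiableAt.differentiableWithinAt, by simp, ?_⟩
    exact contDiffOn_zero.2 (ContinuousOn.congr (fun t ht => (u5 x t ht).2.continuousWithinAt)
      fun t ht => (u5 x t ht).1.deriv)
  · rw [(u5 x t ht).1.deriv, Lop_eq a b (u4 t ht)]
    ring
  · obtain ⟨x, t, ht, hvt⟩ := hv_nontriv
    have h := mul_pos (Real.exp_pos (-(max 0 (a₁ * M ^ (p - 1) - b₀)) * t))
      (lt_of_le_of_ne (hv_nonneg x t ht) hvt.symm)
    exact ⟨x, t, ht, (h.trans_le (u2 t ht x).2).ne'⟩
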